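/- Let m ≥ 2 be a squarefree integer. Then the subgroup {x · x̄⁻¹ : x ∈ Cl_m} of Cl_m is trivial if and only if m belongs to the explicit set {2, 3, 5, 6, 7, 10, 11, 13, 14, 15, 17, 19, 21, 22, 26, 29, 30, 33, 34, 35, 38, 39, 42, 58, 66, 70, 78} (equivalently: m = p for a prime p ∈ {2,3,5,7,11,13,17,19,29}, or m = 2p for p ∈ {3,5,7,11,13,17,19,29}, or m = pq or 2pq for (p,q) ∈ {(3,5),(3,7),(3,11),(5,7),(3,13)}). -/

import Mathlib

open NumberField
open scoped nonZeroDivisors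
set_option linter.unusedSectionVars false
set_option linter.style.haveILetI false

section CyclotomicClassNumbers

open Finset

local notation "𝐑" => NumberField.maximalRealSubfield

local notation "𝐗" => DirichletCharacter ℂ

section IdealCount

open Ideal

variable (F : Type*) [Field F] [NumberField F]

/-- The number of integral ideals of norm `n`. -/
noncomputable def idealCount (n : ℕ) : ℕ := Nat.card {I : Ideal (𝓞 F) // absNorm I = n}

theorem idealCount_one : idealCount F 1 = 1 := by
  simp [idealCount, Ideal.absNorm_eq_one_iff]

variable {F}

theorem Ideal.sup_span_mul_sup_span {m n : ℕ} (h : m.Coprime n) {I : Ideal (𝓞 F)}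
    (hI : ((m * n : ℕ) : 𝓞 F) ∈ I) :
    (I ⊔ span {(m : 𝓞 F)}) * (I ⊔ span {(n : 𝓞 F)}) = I := by
  have hcop : span {(m : 𝓞 F)} ⊔ span {(n : 𝓞 F)} = ⊤ := by
    rw [Ideal.sup_eq_top_iff_isCoprime]
    simpa using (Nat.isCoprime_iff_coprime.mpr h).map (Int.castRingHom (𝓞 F))
  have hmn : span {(m : 𝓞 F)} * span {(n : 𝓞 F)} ≤ I := by
    rw [span_singleton_mul_span_singleton, span_singleton_le_iff_mem]
    exact_mod_cast hI
  apply le_antisymm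
  · rw [Ideal.sup_mul, Ideal.mul_sup, Ideal.mul_sup]
    exact sup_le (sup_le Ideal.mul_le_left Ideal.mul_le_left) (sup_le Ideal.mul_le_right hmn)
  · calc I = I * (span {(m : 𝓞 F)} ⊔ span {(n : 𝓞 F)}) := by rw [hcop, Ideal.mul_top]
      _ = span {(m : 𝓞 F)} * I ⊔ I * span {(n : 𝓞 F)} := by rw [Ideal.mul_sup, mul_comm I (span {(m : 𝓞 F)})]
      _ ≤ _ := sup_le (Ideal.mul_mono le_sup_right le_sup_left) (Ideal.mul_mono le_sup_left le_sup_right)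

theorem Ideal.mul_sup_span_absNorm {A B : Ideal (𝓞 F)} (h : (absNorm A).Coprime (absNorm B)) :
    A * B ⊔ span {(absNorm A : 𝓞 F)} = A := by
  have hcop : B ⊔ span {(absNorm A : 𝓞 F)} = ⊤ := by
    rw [eq_top_iff]
    have : span {(absNorm B : 𝓞 F)} ⊔ span {(absNorm A : 𝓞 F)} = ⊤ := by
      rw [Ideal.sup_eq_top_iff_isCoprime]
      simpa using (Nat.isCoprime_iff_coprime.mpr h.symm).map (Int.castRingHom (𝓞 F))
    rw [← this]
    exact sup_le_sup_right (by rw [span_singleton_le_iff_mem]; exact absNorm_mem B) _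
  apply le_antisymm
  · exact sup_le Ideal.mul_le_left (by rw [span_singleton_le_iff_mem]; exact absNorm_mem A)
  · calc A = A * (B ⊔ span {(absNorm A : 𝓞 F)}) := by rw [hcop, Ideal.mul_top]
      _ = A * B ⊔ A * span {(absNorm A : 𝓞 F)} := Ideal.mul_sup ..
      _ ≤ _ := sup_le_sup_left Ideal.mul_le_right _

theorem Ideal.absNorm_sup_span_coprime {m n : ℕ} (h : m.Coprime n) (I : Ideal (𝓞 F)) :
    (absNorm (I ⊔ span {(m : 𝓞 F)})).Coprime n := by
  have h1 : absNorm (I ⊔ span {(m : 𝓞 F)}) ∣ absNorm (span {(m : 𝓞 F)}) :=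
    absNorm_dvd_absNorm_of_le le_sup_right
  have h2 : absNorm (span {(m : 𝓞 F)}) = m ^ Module.finrank ℤ (𝓞 F) := by
    rw [absNorm_span_singleton, ← map_natCast (algebraMap ℤ (𝓞 F)), Algebra.norm_algebraMap]
    simp [Int.natAbs_pow]
  exact Nat.Coprime.coprime_dvd_left h1 (h2 ▸ h.pow_left _)

theorem idealCount_mul_of_coprime {m n : ℕ} (h : m.Coprime n) :
    idealCount F (m * n) = idealCount F m * idealCount F n := by
  rw [idealCount, idealCount, idealCount, ← Nat.card_prod]
  refine (Nat.card_congr (Equiv.ofBijective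
    (fun p : {I : Ideal (𝓞 F) // absNorm I = m} × {I : Ideal (𝓞 F) // absNorm I = n} ↦
      (⟨p.1.1 * p.2.1, by rw [map_mul, p.1.2, p.2.2]⟩ : {I : Ideal (𝓞 F) // absNorm I = m * n}))
    ⟨?_, ?_⟩)).symm
  · rintro ⟨⟨A, hA⟩, ⟨B, hB⟩⟩ ⟨⟨A', hA'⟩, ⟨B', hB'⟩⟩ heq
    simp only [Subtype.mk.injEq] at heq
    have e1 := Ideal.mul_sup_span_absNorm (A := A) (B := B) (by rwa [hA, hB])
    have e2 := Ideal.mul_sup_span_absNorm (A := A') (B := B') (by rwa [hA', hB'])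
    have e3 := Ideal.mul_sup_span_absNorm (A := B) (B := A) (by rw [hA, hB]; exact h.symm)
    have e4 := Ideal.mul_sup_span_absNorm (A := B') (B := A') (by rw [hA', hB']; exact h.symm)
    have hAA : A = A' := by rw [← e1, ← e2, heq, hA, hA']
    have hBB : B = B' := by rw [← e3, ← e4, mul_comm, heq, mul_comm A', hB, hB']
    simp [hAA, hBB]
  · rintro ⟨I, hI⟩
    have hmem : ((m * n : ℕ) : 𝓞 F) ∈ I := hI ▸ absNorm_mem I
    have hprod := Ideal.sup_span_mul_sup_span h hmem
    have hN : absNorm (I ⊔ span {(m : 𝓞 F)}) * absNorm (I ⊔ span {(n : 𝓞 F)}) = m * n := by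
      rw [← map_mul, hprod, hI]
    have c1 := Ideal.absNorm_sup_span_coprime h I
    have c2 := Ideal.absNorm_sup_span_coprime h.symm I
    have d1 : absNorm (I ⊔ span {(m : 𝓞 F)}) ∣ m :=
      c1.dvd_of_dvd_mul_right (Dvd.intro _ hN)
    have d1' : m ∣ absNorm (I ⊔ span {(m : 𝓞 F)}) :=
      c2.symm.dvd_of_dvd_mul_right (hN ▸ dvd_mul_right m n)
    have d2 : absNorm (I ⊔ span {(n : 𝓞 F)}) ∣ n :=
      c2.dvd_of_dvd_mul_left (Dvd.intro_left _ hN)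
    have d2' : n ∣ absNorm (I ⊔ span {(n : 𝓞 F)}) :=
      c1.symm.dvd_of_dvd_mul_left (hN ▸ dvd_mul_left n m)
    exact ⟨⟨⟨_, Nat.dvd_antisymm d1 d1'⟩, ⟨_, Nat.dvd_antisymm d2 d2'⟩⟩, Subtype.ext hprod⟩

theorem mem_primesOver_of_dvd_of_absNorm {p k : ℕ} (hp : p.Prime) {I P : Ideal (𝓞 F)}
    (hI : absNorm I = p ^ k) (hP : Prime P) (hPI : P ∣ I) :
    P ∈ primesOver (span {(p : ℤ)}) (𝓞 F) := by
  have hPp : P.IsPrime := isPrime_of_prime hP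
  have hmem : ((p : ℕ) : 𝓞 F) ∈ P := by
    have : ((p ^ k : ℕ) : 𝓞 F) ∈ P := (Ideal.le_of_dvd hPI) (hI ▸ absNorm_mem I)
    rw [Nat.cast_pow] at this
    exact hPp.mem_of_pow_mem _ this
  refine ⟨hPp, ⟨?_⟩⟩
  have hmax : (span {(p : ℤ)}).IsMaximal :=
    PrincipalIdealRing.isMaximal_of_irreducible (Nat.prime_iff_prime_int.mp hp).irreducible
  refine hmax.eq_of_le (IsPrime.ne_top (hPp.under ℤ)) ?_
  rw [span_singleton_le_iff_mem]
  simpa [Ideal.mem_comap] using hmem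

variable (F) in
theorem finite_primesOver_span {p : ℕ} (hp : p.Prime) :
    (primesOver (span {(p : ℤ)}) (𝓞 F)).Finite := by
  have : (span {(p : ℤ)}).IsMaximal :=
    PrincipalIdealRing.isMaximal_of_irreducible (Nat.prime_iff_prime_int.mp hp).irreducible
  exact IsDedekindDomain.primesOver_finite _ _

theorem prime_of_mem_primesOver_span {p : ℕ} (hp : p.Prime) {P : Ideal (𝓞 F)}
    (hP : P ∈ primesOver (span {(p : ℤ)}) (𝓞 F)) : Prime P := by
  have h1 := hP.1
  have h2 := hP.2
  have : (span {(p : ℤ)} : Ideal ℤ) ≠ ⊥ := by simpa using hp.ne_zero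
  exact prime_of_isPrime (ne_bot_of_liesOver_of_ne_bot this P) h1

theorem idealCount_prime_pow {p f : ℕ} (hp : p.Prime) (hf : f ≠ 0)
    (hN : ∀ P ∈ primesOver (span {(p : ℤ)}) (𝓞 F), absNorm P = p ^ f) (k : ℕ) :
    idealCount F (p ^ k) =
      if f ∣ k then Nat.multichoose (primesOver (span {(p : ℤ)}) (𝓞 F)).ncard (k / f) else 0 := by
  classical
  set S := primesOver (span {(p : ℤ)}) (𝓞 F) with hS
  have hfin : Finite S := finite_primesOver_span F hp
  have hcard (I : Ideal (𝓞 F)) (hI : absNorm I = p ^ k) :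
      f * (UniqueFactorizationMonoid.normalizedFactors I).card = k := by
    have hI0 : I ≠ 0 := by
      rintro rfl
      simp at hI
      exact absurd hI.symm (pow_ne_zero _ hp.ne_zero)
    have h1 : ((UniqueFactorizationMonoid.normalizedFactors I).map absNorm).prod = p ^ k := by
      rw [← map_multiset_prod, Ideal.prod_normalizedFactors_eq_self hI0, hI]
    rw [Multiset.map_congr rfl (g := fun _ ↦ p ^ f), Multiset.map_const', Multiset.prod_replicate,
      ← pow_mul] at h1
    · exact Nat.pow_right_injective hp.two_le h1
    · intro P hP
      exact hN P (mem_primesOver_of_dvd_of_absNorm hp hI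
        (UniqueFactorizationMonoid.prime_of_normalized_factor P hP)
        (UniqueFactorizationMonoid.dvd_of_mem_normalizedFactors hP))
  split_ifs with hk
  · obtain ⟨j, rfl⟩ := hk
    have : Fintype S := Fintype.ofFinite S
    rw [Nat.mul_div_cancel_left _ (Nat.pos_of_ne_zero hf), Set.ncard_eq_toFinset_card',
      Set.toFinset_card, ← Sym.card_sym_eq_multichoose, ← Nat.card_eq_fintype_card, idealCount]
    have hprime (s : Multiset S) : ∀ P ∈ s.map (fun P : S ↦ P.1), Prime P := by
      intro P hP
      obtain ⟨Q, _, rfl⟩ := Multiset.mem_map.mp hP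
      exact prime_of_mem_primesOver_span hp Q.2
    refine (Nat.card_congr (Equiv.ofBijective (fun s : Sym S j ↦
      (⟨((s : Multiset S).map (fun P : S ↦ P.1)).prod, ?_⟩ :
        {I : Ideal (𝓞 F) // absNorm I = p ^ (f * j)})) ⟨?_, ?_⟩)).symm
    · rw [map_multiset_prod, Multiset.map_map, Multiset.map_congr rfl (g := fun _ ↦ p ^ f),
        Multiset.map_const', Multiset.prod_replicate, pow_mul]
      · exact congrArg _ s.2
      intro P _
      exact hN P.1 P.2
    · intro s t hst
      simp only [Subtype.mk.injEq] at hst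
      have := congrArg UniqueFactorizationMonoid.normalizedFactors hst
      rw [UniqueFactorizationMonoid.normalizedFactors_prod_of_prime (hprime _),
        UniqueFactorizationMonoid.normalizedFactors_prod_of_prime (hprime _)] at this
      exact Subtype.ext (Multiset.map_injective Subtype.val_injective this)
    · rintro ⟨I, hI⟩
      have hI0 : I ≠ 0 := by
        rintro rfl
        simp at hI
        exact absurd hI.symm (pow_ne_zero _ hp.ne_zero)
      have hmem : ∀ P ∈ UniqueFactorizationMonoid.normalizedFactors I, P ∈ S := fun P hP ↦
        mem_primesOver_of_dvd_of_absNorm hp hI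
          (UniqueFactorizationMonoid.prime_of_normalized_factor P hP)
          (UniqueFactorizationMonoid.dvd_of_mem_normalizedFactors hP)
      refine ⟨⟨(UniqueFactorizationMonoid.normalizedFactors I).attach.map
        (fun P ↦ (⟨P.1, hmem P.1 P.2⟩ : S)), ?_⟩, ?_⟩
      · rw [Multiset.card_map, Multiset.card_attach]
        exact Nat.eq_of_mul_eq_mul_left (Nat.pos_of_ne_zero hf) (hcard I hI)
      · apply Subtype.ext
        simp only [Sym.coe_mk, Multiset.map_map, Function.comp_def]
        rw [Multiset.attach_map_val, Ideal.prod_normalizedFactors_eq_self hI0]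
  · rw [idealCount, Nat.card_eq_zero]
    left
    exact ⟨fun I ↦ hk ⟨_, (hcard I.1 I.2).symm⟩⟩

variable (F) in
theorem summable_idealCount {s : ℂ} (hs : 1 < s.re) :
    LSeriesSummable (fun n ↦ (idealCount F n : ℂ)) s := by
  have h := (Ideal.tendsto_norm_le_div_atTop₀ F).comp tendsto_natCast_atTop_atTop
  have key : (fun n : ℕ ↦ ∑ k ∈ Finset.Icc 1 n, (idealCount F k : ℝ)) =O[Filter.atTop]
      fun n ↦ (n : ℝ) ^ (1 : ℝ) := by
    simp_rw [Real.rpow_one]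
    have hO := h.isBigO_one ℝ
    refine (hO.mul (Asymptotics.isBigO_refl (fun n : ℕ ↦ (n : ℝ)) Filter.atTop)).congr' ?_ ?_
    · filter_upwards [Filter.eventually_gt_atTop 0] with n hn
      have hn' : (n : ℝ) ≠ 0 := by exact_mod_cast hn.ne'
      simp only [Function.comp_apply, Nat.cast_le]
      rw [div_mul_cancel₀ _ hn', ← Nat.cast_sum]
      congr 1
      simp only [idealCount]
      rw [← add_left_inj 1, ← card_norm_le_eq_card_norm_le_add_one,
        show Finset.Icc 1 n = Finset.Ioc 0 n from Finset.Icc_succ_left_eq_Ioc _ _,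
        show 1 = Nat.card {I : Ideal (𝓞 F) // absNorm I = 0} by simp [Ideal.absNorm_eq_zero_iff],
        Finset.sum_Ioc_add_eq_sum_Icc (n.zero_le),
        ← Finset.card_preimage_eq_sum_card_image_eq (fun k _ ↦ finite_setOfPred_absNorm_eq k)]
      simp [Set.coe_eq_subtype]
    · exact Filter.Eventually.of_forall fun n ↦ by simp
  simpa using LSeriesSummable_of_sum_norm_bigO_and_nonneg key (fun _ ↦ Nat.cast_nonneg _)
    zero_le_one (by simpa using hs)

theorem tsum_multichoose_mul_pow (g : ℕ) {x : ℂ} (hx : ‖x‖ < 1) :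
    HasSum (fun j : ℕ ↦ (Nat.multichoose g j : ℂ) * x ^ j) ((1 - x)⁻¹ ^ g) := by
  rcases g with _ | g
  · rw [pow_zero]
    convert hasSum_ite_eq 0 (1 : ℂ) using 2 with j
    rcases j with _ | j <;> simp
  · have := hasSum_choose_mul_geometric_of_norm_lt_one g hx
    rw [one_div, ← inv_pow] at this
    refine this.congr_fun fun j ↦ ?_
    rw [Nat.multichoose_eq, show g + 1 + j - 1 = j + g by omega, Nat.choose_symm_add]

/-- The Euler product of the Dedekind zeta function of a number field in which, for every rational
prime, all primes above it have the same residue degree. -/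
theorem dedekindZeta_hasProd {f : ℕ → ℕ} (hf : ∀ p, p.Prime → f p ≠ 0)
    (hN : ∀ p : ℕ, p.Prime → ∀ P ∈ primesOver (span {(p : ℤ)}) (𝓞 F), absNorm P = p ^ f p)
    {s : ℂ} (hs : 1 < s.re) :
    HasProd (fun p : Nat.Primes ↦ ((1 - ((p : ℂ) ^ (-s)) ^ f p)⁻¹) ^
      (primesOver (span {((p : ℕ) : ℤ)}) (𝓞 F)).ncard) (dedekindZeta F s) := by
  have hs0 : s ≠ 0 := by rintro rfl; simp at hs; linarith
  set φ : ℕ → ℂ := fun n ↦ if n = 0 then 0 else (idealCount F n : ℂ) * (n : ℂ) ^ (-s) with hφ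
  have hterm : ∀ n, LSeries.term (fun n ↦ (idealCount F n : ℂ)) s n = φ n := by
    intro n
    rcases eq_or_ne n 0 with rfl | hn
    · simp [hφ]
    · rw [LSeries.term_of_ne_zero hn, hφ]
      simp [hn, Complex.cpow_neg, div_eq_mul_inv]
  have hsum : Summable φ := by
    have := summable_idealCount F hs
    rw [LSeriesSummable] at this
    exact this.congr fun n ↦ (hterm n).symm ▸ rfl
  have h1 : φ 1 = 1 := by simp [hφ, idealCount_one]
  have hmul : ∀ {m n : ℕ}, m.Coprime n → φ (m * n) = φ m * φ n := by
    intro m n hmn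
    rcases eq_or_ne m 0 with rfl | hm
    · simp [hφ]
    rcases eq_or_ne n 0 with rfl | hn
    · simp [hφ]
    simp only [hφ, mul_eq_zero, hm, hn, or_self, if_false, idealCount_mul_of_coprime hmn,
      Nat.cast_mul, Complex.natCast_mul_natCast_cpow]
    ring
  have := EulerProduct.eulerProduct_hasProd (f := φ) h1 hmul hsum.norm (by simp [hφ])
  have hz : ∑' n, φ n = dedekindZeta F s := by
    rw [dedekindZeta, LSeries]
    exact tsum_congr fun n ↦ (hterm n).symm
  rw [hz] at this
  refine this.congr_fun fun p ↦ ?_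
  set g := (primesOver (span {((p : ℕ) : ℤ)}) (𝓞 F)).ncard with hg
  have hp := p.2
  have hfp := hf p hp
  set x : ℂ := ((p : ℂ) ^ (-s)) ^ f p with hx
  have hpx : ‖((p : ℕ) : ℂ) ^ (-s)‖ < 1 := by
    rw [Complex.norm_natCast_cpow_of_pos hp.pos]
    exact Real.rpow_lt_one_of_one_lt_of_neg (by exact_mod_cast hp.one_lt) (by simp; linarith)
  have hx1 : ‖x‖ < 1 := by
    rw [hx, norm_pow]
    exact pow_lt_one₀ (norm_nonneg _) hpx hfp
  have key : HasSum (fun e : ℕ ↦ φ ((p : ℕ) ^ e)) ((1 - x)⁻¹ ^ g) := by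
    have hinj : Function.Injective (fun j : ℕ ↦ f p * j) :=
      fun a b h ↦ Nat.eq_of_mul_eq_mul_left (Nat.pos_of_ne_zero hfp) h
    rw [← hinj.hasSum_iff]
    · refine (tsum_multichoose_mul_pow g hx1).congr_fun fun j ↦ ?_
      have : ((p : ℕ) ^ (f p * j)) ≠ 0 := pow_ne_zero _ hp.ne_zero
      simp only [Function.comp_apply, hφ, this, if_false]
      rw [idealCount_prime_pow hp hfp (hN p hp), if_pos (dvd_mul_right _ _),
        Nat.mul_div_cancel_left _ (Nat.pos_of_ne_zero hfp), hx, ← pow_mul, Nat.cast_pow,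
        ← Complex.natCast_cpow_natCast_mul, ← Complex.cpow_nat_mul]
    · intro e he
      have h1 : ¬ f p ∣ e := fun ⟨j, hj⟩ ↦ he ⟨j, hj.symm⟩
      simp only [hφ]
      rw [idealCount_prime_pow hp hfp (hN p hp), if_neg h1]
      simp
  exact key.tsum_eq.symm

end IdealCount

section CharacterProducts

/-- The product of `1 - ψ(u) T` over all characters `ψ` of a finite abelian group. -/
theorem prod_one_sub_monoidHom_apply {G : Type*} [CommGroup G] [Finite G] [Fintype (G →* ℂˣ)]
    (u : G) (T : ℂ) :
    ∏ ψ : G →* ℂˣ, (1 - (ψ u : ℂ) * T) = (1 - T ^ orderOf u) ^ (Nat.card G / orderOf u) := by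
  classical
  have ho : 0 < orderOf u := orderOf_pos u
  have : NeZero (orderOf u) := ⟨ho.ne'⟩
  let ev : (G →* ℂˣ) →* ℂˣ :=
    { toFun := fun ψ ↦ ψ u, map_one' := rfl, map_mul' := fun _ _ ↦ rfl }
  have hrange : ∀ z : ℂˣ, z ∈ Set.range ev ↔ z ^ orderOf u = 1 := by
    intro z
    constructor
    · rintro ⟨ψ, rfl⟩
      change (ψ u) ^ orderOf u = 1
      rw [← map_pow, pow_orderOf_eq_one, map_one]
    · intro hz
      have hz' : orderOf z ∣ orderOf (⟨u, Subgroup.mem_zpowers u⟩ : Subgroup.zpowers u) := by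
        rw [Subgroup.orderOf_mk]; exact orderOf_dvd_of_pow_eq_one hz
      have hgen : ∀ x : Subgroup.zpowers u,
          x ∈ Subgroup.zpowers (⟨u, Subgroup.mem_zpowers u⟩ : Subgroup.zpowers u) := by
        rintro ⟨x, k, rfl⟩
        exact ⟨k, Subtype.ext (by simp)⟩
      let φ : Subgroup.zpowers u →* ℂˣ := monoidHomOfForallMemZpowers hgen hz'
      obtain ⟨ψ, hψ⟩ := MonoidHom.domRestrict_surjective (M := ℂ) (Subgroup.zpowers u) φ
      refine ⟨ψ, ?_⟩
      have := congrArg (fun χ : Subgroup.zpowers u →* ℂˣ ↦ χ ⟨u, Subgroup.mem_zpowers u⟩) hψ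
      simpa [φ, ev] using this
  have himg : ∀ ψ ∈ (univ : Finset (G →* ℂˣ)),
      ((ev ψ : ℂˣ) : ℂ) ∈ Polynomial.nthRootsFinset (orderOf u) (1 : ℂ) := by
    intro ψ _
    rw [Polynomial.mem_nthRootsFinset ho]
    rw [← Units.val_pow_eq_pow_val, (hrange (ev ψ)).1 ⟨ψ, rfl⟩, Units.val_one]
  have hconst : ∀ z ∈ Polynomial.nthRootsFinset (orderOf u) (1 : ℂ),
      (univ.filter fun ψ : G →* ℂˣ ↦ ((ev ψ : ℂˣ) : ℂ) = z).card =
        Fintype.card (ev.ker) := by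
    intro z hz
    rw [Polynomial.mem_nthRootsFinset ho] at hz
    have hz0 : z ≠ 0 := by rintro rfl; simp [ho.ne'] at hz
    have h1 := MonoidHom.card_fiber_eq_of_mem_range ev (x := Units.mk0 z hz0) (y := 1)
      ((hrange _).2 (Units.ext (by simpa using hz))) ⟨1, map_one ev⟩
    rw [Fintype.card_subtype]
    refine Eq.trans ?_ (h1.trans ?_)
    · congr 1; ext ψ; simp [Units.ext_iff]
    · congr 1; ext ψ; simp [MonoidHom.mem_ker]
  have hcard : (Polynomial.nthRootsFinset (orderOf u) (1 : ℂ)).card = orderOf u :=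
    (Complex.isPrimitiveRoot_exp _ ho.ne').card_nthRootsFinset
  have htot : Nat.card G = orderOf u * Fintype.card ev.ker := by
    have h2 := Finset.card_eq_sum_card_fiberwise himg
    rw [sum_congr rfl hconst, Finset.sum_const, hcard, smul_eq_mul, Finset.card_univ,
      ← Nat.card_eq_fintype_card, CommGroup.card_monoidHom_of_hasEnoughRootsOfUnity] at h2
    exact h2
  rw [htot, Nat.mul_div_cancel_left _ ho]
  have h3 : ∏ ψ : G →* ℂˣ, (1 - (ψ u : ℂ) * T) =
      ∏ z ∈ Polynomial.nthRootsFinset (orderOf u) (1 : ℂ),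
        ∏ ψ : G →* ℂˣ with ((ev ψ : ℂˣ) : ℂ) = z, (1 - ((ev ψ : ℂˣ) : ℂ) * T) :=
    (Finset.prod_fiberwise_of_maps_to himg _).symm
  rw [h3]
  have h4 := (Complex.isPrimitiveRoot_exp _ ho.ne').pow_sub_pow_eq_prod_sub_mul 1 T ho
  rw [one_pow] at h4
  rw [h4, ← Finset.prod_pow]
  refine prod_congr rfl fun z hz ↦ ?_
  rw [← hconst z hz, ← Finset.prod_const]
  refine prod_congr rfl fun ψ hψ ↦ ?_
  rw [(mem_filter.1 hψ).2]

/-- The product of `1 - ψ(u) T` over the characters of a finite abelian group that are trivial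
on a given element. -/
theorem prod_one_sub_monoidHom_apply_of_trivial {G : Type*} [CommGroup G] [Finite G]
    [Fintype (G →* ℂˣ)] [DecidableEq ℂˣ] (e u : G) (T : ℂ) :
    ∏ ψ : G →* ℂˣ with ψ e = 1, (1 - (ψ u : ℂ) * T) =
      (1 - T ^ orderOf (u : G ⧸ Subgroup.zpowers e)) ^
        (Nat.card (G ⧸ Subgroup.zpowers e) / orderOf (u : G ⧸ Subgroup.zpowers e)) := by
  classical
  have : Fintype ((G ⧸ Subgroup.zpowers e) →* ℂˣ) := Fintype.ofFinite _
  rw [← prod_one_sub_monoidHom_apply]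
  symm
  refine Finset.prod_bij (fun ψ _ ↦ ψ.comp (QuotientGroup.mk' (Subgroup.zpowers e))) ?_ ?_ ?_ ?_
  · intro ψ _
    simp only [mem_filter, mem_univ, true_and, MonoidHom.comp_apply]
    rw [QuotientGroup.mk'_apply, (QuotientGroup.eq_one_iff e).2 (Subgroup.mem_zpowers e), map_one]
  · intro ψ _ φ _ h
    exact (MonoidHom.cancel_right (QuotientGroup.mk'_surjective _)).1 h
  · intro ψ hψ
    have hψ' : ψ e = 1 := (mem_filter.1 hψ).2
    refine ⟨QuotientGroup.lift _ ψ ?_, mem_univ _, ?_⟩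
    · rintro x ⟨k, rfl⟩
      simp [hψ']
    · ext x; simp
  · intro ψ _
    rfl

open DirichletCharacter in
/-- The product of `1 - χ(p) T` over the Dirichlet characters trivial on the sign `ε`. -/
theorem prod_one_sub_dirichletCharacter_apply {n : ℕ} [NeZero n] (ε : ℤˣ) (u : (ZMod n)ˣ)
    (T : ℂ) :
    ∏ χ : 𝐗 n with χ ((ε : ℤ) : ZMod n) = 1, (1 - χ (u : ZMod n) * T) =
      (1 - T ^ orderOf (u : (ZMod n)ˣ ⧸
          Subgroup.zpowers (Units.map (Int.castRingHom (ZMod n)).toMonoidHom ε))) ^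
        (Nat.card ((ZMod n)ˣ ⧸
          Subgroup.zpowers (Units.map (Int.castRingHom (ZMod n)).toMonoidHom ε)) /
        orderOf (u : (ZMod n)ˣ ⧸
          Subgroup.zpowers (Units.map (Int.castRingHom (ZMod n)).toMonoidHom ε))) := by
  classical
  have : Fintype ((ZMod n)ˣ →* ℂˣ) := Fintype.ofFinite _
  rw [← prod_one_sub_monoidHom_apply_of_trivial]
  refine Finset.prod_equiv MulChar.equivToUnitHom ?_ ?_
  · intro χ
    simp only [mem_filter, mem_univ, true_and]
    rw [Units.ext_iff, MulChar.coe_equivToUnitHom]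
    simp
  · intro χ _
    rw [MulChar.coe_equivToUnitHom]

open DirichletCharacter in
/-- Only the characters unramified at `p` contribute to an Euler factor at `p`. -/
theorem prod_one_sub_primitiveCharacter_apply {M n : ℕ} [NeZero M] [NeZero n] (hn : n ∣ M) {p : ℕ}
    (hpn : p.Coprime n) (hM : ∀ d, d ∣ M → p.Coprime d → d ∣ n) (ε : ℤˣ)
    (T : ℂ) :
    ∏ χ : 𝐗 M with χ ((ε : ℤ) : ZMod M) = 1,
      (1 - χ.primitiveCharacter (p : ZMod χ.conductor) * T) =
    ∏ χ : 𝐗 n with χ ((ε : ℤ) : ZMod n) = 1, (1 - χ (p : ZMod n) * T) := by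
  classical
  have hε : ∀ χ : 𝐗 n,
      changeLevel hn χ ((ε : ℤ) : ZMod M) = χ ((ε : ℤ) : ZMod n) := fun χ ↦
    changeLevel_eq_cast_of_dvd' χ hn (a := (ε : ℤ)) (isCoprime_one_left.of_isCoprime_of_dvd_left
      (by rcases Int.units_eq_one_or ε with h | h <;> simp [h]))
  have hval : ∀ χ : 𝐗 n,
      (changeLevel hn χ).primitiveCharacter (p : ZMod (changeLevel hn χ).conductor) =
        χ (p : ZMod n) := by
    intro χ
    have h1 := primitiveCharacter_changeLevel_apply hn χ (p : ℤ)
    have h2 := primitiveCharacter_apply_of_isCoprime χ (a := (p : ℤ))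
      (Nat.isCoprime_iff_coprime.2 hpn)
    push_cast at h1 h2
    rw [h1, h2]
  symm
  refine Finset.prod_of_injOn (changeLevel (R := ℂ) hn) ((changeLevel_injective hn).injOn) ?_ ?_ ?_
  · intro χ hχ
    simp only [Finset.coe_filter, mem_univ, true_and, Set.mem_ofPred_eq] at hχ ⊢
    rw [hε, hχ]
  · intro χ hχ hχ'
    have hc : ¬ p.Coprime χ.conductor := by
      intro hc
      have hfac : χ.FactorsThrough n :=
        (mem_conductorSet_iff_conductor_dvd χ hn).2 (hM _ χ.conductor_dvd_level hc)
      obtain ⟨h, χ', rfl⟩ := hfac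
      refine hχ' ⟨χ', ?_, rfl⟩
      simpa [hε] using hχ
    have : χ.primitiveCharacter ((p : ℤ) : ZMod χ.conductor) = 0 := by
      rw [apply_eq_zero_iff, Nat.isCoprime_iff_coprime]
      exact hc
    push_cast at this
    rw [this]; simp
  · intro χ _
    rw [hval]

end CharacterProducts

section SignOrder

/-- The subgroup of `(ℤ/n)ˣ` generated by the image of a sign. -/
def signSubgroup (ε : ℤˣ) (n : ℕ) : Subgroup (ZMod n)ˣ :=
  Subgroup.zpowers (Units.map (Int.castRingHom (ZMod n)).toMonoidHom ε)

/-- The order of `p` in `(ℤ/n)ˣ` modulo the sign `ε`. -/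
noncomputable def signOrder (ε : ℤˣ) (n p : ℕ) : ℕ :=
  if h : p.Coprime n then
    orderOf (QuotientGroup.mk (ZMod.unitOfCoprime p h) : (ZMod n)ˣ ⧸ signSubgroup ε n) else 0

/-- The order of `(ℤ/n)ˣ` modulo the sign `ε`. -/
noncomputable def signIndex (ε : ℤˣ) (n : ℕ) : ℕ := Nat.card ((ZMod n)ˣ ⧸ signSubgroup ε n)

theorem mem_signSubgroup_iff {ε : ℤˣ} {n : ℕ} {u : (ZMod n)ˣ} :
    u ∈ signSubgroup ε n ↔ (u : ZMod n) = 1 ∨ (u : ZMod n) = ((ε : ℤ) : ZMod n) := by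
  constructor
  · rintro ⟨k, rfl⟩
    simp only [← map_zpow]
    rcases Int.units_eq_one_or ε with rfl | rfl
    · simp
    · rcases Int.even_or_odd k with h | h
      · simp [h.neg_one_zpow]
      · right; simp [h.neg_one_zpow]
  · rintro (h | h)
    · rw [Units.val_eq_one.1 h]; exact one_mem _
    · have : u = Units.map (Int.castRingHom (ZMod n)).toMonoidHom ε := Units.ext (by simpa using h)
      rw [this]; exact Subgroup.mem_zpowers _

theorem signOrder_dvd_iff {ε : ℤˣ} {n p : ℕ} (h : p.Coprime n) (j : ℕ) :
    signOrder ε n p ∣ j ↔ (p : ZMod n) ^ j = 1 ∨ (p : ZMod n) ^ j = ((ε : ℤ) : ZMod n) := by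
  rw [signOrder, dif_pos h, orderOf_dvd_iff_pow_eq_one, ← QuotientGroup.mk_pow,
    QuotientGroup.eq_one_iff, mem_signSubgroup_iff]
  simp

theorem signOrder_ne_zero {ε : ℤˣ} {n p : ℕ} [NeZero n] (h : p.Coprime n) :
    signOrder ε n p ≠ 0 := by
  rw [signOrder, dif_pos h]
  exact (orderOf_pos (QuotientGroup.mk (ZMod.unitOfCoprime p h) :
    (ZMod n)ˣ ⧸ signSubgroup ε n)).ne'

theorem signOrder_one {n p : ℕ} (h : p.Coprime n) : signOrder 1 n p = orderOf (p : ZMod n) := by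
  refine Nat.dvd_antisymm ?_ ?_
  · rw [signOrder_dvd_iff h]; exact Or.inl (pow_orderOf_eq_one _)
  · have := (signOrder_dvd_iff (ε := 1) h (signOrder 1 n p)).1 dvd_rfl
    simp only [Units.val_one, Int.cast_one, or_self] at this
    exact orderOf_dvd_of_pow_eq_one this

theorem signIndex_one (n : ℕ) [NeZero n] : signIndex 1 n = n.totient := by
  rw [signIndex, signSubgroup, map_one, Subgroup.zpowers_one_eq_bot,
    Nat.card_congr (QuotientGroup.quotientBot (G := (ZMod n)ˣ)).toEquiv, Nat.card_eq_fintype_card,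
    ZMod.card_units_eq_totient]

theorem signIndex_neg_one_one : signIndex (-1) 1 = 1 := by
  rw [signIndex]
  have : Subsingleton ((ZMod 1)ˣ ⧸ signSubgroup (-1) 1) := Quotient.instSubsingletonQuotient _
  exact Nat.card_unique

theorem two_mul_signIndex_neg_one {n : ℕ} (hn : 2 < n) : 2 * signIndex (-1) n = n.totient := by
  have : NeZero n := ⟨by omega⟩
  have h1 := Subgroup.card_eq_card_quotient_mul_card_subgroup (signSubgroup (-1) n)
  rw [Nat.card_eq_fintype_card (α := (ZMod n)ˣ), ZMod.card_units_eq_totient] at h1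
  have h2 : Nat.card (signSubgroup (-1) n) = 2 := by
    rw [signSubgroup, Nat.card_zpowers]
    refine orderOf_eq_prime_iff.2 ⟨?_, ?_⟩
    · rw [← map_pow]; simp
    · intro h
      have h3 := congrArg Units.val h
      simp only [Units.coe_map, Units.val_neg, Units.val_one] at h3
      have h4 : ((-1 : ℤ) : ZMod n) = ((1 : ℤ) : ZMod n) := by simpa using h3
      rw [ZMod.intCast_eq_intCast_iff_dvd_sub] at h4
      have := Int.le_of_dvd (by norm_num) h4
      omega
  rw [h2, mul_comm] at h1
  exact h1.symm

/-- A Dedekind zeta function whose Euler factors are those of the Dirichlet characters modulo `M`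
trivial on the sign `ε` is the product of their `L`-series. -/
theorem dedekindZeta_eq_prod_LSeries (F : Type*) [Field F] [NumberField F] (M : ℕ) [NeZero M]
    (ε : ℤˣ)
    (hN : ∀ p n k : ℕ, p.Prime → M = p ^ k * n → p.Coprime n →
      ∀ P ∈ Ideal.primesOver (Ideal.span {(p : ℤ)}) (𝓞 F), Ideal.absNorm P = p ^ signOrder ε n p)
    (hg : ∀ p n k : ℕ, p.Prime → M = p ^ k * n → p.Coprime n →
      (Ideal.primesOver (Ideal.span {(p : ℤ)}) (𝓞 F)).ncard * signOrder ε n p = signIndex ε n)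
    {s : ℂ} (hs : 1 < s.re) :
    dedekindZeta F s = ∏ χ : 𝐗 M with χ ((ε : ℤ) : ZMod M) = 1,
      LSeries (fun n ↦ χ.primitiveCharacter n) s := by
  have hdec : ∀ p : ℕ, p.Prime → ∃ n k : ℕ, M = p ^ k * n ∧ p.Coprime n := fun p hp ↦ by
    obtain ⟨k, n, hpn, h⟩ := Nat.exists_eq_pow_mul_and_not_dvd (NeZero.ne M) p hp.ne_one
    exact ⟨n, k, h, (Nat.Prime.coprime_iff_not_dvd hp).2 hpn⟩
  choose! n k hM hpn using hdec
  have hn0 : ∀ p : ℕ, p.Prime → NeZero (n p) := fun p hp ↦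
    ⟨fun h ↦ NeZero.ne M (by rw [hM p hp, h, mul_zero])⟩
  have h1 := dedekindZeta_hasProd (F := F) (f := fun p ↦ signOrder ε (n p) p)
    (fun p hp ↦ by have := hn0 p hp; exact signOrder_ne_zero (hpn p hp))
    (fun p hp ↦ hN p (n p) (k p) hp (hM p hp) (hpn p hp)) hs
  have h2 : HasProd (fun p : Nat.Primes ↦
      ∏ χ : 𝐗 M with χ ((ε : ℤ) : ZMod M) = 1,
        (1 - χ.primitiveCharacter ((p : ℕ) : ZMod χ.conductor) * (p : ℂ) ^ (-s))⁻¹)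
      (∏ χ : 𝐗 M with χ ((ε : ℤ) : ZMod M) = 1,
        LSeries (fun n ↦ χ.primitiveCharacter n) s) :=
    hasProd_prod fun χ _ ↦ DirichletCharacter.LSeries_eulerProduct_hasProd χ.primitiveCharacter hs
  refine h1.unique (h2.congr_fun fun p ↦ ?_)
  have := hn0 p p.2
  have hp := hpn p p.2
  rw [Finset.prod_inv_distrib,
    prod_one_sub_primitiveCharacter_apply (n := n p) ⟨_, (hM p p.2).trans (mul_comm _ _)⟩ hp
      (fun d hd hpd ↦ ?_)]
  · rw [← ZMod.coe_unitOfCoprime (p : ℕ) hp, prod_one_sub_dirichletCharacter_apply]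
    have h3 := hg p (n p) (k p) p.2 (hM p p.2) hp
    have h4 := signOrder_ne_zero (ε := ε) hp
    have h5 : (Ideal.primesOver (Ideal.span {((p : ℕ) : ℤ)}) (𝓞 F)).ncard =
        signIndex ε (n p) / signOrder ε (n p) p := by
      rw [← h3, Nat.mul_div_cancel _ (Nat.pos_of_ne_zero h4)]
    rw [h5, inv_pow, signIndex]
    simp only [signOrder, dif_pos hp]
    rfl
  · have h6 : d ∣ (p : ℕ) ^ k p * n p := (hM p p.2) ▸ hd
    exact (Nat.Coprime.pow_right _ hpd.symm).dvd_of_dvd_mul_left h6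

end SignOrder

section Cyclotomic

theorem IsPrimitiveRoot.isUnit_one_sub {R : Type*} [CommRing R] [IsDomain R] {n : ℕ} {z : R}
    (hz : IsPrimitiveRoot z n) (hn0 : 0 < n) (hn : ¬ IsPrimePow n) (hn1 : n ≠ 1) :
    IsUnit (1 - z) := by
  classical
  have h1 := Polynomial.eval_one_cyclotomic_not_prime_pow (R := R) (n := n) fun {p} hp k h ↦ by
    rcases Nat.eq_zero_or_pos k with rfl | hk
    · exact hn1 (by simpa using h.symm)
    · exact hn (h ▸ hp.isPrimePow.pow hk.ne')
  rw [Polynomial.cyclotomic_eq_prod_X_sub_primitiveRoots hz, Polynomial.eval_prod] at h1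
  simp only [Polynomial.eval_sub, Polynomial.eval_X, Polynomial.eval_C] at h1
  rw [← Finset.mul_prod_erase _ _ ((mem_primitiveRoots hn0).2 hz)] at h1
  exact IsUnit.of_mul_eq_one _ h1

variable (M : ℕ) [NeZero M] (K : Type*) [Field K] [NumberField K] [IsCyclotomicExtension {M} ℚ K]

theorem absNorm_primesOver_cyclotomic (p n k : ℕ) (hp : p.Prime) (hM : M = p ^ k * n)
    (hpn : p.Coprime n) (P : Ideal (𝓞 K))
    (hP : P ∈ Ideal.primesOver (Ideal.span {(p : ℤ)}) (𝓞 K)) :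
    Ideal.absNorm P = p ^ signOrder 1 n p := by
  have : Fact p.Prime := ⟨hp⟩
  obtain ⟨_, _⟩ := hP
  have hnd : ¬ p ∣ n := (Nat.Prime.coprime_iff_not_dvd hp).1 hpn
  rw [signOrder_one hpn, ← Ideal.natAbs_pow_inertiaDeg (p : ℤ) P, Int.natAbs_natCast]
  congr 1
  rcases k with _ | k
  · rw [pow_zero, one_mul] at hM
    subst hM
    exact IsCyclotomicExtension.Rat.inertiaDeg_eq_of_not_dvd p K P hnd
  · exact IsCyclotomicExtension.Rat.inertiaDeg_eq M K P hM hnd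

theorem ncard_primesOver_cyclotomic (p n k : ℕ) (hp : p.Prime) (hM : M = p ^ k * n)
    (hpn : p.Coprime n) :
    (Ideal.primesOver (Ideal.span {(p : ℤ)}) (𝓞 K)).ncard * signOrder 1 n p = signIndex 1 n := by
  have : Fact p.Prime := ⟨hp⟩
  have hn0 : NeZero n := ⟨fun h ↦ NeZero.ne M (by rw [hM, h, mul_zero])⟩
  have hnd : ¬ p ∣ n := (Nat.Prime.coprime_iff_not_dvd hp).1 hpn
  have : IsGalois ℚ K := IsCyclotomicExtension.isGalois {M} ℚ K
  have h := Ideal.ncard_primesOver_mul_ramificationIdxIn_mul_inertiaDegIn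
    (Ideal.span {(p : ℤ)}) (𝓞 K) Gal(K/ℚ)
  rw [IsGalois.card_aut_eq_finrank, IsCyclotomicExtension.Rat.finrank M K] at h
  rw [signOrder_one hpn, signIndex_one]
  rcases k with _ | k
  · rw [pow_zero, one_mul] at hM
    subst hM
    rw [IsCyclotomicExtension.Rat.inertiaDegIn_eq_of_not_dvd p K hnd,
      IsCyclotomicExtension.Rat.ramificationIdxIn_eq_of_not_dvd p K hnd, one_mul] at h
    exact h
  · rw [IsCyclotomicExtension.Rat.inertiaDegIn_eq M K hM hnd,
      IsCyclotomicExtension.Rat.ramificationIdxIn_eq M K hM hnd, hM,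
      Nat.totient_mul (hpn.pow_left _), Nat.totient_prime_pow_succ hp] at h
    have h0 : 0 < p ^ k * (p - 1) := Nat.mul_pos (pow_pos hp.pos _) (Nat.sub_pos_of_lt hp.one_lt)
    exact Nat.eq_of_mul_eq_mul_left h0 (by rw [← h]; ring)

/-- The Dedekind zeta function of the `M`-th cyclotomic field. -/
theorem dedekindZeta_cyclotomic {s : ℂ} (hs : 1 < s.re) :
    dedekindZeta K s = ∏ χ : 𝐗 M, LSeries (fun n ↦ χ.primitiveCharacter n) s := by
  rw [dedekindZeta_eq_prod_LSeries K M 1 (absNorm_primesOver_cyclotomic M K)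
    (ncard_primesOver_cyclotomic M K) hs]
  refine prod_congr (Finset.filter_true_of_mem fun χ _ ↦ ?_) fun _ _ ↦ rfl
  simp

end Cyclotomic

section RealCyclotomic

variable (M : ℕ) [NeZero M] (K : Type*) [Field K] [NumberField K] [IsCyclotomicExtension {M} ℚ K]
  [IsCMField K]

open IsCMField

theorem ringOfIntegersComplexConj_toInteger {ζ : K} (hζ : IsPrimitiveRoot ζ M) :
    ringOfIntegersComplexConj K hζ.toInteger * hζ.toInteger = 1 := by
  apply RingOfIntegers.ext
  have hu : IsUnit hζ.toInteger := hζ.toInteger_isPrimitiveRoot.isUnit (NeZero.ne M)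
  have h1 : IsOfFinOrder hu.unit :=
    isOfFinOrder_iff_pow_eq_one.2 ⟨M, NeZero.pos M, Units.ext (by
      simpa using hζ.toInteger_isPrimitiveRoot.pow_eq_one)⟩
  have h2 := complexConj_torsion K ⟨hu.unit, (CommGroup.mem_torsion _).2 h1⟩
  have hne : ζ ≠ 0 := hζ.ne_zero (NeZero.ne M)
  simp only [map_mul, map_one, coe_ringOfIntegersComplexConj]
  simp only [IsUnit.unit_spec] at h2
  rw [h2]
  exact inv_mul_cancel₀ hne

theorem charP_quotient_of_mem {K : Type*} [Field K] [NumberField K] {p : ℕ} (hp : p.Prime) {P : Ideal (𝓞 K)} [P.IsPrime]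
    (hpP : (p : 𝓞 K) ∈ P) : CharP (𝓞 K ⧸ P) p := by
  have : Nontrivial (𝓞 K ⧸ P) := Ideal.Quotient.nontrivial_iff.2 (Ideal.IsPrime.ne_top ‹_›)
  rw [CharP.charP_iff_prime_eq_zero hp, ← map_natCast (Ideal.Quotient.mk P)]
  exact Ideal.Quotient.eq_zero_iff_mem.2 hpP

variable {M K} in
/-- Modulo a prime above `p`, a `p`-power map acts on the cyclotomic integers as the identity or
as complex conjugation whenever it does so on roots of unity of order prime to `p`. -/
theorem quotient_mk_pow_eq {p j : ℕ} (hp : p.Prime) {P : Ideal (𝓞 K)}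
    [P.IsPrime] (hpP : (p : 𝓞 K) ∈ P) (τ : 𝓞 K →+* 𝓞 K) {ζ : K} (hζ : IsPrimitiveRoot ζ M)
    (hτ : (Ideal.Quotient.mk P hζ.toInteger) ^ p ^ j = Ideal.Quotient.mk P (τ hζ.toInteger))
    (x : 𝓞 K) :
    (Ideal.Quotient.mk P x) ^ p ^ j = Ideal.Quotient.mk P (τ x) := by
  have : Fact p.Prime := ⟨hp⟩
  have := charP_quotient_of_mem hp hpP
  have hx : x ∈ Algebra.adjoin ℤ {hζ.toInteger} := by
    rw [IsCyclotomicExtension.Rat.adjoin_singleton_eq_top hζ]; trivial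
  induction hx using Algebra.adjoin_induction with
  | mem y hy => rw [Set.mem_singleton_iff.1 hy]; exact hτ
  | algebraMap r =>
    have : ((r : 𝓞 K ⧸ P)) ^ p ^ j = r := by
      have := map_intCast (iterateFrobenius (𝓞 K ⧸ P) p j) r
      rwa [iterateFrobenius_def] at this
    simpa using this
  | add y z _ _ hy hz => rw [map_add, add_pow_char_pow, hy, hz, map_add, map_add]
  | mul y z _ _ hy hz => rw [map_mul, mul_pow, hy, hz, map_mul, map_mul]

theorem quotient_mk_toInteger_pow_eq_one {M : ℕ} [NeZero M] {K : Type*} [Field K] [NumberField K]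
    {p n k : ℕ} (hp : p.Prime) (hM : M = p ^ k * n)
    {P : Ideal (𝓞 K)} [P.IsPrime] (hpP : (p : 𝓞 K) ∈ P) {ζ : K} (hζ : IsPrimitiveRoot ζ M) :
    (Ideal.Quotient.mk P hζ.toInteger) ^ n = 1 := by
  have : Fact p.Prime := ⟨hp⟩
  have := charP_quotient_of_mem hp hpP
  have h1 : ((Ideal.Quotient.mk P hζ.toInteger) ^ n - 1) ^ p ^ k = 0 := by
    rw [sub_pow_char_pow, one_pow, ← pow_mul, mul_comm, ← hM, ← map_pow,
      hζ.toInteger_isPrimitiveRoot.pow_eq_one, map_one, sub_self]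
  exact sub_eq_zero.1 (pow_eq_zero_iff (pow_ne_zero _ hp.ne_zero) |>.1 h1)

/-- The minimal polynomial relation of `ζ` over the real subfield: `ζ + ζ⁻¹` is real. -/
theorem exists_real_add_conj (x : 𝓞 K) :
    ∃ y : 𝓞 (𝐑 K),
      algebraMap (𝓞 (𝐑 K)) (𝓞 K) y = x + ringOfIntegersComplexConj K x := by
  have h : x + ringOfIntegersComplexConj K x ∈
      Set.range (algebraMap (𝓞 (𝐑 K)) (𝓞 K)) := by
    rw [← ringOfIntegersComplexConj_eq_self_iff, map_add, add_comm]
    congr 1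
    apply RingOfIntegers.ext
    simp
  exact h

theorem absNorm_primesOver_real (p n k : ℕ) (hp : p.Prime) (hM : M = p ^ k * n)
    (hpn : p.Coprime n) (Q : Ideal (𝓞 (𝐑 K)))
    (hQ : Q ∈ Ideal.primesOver (Ideal.span {(p : ℤ)}) (𝓞 (𝐑 K))) :
    Ideal.absNorm Q = p ^ signOrder (-1) n p := by
  have : Fact p.Prime := ⟨hp⟩
  have hn0 : NeZero n := ⟨fun h ↦ NeZero.ne M (by rw [hM, h, mul_zero])⟩
  obtain ⟨_, hQp⟩ := hQ
  have hp0 : (Ideal.span {(p : ℤ)}) ≠ ⊥ := by simpa using hp.ne_zero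
  have hpm : (Ideal.span {(p : ℤ)}).IsMaximal := Int.ideal_span_isMaximal_of_prime p
  have : Q.IsMaximal := Ideal.IsMaximal.of_liesOver_isMaximal Q (Ideal.span {(p : ℤ)})
  obtain ⟨P, hPm, hPQ⟩ := Ideal.exists_maximal_ideal_liesOver_of_isIntegral Q (S := 𝓞 K)
  have hPprime : P.IsPrime := hPm.isPrime
  have hQ0 : Q ≠ ⊥ := Ideal.ne_bot_of_liesOver_of_ne_bot hp0 Q
  have hmem : ∀ x : 𝓞 (𝐑 K),
      x ∈ Q ↔ algebraMap (𝓞 (𝐑 K)) (𝓞 K) x ∈ P := fun x ↦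
    Ideal.mem_of_liesOver P Q x
  have hpQ : (p : 𝓞 (𝐑 K)) ∈ Q := by
    have h1 : ((p : ℤ)) ∈ Ideal.span {(p : ℤ)} := Ideal.mem_span_singleton_self _
    rw [Ideal.mem_of_liesOver Q (Ideal.span {(p : ℤ)})] at h1
    simpa using h1
  have hpP : (p : 𝓞 K) ∈ P := by simpa using (hmem _).1 hpQ
  have := charP_quotient_of_mem hp hpP
  let ζ := IsCyclotomicExtension.zeta M ℚ K
  have hζ : IsPrimitiveRoot ζ M := IsCyclotomicExtension.zeta_spec M ℚ K
  have hconj := ringOfIntegersComplexConj_toInteger M K hζ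
  letI : Field (𝓞 (𝐑 K) ⧸ Q) := Ideal.Quotient.field Q
  have : Finite (𝓞 (𝐑 K) ⧸ Q) := Ideal.finiteQuotientOfFreeOfNeBot Q hQ0
  letI : Fintype (𝓞 (𝐑 K) ⧸ Q) := Fintype.ofFinite _
  have hcard : Fintype.card (𝓞 (𝐑 K) ⧸ Q) = Ideal.absNorm Q := by
    rw [← Nat.card_eq_fintype_card]; rfl
  set f := Q.inertiaDeg ℤ with hf
  have hq : Ideal.absNorm Q = p ^ f := by
    rw [hf, ← Ideal.natAbs_pow_inertiaDeg (p : ℤ) Q, Int.natAbs_natCast]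
  have hf0 : 0 < f := Ideal.inertiaDeg_pos ..
  rw [hq] at hcard ⊢
  congr 1
  refine le_antisymm ?_ (Nat.le_of_dvd hf0 ?_)
  · set j := signOrder (-1) n p with hj
    have hj0 : 0 < j := Nat.pos_of_ne_zero (signOrder_ne_zero hpn)
    have hreal : ∀ x : 𝓞 (𝐑 K),
        (Ideal.Quotient.mk P (algebraMap _ (𝓞 K) x)) ^ p ^ j =
          Ideal.Quotient.mk P (algebraMap _ (𝓞 K) x) := by
      intro x
      have hz := quotient_mk_toInteger_pow_eq_one hp hM hpP hζ
      rcases (signOrder_dvd_iff hpn j).1 (by rw [hj]) with h | h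
      · refine quotient_mk_pow_eq hp hpP (RingHom.id _) hζ ?_ _
        have h1 : p ^ j ≡ 1 [MOD n] := (ZMod.natCast_eq_natCast_iff _ _ _).1 (by simpa using h)
        rw [RingHom.id_apply, ← Nat.mod_add_div (p ^ j) n, h1, pow_add, pow_mul, hz, one_pow,
          mul_one, ← pow_one (Ideal.Quotient.mk P hζ.toInteger), ← pow_mul, one_mul,
          ← Nat.mod_add_div 1 n, pow_add, pow_mul, hz, one_pow, mul_one]
        simp
      · have hc : (ringOfIntegersComplexConj K : 𝓞 K →+* 𝓞 K) (algebraMap _ (𝓞 K) x) =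
            algebraMap _ (𝓞 K) x := (ringOfIntegersComplexConj K).commutes x
        have h2 := quotient_mk_pow_eq (M := M) (j := j) hp hpP
          (ringOfIntegersComplexConj K : 𝓞 K →+* 𝓞 K) hζ ?_ (algebraMap _ (𝓞 K) x)
        · rw [h2, hc]
        have h1 : n ∣ p ^ j + 1 := by
          rw [← ZMod.natCast_eq_zero_iff]
          push_cast
          rw [h]; simp
        obtain ⟨c, hc⟩ := h1
        have h3 : (Ideal.Quotient.mk P hζ.toInteger) ^ p ^ j * Ideal.Quotient.mk P hζ.toInteger =
            1 := by rw [← pow_succ, hc, pow_mul, hz, one_pow]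
        have h4 : Ideal.Quotient.mk P (ringOfIntegersComplexConj K hζ.toInteger) *
            Ideal.Quotient.mk P hζ.toInteger = 1 := by rw [← map_mul, hconj, map_one]
        calc _ = (Ideal.Quotient.mk P hζ.toInteger) ^ p ^ j *
              (Ideal.Quotient.mk P (ringOfIntegersComplexConj K hζ.toInteger) *
              Ideal.Quotient.mk P hζ.toInteger) := by rw [h4, mul_one]
          _ = Ideal.Quotient.mk P (ringOfIntegersComplexConj K hζ.toInteger) *
              ((Ideal.Quotient.mk P hζ.toInteger) ^ p ^ j *
              Ideal.Quotient.mk P hζ.toInteger) := by ring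
          _ = _ := by rw [h3, mul_one]; rfl
    have hk : ∀ x : 𝓞 (𝐑 K) ⧸ Q, x ^ p ^ j = x := by
      intro x
      obtain ⟨x, rfl⟩ := Ideal.Quotient.mk_surjective x
      rw [← map_pow, Ideal.Quotient.eq, hmem, map_sub, map_pow, ← Ideal.Quotient.eq, map_pow]
      exact hreal x
    have hpj : 1 < p ^ j := Nat.one_lt_pow hj0.ne' hp.one_lt
    have h5 := (FiniteField.forall_pow_eq_one_iff (𝓞 (𝐑 K) ⧸ Q) (p ^ j - 1)).1
      fun x ↦ Units.ext (by
        have h6 := hk x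
        rw [← Nat.sub_add_cancel hpj.le, pow_succ] at h6
        have := mul_right_cancel₀ x.ne_zero (h6.trans (one_mul _).symm)
        simpa using this)
    rw [hcard] at h5
    have h7 := Nat.le_of_dvd (by omega) h5
    have : p ^ f ≤ p ^ j := by omega
    exact (Nat.pow_le_pow_iff_right hp.one_lt).1 this
  · rw [signOrder_dvd_iff hpn]
    have hξ : IsPrimitiveRoot (hζ.toInteger ^ p ^ k) n :=
      hζ.toInteger_isPrimitiveRoot.pow (NeZero.pos M) hM
    set ξ := hζ.toInteger ^ p ^ k with hξdef
    have hpow : ringOfIntegersComplexConj K ξ * ξ = 1 := by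
      rw [hξdef, map_pow, ← mul_pow, hconj, one_pow]
    letI : Field (𝓞 K ⧸ P) := Ideal.Quotient.field P
    set z := Ideal.Quotient.mk P ξ with hz
    set z' := Ideal.Quotient.mk P (ringOfIntegersComplexConj K ξ) with hz'
    have hzz : z' * z = 1 := by rw [hz, hz', ← map_mul, hpow, map_one]
    have hzn : IsPrimitiveRoot z n := by
      have : NeZero ((n : ℕ) : 𝓞 K ⧸ P) := ⟨fun h ↦ by
        rw [CharP.cast_eq_zero_iff (𝓞 K ⧸ P) p] at h
        exact ((Nat.Prime.coprime_iff_not_dvd hp).1 hpn) h⟩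
      rw [← Polynomial.isRoot_cyclotomic_iff, ← Polynomial.map_cyclotomic n (Ideal.Quotient.mk P),
        hz]
      exact Polynomial.IsRoot.map (hξ.isRoot_cyclotomic (NeZero.pos n))
    obtain ⟨y, hy⟩ := exists_real_add_conj K ξ
    have h1 : (Ideal.Quotient.mk Q y) ^ p ^ f = Ideal.Quotient.mk Q y := by
      rw [← hcard, FiniteField.pow_card]
    rw [← map_pow, Ideal.Quotient.eq, hmem, map_sub, map_pow, ← Ideal.Quotient.eq, map_pow, hy,
      map_add, ← hz, ← hz', add_pow_char_pow] at h1
    have h2 : (z ^ p ^ f - z) * (z ^ p ^ f - z') = 0 := by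
      have h3 : z' ^ p ^ f * z ^ p ^ f = 1 := by rw [← mul_pow, hzz, one_pow]
      linear_combination (z ^ p ^ f) * h1 + hzz - h3
    rcases mul_eq_zero.1 h2 with h | h
    · left
      have h3 : z ^ p ^ f = z ^ 1 := by rw [pow_one]; exact sub_eq_zero.1 h
      have h4 : p ^ f ≡ 1 [MOD n] := by
        have := (hzn.isOfFinOrder (NeZero.ne n)).pow_eq_pow_iff_modEq.1 h3
        rwa [← hzn.eq_orderOf] at this
      have := (ZMod.natCast_eq_natCast_iff _ _ _).2 h4
      simpa using this
    · right
      have h3 : z ^ (p ^ f + 1) = 1 := by rw [pow_succ, sub_eq_zero.1 h, hzz]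
      have h4 := (ZMod.natCast_eq_zero_iff _ _).2 ((hzn.pow_eq_one_iff_dvd _).1 h3)
      push_cast at h4
      simpa using eq_neg_of_add_eq_zero_left h4

end RealCyclotomic

section RealCyclotomic

variable (M : ℕ) [NeZero M] (K : Type*) [Field K] [NumberField K] [IsCyclotomicExtension {M} ℚ K]
  [IsCMField K]

open IsCMField Polynomial

theorem adjoin_real_eq_top {ζ : K} (hζ : IsPrimitiveRoot ζ M) :
    Algebra.adjoin (𝐑 K) {algebraMap (𝓞 K) K hζ.toInteger} = ⊤ := by
  have h2 := IsCyclotomicExtension.adjoin_primitive_root_eq_top (n := M) (A := ℚ) (B := K) hζ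
  rw [eq_top_iff]
  intro x _
  have hx : x ∈ Algebra.adjoin ℚ {ζ} := h2 ▸ Algebra.mem_top
  induction hx using Algebra.adjoin_induction with
  | mem y hy => exact Algebra.subset_adjoin hy
  | algebraMap r =>
    rw [IsScalarTower.algebraMap_apply ℚ (𝐑 K) K]
    exact Subalgebra.algebraMap_mem _ _
  | add y z _ _ hy hz => exact add_mem (hy trivial) (hz trivial)
  | mul y z _ _ hy hz => exact mul_mem (hy trivial) (hz trivial)

theorem sub_conj_mem_differentIdeal {ζ : K} (hζ : IsPrimitiveRoot ζ M) :
    hζ.toInteger - ringOfIntegersComplexConj K hζ.toInteger ∈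
      differentIdeal (𝓞 (𝐑 K)) (𝓞 K) := by
  obtain ⟨y, hy⟩ := exists_real_add_conj K hζ.toInteger
  have hconj := ringOfIntegersComplexConj_toInteger M K hζ
  have hmem := aeval_derivative_mem_differentIdeal (𝓞 (𝐑 K))
    (𝐑 K) K hζ.toInteger (adjoin_real_eq_top M K hζ)
  generalize hζ.toInteger = z at *
  generalize ringOfIntegersComplexConj K z = z' at *
  have hf0 : aeval z (X ^ 2 - C y * X + 1 : (𝓞 (𝐑 K))[X]) = 0 := by
    simp only [map_add, map_sub, map_mul, map_pow, aeval_X, aeval_C, map_one, hy]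
    linear_combination -hconj
  have hfd : aeval z (derivative (X ^ 2 - C y * X + 1 : (𝓞 (𝐑 K))[X])) =
      z - z' := by
    simp only [derivative_mul, derivative_X_pow, derivative_C,
      derivative_X, derivative_one, map_add, map_sub, map_mul, map_pow, aeval_X, aeval_C, map_one,
      hy, map_zero, Nat.cast_ofNat, map_ofNat]
    norm_num
    ring
  have h_int : IsIntegral (𝓞 (𝐑 K)) z := Algebra.IsIntegral.isIntegral z
  obtain ⟨g, hg⟩ := minpoly.isIntegrallyClosed_dvd h_int hf0
  have h1 : z - z' = aeval z (derivative (minpoly (𝓞 (𝐑 K)) z)) *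
      aeval z g := by
    rw [← hfd, hg, derivative_mul, map_add, map_mul, map_mul, minpoly.aeval, zero_mul, add_zero]
  rw [h1]
  exact Ideal.mul_mem_right _ _ hmem

/-- For odd `M` that is not a prime power, `ζ - ζ⁻¹` is a unit. -/
theorem isUnit_sub_conj (hodd : Odd M) (h1 : M ≠ 1) (hpp : ¬ IsPrimePow M) {ζ : K}
    (hζ : IsPrimitiveRoot ζ M) :
    IsUnit (hζ.toInteger - ringOfIntegersComplexConj K hζ.toInteger) := by
  have hconj := ringOfIntegersComplexConj_toInteger M K hζ
  set z := hζ.toInteger with hz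
  have h2 : IsPrimitiveRoot (z ^ 2) M :=
    hζ.toInteger_isPrimitiveRoot.pow_of_coprime 2 (Nat.coprime_two_left.2 hodd)
  have h3 := h2.isUnit_one_sub (NeZero.pos M) hpp h1
  have h4 : z - ringOfIntegersComplexConj K z =
      (1 - z ^ 2) * (-ringOfIntegersComplexConj K z) := by
    linear_combination (-z) * hconj
  rw [h4]
  exact h3.mul (IsUnit.of_mul_eq_one _ hconj).neg

theorem differentIdeal_real_eq_top (hodd : Odd M) (h1 : M ≠ 1) (hpp : ¬ IsPrimePow M) :
    differentIdeal (𝓞 (𝐑 K)) (𝓞 K) = ⊤ :=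
  Ideal.eq_top_of_isUnit_mem _
    (sub_conj_mem_differentIdeal M K (IsCyclotomicExtension.zeta_spec M ℚ K))
    (isUnit_sub_conj M K hodd h1 hpp _)

theorem isAbelianGalois_real (M : ℕ) [NeZero M] (K : Type*) [Field K] [NumberField K]
    [IsCyclotomicExtension {M} ℚ K] : IsAbelianGalois ℚ (𝐑 K) :=
  have : IsAbelianGalois ℚ K := IsCyclotomicExtension.isAbelianGalois {M} ℚ K
  IsAbelianGalois.tower_bot ℚ (𝐑 K) K

theorem two_mul_finrank_real : 2 * Module.finrank ℚ (𝐑 K) = M.totient := by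
  rw [← IsCyclotomicExtension.Rat.finrank M K,
    ← Module.finrank_mul_finrank ℚ (𝐑 K) K,
    Algebra.IsQuadraticExtension.finrank_eq_two (𝐑 K) K, mul_comm]

theorem ncard_primesOver_real (hodd : Odd M) (h1 : M ≠ 1) (hM' : IsPrimePow M → M.Prime)
    (p n k : ℕ) (hp : p.Prime) (hM : M = p ^ k * n) (hpn : p.Coprime n) :
    (Ideal.primesOver (Ideal.span {(p : ℤ)}) (𝓞 (𝐑 K))).ncard *
      signOrder (-1) n p = signIndex (-1) n := by
  have : Fact p.Prime := ⟨hp⟩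
  have hn0 : NeZero n := ⟨fun h ↦ NeZero.ne M (by rw [hM, h, mul_zero])⟩
  have hnd : ¬ p ∣ n := (Nat.Prime.coprime_iff_not_dvd hp).1 hpn
  have : IsGalois ℚ K := IsCyclotomicExtension.isGalois {M} ℚ K
  have : IsAbelianGalois ℚ (𝐑 K) := isAbelianGalois_real M K
  have h := Ideal.ncard_primesOver_mul_ramificationIdxIn_mul_inertiaDegIn
    (Ideal.span {(p : ℤ)}) (𝓞 (𝐑 K)) Gal(𝐑 K/ℚ)
  rw [IsGalois.card_aut_eq_finrank] at h
  have hp0 : (Ideal.span {(p : ℤ)}) ≠ ⊥ := by simpa using hp.ne_zero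
  have hpm : (Ideal.span {(p : ℤ)}).IsMaximal := Int.ideal_span_isMaximal_of_prime p
  obtain ⟨P, hPm, hPp⟩ := Ideal.exists_maximal_ideal_liesOver_of_isIntegral
    (Ideal.span {(p : ℤ)}) (S := 𝓞 K)
  have hPprime : P.IsPrime := hPm.isPrime
  set Q := P.under (𝓞 (𝐑 K)) with hQ
  have hPQ : P.LiesOver Q := ⟨rfl⟩
  have hQp : Q.LiesOver (Ideal.span {(p : ℤ)}) := Ideal.LiesOver.tower_bot P Q _
  have hQprime : Q.IsPrime := Ideal.IsPrime.under _ _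
  have hinert : Ideal.inertiaDegIn (Ideal.span {(p : ℤ)}) (𝓞 (𝐑 K)) =
      signOrder (-1) n p := by
    rw [Ideal.inertiaDegIn_eq_inertiaDeg _ Q Gal(𝐑 K/ℚ)]
    have h2 := absNorm_primesOver_real M K p n k hp hM hpn Q ⟨hQprime, hQp⟩
    rw [← Ideal.natAbs_pow_inertiaDeg (p : ℤ) Q, Int.natAbs_natCast] at h2
    exact Nat.pow_right_injective hp.two_le h2
  rw [hinert, Ideal.ramificationIdxIn_eq_ramificationIdx _ Q Gal(𝐑 K/ℚ)] at h
  have htow := Ideal.ramificationIdx_tower (R := ℤ) Q P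
  have hM3 : 2 < M := by
    have := NeZero.pos M
    obtain ⟨c, hc⟩ := hodd
    omega
  have hdeg := two_mul_finrank_real M K
  rcases k with _ | k
  · rw [pow_zero, one_mul] at hM
    subst hM
    rw [IsCyclotomicExtension.Rat.ramificationIdx_eq_of_not_dvd p K P hnd] at htow
    rw [Nat.eq_one_of_mul_eq_one_right htow.symm, one_mul] at h
    rw [h]
    have := two_mul_signIndex_neg_one hM3
    omega
  · by_cases hpp : IsPrimePow M
    · have hMp := hM' hpp
      have hn1 : n = 1 := by
        rcases (Nat.dvd_prime hMp).1 ⟨_, hM.trans (mul_comm _ _)⟩ with h | h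
        · exact h
        · exfalso
          refine hnd (h ▸ hM ▸ ?_)
          exact (dvd_pow_self p k.succ_ne_zero).mul_right n
      subst hn1
      have hcard := Ideal.ncard_primesOver_mul_ncard_primesOver (p := Ideal.span {(p : ℤ)}) Q
        Gal(𝐑 K/ℚ) (𝓞 K) Gal(K/ℚ)
      have hMk : M = p ^ (k + 1) := by rw [hM, mul_one]
      have : IsCyclotomicExtension {p ^ (k + 1)} ℚ K := hMk ▸ ‹IsCyclotomicExtension {M} ℚ K›
      rw [IsCyclotomicExtension.Rat.ncard_primesOver_of_prime_pow p k K] at hcard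
      rw [Nat.eq_one_of_mul_eq_one_right hcard, signIndex_neg_one_one, one_mul]
      exact Nat.dvd_one.1 ((signOrder_dvd_iff hpn 1).2 (Or.inl (Subsingleton.elim _ _)))
    · have hdiff := differentIdeal_real_eq_top M K hodd h1 hpp
      have hunr : Algebra.IsUnramifiedAt (𝓞 (𝐑 K)) P := by
        rw [← not_dvd_differentIdeal_iff, hdiff, Ideal.dvd_iff_le, top_le_iff]
        exact hPprime.ne_top
      have he : P.ramificationIdx (𝓞 (𝐑 K)) = 1 :=
        Ideal.ramificationIdx_eq_one_of_isUnramifiedAt ..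
      rw [he, mul_one, IsCyclotomicExtension.Rat.ramificationIdx_eq M K P hM hnd] at htow
      have hn2 : 2 < n := by
        have hno : Odd n := Odd.of_dvd_nat hodd ⟨_, hM.trans (mul_comm _ _)⟩
        have hn1 : n ≠ 1 := by
          rintro rfl
          exact hpp (by rw [hM, mul_one]; exact hp.isPrimePow.pow k.succ_ne_zero)
        obtain ⟨c, hc⟩ := hno
        omega
      have h3 := two_mul_signIndex_neg_one hn2
      rw [← htow] at h
      rw [hM, Nat.totient_mul (hpn.pow_left _), Nat.totient_prime_pow_succ hp, ← h, ← h3] at hdeg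
      have h0 : 0 < p ^ k * (p - 1) * 2 :=
        Nat.mul_pos (Nat.mul_pos (pow_pos hp.pos _) (Nat.sub_pos_of_lt hp.one_lt)) two_pos
      exact Nat.eq_of_mul_eq_mul_left h0 (by linarith)

/-- The Dedekind zeta function of the real subfield of the `M`-th cyclotomic field. -/
theorem dedekindZeta_real (hodd : Odd M) (h1 : M ≠ 1) (hM' : IsPrimePow M → M.Prime) {s : ℂ}
    (hs : 1 < s.re) :
    dedekindZeta (𝐑 K) s = ∏ χ : 𝐗 M with χ (-1) = 1,
      LSeries (fun n ↦ χ.primitiveCharacter n) s := by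
  rw [dedekindZeta_eq_prod_LSeries (𝐑 K) M (-1) (absNorm_primesOver_real M K)
    (ncard_primesOver_real M K hodd h1 hM') hs]
  refine prod_congr (Finset.filter_congr fun χ _ ↦ ?_) fun _ _ ↦ rfl
  simp

end RealCyclotomic

section AbelSummation

open Filter Topology Complex

/-- The weights `(n+1)^{-s} - (n+2)^{-s}` of Abel summation. -/
noncomputable def abelWeight (s : ℂ) (n : ℕ) : ℂ :=
  ((n + 1 : ℕ) : ℂ) ^ (-s) - ((n + 2 : ℕ) : ℂ) ^ (-s)

/-- The Abel-summed Dirichlet series of a sequence with partial sums `S`. -/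
noncomputable def abelSeries (S : ℕ → ℂ) (s : ℂ) : ℂ := ∑' n, S (n + 1) * abelWeight s n

theorem norm_abelWeight_le {s : ℂ} (hs : 0 < s.re) (n : ℕ) :
    ‖abelWeight s n‖ ≤ ‖s‖ * ((n + 1 : ℕ) : ℝ) ^ (-(s.re + 1)) := by
  have hn : (0 : ℝ) < (n + 1 : ℕ) := by positivity
  have hs0 : s ≠ 0 := by rintro rfl; simp at hs
  have hderiv : ∀ t ∈ Set.Icc ((n + 1 : ℕ) : ℝ) (n + 2 : ℕ),
      HasDerivWithinAt (fun t : ℝ ↦ (t : ℂ) ^ (-s)) (-s * (t : ℂ) ^ (-s - 1))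
        (Set.Icc ((n + 1 : ℕ) : ℝ) (n + 2 : ℕ)) t := by
    intro t ht
    have ht0 : t ≠ 0 := (hn.trans_le ht.1).ne'
    exact (hasDerivAt_ofReal_cpow_const ht0 (neg_ne_zero.2 hs0)).hasDerivWithinAt
  have hbound : ∀ t ∈ Set.Icc ((n + 1 : ℕ) : ℝ) (n + 2 : ℕ),
      ‖-s * (t : ℂ) ^ (-s - 1)‖ ≤ ‖s‖ * ((n + 1 : ℕ) : ℝ) ^ (-(s.re + 1)) := by
    intro t ht
    have ht0 : 0 < t := hn.trans_le ht.1
    rw [norm_mul, norm_neg, norm_cpow_eq_rpow_re_of_pos ht0]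
    refine mul_le_mul_of_nonneg_left ?_ (norm_nonneg _)
    have : (-s - 1).re = -(s.re + 1) := by simp; ring
    rw [this]
    exact Real.rpow_le_rpow_of_nonpos hn ht.1 (by linarith)
  have hle : ((n + 1 : ℕ) : ℝ) ≤ (n + 2 : ℕ) := by push_cast; linarith
  have := Convex.norm_image_sub_le_of_norm_hasDerivWithin_le hderiv hbound (convex_Icc _ _)
    (Set.right_mem_Icc.2 hle) (Set.left_mem_Icc.2 hle)
  have h1 : ‖((n + 1 : ℕ) : ℝ) - ((n + 2 : ℕ) : ℝ)‖ = 1 := by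
    push_cast; norm_num
  rw [h1, mul_one] at this
  simpa [abelWeight] using this

theorem summable_abel_bound {σ : ℝ} (hσ : 0 < σ) :
    Summable fun n : ℕ ↦ ((n + 1 : ℕ) : ℝ) ^ (-(σ + 1)) :=
  (summable_nat_add_iff 1).2 (Real.summable_nat_rpow.2 (by linarith))

variable {S : ℕ → ℂ} {C : ℝ}

theorem summable_abelSeries (hS : ∀ n, ‖S n‖ ≤ C) {s : ℂ} (hs : 0 < s.re) :
    Summable fun n ↦ S (n + 1) * abelWeight s n := by
  have hC : 0 ≤ C := (norm_nonneg _).trans (hS 0)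
  refine Summable.of_norm_bounded
    (((summable_abel_bound hs).mul_left ‖s‖).mul_left C) fun n ↦ ?_
  rw [norm_mul]
  exact mul_le_mul (hS _) (norm_abelWeight_le hs n) (norm_nonneg _) hC

theorem norm_abelSeries_le (hS : ∀ n, ‖S n‖ ≤ C) {s : ℂ} (hs : 0 < s.re) :
    ‖abelSeries S s‖ ≤ C * (‖s‖ * ∑' n : ℕ, ((n + 1 : ℕ) : ℝ) ^ (-(s.re + 1))) := by
  have hC : 0 ≤ C := (norm_nonneg _).trans (hS 0)
  rw [← tsum_mul_left, ← tsum_mul_left]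
  refine tsum_of_norm_bounded
    (((summable_abel_bound hs).mul_left ‖s‖).mul_left C).hasSum fun n ↦ ?_
  rw [norm_mul]
  exact mul_le_mul (hS _) (norm_abelWeight_le hs n) (norm_nonneg _) hC

theorem differentiableOn_abelSeries (hS : ∀ n, ‖S n‖ ≤ C) :
    DifferentiableOn ℂ (abelSeries S) {s | 0 < s.re} := by
  have hC : 0 ≤ C := (norm_nonneg _).trans (hS 0)
  have hopen : IsOpen {s : ℂ | 0 < s.re} := isOpen_lt continuous_const continuous_re
  intro s₀ hs₀
  have hs₀ : 0 < s₀.re := hs₀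
  set U : Set ℂ := {s | s₀.re / 2 < s.re} ∩ Metric.ball 0 (‖s₀‖ + 1) with hU
  have hUo : IsOpen U :=
    (isOpen_lt continuous_const continuous_re).inter Metric.isOpen_ball
  have hmem : s₀ ∈ U := ⟨by simp; linarith, by simp⟩
  have : DifferentiableOn ℂ (abelSeries S) U := by
    refine differentiableOn_tsum_of_summable_norm (u := fun n : ℕ ↦
      C * ((‖s₀‖ + 1) * ((n + 1 : ℕ) : ℝ) ^ (-(s₀.re / 2 + 1))))
      (((summable_abel_bound (half_pos hs₀)).mul_left _).mul_left _) ?_ hUo ?_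
    · intro n
      refine DifferentiableOn.const_mul ?_ _
      refine Differentiable.differentiableOn ?_
      intro s
      unfold abelWeight
      refine DifferentiableAt.sub ?_ ?_
      · exact (differentiable_id.neg s).const_cpow (Or.inl (by exact_mod_cast n.succ_ne_zero))
      · exact (differentiable_id.neg s).const_cpow (Or.inl (by exact_mod_cast (n + 1).succ_ne_zero))
    · rintro n s ⟨hs, hs'⟩
      have hs : s₀.re / 2 < s.re := hs
      have hs' : ‖s‖ < ‖s₀‖ + 1 := by simpa using hs'
      rw [norm_mul]
      refine mul_le_mul (hS _) ((norm_abelWeight_le (by linarith) n).trans ?_) (norm_nonneg _) hC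
      refine mul_le_mul hs'.le ?_ (by positivity) (by positivity)
      exact Real.rpow_le_rpow_of_exponent_le (by push_cast; linarith [n.cast_nonneg (α := ℝ)])
        (by linarith)
  exact ((this s₀ hmem).differentiableAt (hUo.mem_nhds hmem)).differentiableWithinAt

theorem sum_abelWeight (a : ℕ → ℂ) (s : ℂ) (N : ℕ) :
    ∑ k ∈ range N, a (k + 1) * ((k + 1 : ℕ) : ℂ) ^ (-s) =
      (∑ k ∈ range N, a (k + 1)) * ((N + 1 : ℕ) : ℂ) ^ (-s) +
      ∑ n ∈ range N, (∑ k ∈ range (n + 1), a (k + 1)) * abelWeight s n := by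
  induction N with
  | zero => simp
  | succ N ih =>
    rw [sum_range_succ, ih]
    simp only [sum_range_succ _ N, abelWeight]
    ring

theorem LSeries_eq_abelSeries {a : ℕ → ℂ}
    (hS : ∀ n, ‖∑ k ∈ range n, a (k + 1)‖ ≤ C) {s : ℂ} (hs : 0 < s.re)
    (ha : LSeriesSummable a s) :
    LSeries a s = abelSeries (fun n ↦ ∑ k ∈ range n, a (k + 1)) s := by
  have h1 : Tendsto (fun N ↦ ∑ k ∈ range N, a (k + 1) * ((k + 1 : ℕ) : ℂ) ^ (-s)) atTop
      (𝓝 (LSeries a s)) := by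
    have h2 := (hasSum_nat_add_iff' 1).2 ha.LSeriesHasSum
    simp only [Finset.range_one, Finset.sum_singleton, LSeries.term_zero, sub_zero] at h2
    refine h2.tendsto_sum_nat.congr fun N ↦ sum_congr rfl fun k _ ↦ ?_
    rw [LSeries.term_of_ne_zero (Nat.succ_ne_zero k), cpow_neg, div_eq_mul_inv]
  have h2 : Tendsto (fun N ↦ (∑ k ∈ range N, a (k + 1)) * ((N + 1 : ℕ) : ℂ) ^ (-s)) atTop
      (𝓝 0) := by
    refine squeeze_zero_norm (a := fun N : ℕ ↦ C * ((N + 1 : ℕ) : ℝ) ^ (-s.re)) (fun N ↦ ?_) ?_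
    · rw [norm_mul, norm_natCast_cpow_of_pos N.succ_pos]
      exact mul_le_mul_of_nonneg_right (hS N) (by positivity)
    · have h3 := (tendsto_rpow_neg_atTop hs).comp
        (tendsto_natCast_atTop_atTop.comp (tendsto_add_atTop_nat 1))
      simpa using h3.const_mul C
  have h3 := (summable_abelSeries hS hs).hasSum.tendsto_sum_nat
  have h4 := h2.add h3
  rw [zero_add] at h4
  refine tendsto_nhds_unique h1 (h4.congr fun N ↦ ?_)
  rw [sum_abelWeight]

end AbelSummation

section DirichletAbel

open Filter Topology Complex

variable {N : ℕ} [NeZero N] (χ : 𝐗 N)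

/-- The partial sums of a Dirichlet character. -/
noncomputable def DirichletCharacter.partialSum (n : ℕ) : ℂ :=
  ∑ k ∈ range n, χ ((k + 1 : ℕ) : ZMod N)

theorem DirichletCharacter.sum_range_add_eq (hχ : χ ≠ 1) (m : ℕ) :
    ∑ k ∈ range N, χ ((m + k + 1 : ℕ) : ZMod N) = 0 := by
  have h0 := MulChar.sum_eq_zero_of_ne_one hχ
  rw [← h0]
  refine Finset.sum_bij (fun k _ ↦ ((m + k + 1 : ℕ) : ZMod N)) (fun _ _ ↦ mem_univ _) ?_ ?_
    (fun _ _ ↦ rfl)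
  · intro a ha b hb h
    rw [ZMod.natCast_eq_natCast_iff] at h
    have h1 : a ≡ b [MOD N] := by
      have h2 : (m + 1) + a ≡ (m + 1) + b [MOD N] := by
        convert h using 1 <;> ring
      exact Nat.ModEq.add_left_cancel' _ h2
    exact Nat.ModEq.eq_of_lt_of_lt h1 (mem_range.1 ha) (mem_range.1 hb)
  · intro x _
    refine ⟨(x - ((m + 1 : ℕ) : ZMod N)).val, mem_range.2 (ZMod.val_lt _), ?_⟩
    have : m + (x - ((m + 1 : ℕ) : ZMod N)).val + 1 = (m + 1) + (x - ((m + 1 : ℕ) : ZMod N)).val := by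
      ring
    rw [this, Nat.cast_add (m + 1), ZMod.natCast_zmod_val]
    ring

theorem DirichletCharacter.partialSum_add (hχ : χ ≠ 1) (n : ℕ) :
    χ.partialSum (n + N) = χ.partialSum n := by
  rw [partialSum, Finset.sum_range_add, χ.sum_range_add_eq hχ, add_zero, partialSum]

theorem DirichletCharacter.norm_partialSum_le (hχ : χ ≠ 1) (n : ℕ) : ‖χ.partialSum n‖ ≤ N := by
  induction n using Nat.strong_induction_on with
  | _ n ih =>
    rcases lt_or_ge n N with h | h
    · refine (norm_sum_le _ _).trans ((Finset.sum_le_card_nsmul _ _ 1 fun k _ ↦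
        χ.norm_le_one _).trans ?_)
      simp only [Finset.card_range, nsmul_eq_mul, mul_one]
      exact_mod_cast h.le
    · obtain ⟨m, rfl⟩ := Nat.exists_eq_add_of_le' h
      rw [χ.partialSum_add hχ]
      exact ih m (by have := NeZero.pos N; omega)

theorem DirichletCharacter.LFunction_eq_abelSeries (hχ : χ ≠ 1) {s : ℂ} (hs : 0 < s.re) :
    LFunction χ s = abelSeries χ.partialSum s := by
  have hopen : IsOpen {s : ℂ | 0 < s.re} := isOpen_lt continuous_const continuous_re
  have h1 : AnalyticOnNhd ℂ (LFunction χ) {s | 0 < s.re} :=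
    (differentiable_LFunction hχ).differentiableOn.analyticOnNhd hopen
  have h2 : AnalyticOnNhd ℂ (abelSeries χ.partialSum) {s | 0 < s.re} :=
    (differentiableOn_abelSeries (χ.norm_partialSum_le hχ)).analyticOnNhd hopen
  have hpre : IsPreconnected {s : ℂ | 0 < s.re} := (convex_halfSpace_re_gt 0).isPreconnected
  refine h1.eqOn_of_preconnected_of_eventuallyEq h2 hpre (z₀ := 2) (by simp) ?_ hs
  filter_upwards [(isOpen_lt continuous_const continuous_re).mem_nhds
    (show (1 : ℝ) < (2 : ℂ).re by simp)] with z hz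
  have hz : 1 < z.re := hz
  rw [LFunction_eq_LSeries χ hz]
  exact LSeries_eq_abelSeries (a := fun n ↦ χ n) (C := N) (χ.norm_partialSum_le hχ)
    (by linarith) (ZMod.LSeriesSummable_of_one_lt_re χ hz)

theorem sum_mul_antitone_bound {T : ℕ → ℂ} {C : ℝ} {w : ℕ → ℝ} {b : ℕ → ℂ}
    (hT : ∀ n, T n = ∑ k ∈ range n, b k) (hC : ∀ n, ‖T n‖ ≤ C) (hw : Antitone w)
    (hw0 : ∀ n, 0 ≤ w n) (N : ℕ) :
    ‖∑ k ∈ range N, b k * w k‖ ≤ C * w 0 := by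
  have h1 : ∀ N, ∑ k ∈ range N, b k * (w k : ℂ) =
      T N * w N + ∑ k ∈ range N, T (k + 1) * ((w k - w (k + 1) : ℝ) : ℂ) := by
    intro N
    induction N with
    | zero => simp [hT]
    | succ N ih =>
      rw [sum_range_succ, ih, sum_range_succ _ N, hT (N + 1), sum_range_succ,
        ← hT]
      push_cast
      ring
  rw [h1]
  have hC0 : 0 ≤ C := (norm_nonneg _).trans (hC 0)
  calc _ ≤ C * w N + ∑ k ∈ range N, C * (w k - w (k + 1)) := by
        refine (norm_add_le _ _).trans (add_le_add ?_ ((norm_sum_le _ _).trans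
          (Finset.sum_le_sum fun k _ ↦ ?_)))
        · rw [norm_mul, Complex.norm_real, Real.norm_of_nonneg (hw0 N)]
          exact mul_le_mul_of_nonneg_right (hC N) (hw0 N)
        · rw [norm_mul, Complex.norm_real,
            Real.norm_of_nonneg (sub_nonneg.2 (hw (Nat.le_succ k)))]
          exact mul_le_mul_of_nonneg_right (hC _) (sub_nonneg.2 (hw (Nat.le_succ k)))
    _ = C * w 0 := by
        rw [← mul_sum, Finset.sum_range_sub']
        ring

theorem abelWeight_ofReal (s : ℝ) (n : ℕ) :
    abelWeight s n = ((((n + 1 : ℕ) : ℝ) ^ (-s) - ((n + 2 : ℕ) : ℝ) ^ (-s) : ℝ) : ℂ) := by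
  rw [abelWeight, ofReal_sub, ofReal_cpow (by positivity), ofReal_cpow (by positivity)]
  simp

theorem antitone_abelWeight {s : ℝ} (hs : 0 < s) :
    Antitone fun n : ℕ ↦ ((n + 1 : ℕ) : ℝ) ^ (-s) - ((n + 2 : ℕ) : ℝ) ^ (-s) := by
  refine antitone_nat_of_succ_le fun n ↦ ?_
  have ha : (0 : ℝ) < (n + 1 : ℕ) := by positivity
  have hb : (0 : ℝ) < (n + 2 : ℕ) := by positivity
  have hc : (0 : ℝ) < (n + 3 : ℕ) := by positivity
  have h1 : (((n + 2 : ℕ) : ℝ) ^ (-s)) ^ 2 ≤ ((n + 1 : ℕ) : ℝ) ^ (-s) * ((n + 3 : ℕ) : ℝ) ^ (-s) := by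
    rw [← Real.mul_rpow ha.le hc.le, ← Real.rpow_natCast, ← Real.rpow_mul hb.le, mul_comm (-s),
      Real.rpow_mul hb.le]
    refine Real.rpow_le_rpow_of_nonpos (by positivity) ?_ (by linarith)
    push_cast
    norm_num
    nlinarith
  have hpa := Real.rpow_pos_of_pos ha (-s)
  have hpb := Real.rpow_pos_of_pos hb (-s)
  have hpc := Real.rpow_pos_of_pos hc (-s)
  have h2 : 2 * ((n + 2 : ℕ) : ℝ) ^ (-s) ≤ ((n + 1 : ℕ) : ℝ) ^ (-s) + ((n + 3 : ℕ) : ℝ) ^ (-s) := by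
    refine abs_le_of_sq_le_sq' ?_ (by positivity) |>.2
    nlinarith [sq_nonneg (((n + 1 : ℕ) : ℝ) ^ (-s) - ((n + 3 : ℕ) : ℝ) ^ (-s))]
  have h3 : n + 1 + 1 = n + 2 := rfl
  have h4 : n + 1 + 2 = n + 3 := rfl
  rw [h3, h4]
  linarith

/-- If the partial sums are periodic, the Abel-summed series tends to their mean at `0`. -/
theorem tendsto_abelSeries_zero {S : ℕ → ℂ} {C : ℝ} (hS : ∀ n, ‖S n‖ ≤ C) {m : ℂ} {C' : ℝ}
    (hT : ∀ n, ‖∑ k ∈ range n, (S (k + 1) - m)‖ ≤ C') :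
    Tendsto (fun s : ℝ ↦ abelSeries S s) (𝓝[>] 0) (𝓝 m) := by
  have hw : ∀ s : ℝ, 0 < s → HasSum (fun n ↦ abelWeight s n) 1 := by
    intro s hs
    have h1 : Tendsto (fun N : ℕ ↦ ∑ n ∈ range N, abelWeight s n) atTop (𝓝 1) := by
      have h2 : ∀ N : ℕ, ∑ n ∈ range N, abelWeight s n =
          1 - ((((N + 1 : ℕ) : ℝ) ^ (-s) : ℝ) : ℂ) := by
        intro N
        induction N with
        | zero => simp
        | succ N ih => rw [sum_range_succ, ih, abelWeight_ofReal]; push_cast; ring_nf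
      have h3 := (tendsto_rpow_neg_atTop hs).comp
        (tendsto_natCast_atTop_atTop.comp (tendsto_add_atTop_nat 1))
      have h4 := (continuous_ofReal.tendsto 0).comp h3
      simp_rw [h2]
      simpa using h4.const_sub (1 : ℂ)
    have h5 : Summable fun n ↦ abelWeight s n := by
      simpa using summable_abelSeries (S := fun _ ↦ 1) (C := 1) (by simp) (s := s) (by simpa using hs)
    exact (h5.hasSum_iff_tendsto_nat).2 h1
  have hbd : ∀ s : ℝ, 0 < s → ‖abelSeries S s - m‖ ≤ C' * (1 - (2 : ℝ) ^ (-s)) := by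
    intro s hs
    have h1 := (summable_abelSeries hS (s := s) (by simpa using hs)).hasSum.sub ((hw s hs).mul_left m)
    rw [mul_one] at h1
    refine le_of_tendsto h1.tendsto_sum_nat.norm (Eventually.of_forall fun N ↦ ?_)
    have h2 := sum_mul_antitone_bound (T := fun n ↦ ∑ k ∈ range n, (S (k + 1) - m))
      (fun _ ↦ rfl) hT (antitone_abelWeight hs) (fun n ↦ ?_) N
    · simp only [← abelWeight_ofReal] at h2
      norm_num at h2
      simpa [sub_mul] using h2
    · refine sub_nonneg.2 (Real.rpow_le_rpow_of_nonpos (by positivity) ?_ (by linarith))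
      push_cast; linarith
  rw [tendsto_iff_norm_sub_tendsto_zero]
  refine squeeze_zero' (Eventually.of_forall fun _ ↦ norm_nonneg _)
    (eventually_nhdsWithin_of_forall hbd) ?_
  have h6 : Continuous fun s : ℝ ↦ C' * (1 - (2 : ℝ) ^ (-s)) := by
    refine continuous_const.mul (continuous_const.sub ?_)
    exact continuous_const.rpow continuous_neg fun _ ↦ Or.inl two_ne_zero
  have := (h6.tendsto 0).mono_left (nhdsWithin_le_nhds (s := Set.Ioi 0))
  simpa using this

theorem norm_sum_range_le_of_periodic {b : ℕ → ℂ} {N : ℕ} (hN : 0 < N) (hb : ∀ k, b (k + N) = b k)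
    (h0 : ∑ k ∈ range N, b k = 0) (n : ℕ) :
    ‖∑ k ∈ range n, b k‖ ≤ ∑ k ∈ range N, ‖b k‖ := by
  induction n using Nat.strong_induction_on with
  | _ n ih =>
    rcases lt_or_ge n N with h | h
    · refine (norm_sum_le _ _).trans (Finset.sum_le_sum_of_subset_of_nonneg
        (Finset.range_subset_range.2 h.le) fun _ _ _ ↦ norm_nonneg _)
    · obtain ⟨m, rfl⟩ := Nat.exists_eq_add_of_le h
      rw [Finset.sum_range_add, h0, zero_add]
      simp_rw [add_comm N, hb]
      exact ih m (by omega)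

/-- The sum `∑ a χ(a)`, which is `N` times the generalized Bernoulli number of `χ`. -/
noncomputable def DirichletCharacter.bernoulliSum (χ : 𝐗 N) : ℂ :=
  ∑ x : ZMod N, (x.val : ℂ) * χ x

theorem ZMod.sum_range_natCast {β : Type*} [AddCommMonoid β] (F : ℕ → ZMod N → β) :
    ∑ k ∈ range N, F k (k : ZMod N) = ∑ x : ZMod N, F x.val x := by
  refine Finset.sum_bij (fun k _ ↦ (k : ZMod N)) (fun _ _ ↦ mem_univ _) ?_ ?_ ?_
  · intro a ha b hb h
    exact Nat.ModEq.eq_of_lt_of_lt ((ZMod.natCast_eq_natCast_iff _ _ _).1 h)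
      (mem_range.1 ha) (mem_range.1 hb)
  · intro x _
    exact ⟨x.val, mem_range.2 (ZMod.val_lt _), ZMod.natCast_zmod_val x⟩
  · intro k hk
    rw [ZMod.val_cast_of_lt (mem_range.1 hk)]

theorem DirichletCharacter.LFunction_zero_eq (hχ : χ ≠ 1) :
    LFunction χ 0 = -(χ.bernoulliSum / N) := by
  have hN0 : (N : ℂ) ≠ 0 := by exact_mod_cast NeZero.ne N
  have hN1 : N ≠ 1 := by rintro rfl; exact hχ (level_one χ)
  have hSN : χ.partialSum N = 0 := by
    have := χ.partialSum_add hχ 0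
    rwa [zero_add, partialSum, partialSum, Finset.sum_range_zero] at this
  have hsum : ∀ n : ℕ, ∑ k ∈ range n, χ.partialSum (k + 1) +
      ∑ k ∈ range n, (k : ℂ) * χ ((k + 1 : ℕ) : ZMod N) = n * χ.partialSum n := by
    intro n
    induction n with
    | zero => simp
    | succ n ih =>
      have h1 : χ.partialSum (n + 1) = χ.partialSum n + χ ((n + 1 : ℕ) : ZMod N) :=
        sum_range_succ _ _
      rw [sum_range_succ, sum_range_succ]
      push_cast at ih h1 ⊢
      rw [h1]
      linear_combination ih
  have hB : ∑ k ∈ range N, (k : ℂ) * χ ((k + 1 : ℕ) : ZMod N) = χ.bernoulliSum := by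
    have h1 : ∑ k ∈ range N, ((k + 1 : ℕ) : ℂ) * χ ((k + 1 : ℕ) : ZMod N) =
        χ.bernoulliSum := by
      have h2 := Finset.sum_range_succ' (fun k : ℕ ↦ (k : ℂ) * χ (k : ZMod N)) N
      rw [sum_range_succ, ZMod.sum_range_natCast (fun k x ↦ (k : ℂ) * χ x)] at h2
      simp only [CharP.cast_eq_zero, zero_mul, add_zero, χ.map_zero' hN1,
        mul_zero] at h2
      rw [bernoulliSum, h2]
    rw [← h1]
    have h3 : ∑ k ∈ range N, ((k + 1 : ℕ) : ℂ) * χ ((k + 1 : ℕ) : ZMod N) =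
        ∑ k ∈ range N, (k : ℂ) * χ ((k + 1 : ℕ) : ZMod N) + χ.partialSum N := by
      rw [partialSum, ← sum_add_distrib]
      refine sum_congr rfl fun k _ ↦ ?_
      push_cast; ring
    rw [h3, hSN, add_zero]
  have hmean := hsum N
  rw [hSN, mul_zero, hB] at hmean
  have hT := norm_sum_range_le_of_periodic (b := fun k ↦ χ.partialSum (k + 1) -
    -(χ.bernoulliSum / N)) (NeZero.pos N) (fun k ↦ by
      rw [show k + N + 1 = k + 1 + N by ring, χ.partialSum_add hχ]) (by
      rw [sum_sub_distrib, Finset.sum_const, Finset.card_range, nsmul_eq_mul]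
      field_simp
      linear_combination hmean)
  have h1 := tendsto_abelSeries_zero (χ.norm_partialSum_le hχ) hT
  have h2 : Tendsto (fun s : ℝ ↦ LFunction χ s) (𝓝[>] 0) (𝓝 (LFunction χ 0)) := by
    have h3 := ((differentiable_LFunction hχ).continuous.comp continuous_ofReal).tendsto 0
    simpa [Function.comp_def] using h3.mono_left (nhdsWithin_le_nhds (s := Set.Ioi 0))
  refine tendsto_nhds_unique h2 (h1.congr' ?_)
  filter_upwards [self_mem_nhdsWithin] with s hs
  exact (χ.LFunction_eq_abelSeries hχ (by simpa using hs)).symm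

theorem DirichletCharacter.norm_bernoulliSum_inv : ‖χ⁻¹.bernoulliSum‖ = ‖χ.bernoulliSum‖ := by
  have : χ⁻¹.bernoulliSum = star χ.bernoulliSum := by
    simp only [bernoulliSum, star_sum, star_mul']
    refine sum_congr rfl fun x _ ↦ ?_
    rw [MulChar.star_apply', star_natCast]
  rw [this, norm_star]

theorem DirichletCharacter.norm_gaussSum_inv :
    ‖gaussSum χ⁻¹ (ZMod.stdAddChar (N := N))‖ = ‖gaussSum χ (ZMod.stdAddChar (N := N))‖ := by
  have h : star (gaussSum χ (ZMod.stdAddChar (N := N))) =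
      χ⁻¹ (-1) * gaussSum χ⁻¹ (ZMod.stdAddChar (N := N)) := by
    simp only [gaussSum, star_sum, star_mul', mul_sum]
    refine Fintype.sum_equiv (Equiv.neg _) _ _ fun x ↦ ?_
    rw [MulChar.star_apply', Equiv.neg_apply, ← mul_assoc, ← map_mul, neg_one_mul, neg_neg,
      AddChar.map_neg_eq_conj]
    rfl
  have h1 : ‖χ⁻¹ (-1)‖ = 1 := by
    have := χ⁻¹.unit_norm_eq_one (-1 : (ZMod N)ˣ)
    simpa using this
  have h2 := congrArg norm h
  rw [norm_star, norm_mul, h1, one_mul] at h2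
  exact h2.symm

/-- The value at `1` of the `L`-function of an odd primitive character. -/
theorem DirichletCharacter.norm_LFunction_one_of_odd (hχ : χ.IsPrimitive) (hodd : χ (-1) = -1) :
    ‖LFunction χ 1‖ = Real.pi / √N * (‖χ.bernoulliSum‖ / N) := by
  have hne : ∀ ψ : 𝐗 N, ψ (-1) = -1 → ψ ≠ 1 := by
    rintro ψ h rfl
    have h1 : (1 : 𝐗 N) (-1) = 1 := by
      simpa using MulChar.one_apply_coe (R' := ℂ) (-1 : (ZMod N)ˣ)
    rw [h1] at h
    norm_num at h
  have hev : ∀ ψ : 𝐗 N, ψ (-1) = -1 → ¬ ψ.Even := by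
    intro ψ h h'
    rw [Even, h] at h'
    norm_num at h'
  have hodd' : χ⁻¹ (-1) = -1 := by rw [MulChar.inv_apply_eq_inv', hodd]; norm_num
  have hprim' : χ⁻¹.IsPrimitive := by rw [isPrimitive_def, conductor_inv]; exact hχ
  have hN1 : N ≠ 1 := by rintro rfl; exact hne χ hodd (level_one χ)
  have hNpos : (0 : ℝ) < N := by exact_mod_cast NeZero.pos N
  have hN0 : (N : ℂ) ≠ 0 := by exact_mod_cast NeZero.ne N
  have hL1 : ∀ ψ : 𝐗 N, ψ (-1) = -1 →
      LFunction ψ 1 = completedLFunction ψ 1 * Real.pi := by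
    intro ψ h
    rw [LFunction_eq_completed_div_gammaFactor ψ 1 (Or.inl one_ne_zero), gammaFactor,
      if_neg (hev ψ h), Gammaℝ_def]
    norm_num
    rw [Complex.cpow_neg_one, div_inv_eq_mul]
  have hL0 : ∀ ψ : 𝐗 N, ψ (-1) = -1 →
      LFunction ψ 0 = completedLFunction ψ 0 := by
    intro ψ h
    rw [LFunction_eq_completed_div_gammaFactor ψ 0 (Or.inr hN1), gammaFactor,
      if_neg (hev ψ h), zero_add, Gammaℝ_one, div_one]
  have hW : ∀ ψ : 𝐗 N, ψ (-1) = -1 →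
      ‖ψ.rootNumber‖ = ‖gaussSum ψ (ZMod.stdAddChar (N := N))‖ / √N := by
    intro ψ h
    rw [rootNumber, if_neg (hev ψ h), norm_div, norm_div, pow_one, norm_I, div_one,
      norm_natCast_cpow_of_pos (NeZero.pos N), Real.sqrt_eq_rpow]
    norm_num
  have hWeq : ‖χ⁻¹.rootNumber‖ = ‖χ.rootNumber‖ := by
    rw [hW _ hodd, hW _ hodd', norm_gaussSum_inv]
  have e1 := hχ.completedLFunction_one_sub 1
  have e2 := hprim'.completedLFunction_one_sub 0
  have e3 := hχ.completedLFunction_one_sub 0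
  rw [sub_self] at e1
  rw [sub_zero, inv_inv] at e2
  rw [sub_zero] at e3
  have hn1 := congrArg norm e1
  have hn2 := congrArg norm e2
  have hn3 := congrArg norm e3
  simp only [norm_mul, norm_natCast_cpow_of_pos (NeZero.pos N)] at hn1 hn2 hn3
  norm_num at hn1 hn2 hn3
  rw [hWeq] at hn2
  have hΛ : ‖completedLFunction χ⁻¹ 1‖ ≠ 0 := by
    rw [norm_ne_zero_iff]
    intro h0
    have := LFunction_apply_one_ne_zero (hne _ hodd')
    rw [hL1 _ hodd', h0, zero_mul] at this
    exact this rfl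
  have hpow : (N : ℝ) ^ (-(1 / 2) : ℝ) * (N : ℝ) ^ (1 / 2 : ℝ) = 1 := by
    rw [← Real.rpow_add hNpos]; norm_num
  have hW1 : ‖χ.rootNumber‖ = 1 := by
    rw [hn1] at hn2
    have h5 : ‖completedLFunction χ⁻¹ 1‖ * (‖χ.rootNumber‖ ^ 2 - 1) = 0 := by
      norm_num at hpow
      linear_combination -hn2 - ‖χ.rootNumber‖ ^ 2 * ‖completedLFunction χ⁻¹ 1‖ * hpow
    have h6 := (mul_eq_zero.1 h5).resolve_left hΛ
    have h7 := norm_nonneg χ.rootNumber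
    nlinarith
  rw [hL1 _ hodd, norm_mul, hn3, hW1, ← hL0 _ hodd', LFunction_zero_eq _ (hne _ hodd'), norm_neg,
    norm_div, norm_bernoulliSum_inv, Complex.norm_real, Real.norm_of_nonneg Real.pi_pos.le,
    Real.rpow_neg hNpos.le, Real.sqrt_eq_rpow, Complex.norm_natCast]
  ring

end DirichletAbel

section ClassNumberRatio

open Filter Topology Complex DirichletCharacter

instance DirichletCharacter.neZero_conductor {M : ℕ} [NeZero M] (χ : 𝐗 M) :
    NeZero χ.conductor := ⟨conductor_ne_zero χ⟩

theorem DirichletCharacter.primitiveCharacter_ne_one {M : ℕ} [NeZero M]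
    {χ : 𝐗 M} (hχ : χ ≠ 1) : χ.primitiveCharacter ≠ 1 := by
  intro h
  apply hχ
  rw [← χ.changeLevel_primitiveCharacter, h, changeLevel_one]

theorem DirichletCharacter.primitiveCharacter_neg_one {M : ℕ} [NeZero M]
    (χ : 𝐗 M) : χ.primitiveCharacter (-1) = χ (-1) := by
  have := primitiveCharacter_apply_of_isCoprime χ (a := -1) isCoprime_one_left.neg_left
  simpa using this

theorem DirichletCharacter.apply_neg_one_eq {M : ℕ} (χ : 𝐗 M) :
    χ (-1) = 1 ∨ χ (-1) = -1 := by
  have h : χ (-1) * χ (-1) = 1 := by rw [← map_mul]; simp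
  exact mul_self_eq_one_iff.1 h

/-- The residue of a Dedekind zeta function that is a product of Dirichlet `L`-series. -/
theorem dedekindZeta_residue_eq_prod (F : Type*) [Field F] [NumberField F] {M : ℕ} [NeZero M]
    (X : Finset (𝐗 M)) (h1 : 1 ∈ X)
    (hX : ∀ s : ℂ, 1 < s.re → dedekindZeta F s =
      ∏ χ ∈ X, LSeries (fun n ↦ χ.primitiveCharacter n) s) :
    (dedekindZeta_residue F : ℂ) = ∏ χ ∈ X.erase 1, LFunction χ.primitiveCharacter 1 := by
  have hofReal : Tendsto (fun s : ℝ ↦ (s : ℂ)) (𝓝[>] 1) (𝓝 1) := by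
    have := continuous_ofReal.tendsto 1
    rw [ofReal_one] at this
    exact this.mono_left nhdsWithin_le_nhds
  have hζ : Tendsto (fun s : ℝ ↦ ((s : ℂ) - 1) * riemannZeta s) (𝓝[>] 1) (𝓝 1) := by
    refine riemannZeta_residue_one.comp (tendsto_nhdsWithin_iff.2 ⟨hofReal, ?_⟩)
    filter_upwards [self_mem_nhdsWithin] with s hs
    have hs : 1 < s := hs
    simp only [Set.mem_compl_iff, Set.mem_singleton_iff]
    intro h
    exact hs.ne' (by exact_mod_cast h)
  have hprod : Tendsto (fun s : ℝ ↦ ∏ χ ∈ X.erase 1, LFunction χ.primitiveCharacter (s : ℂ))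
      (𝓝[>] 1) (𝓝 (∏ χ ∈ X.erase 1, LFunction χ.primitiveCharacter 1)) := by
    refine tendsto_finsetProd _ fun χ hχ ↦ ?_
    have := (differentiable_LFunction
      (primitiveCharacter_ne_one (Finset.ne_of_mem_erase hχ))).continuous.tendsto 1
    exact this.comp hofReal
  have h2 := hζ.mul hprod
  rw [one_mul] at h2
  refine tendsto_nhds_unique (tendsto_sub_one_mul_dedekindZeta_nhdsGT F) (h2.congr' ?_)
  filter_upwards [self_mem_nhdsWithin] with s hs
  have hs' : 1 < (s : ℂ).re := by simpa using hs
  rw [hX s hs', ← Finset.mul_prod_erase _ _ h1, mul_assoc]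
  congr 2
  · rw [← LSeries_one_eq_riemannZeta hs']
    refine congrFun (congrArg LSeries ?_) _
    funext n
    have hc : (1 : 𝐗 M).conductor = 1 := conductor_one
    have : Subsingleton (ZMod (1 : 𝐗 M).conductor) := by rw [hc]; infer_instance
    have hn : ((n : ℕ) : ZMod (1 : 𝐗 M).conductor) = 1 := Subsingleton.elim _ _
    rw [primitiveCharacter_one, hn, map_one]
    rfl
  · exact prod_congr rfl fun χ _ ↦ LFunction_eq_LSeries _ hs'

variable (M : ℕ) [NeZero M] (K : Type*) [Field K] [NumberField K] [IsCyclotomicExtension {M} ℚ K]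
  [IsCMField K]

theorem residue_cyclotomic_eq (hodd : Odd M) (h1 : M ≠ 1) (hM' : IsPrimePow M → M.Prime) :
    dedekindZeta_residue K = dedekindZeta_residue (𝐑 K) *
      ∏ χ : 𝐗 M with χ (-1) = -1, ‖LFunction χ.primitiveCharacter 1‖ := by
  have hone : (1 : 𝐗 M) (-1) = 1 := by
    simpa using MulChar.one_apply_coe (R' := ℂ) (-1 : (ZMod M)ˣ)
  have hK := dedekindZeta_residue_eq_prod K (M := M) univ (mem_univ 1)
    (fun s hs ↦ dedekindZeta_cyclotomic M K hs)
  have hR := dedekindZeta_residue_eq_prod (𝐑 K) (M := M)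
    (univ.filter fun χ ↦ χ (-1) = 1) (by simpa using hone)
    (fun s hs ↦ dedekindZeta_real M K hodd h1 hM' hs)
  have hsplit : (univ : Finset (𝐗 M)).erase 1 =
      ((univ.filter fun χ ↦ χ (-1) = 1).erase 1).disjUnion
        (univ.filter fun χ ↦ χ (-1) = -1) (by
          rw [Finset.disjoint_left]
          intro χ hχ hχ'
          simp only [Finset.mem_erase, mem_filter, mem_univ, true_and] at hχ hχ'
          rw [hχ.2] at hχ'
          norm_num at hχ') := by
    ext χ
    simp only [Finset.mem_erase, mem_univ, and_true, Finset.mem_disjUnion,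
      mem_filter, true_and]
    constructor
    · intro h
      rcases χ.apply_neg_one_eq with h' | h'
      · exact Or.inl ⟨h, h'⟩
      · exact Or.inr h'
    · rintro (h | h)
      · exact h.1
      · rintro rfl
        rw [hone] at h
        norm_num at h
  rw [hsplit, Finset.prod_disjUnion, ← hR] at hK
  have := congrArg norm hK
  rw [norm_mul, norm_real, norm_real, Real.norm_of_nonneg (dedekindZeta_residue_pos K).le,
    Real.norm_of_nonneg (dedekindZeta_residue_pos (𝐑 K)).le, norm_prod] at this
  exact this

theorem torsionOrder_real : Units.torsionOrder (𝐑 K) = 2 := by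
  obtain ⟨μ, hμ⟩ : ∃ μ : Units.torsion (𝐑 K),
      orderOf μ = Units.torsionOrder (𝐑 K) := IsCyclic.exists_ofOrder_eq_natCard
  rw [← IsPrimitiveRoot.iff_orderOf, ← IsPrimitiveRoot.coe_submonoidClass_iff,
    ← IsPrimitiveRoot.coe_units_iff] at hμ
  replace hμ := hμ.map_of_injective
    (FaithfulSMul.algebraMap_injective (𝓞 (𝐑 K)) (𝐑 K))
  have hpos := Units.torsionOrder_pos (𝐑 K)
  obtain ⟨c, hc⟩ := Units.even_torsionOrder (𝐑 K)
  by_contra hne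
  have h2 : 2 < Units.torsionOrder (𝐑 K) := by omega
  have h3 := InfinitePlace.IsPrimitiveRoot.nrRealPlaces_eq_zero_of_two_lt h2 hμ
  rw [← IsTotallyReal.finrank] at h3
  exact Module.finrank_pos.ne' h3

/-- The relative class number formula. -/
theorem classNumber_cyclotomic_eq (hodd : Odd M) (h1 : M ≠ 1) (hM' : IsPrimePow M → M.Prime) :
    (classNumber K : ℝ) = classNumber (𝐑 K) *
      (IsCMField.indexRealUnits K * (2 * M) *
        (√|(discr K : ℝ)| / √|(discr (𝐑 K) : ℝ)|) /
        (2 * Real.pi) ^ (Module.finrank ℚ (𝐑 K)) *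
      ∏ χ : 𝐗 M with χ (-1) = -1, ‖LFunction χ.primitiveCharacter 1‖) := by
  have hres := residue_cyclotomic_eq M K hodd h1 hM'
  generalize (∏ χ : 𝐗 M with χ (-1) = -1,
    ‖LFunction χ.primitiveCharacter 1‖) = L at hres ⊢
  have hreg := IsCMField.regulator_div_regulator_eq_two_pow_mul_indexRealUnits_inv K
  have hn : InfinitePlace.nrComplexPlaces K = Module.finrank ℚ (𝐑 K) := by
    have h2 := IsTotallyComplex.finrank K
    rw [← Module.finrank_mul_finrank ℚ (𝐑 K) K,
      Algebra.IsQuadraticExtension.finrank_eq_two (𝐑 K) K] at h2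
    omega
  have hrank : Units.rank K + 1 = Module.finrank ℚ (𝐑 K) := by
    rw [Units.rank, InfinitePlace.card_eq_nrRealPlaces_add_nrComplexPlaces,
      IsTotallyComplex.nrRealPlaces_eq_zero K, zero_add, hn]
    have : 0 < Module.finrank ℚ (𝐑 K) := Module.finrank_pos
    omega
  have hw : Units.torsionOrder K = 2 * M := by
    rw [IsCyclotomicExtension.Rat.torsionOrder_eq (n := M), if_neg (Nat.not_even_iff_odd.2 hodd)]
  rw [dedekindZeta_residue_def, dedekindZeta_residue_def, IsTotallyComplex.nrRealPlaces_eq_zero K,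
    IsTotallyReal.nrComplexPlaces_eq_zero (𝐑 K),
    ← IsTotallyReal.finrank (𝐑 K), hn, torsionOrder_real K, hw]
    at hres
  generalize hnn : Module.finrank ℚ (𝐑 K) = n at *
  have hQ : (IsCMField.indexRealUnits K : ℝ) ≠ 0 := by
    rcases IsCMField.indexRealUnits_eq_one_or_two K with h | h <;> rw [h] <;> norm_num
  have hR : Units.regulator (𝐑 K) ≠ 0 := (Units.regulator_pos _).ne'
  have hRK : Units.regulator K ≠ 0 := (Units.regulator_pos _).ne'
  have hM0 : (M : ℝ) ≠ 0 := by exact_mod_cast NeZero.ne M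
  have hd : √|(discr K : ℝ)| ≠ 0 := by
    have : (discr K : ℝ) ≠ 0 := by exact_mod_cast discr_ne_zero K
    positivity
  have hd' : √|(discr (𝐑 K) : ℝ)| ≠ 0 := by
    have : (discr (𝐑 K) : ℝ) ≠ 0 := by exact_mod_cast discr_ne_zero _
    positivity
  generalize (IsCMField.indexRealUnits K : ℝ) = Q at *
  generalize √|(discr K : ℝ)| = d at *
  generalize √|(discr (𝐑 K) : ℝ)| = d' at *
  have hRK' : Units.regulator K = Units.regulator (𝐑 K) *
      (2 ^ Units.rank K * Q⁻¹) := by rw [← hreg]; field_simp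
  rw [hRK'] at hres
  rw [← hrank] at hres ⊢
  generalize Units.rank K = r at *
  have hpi := Real.pi_ne_zero
  push_cast at hres
  field_simp at hres ⊢
  rw [mul_pow, pow_succ, pow_succ] at *
  refine mul_left_cancel₀ (pow_ne_zero r (two_ne_zero (α := ℝ))) ?_
  linear_combination hres

end ClassNumberRatio

section UnitIndex

theorem Squarefree.prime_of_isPrimePow {n : ℕ} (hsq : Squarefree n) (h : IsPrimePow n) :
    n.Prime := by
  obtain ⟨p, k, hp, hk, rfl⟩ := h
  rcases (Nat.squarefree_pow_iff hp.nat_prime.ne_one hk.ne').1 hsq with ⟨_, rfl⟩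
  simpa using hp.nat_prime

open DirichletCharacter IsCMField

variable (M : ℕ) [NeZero M] (K : Type*) [Field K] [NumberField K] [IsCyclotomicExtension {M} ℚ K]
  [IsCMField K]

theorem indexRealUnits_eq_two (hodd : Odd M) (h1 : M ≠ 1) (hpp : ¬ IsPrimePow M) :
    indexRealUnits K = 2 := by
  have hζ := IsCyclotomicExtension.zeta_spec M ℚ K
  have hconj := ringOfIntegersComplexConj_toInteger M K hζ
  have hz := hζ.toInteger_isPrimitiveRoot
  set z := hζ.toInteger
  have hu := hz.isUnit_one_sub (NeZero.pos M) hpp h1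
  rw [indexRealUnits_eq_two_iff]
  refine ⟨hu.unit, ?_⟩
  have hval : (((unitsMulComplexConjInv K hu.unit : Units.torsion K) : (𝓞 K)ˣ) : 𝓞 K) = -z := by
    rw [unitsMulComplexConjInv_apply, Units.val_mul]
    have h2 : ((unitsComplexConj K hu.unit : (𝓞 K)ˣ) : 𝓞 K) =
        1 - ringOfIntegersComplexConj K z := by
      change ringOfIntegersComplexConj K (1 - z) = _
      rw [map_sub, map_one]
    rw [Units.mul_inv_eq_iff_eq_mul, h2, IsUnit.unit_spec]
    linear_combination -hconj
  have hord : orderOf (unitsMulComplexConjInv K hu.unit) = 2 * M := by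
    rw [← Subgroup.orderOf_coe, ← orderOf_units, hval]
    have h3 : orderOf (-1 : 𝓞 K) = 2 := by
      rw [orderOf_neg_one, ringChar.eq_zero, if_neg (by decide)]
    have h4 : orderOf z = M := hz.eq_orderOf.symm
    rw [← neg_one_mul, (Commute.all _ _).orderOf_mul_eq_mul_orderOf_of_coprime, h3, h4]
    rw [h3, h4]
    exact Nat.coprime_two_left.2 hodd
  refine Subgroup.eq_top_of_card_eq _ ?_
  rw [Nat.card_zpowers, hord]
  have := IsCyclotomicExtension.Rat.torsionOrder_eq (n := M) (K := K)
  rw [if_neg (Nat.not_even_iff_odd.2 hodd)] at this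
  exact this.symm

theorem conj_sub_mem_span_zeta_sub_one {ζ : K} (hζ : IsPrimitiveRoot ζ M) (x : 𝓞 K) :
    ringOfIntegersComplexConj K x - x ∈ Ideal.span {hζ.toInteger - 1} := by
  have hconj := ringOfIntegersComplexConj_toInteger M K hζ
  have htop := IsCyclotomicExtension.Rat.adjoin_singleton_eq_top hζ
  generalize hζ.toInteger = z at *
  have hx : x ∈ Algebra.adjoin ℤ {z} := htop ▸ Algebra.mem_top
  induction hx using Algebra.adjoin_induction with
  | mem y hy =>
    rw [Set.mem_singleton_iff.1 hy, Ideal.mem_span_singleton]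
    exact ⟨-(1 + ringOfIntegersComplexConj K z), by linear_combination hconj⟩
  | algebraMap r => simp
  | add a b _ _ ha hb =>
    rw [map_add, add_sub_add_comm]
    exact add_mem ha hb
  | mul a b _ _ ha hb =>
    have : ringOfIntegersComplexConj K (a * b) - a * b =
        (ringOfIntegersComplexConj K a - a) * ringOfIntegersComplexConj K b +
          a * (ringOfIntegersComplexConj K b - b) := by rw [map_mul]; ring
    rw [this]
    exact add_mem (Ideal.mul_mem_right _ _ ha) (Ideal.mul_mem_left _ _ hb)

theorem indexRealUnits_eq_one (hodd : Odd M) (hp : M.Prime) :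
    indexRealUnits K = 1 := by
  rcases indexRealUnits_eq_one_or_two K with h | h
  · exact h
  exfalso
  have : Fact M.Prime := ⟨hp⟩
  obtain ⟨u, hu⟩ := (indexRealUnits_eq_two_iff K).1 h
  have hζ := IsCyclotomicExtension.zeta_spec M ℚ K
  have hM2 : 2 < M := hp.two_le.lt_of_ne fun h ↦ by rw [← h] at hodd; exact absurd hodd (by decide)
  have hprime : (Ideal.span {hζ.toInteger - 1}).IsPrime :=
    IsCyclotomicExtension.Rat.isPrime_span_zeta_sub_one' M hζ
  have h2 := IsCyclotomicExtension.Rat.two_not_mem_span_zeta_sub_one' M hζ hM2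
  have hw := IsCyclotomicExtension.Rat.torsionOrder_eq (n := M) (K := K)
  rw [if_neg (Nat.not_even_iff_odd.2 hodd)] at hw
  have hord : orderOf (unitsMulComplexConjInv K u) = 2 * M := by
    rw [← Nat.card_zpowers, hu, Subgroup.card_top]; exact hw
  set g := unitsMulComplexConjInv K u with hg
  have hgM : (((g : (𝓞 K)ˣ) : 𝓞 K)) ^ M = -1 := by
    have h3 : orderOf (((g : (𝓞 K)ˣ) : 𝓞 K) ^ M) = 2 := by
      rw [orderOf_pow_of_dvd (NeZero.ne M), orderOf_units, Subgroup.orderOf_coe, hord,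
        Nat.mul_div_cancel _ (NeZero.pos M)]
      rw [orderOf_units, Subgroup.orderOf_coe, hord]
      exact dvd_mul_left _ _
    exact (CharP.orderOf_eq_two_iff 0 (by decide)).1 h3
  have hgu : ((g : (𝓞 K)ˣ) : 𝓞 K) * ringOfIntegersComplexConj K (u : 𝓞 K) = u := by
    have h4 : (g : (𝓞 K)ˣ) * unitsComplexConj K u = u := by
      rw [hg, unitsMulComplexConjInv_apply, inv_mul_cancel_right]
    exact congrArg Units.val h4
  have h5 : (u : 𝓞 K) ^ M = -(ringOfIntegersComplexConj K (u : 𝓞 K)) ^ M := by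
    rw [← neg_one_mul, ← hgM, ← mul_pow, hgu]
  have h6 : ringOfIntegersComplexConj K ((u : 𝓞 K) ^ M) - (u : 𝓞 K) ^ M ∈
      Ideal.span {hζ.toInteger - 1} := conj_sub_mem_span_zeta_sub_one M K hζ _
  have h7 : (2 : 𝓞 K) * (u : 𝓞 K) ^ M ∈ Ideal.span {hζ.toInteger - 1} := by
    have : (2 : 𝓞 K) * (u : 𝓞 K) ^ M =
        -(ringOfIntegersComplexConj K ((u : 𝓞 K) ^ M) - (u : 𝓞 K) ^ M) := by
      rw [map_pow]; linear_combination h5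
    rw [this]
    exact neg_mem h6
  rcases hprime.mem_or_mem h7 with h8 | h8
  · exact h2 h8
  · exact hprime.ne_top (Ideal.eq_top_of_isUnit_mem _ h8 (u.isUnit.pow M))

theorem natAbs_discr_eq_absNorm_mul :
    (discr K).natAbs = Ideal.absNorm (differentIdeal (𝓞 (𝐑 K)) (𝓞 K)) *
      (discr (𝐑 K)).natAbs ^ 2 := by
  rw [natAbs_discr_eq_absNorm_differentIdeal_mul_natAbs_discr_pow (𝐑 K)
    (𝓞 (𝐑 K)) K (𝓞 K),
    Algebra.IsQuadraticExtension.finrank_eq_two (𝐑 K) K]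

theorem absNorm_differentIdeal_real_of_prime (hodd : Odd M) (hp : M.Prime) :
    Ideal.absNorm (differentIdeal (𝓞 (𝐑 K)) (𝓞 K)) = M := by
  have : Fact M.Prime := ⟨hp⟩
  have hζ := IsCyclotomicExtension.zeta_spec M ℚ K
  have hconj := ringOfIntegersComplexConj_toInteger M K hζ
  have h1 : Ideal.absNorm (Ideal.span {hζ.toInteger - ringOfIntegersComplexConj K hζ.toInteger}) =
      M := by
    have hassoc : Associated (hζ.toInteger - ringOfIntegersComplexConj K hζ.toInteger)
        (hζ.toInteger - 1) := by
      have hη : IsPrimitiveRoot (IsCyclotomicExtension.zeta M ℚ K ^ 2) M :=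
        hζ.pow_of_coprime 2 (Nat.coprime_two_left.2 hodd)
      have h2 := IsCyclotomicExtension.Rat.associated_sub_one_of_isPrimitiveRoot M hζ hη
      have h3 : hη.toInteger = hζ.toInteger ^ 2 := RingOfIntegers.ext rfl
      rw [h3] at h2
      refine Associated.trans ?_ h2.symm
      refine ⟨(IsUnit.of_mul_eq_one_right _ hconj).unit, ?_⟩
      rw [IsUnit.unit_spec]
      linear_combination -hconj
    rw [Ideal.span_singleton_eq_span_singleton.2 hassoc]
    have hcyc : IsCyclotomicExtension {M ^ (0 + 1)} ℚ K := by simp; infer_instance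
    exact IsCyclotomicExtension.Rat.absNorm_span_zeta_sub_one M 0 (K := K)
      (ζ := IsCyclotomicExtension.zeta M ℚ K) (by simpa using hζ)
  have h2 : Ideal.absNorm (differentIdeal (𝓞 (𝐑 K)) (𝓞 K)) ∣ M := by
    have h3 := Ideal.absNorm_dvd_absNorm_of_le
      ((Ideal.span_singleton_le_iff_mem _).2 (sub_conj_mem_differentIdeal M K hζ))
    rwa [h1] at h3
  rcases (Nat.dvd_prime hp).1 h2 with h3 | h3
  · exfalso
    have h4 := natAbs_discr_eq_absNorm_mul K
    rw [h3, one_mul, IsCyclotomicExtension.Rat.natAbs_discr M K, hp.primeFactors,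
      Finset.prod_singleton, Nat.totient_prime hp,
      Nat.div_self (Nat.sub_pos_of_lt hp.one_lt), pow_one] at h4
    obtain ⟨c, hc⟩ := hodd
    have hc0 : c ≠ 0 := by rintro rfl; exact hp.ne_one (by omega)
    have h5 : M ^ (M - 1) / M = M ^ (M - 2) := by
      rw [show M - 1 = M - 2 + 1 by omega, pow_succ, Nat.mul_div_cancel _ hp.pos]
    rw [h5] at h4
    have h6 := congrArg (fun k ↦ k.factorization M) h4
    simp only [Nat.factorization_pow, Finsupp.smul_apply, hp.factorization_self, smul_eq_mul] at h6
    omega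
  · exact h3

theorem card_odd_characters {n : ℕ} (hn : 2 < n) :
    2 * (univ.filter fun χ : 𝐗 n ↦ χ (-1) = -1).card = n.totient := by
  have : NeZero n := ⟨by omega⟩
  have h1 := prod_one_sub_dirichletCharacter_apply (n := n) (-1) 1 (-1)
  simp only [Units.val_one, map_one, Finset.prod_const, QuotientGroup.mk_one, orderOf_one,
    pow_one, Nat.div_one] at h1
  rw [show Nat.card ((ZMod n)ˣ ⧸ Subgroup.zpowers
    (Units.map (Int.castRingHom (ZMod n)).toMonoidHom (-1))) = signIndex (-1) n from rfl] at h1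
  norm_num at h1
  have heven : (univ.filter fun χ : 𝐗 n ↦ χ (-1) = 1).card =
      signIndex (-1) n := by
    have h2 : (2 : ℕ) ^ (univ.filter fun χ : 𝐗 n ↦ χ (-1) = 1).card =
        2 ^ signIndex (-1) n := by exact_mod_cast h1
    exact Nat.pow_right_injective le_rfl h2
  have htot : (univ : Finset (𝐗 n)).card = n.totient := by
    rw [Finset.card_univ, ← Nat.card_eq_fintype_card,
      MulChar.card_eq_card_units_of_hasEnoughRootsOfUnity, Nat.card_eq_fintype_card,
      ZMod.card_units_eq_totient]
  have hsplit := Finset.card_filter_add_card_filter_not (s := univ)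
    (fun χ : 𝐗 n ↦ χ (-1) = 1)
  have hneg : (univ.filter fun χ : 𝐗 n ↦ ¬ χ (-1) = 1) =
      univ.filter fun χ : 𝐗 n ↦ χ (-1) = -1 := by
    refine Finset.filter_congr fun χ _ ↦ ?_
    rcases χ.apply_neg_one_eq with h | h <;> rw [h] <;> norm_num
  rw [hneg, heven, htot] at hsplit
  have := two_mul_signIndex_neg_one hn
  omega

theorem card_odd_characters_one :
    (univ.filter fun χ : 𝐗 1 ↦ χ (-1) = -1).card = 0 := by
  rw [Finset.card_eq_zero, Finset.filter_eq_empty_iff]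
  intro χ _
  rw [Subsingleton.elim (-1 : ZMod 1) 1, map_one]
  norm_num

theorem card_odd_characters_not_dvd_conductor {p n : ℕ} [NeZero n] (hp : p.Prime)
    (hpn : p.Coprime n) :
    (univ.filter fun χ : 𝐗 (p * n) ↦
      χ (-1) = -1 ∧ ¬ p ∣ χ.conductor).card =
    (univ.filter fun χ : 𝐗 n ↦ χ (-1) = -1).card := by
  have : NeZero (p * n) := ⟨mul_ne_zero hp.ne_zero (NeZero.ne n)⟩
  have hd : n ∣ p * n := dvd_mul_left n p
  have hneg : ∀ χ : 𝐗 n, changeLevel hd χ (-1) = χ (-1) := fun χ ↦ by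
    have := changeLevel_eq_cast_of_dvd' χ hd (a := -1) isCoprime_one_left.neg_left
    simpa using this
  symm
  refine Finset.card_bij (fun χ _ ↦ changeLevel hd χ) ?_ ?_ ?_
  · intro χ hχ
    simp only [mem_filter, mem_univ, true_and] at hχ ⊢
    refine ⟨(hneg χ).trans hχ, ?_⟩
    rw [conductor_changeLevel]
    intro h
    exact ((Nat.Prime.coprime_iff_not_dvd hp).1 hpn) (h.trans χ.conductor_dvd_level)
  · intro χ _ ψ _ h
    exact changeLevel_injective hd h
  · intro χ hχ
    simp only [mem_filter, mem_univ, true_and] at hχ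
    have hcop : χ.conductor.Coprime p := ((Nat.Prime.coprime_iff_not_dvd hp).2 hχ.2).symm
    have hfac : χ.FactorsThrough n := (mem_conductorSet_iff_conductor_dvd χ hd).2
      (hcop.dvd_of_dvd_mul_left χ.conductor_dvd_level)
    obtain ⟨h, χ', rfl⟩ := hfac
    exact ⟨χ', by simpa [hneg] using hχ.1, rfl⟩

theorem prod_conductor_odd {M : ℕ} [NeZero M] (hsq : Squarefree M) :
    ∏ χ : 𝐗 M with χ (-1) = -1, χ.conductor =
      ∏ p ∈ M.primeFactors, p ^ (univ.filter fun χ : 𝐗 M ↦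
        χ (-1) = -1 ∧ p ∣ χ.conductor).card := by
  have h1 : ∀ χ : 𝐗 M,
      χ.conductor = ∏ p ∈ M.primeFactors, if p ∣ χ.conductor then p else 1 := by
    intro χ
    have h2 : Squarefree χ.conductor := hsq.squarefree_of_dvd χ.conductor_dvd_level
    conv_lhs => rw [← Nat.prod_primeFactors_of_squarefree h2]
    rw [Finset.prod_ite, Finset.prod_const_one, mul_one]
    refine prod_congr ?_ fun _ _ ↦ rfl
    ext p
    simp only [Nat.mem_primeFactors, mem_filter]
    constructor
    · rintro ⟨hp, hpc, hc⟩
      exact ⟨⟨hp, hpc.trans χ.conductor_dvd_level, NeZero.ne M⟩, hpc⟩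
    · rintro ⟨⟨hp, _, _⟩, hpc⟩
      exact ⟨hp, hpc, conductor_ne_zero χ⟩
  calc _ = ∏ χ : 𝐗 M with χ (-1) = -1,
        ∏ p ∈ M.primeFactors, (if p ∣ χ.conductor then p else 1) :=
      prod_congr rfl fun χ _ ↦ h1 χ
    _ = _ := by
      rw [Finset.prod_comm]
      refine prod_congr rfl fun p _ ↦ ?_
      rw [Finset.prod_ite, Finset.prod_const_one, mul_one, Finset.prod_const, Finset.filter_filter]

theorem sq_prod_conductor_odd (hodd : Odd M) (h1 : M ≠ 1) (hsq : Squarefree M) :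
    (∏ χ : 𝐗 M with χ (-1) = -1, χ.conductor) ^ 2 =
      (discr K).natAbs * Ideal.absNorm (differentIdeal (𝓞 (𝐑 K)) (𝓞 K)) := by
  have hM3 : 2 < M := by
    have := NeZero.pos M
    obtain ⟨c, hc⟩ := hodd
    omega
  have hcard := card_odd_characters hM3
  rw [prod_conductor_odd hsq, ← Finset.prod_pow]
  have hcount : ∀ p ∈ M.primeFactors, ∀ n, M = p * n →
      (univ.filter fun χ : 𝐗 M ↦ χ (-1) = -1 ∧ p ∣ χ.conductor).card +
      (univ.filter fun χ : 𝐗 n ↦ χ (-1) = -1).card =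
      (univ.filter fun χ : 𝐗 M ↦ χ (-1) = -1).card := by
    intro p hp n hn
    subst hn
    have hpp := Nat.prime_of_mem_primeFactors hp
    have : NeZero n := ⟨fun h ↦ NeZero.ne (p * n) (by rw [h, mul_zero])⟩
    rw [← card_odd_characters_not_dvd_conductor hpp (Nat.coprime_of_squarefree_mul hsq),
      ← Finset.filter_filter, ← Finset.filter_filter]
    exact Finset.card_filter_add_card_filter_not _
  have hdisc := IsCyclotomicExtension.Rat.natAbs_discr M K
  by_cases hp : M.Prime
  · rw [absNorm_differentIdeal_real_of_prime M K hodd hp, hdisc, hp.primeFactors,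
      Finset.prod_singleton, Finset.prod_singleton, Nat.totient_prime hp,
      Nat.div_self (Nat.sub_pos_of_lt hp.one_lt), pow_one]
    have h2 := hcount M (by rw [hp.primeFactors]; simp) 1 (mul_one M).symm
    rw [card_odd_characters_one, add_zero] at h2
    rw [h2, ← pow_mul, mul_comm _ 2, hcard, Nat.totient_prime hp, Nat.div_mul_cancel]
    exact dvd_pow_self _ (Nat.sub_ne_zero_of_lt hp.one_lt)
  · have hpp : ¬ IsPrimePow M := fun h ↦ hp (hsq.prime_of_isPrimePow h)
    rw [differentIdeal_real_eq_top M K hodd h1 hpp, Ideal.absNorm_top, mul_one, hdisc]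
    symm
    have hpos : 0 < ∏ p ∈ M.primeFactors, p ^ (M.totient / (p - 1)) :=
      Finset.prod_pos fun p hp ↦ pow_pos (Nat.prime_of_mem_primeFactors hp).pos _
    apply Nat.div_eq_of_eq_mul_left hpos
    rw [← prod_mul_distrib]
    conv_lhs => rw [← Nat.prod_primeFactors_of_squarefree hsq, ← Finset.prod_pow]
    rw [Nat.prod_primeFactors_of_squarefree hsq]
    refine prod_congr rfl fun p hpm ↦ ?_
    have hpr := Nat.prime_of_mem_primeFactors hpm
    obtain ⟨n, hn⟩ := Nat.dvd_of_mem_primeFactors hpm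
    have h2 := hcount p hpm n hn
    have hn2 : 2 < n := by
      have hno : Odd n := Odd.of_dvd_nat hodd ⟨_, hn.trans (mul_comm _ _)⟩
      have hn1 : n ≠ 1 := by rintro rfl; exact hp (by rw [hn, mul_one]; exact hpr)
      obtain ⟨c, hc⟩ := hno
      omega
    have hcop : p.Coprime n := Nat.coprime_of_squarefree_mul (hn ▸ hsq)
    have h3 : M.totient / (p - 1) = n.totient := by
      rw [hn, Nat.totient_mul hcop, Nat.totient_prime hpr,
        Nat.mul_div_cancel_left _ (Nat.sub_pos_of_lt hpr.one_lt)]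
    rw [h3, ← pow_mul, ← pow_add]
    congr 1
    have h4 := card_odd_characters hn2
    omega

theorem sqrt_discr_div_eq (hodd : Odd M) (h1 : M ≠ 1) (hsq : Squarefree M) :
    √|(discr K : ℝ)| / √|(discr (𝐑 K) : ℝ)| =
      ∏ χ : 𝐗 M with χ (-1) = -1, √(χ.conductor : ℝ) := by
  have e1 := sq_prod_conductor_odd M K hodd h1 hsq
  have e2 := natAbs_discr_eq_absNorm_mul K
  have hd : (discr (𝐑 K)).natAbs ≠ 0 :=
    Int.natAbs_ne_zero.2 (discr_ne_zero _)
  have e3 : ∏ χ : 𝐗 M with χ (-1) = -1, χ.conductor =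
      Ideal.absNorm (differentIdeal (𝓞 (𝐑 K)) (𝓞 K)) *
        (discr (𝐑 K)).natAbs := by
    refine Nat.pow_left_injective (n := 2) two_ne_zero ?_
    simp only
    rw [e1, e2]
    ring
  have e4 : ((discr K).natAbs : ℝ) = ((∏ χ : 𝐗 M with χ (-1) = -1,
      χ.conductor : ℕ) : ℝ) * (discr (𝐑 K)).natAbs := by
    rw [e3, e2]; push_cast; ring
  rw [← Int.cast_abs, ← Int.cast_abs, Int.abs_eq_natAbs, Int.abs_eq_natAbs, Int.cast_natCast,
    Int.cast_natCast, e4, Real.sqrt_mul (Nat.cast_nonneg _), mul_div_assoc, div_self, mul_one,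
    Nat.cast_prod, Real.sqrt_prod]
  · exact fun _ _ ↦ Nat.cast_nonneg _
  · have : (0 : ℝ) < (discr (𝐑 K)).natAbs := by exact_mod_cast Nat.pos_of_ne_zero hd
    positivity

/-- The relative class number of a cyclotomic field in terms of Bernoulli numbers. -/
theorem classNumber_eq_bernoulli (hodd : Odd M) (h1 : M ≠ 1) (hsq : Squarefree M) :
    (classNumber K : ℝ) = classNumber (𝐑 K) *
      (indexRealUnits K * (2 * M) / 2 ^ (Module.finrank ℚ (𝐑 K)) *
      ∏ χ : 𝐗 M with χ (-1) = -1,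
        (‖χ.primitiveCharacter.bernoulliSum‖ / χ.conductor)) := by
  rw [classNumber_cyclotomic_eq M K hodd h1 (fun h ↦ hsq.prime_of_isPrimePow h),
    sqrt_discr_div_eq M K hodd h1 hsq]
  have hM3 : 2 < M := by
    have := NeZero.pos M
    obtain ⟨c, hc⟩ := hodd
    omega
  have h2 : (univ.filter fun χ : 𝐗 M ↦ χ (-1) = -1).card =
      Module.finrank ℚ (𝐑 K) := by
    have h3 := card_odd_characters hM3
    have h4 := two_mul_finrank_real M K
    omega
  have h5 : ∏ χ : 𝐗 M with χ (-1) = -1, ‖LFunction χ.primitiveCharacter 1‖ =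
      ∏ χ : 𝐗 M with χ (-1) = -1, (Real.pi / √(χ.conductor : ℝ) *
        (‖χ.primitiveCharacter.bernoulliSum‖ / χ.conductor)) :=
    prod_congr rfl fun χ hχ ↦ norm_LFunction_one_of_odd _
      χ.primitiveCharacter_isPrimitive
      (by rw [χ.primitiveCharacter_neg_one]; exact (mem_filter.1 hχ).2)
  rw [h5, prod_mul_distrib, Finset.prod_div_distrib, Finset.prod_const, h2, mul_pow]
  have h6 : (∏ χ : 𝐗 M with χ (-1) = -1, √(χ.conductor : ℝ)) ≠ 0 := by
    refine Finset.prod_ne_zero_iff.2 fun χ _ ↦ ?_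
    have : (0 : ℝ) < χ.conductor := by exact_mod_cast NeZero.pos _
    positivity
  have hpi := Real.pi_ne_zero
  field_simp

end UnitIndex

section Ambiguous

open Ideal

variable {B : Type*} [CommRing B] [IsDedekindDomain B] (c : B ≃+* B)

/-- The homomorphism `v ↦ v * c v` on units. -/
def unitNorm : Bˣ →* Bˣ where
  toFun v := v * Units.map c.toMonoidHom v
  map_one' := by simp
  map_mul' v w := by rw [map_mul]; exact mul_mul_mul_comm _ _ _ _

theorem unitNorm_val (v : Bˣ) : (unitNorm c v : B) = v * c v := rfl

/-- `I = α · c I` for some `α = a / b` with `α * c α = u`. -/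
def AmbiguousIdeal (I : Ideal B) (u : Bˣ) : Prop :=
  ∃ a b : B, a ≠ 0 ∧ b ≠ 0 ∧ span {b} * I = span {a} * I.map c ∧ a * c a = u * (b * c b)

theorem map_span_singleton_mul (a : B) (I : Ideal B) :
    (span {a} * I).map c = span {c a} * I.map c := by
  rw [Ideal.map_mul, map_span, Set.image_singleton]

variable {c}

theorem map_map_involutive (hc : ∀ x, c (c x) = x) (I : Ideal B) : (I.map c).map c = I := by
  ext x
  rw [Ideal.mem_map_of_equiv]
  constructor
  · rintro ⟨y, hy, rfl⟩
    obtain ⟨z, hz, rfl⟩ := (Ideal.mem_map_of_equiv c y).1 hy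
    rwa [hc]
  · exact fun hx ↦ ⟨c x, mem_map_of_mem c hx, hc x⟩

theorem AmbiguousIdeal.mul {I I' : Ideal B} {u u' : Bˣ} (h : AmbiguousIdeal c I u)
    (h' : AmbiguousIdeal c I' u') : AmbiguousIdeal c (I * I') (u * u') := by
  obtain ⟨a, b, ha, hb, h1, h2⟩ := h
  obtain ⟨a', b', ha', hb', h1', h2'⟩ := h'
  refine ⟨a * a', b * b', mul_ne_zero ha ha', mul_ne_zero hb hb', ?_, ?_⟩
  · rw [← span_singleton_mul_span_singleton, ← span_singleton_mul_span_singleton, Ideal.map_mul,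
      mul_mul_mul_comm, h1, h1', mul_mul_mul_comm]
  · rw [map_mul, map_mul, Units.val_mul]
    linear_combination a' * c a' * h2 + u * (b * c b) * h2'

theorem exists_ambiguousIdeal (hc : ∀ x, c (c x) = x) {I : Ideal B} (hI : I ≠ ⊥) {a b : B}
    (ha : a ≠ 0) (hb : b ≠ 0) (h : span {b} * I = span {a} * I.map c) :
    ∃ u, AmbiguousIdeal c I u := by
  have h1 := congrArg (Ideal.map c) h
  rw [map_span_singleton_mul, map_span_singleton_mul, map_map_involutive hc] at h1
  have hI' : I.map c ≠ ⊥ := by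
    rwa [Ne, Ideal.map_eq_bot_iff_of_injective c.injective]
  have h2 : span {b * c b} * (I * I.map c) = span {a * c a} * (I * I.map c) := by
    rw [← span_singleton_mul_span_singleton, ← span_singleton_mul_span_singleton,
      mul_mul_mul_comm, h, h1]
    ring
  have h3 := mul_right_cancel₀ (mul_ne_zero hI hI') h2
  obtain ⟨u, hu⟩ := span_singleton_eq_span_singleton.1 h3
  exact ⟨u, a, b, ha, hb, h, by rw [← hu]; ring⟩

theorem AmbiguousIdeal.unique (hc : ∀ x, c (c x) = x) {I I' : Ideal B} (hI' : I' ≠ ⊥) {u u' : Bˣ}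
    (h : AmbiguousIdeal c I u) (h' : AmbiguousIdeal c I' u') {e f : B} (he : e ≠ 0) (hf : f ≠ 0)
    (hef : span {e} * I = span {f} * I') : u' * u⁻¹ ∈ (unitNorm c).range := by
  obtain ⟨a, b, ha, hb, h1, h2⟩ := h
  obtain ⟨a', b', ha', hb', h1', h2'⟩ := h'
  have hef' := congrArg (Ideal.map c) hef
  rw [map_span_singleton_mul, map_span_singleton_mul] at hef'
  have h3 : span {a' * b * f * c e} * I' = span {a * b' * e * c f} * I' := by
    simp only [← span_singleton_mul_span_singleton]
    calc span {a'} * span {b} * span {f} * span {c e} * I'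
        = span {a'} * span {b} * span {c e} * (span {f} * I') := by ring
      _ = span {a'} * span {c e} * span {e} * (span {b} * I) := by rw [← hef]; ring
      _ = span {a'} * span {e} * span {a} * (span {c e} * I.map c) := by rw [h1]; ring
      _ = span {e} * span {a} * span {c f} * (span {a'} * I'.map c) := by rw [hef']; ring
      _ = span {a} * span {b'} * span {e} * span {c f} * I' := by rw [← h1']; ring
  have h4 := mul_right_cancel₀ hI' h3
  obtain ⟨v, hv⟩ := span_singleton_eq_span_singleton.1 h4
  refine ⟨v⁻¹, ?_⟩
  have h5 := congrArg c hv
  simp only [map_mul, hc] at h5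
  have hc0 : ∀ x : B, x ≠ 0 → c x ≠ 0 := fun x hx ↦ (map_ne_zero_iff c c.injective).2 hx
  have h6 : (u' : B) * (v * c v) = u := by
    have hne : b * c b * (b' * c b') * (f * c f) * (e * c e) ≠ 0 := by
      simp [hb, hb', hf, he]
    refine mul_right_cancel₀ hne ?_
    calc (u' : B) * (v * c v) * (b * c b * (b' * c b') * (f * c f) * (e * c e))
        = (u' * (b' * c b')) * (v * c v) * (b * c b) * (f * c f) * (e * c e) := by ring
      _ = (a' * b * f * c e * v) * (c a' * c b * c f * e * c v) := by rw [← h2']; ring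
      _ = (a * b' * e * c f) * (c a * c b' * c e * f) := by rw [hv, h5]
      _ = (a * c a) * (b' * c b') * (f * c f) * (e * c e) := by ring
      _ = _ := by rw [h2]; ring
  rw [map_inv, inv_eq_iff_eq_inv]
  ext
  rw [unitNorm_val, mul_inv_rev, inv_inv, Units.val_mul, ← h6]
  rw [mul_comm (u' : B), mul_assoc, Units.mul_inv, mul_one]

/-- A principal ambiguous ideal. -/
theorem ambiguousIdeal_of_mul_conj {β b : B} (hβ : β ≠ 0) (hb : b ≠ 0) (hcb : c b = b) {u : Bˣ}
    (h : β * c β = u * b ^ 2) : AmbiguousIdeal c (span {b, β}) u := by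
  refine ⟨β, b, hβ, hb, ?_, by rw [h, hcb]; ring⟩
  have hu : span {(u : B) * b ^ 2} = span {b ^ 2} :=
    span_singleton_mul_left_unit u.isUnit _
  rw [map_span, Set.image_pair, hcb, span_insert, span_insert, Ideal.mul_sup, Ideal.mul_sup,
    span_singleton_mul_span_singleton, span_singleton_mul_span_singleton,
    span_singleton_mul_span_singleton, span_singleton_mul_span_singleton, h, hu, ← sq,
    sup_comm, mul_comm]

/-- An ideal whose attached unit is a norm is, up to principal ideals, invariant. -/
theorem AmbiguousIdeal.exists_invariant (hc : ∀ x, c (c x) = x) {I : Ideal B}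
    {u : Bˣ} (h : AmbiguousIdeal c I u) (hu : u ∈ (unitNorm c).range) :
    ∃ g : B, g ≠ 0 ∧ (span {g} * I).map c = span {g} * I := by
  obtain ⟨a, b, ha, hb, h1, h2⟩ := h
  obtain ⟨v, rfl⟩ := hu
  rw [← span_singleton_mul_right_unit v.isUnit b] at h1
  rw [unitNorm_val] at h2
  have hb' : b * v ≠ 0 := mul_ne_zero hb v.ne_zero
  have h2' : a * c a = (b * v) * c (b * v) := by rw [h2, map_mul]; ring
  generalize b * (v : B) = d at h1 hb' h2'
  by_cases hs : a + d = 0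
  · refine ⟨1, one_ne_zero, ?_⟩
    rw [eq_neg_of_add_eq_zero_left hs, span_singleton_neg] at h1
    have := mul_left_cancel₀ (by simpa using hb') h1
    rw [map_span_singleton_mul, map_one, ← this]
  · have hg : (a + d) * c d ≠ 0 := mul_ne_zero hs ((map_ne_zero_iff c c.injective).2 hb')
    refine ⟨c ((a + d) * c d), (map_ne_zero_iff c c.injective).2 hg, ?_⟩
    rw [map_span_singleton_mul, hc, map_mul, hc, ← span_singleton_mul_span_singleton _ d, mul_assoc,
      h1, ← mul_assoc, span_singleton_mul_span_singleton]
    congr 3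
    rw [map_add]
    linear_combination -h2'

/-- `J` is the action of `c` on ideal classes. -/
def IsClassAction (c : B ≃+* B) (J : ClassGroup B →* ClassGroup B) : Prop :=
  ∀ I I' : (Ideal B)⁰, Ideal.map c (I : Ideal B) = (I' : Ideal B) →
    J (ClassGroup.mk0 I) = ClassGroup.mk0 I'

variable (J : ClassGroup B →* ClassGroup B) (hJ : IsClassAction c J)

theorem exists_ambiguousIdeal_of_fixed (hJ : IsClassAction c J) (hc : ∀ x, c (c x) = x) (I : (Ideal B)⁰)
    (h : J (ClassGroup.mk0 I) = ClassGroup.mk0 I) : ∃ u, AmbiguousIdeal c (I : Ideal B) u := by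
  have hI : (I : Ideal B) ≠ ⊥ := nonZeroDivisors.coe_ne_zero I
  have hI' : (I : Ideal B).map c ≠ ⊥ := by
    rwa [Ne, Ideal.map_eq_bot_iff_of_injective c.injective]
  rw [hJ I ⟨_, mem_nonZeroDivisors_of_ne_zero hI'⟩ rfl, eq_comm, ClassGroup.mk0_eq_mk0_iff] at h
  obtain ⟨b, a, hb, ha, hab⟩ := h
  exact exists_ambiguousIdeal hc hI ha hb hab

theorem AmbiguousIdeal.fixed (hJ : IsClassAction c J) (I : (Ideal B)⁰) {u : Bˣ} (h : AmbiguousIdeal c (I : Ideal B) u) :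
    J (ClassGroup.mk0 I) = ClassGroup.mk0 I := by
  have hI : (I : Ideal B) ≠ ⊥ := nonZeroDivisors.coe_ne_zero I
  have hI' : (I : Ideal B).map c ≠ ⊥ := by
    rwa [Ne, Ideal.map_eq_bot_iff_of_injective c.injective]
  obtain ⟨a, b, ha, hb, h1, -⟩ := h
  rw [hJ I ⟨_, mem_nonZeroDivisors_of_ne_zero hI'⟩ rfl, eq_comm, ClassGroup.mk0_eq_mk0_iff]
  exact ⟨b, a, hb, ha, h1⟩

/-- The subgroup of ambiguous ideal classes. -/
noncomputable def ambiguousClasses : Subgroup (ClassGroup B) := J.eqLocus (MonoidHom.id _)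

/-- The unit attached to an ambiguous ideal class, modulo norms of units. -/
noncomputable def ambiguousUnit (hc : ∀ x, c (c x) = x) :
    ambiguousClasses J →* Bˣ ⧸ (unitNorm c).range :=
  have hrep : ∀ x : ambiguousClasses J, ∃ I : (Ideal B)⁰, ∃ u, ClassGroup.mk0 I = x ∧
      AmbiguousIdeal c (I : Ideal B) u := fun x ↦ by
    obtain ⟨I, hI⟩ := ClassGroup.mk0_surjective (x : ClassGroup B)
    obtain ⟨u, hu⟩ := exists_ambiguousIdeal_of_fixed J hJ hc I (by rw [hI]; exact x.2)
    exact ⟨I, u, hI, hu⟩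
  MonoidHom.mk' (fun x ↦ QuotientGroup.mk (hrep x).choose_spec.choose) fun x y ↦ by
    rw [← QuotientGroup.mk_mul]
    have hx := (hrep x).choose_spec.choose_spec
    have hy := (hrep y).choose_spec.choose_spec
    have hxy := (hrep (x * y)).choose_spec.choose_spec
    have h1 : ClassGroup.mk0 ((hrep x).choose * (hrep y).choose) =
        ClassGroup.mk0 (hrep (x * y)).choose := by rw [map_mul, hx.1, hy.1, hxy.1]; rfl
    rw [ClassGroup.mk0_eq_mk0_iff] at h1
    obtain ⟨e, f, he, hf, hef⟩ := h1
    symm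
    rw [QuotientGroup.eq]
    have := (hx.2.mul hy.2).unique hc (nonZeroDivisors.coe_ne_zero _) hxy.2 he hf
      (by simpa using hef)
    rwa [mul_comm] at this

theorem ambiguousUnit_eq (hc : ∀ x, c (c x) = x) (x : ambiguousClasses J) (I : (Ideal B)⁰)
    (hI : ClassGroup.mk0 I = x) {u : Bˣ} (hu : AmbiguousIdeal c (I : Ideal B) u) :
    ambiguousUnit J hJ hc x = QuotientGroup.mk u := by
  have hrep : ∀ x : ambiguousClasses J, ∃ I : (Ideal B)⁰, ∃ u, ClassGroup.mk0 I = x ∧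
      AmbiguousIdeal c (I : Ideal B) u := fun x ↦ by
    obtain ⟨I, hI⟩ := ClassGroup.mk0_surjective (x : ClassGroup B)
    obtain ⟨u, hu⟩ := exists_ambiguousIdeal_of_fixed J hJ hc I (by rw [hI]; exact x.2)
    exact ⟨I, u, hI, hu⟩
  have hx := (hrep x).choose_spec.choose_spec
  have h1 : ClassGroup.mk0 (hrep x).choose = ClassGroup.mk0 I := hx.1.trans hI.symm
  rw [ClassGroup.mk0_eq_mk0_iff] at h1
  obtain ⟨e, f, he, hf, hef⟩ := h1
  have := hx.2.unique hc (nonZeroDivisors.coe_ne_zero _) hu he hf hef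
  change QuotientGroup.mk (hrep x).choose_spec.choose = _
  rw [QuotientGroup.eq]
  rwa [mul_comm] at this

end Ambiguous

section RealClasses

open IsCMField Ideal

/-- Complex conjugation on the ring of integers, as a ring isomorphism. -/
noncomputable abbrev conjRingEquiv (K : Type*) [Field K] [NumberField K] [IsCMField K] :
    𝓞 K ≃+* 𝓞 K := (ringOfIntegersComplexConj K).toRingEquiv

variable (M : ℕ) [NeZero M] (K : Type*) [Field K] [NumberField K] [IsCyclotomicExtension {M} ℚ K]
  [IsCMField K]

theorem conjRingEquiv_conjRingEquiv (x : 𝓞 K) : conjRingEquiv K (conjRingEquiv K x) = x :=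
  RingOfIntegers.ext (complexConj_apply_apply K _)

theorem exists_real_of_conj_eq {x : 𝓞 K} (hx : conjRingEquiv K x = x) :
    ∃ y : 𝓞 (𝐑 K), algebraMap _ (𝓞 K) y = x :=
  (ringOfIntegersComplexConj_eq_self_iff K x).1 hx

theorem conjRingEquiv_algebraMap (y : 𝓞 (𝐑 K)) :
    conjRingEquiv K (algebraMap _ (𝓞 K) y) = algebraMap _ (𝓞 K) y :=
  (ringOfIntegersComplexConj_eq_self_iff K _).2 ⟨y, rfl⟩

theorem sub_conj_mem_span {ζ : K} (hζ : IsPrimitiveRoot ζ M) (x : 𝓞 K) :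
    x - conjRingEquiv K x ∈ span {hζ.toInteger - conjRingEquiv K hζ.toInteger} := by
  have htop := IsCyclotomicExtension.Rat.adjoin_singleton_eq_top hζ
  generalize hζ.toInteger = z at *
  have hx : x ∈ Algebra.adjoin ℤ {z} := htop ▸ Algebra.mem_top
  induction hx using Algebra.adjoin_induction with
  | mem y hy =>
    rw [Set.mem_singleton_iff.1 hy]
    exact mem_span_singleton_self _
  | algebraMap r => simp
  | add a b _ _ ha hb =>
    rw [map_add, add_sub_add_comm]
    exact add_mem ha hb
  | mul a b _ _ ha hb =>
    have : a * b - conjRingEquiv K (a * b) = (a - conjRingEquiv K a) * conjRingEquiv K b +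
        a * (b - conjRingEquiv K b) := by rw [map_mul]; ring
    rw [this]
    exact add_mem (Ideal.mul_mem_right _ _ ha) (Ideal.mul_mem_left _ _ hb)

theorem sub_conj_ne_zero (hodd : Odd M) (h1 : M ≠ 1) {ζ : K} (hζ : IsPrimitiveRoot ζ M) :
    hζ.toInteger - conjRingEquiv K hζ.toInteger ≠ 0 := by
  intro h
  have hconj := ringOfIntegersComplexConj_toInteger M K hζ
  have h2 : hζ.toInteger ^ 2 = 1 := by
    rw [← hconj, sq]; congr 1; exact sub_eq_zero.1 h
  have h3 := hζ.toInteger_isPrimitiveRoot.dvd_of_pow_eq_one 2 h2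
  rcases (Nat.dvd_prime Nat.prime_two).1 h3 with h4 | h4
  · exact h1 h4
  · rw [h4] at hodd; exact absurd hodd (by decide)

/-- A conjugation-invariant ideal prime to the different comes from the real subfield. -/
theorem map_comap_real_eq (hodd : Odd M) (h1 : M ≠ 1) {ζ : K} (hζ : IsPrimitiveRoot ζ M)
    {I : Ideal (𝓞 K)} (hI : I.map (conjRingEquiv K) = I)
    (hcop : IsCoprime I (span {hζ.toInteger - conjRingEquiv K hζ.toInteger})) :
    (I.comap (algebraMap (𝓞 (𝐑 K)) (𝓞 K))).map
      (algebraMap (𝓞 (𝐑 K)) (𝓞 K)) = I := by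
  refine le_antisymm map_comap_le fun x hx ↦ ?_
  have hδ := sub_conj_ne_zero M K hodd h1 hζ
  obtain ⟨b, hb⟩ := mem_span_singleton.1 (sub_conj_mem_span M K hζ x)
  set z := hζ.toInteger
  have hcc := conjRingEquiv_conjRingEquiv K
  have hcb : conjRingEquiv K b = b := by
    have h2 := congrArg (conjRingEquiv K) hb
    simp only [map_sub, map_mul, hcc] at h2
    refine mul_left_cancel₀ hδ ?_
    linear_combination hb + h2
  have hxbar : conjRingEquiv K x ∈ I := by
    rw [← hI]; exact mem_map_of_mem _ hx
  have hbI : b ∈ I := by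
    obtain ⟨i, hi, j, hj, hij⟩ := isCoprime_iff_exists.1 hcop
    obtain ⟨k, rfl⟩ := mem_span_singleton.1 hj
    have : b = b * i + (x - conjRingEquiv K x) * k := by
      rw [hb]; linear_combination -b * hij
    rw [this]
    exact add_mem (I.mul_mem_left _ hi) (I.mul_mem_right _ (sub_mem hx hxbar))
  have ha : conjRingEquiv K (x - b * z) = x - b * z := by
    rw [map_sub, map_mul, hcb]; linear_combination -hb
  obtain ⟨b', hb'⟩ := exists_real_of_conj_eq K hcb
  obtain ⟨a', ha'⟩ := exists_real_of_conj_eq K ha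
  have : x = algebraMap _ (𝓞 K) a' + algebraMap _ (𝓞 K) b' * z := by rw [ha', hb']; ring
  rw [this]
  refine add_mem (mem_map_of_mem _ ?_) (Ideal.mul_mem_right _ _ (mem_map_of_mem _ ?_))
  · rw [mem_comap, ha']; exact sub_mem hx (I.mul_mem_right _ hbI)
  · rwa [mem_comap, hb']

theorem span_sub_conj_eq (hodd : Odd M) (hp : M.Prime) {ζ : K} (hζ : IsPrimitiveRoot ζ M) :
    span {hζ.toInteger - conjRingEquiv K hζ.toInteger} = span {hζ.toInteger - 1} := by
  have : Fact M.Prime := ⟨hp⟩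
  have hconj := ringOfIntegersComplexConj_toInteger M K hζ
  have hη : IsPrimitiveRoot (ζ ^ 2) M := hζ.pow_of_coprime 2 (Nat.coprime_two_left.2 hodd)
  have h2 := IsCyclotomicExtension.Rat.associated_sub_one_of_isPrimitiveRoot M hζ hη
  have h3 : hη.toInteger = hζ.toInteger ^ 2 := RingOfIntegers.ext rfl
  rw [h3] at h2
  refine span_singleton_eq_span_singleton.2 (Associated.trans ?_ h2.symm)
  refine ⟨(IsUnit.of_mul_eq_one_right _ hconj).unit, ?_⟩
  rw [IsUnit.unit_spec]
  linear_combination -hconj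

/-- Up to a principal ideal, a conjugation-invariant ideal comes from the real subfield. -/
theorem exists_span_mul_map_real (hodd : Odd M) (h1 : M ≠ 1) (hsq : Squarefree M)
    {I : Ideal (𝓞 K)} (h0 : I ≠ ⊥) (hI : I.map (conjRingEquiv K) = I) :
    ∃ g : 𝓞 K, g ≠ 0 ∧ ∃ A : Ideal (𝓞 (𝐑 K)),
      I = span {g} * A.map (algebraMap _ (𝓞 K)) := by
  have hζ := IsCyclotomicExtension.zeta_spec M ℚ K
  by_cases hp : M.Prime
  · have : Fact M.Prime := ⟨hp⟩
    set P := span {hζ.toInteger - 1} with hP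
    have hprime : P.IsPrime := IsCyclotomicExtension.Rat.isPrime_span_zeta_sub_one' M hζ
    have hPδ := span_sub_conj_eq M K hodd hp hζ
    have hP0 : hζ.toInteger - 1 ≠ 0 := by
      intro h
      rw [h, Set.singleton_zero, span_zero, span_singleton_eq_bot] at hPδ
      exact sub_conj_ne_zero M K hodd h1 hζ hPδ
    have hPP : Prime P := prime_of_isPrime (by simpa [hP] using hP0) hprime
    obtain ⟨k, I', hI', rfl⟩ := WfDvdMonoid.max_power_factor h0 hPP.irreducible
    have hPinv : P.map (conjRingEquiv K) = P := by
      rw [hP, ← hPδ, map_span, Set.image_singleton, map_sub, conjRingEquiv_conjRingEquiv,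
        ← neg_sub, span_singleton_neg]
    rw [Ideal.map_mul, Ideal.map_pow, hPinv] at hI
    have hI'inv := mul_left_cancel₀ (pow_ne_zero k hPP.ne_zero) hI
    have hcop : IsCoprime I' P := by
      have hmax : P.IsMaximal := hprime.isMaximal hPP.ne_zero
      rw [isCoprime_iff_codisjoint, codisjoint_iff, sup_comm]
      refine hmax.1.2 _ (lt_of_le_of_ne le_sup_left fun h ↦ hI' ?_)
      rw [dvd_iff_le, h]
      exact le_sup_right
    refine ⟨(hζ.toInteger - 1) ^ k, pow_ne_zero _ hP0, I'.comap (algebraMap _ (𝓞 K)), ?_⟩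
    rw [map_comap_real_eq M K hodd h1 hζ hI'inv (hPδ ▸ hcop), ← span_singleton_pow]
  · have hu := isUnit_sub_conj M K hodd h1 (fun h ↦ hp (hsq.prime_of_isPrimePow h)) hζ
    refine ⟨1, one_ne_zero, I.comap (algebraMap _ (𝓞 K)), ?_⟩
    rw [map_comap_real_eq M K hodd h1 hζ hI, span_singleton_one, one_eq_top.symm, one_mul]
    convert isCoprime_one_right
    rw [one_eq_top]
    exact span_singleton_eq_top.2 hu

theorem map_real_injective : Function.Injective
    (Ideal.map (algebraMap (𝓞 (𝐑 K)) (𝓞 K))) := by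
  intro I I' h
  rw [← comap_map_eq_self_of_faithfullyFlat (B := 𝓞 K) I, h,
    comap_map_eq_self_of_faithfullyFlat]

theorem neg_one_notMem_range (hodd : Odd M) (hp : M.Prime) :
    (⟨-1, (Units.mem_torsion K).2 fun w ↦ by
      rw [Units.val_neg, map_neg]; exact (w.1.map_neg _).trans (by simp)⟩ : Units.torsion K) ∉
      (unitsMulComplexConjInv K).range := by
  rintro ⟨u, hu⟩
  have : Fact M.Prime := ⟨hp⟩
  have hζ := IsCyclotomicExtension.zeta_spec M ℚ K
  have hM2 : 2 < M := hp.two_le.lt_of_ne fun h ↦ by rw [← h] at hodd; exact absurd hodd (by decide)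
  have hprime : (Ideal.span {hζ.toInteger - 1}).IsPrime :=
    IsCyclotomicExtension.Rat.isPrime_span_zeta_sub_one' M hζ
  have h2 := IsCyclotomicExtension.Rat.two_not_mem_span_zeta_sub_one' M hζ hM2
  have h4 : (u : (𝓞 K)ˣ) = -unitsComplexConj K u := by
    have := congrArg Subtype.val hu
    rw [unitsMulComplexConjInv_apply, mul_inv_eq_iff_eq_mul] at this
    exact this.trans (neg_one_mul _)
  have h5 : (u : 𝓞 K) = -ringOfIntegersComplexConj K (u : 𝓞 K) := congrArg Units.val h4
  have h6 := conj_sub_mem_span_zeta_sub_one M K hζ (u : 𝓞 K)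
  have h7 : (2 : 𝓞 K) * (u : 𝓞 K) ∈ Ideal.span {hζ.toInteger - 1} := by
    have : (2 : 𝓞 K) * (u : 𝓞 K) = -(ringOfIntegersComplexConj K (u : 𝓞 K) - (u : 𝓞 K)) := by
      linear_combination h5
    rw [this]
    exact neg_mem h6
  rcases hprime.mem_or_mem h7 with h8 | h8
  · exact h2 h8
  · exact hprime.ne_top (Ideal.eq_top_of_isUnit_mem _ h8 u.isUnit)

/-- Ideal classes of the real subfield do not capitulate. -/
theorem extendedHom_real_injective (hodd : Odd M) (h1 : M ≠ 1) (hsq : Squarefree M) :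
    Function.Injective
      (ClassGroup.extendedHom (𝓞 (𝐑 K)) (𝓞 K)) := by
  rw [injective_iff_map_eq_one]
  intro a ha
  obtain ⟨I, rfl⟩ := ClassGroup.mk0_surjective a
  rw [ClassGroup.extendedHom_mk0, ClassGroup.mk0_eq_one_iff] at ha
  rw [ClassGroup.mk0_eq_one_iff]
  obtain ⟨x, hx⟩ := ha
  rw [← span] at hx
  change (I : Ideal (𝓞 (𝐑 K))).map (algebraMap _ (𝓞 K)) = _ at hx
  have hI0 : (I : Ideal (𝓞 (𝐑 K))) ≠ ⊥ := nonZeroDivisors.coe_ne_zero I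
  have hx0 : x ≠ 0 := by
    rintro rfl
    rw [Set.singleton_zero, span_zero, map_eq_bot_iff_of_injective
      (FaithfulSMul.algebraMap_injective _ _)] at hx
    exact hI0 hx
  have hinv : span {conjRingEquiv K x} = span {x} := by
    rw [← Set.image_singleton, ← map_span, ← hx]
    apply le_antisymm
    · rw [map_le_iff_le_comap, map_le_iff_le_comap]
      intro y hy
      rw [mem_comap, mem_comap]
      exact (conjRingEquiv_algebraMap K y).symm ▸ mem_map_of_mem _ hy
    · rw [map_le_iff_le_comap]
      intro y hy
      rw [mem_comap, ← conjRingEquiv_algebraMap]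
      exact mem_map_of_mem _ (mem_map_of_mem _ hy)
  obtain ⟨v, hv⟩ := span_singleton_eq_span_singleton.1 hinv
  have hxc0 : conjRingEquiv K x ≠ 0 := (map_ne_zero_iff _ (conjRingEquiv K).injective).2 hx0
  have hvK : (x : K) ≠ 0 := RingOfIntegers.coe_ne_zero_iff.2 hx0
  have hvt : v ∈ Units.torsion K := by
    rw [NumberField.Units.mem_torsion]
    intro w
    have h2 := congrArg (fun y : 𝓞 K ↦ w (y : K)) hv
    simp only [map_mul] at h2
    have h3 : w ((conjRingEquiv K x : 𝓞 K) : K) = w (x : K) :=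
      infinitePlace_complexConj K w x
    rw [h3] at h2
    exact (mul_eq_left₀ ((map_ne_zero w).2 hvK)).1 h2
  have hmain : ∀ η : (𝓞 K)ˣ, unitsMulComplexConjInv K η = ⟨v, hvt⟩ →
      ((I : Ideal (𝓞 (𝐑 K)))).IsPrincipal := by
    intro η hη
    have h4 : η = v * unitsComplexConj K η := by
      have := congrArg Subtype.val hη
      rwa [unitsMulComplexConjInv_apply, mul_inv_eq_iff_eq_mul] at this
    have h5 : (η : 𝓞 K) = v * conjRingEquiv K η := congrArg Units.val h4
    have h6 : conjRingEquiv K (x * conjRingEquiv K η) = x * conjRingEquiv K η := by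
      rw [map_mul, conjRingEquiv_conjRingEquiv]
      linear_combination conjRingEquiv K η * hv + conjRingEquiv K x * h5
    obtain ⟨y, hy⟩ := exists_real_of_conj_eq K h6
    refine ⟨y, map_real_injective K ?_⟩
    rw [hx, ← span, map_span, Set.image_singleton, hy]
    exact (span_singleton_mul_right_unit ((unitsComplexConj K η).isUnit) x).symm
  have hidx := indexRealUnits_mul_eq K
  by_cases hp : M.Prime
  · rw [indexRealUnits_eq_one M K hodd hp, one_mul] at hidx
    by_cases hvr : (⟨v, hvt⟩ : Units.torsion K) ∈ (unitsMulComplexConjInv K).range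
    · exact hmain _ hvr.choose_spec
    exfalso
    have hneg := (Subgroup.mul_mem_iff_of_index_two hidx
      (a := (⟨v, hvt⟩ : Units.torsion K)) (b := _)).2
      (iff_of_false hvr (neg_one_notMem_range M K hodd hp))
    obtain ⟨η, hη⟩ := hneg
    have h4 : η = -v * unitsComplexConj K η := by
      have := congrArg Subtype.val hη
      rw [unitsMulComplexConjInv_apply, mul_inv_eq_iff_eq_mul] at this
      nth_rewrite 1 [this]
      simp
    have h5 : (η : 𝓞 K) = -v * conjRingEquiv K η := congrArg Units.val h4
    have hζ := IsCyclotomicExtension.zeta_spec M ℚ K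
    set δ := hζ.toInteger - conjRingEquiv K hζ.toInteger with hδ
    have hδc : conjRingEquiv K δ = -δ := by
      rw [hδ, map_sub, conjRingEquiv_conjRingEquiv]; ring
    have h6 : conjRingEquiv K (x * conjRingEquiv K η * δ) = x * conjRingEquiv K η * δ := by
      rw [map_mul, map_mul, conjRingEquiv_conjRingEquiv, hδc]
      linear_combination conjRingEquiv K η * δ * hv - conjRingEquiv K x * δ * h5
    obtain ⟨y, hy⟩ := exists_real_of_conj_eq K h6
    have h7 : (span {y}).map (algebraMap _ (𝓞 K)) =
        (I : Ideal (𝓞 (𝐑 K))).map (algebraMap _ (𝓞 K)) * span {δ} := by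
      rw [hx, map_span, Set.image_singleton, hy, ← span_singleton_mul_span_singleton]
      congr 1
      exact (span_singleton_mul_right_unit ((unitsComplexConj K η).isUnit) x)
    have h8 := congrArg absNorm h7
    have hfr : Module.finrank (𝓞 (𝐑 K)) (𝓞 K) = 2 := by
      rw [← Algebra.IsQuadraticExtension.finrank_eq_two (𝐑 K) K]
      exact (IsFractionRing.finrank_eq (𝓞 (𝐑 K)) (𝐑 K)
        (𝓞 K) K).symm
    have : Fact M.Prime := ⟨hp⟩
    have hcyc : IsCyclotomicExtension {M ^ (0 + 1)} ℚ K := by simp; infer_instance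
    have hN : absNorm (span {hζ.toInteger - 1}) = M :=
      IsCyclotomicExtension.Rat.absNorm_span_zeta_sub_one M 0 (K := K)
        (ζ := IsCyclotomicExtension.zeta M ℚ K) (by simp [hζ])
    rw [map_mul, absNorm_algebraMap, absNorm_algebraMap, hfr, hδ, span_sub_conj_eq M K hodd hp hζ,
      hN] at h8
    have hI1 : absNorm (I : Ideal (𝓞 (𝐑 K))) ≠ 0 := by
      rwa [Ne, absNorm_eq_zero_iff]
    obtain ⟨k, hk⟩ := (Nat.pow_dvd_pow_iff two_ne_zero).1 (Dvd.intro _ h8.symm)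
    rw [hk, mul_pow] at h8
    have h9 := Nat.eq_of_mul_eq_mul_left (by positivity) h8
    exact (Nat.prime_iff.1 hp).irreducible.not_isSquare ⟨k, by rw [← h9]; ring⟩
  · rw [indexRealUnits_eq_two M K hodd h1 (fun h ↦ hp (hsq.prime_of_isPrimePow h))] at hidx
    have htop := Subgroup.index_eq_one.1 (Nat.eq_of_mul_eq_mul_left two_pos hidx)
    obtain ⟨η, hη⟩ : (⟨v, hvt⟩ : Units.torsion K) ∈ (unitsMulComplexConjInv K).range :=
      htop ▸ Subgroup.mem_top _
    exact hmain η hη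

end RealClasses

section Counting

open IsCMField Ideal

theorem card_quotient_range_pow_two_dvd {G : Type*} [CommGroup G] {n : ℕ} (s : Fin n → G)
    (hs : Subgroup.closure (Set.range s) = ⊤) :
    (powMonoidHom 2 : G →* G).range.index ∣ 2 ^ n := by
  classical
  let V := Additive (G ⧸ (powMonoidHom 2 : G →* G).range)
  have hV : ∀ x : V, 2 • x = 0 := by
    intro x
    induction x using Additive.rec with | ofMul x => ?_
    induction x using QuotientGroup.induction_on with | H g => ?_
    rw [← ofMul_pow, ← QuotientGroup.mk_pow]
    exact congrArg Additive.ofMul ((QuotientGroup.eq_one_iff _).2 ⟨g, rfl⟩)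
  letI : Module (ZMod 2) V := AddCommGroup.zmodModule hV
  let t : Fin n → V := fun i ↦ Additive.ofMul (QuotientGroup.mk (s i))
  have ht : Submodule.span (ZMod 2) (Set.range t) = ⊤ := by
    rw [eq_top_iff]
    rintro x -
    induction x using Additive.rec with | ofMul x => ?_
    induction x using QuotientGroup.induction_on with | H g => ?_
    have hg : g ∈ Subgroup.closure (Set.range s) := hs ▸ Subgroup.mem_top g
    induction hg using Subgroup.closure_induction with
    | mem x hx =>
      obtain ⟨i, rfl⟩ := hx
      exact Submodule.subset_span ⟨i, rfl⟩
    | one => exact zero_mem _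
    | mul x y _ _ hx hy => exact add_mem hx hy
    | inv x _ hx => exact neg_mem hx
  have hfin : Module.Finite (ZMod 2) V := ⟨⟨univ.image t, by simpa using ht⟩⟩
  have hle : Module.finrank (ZMod 2) V ≤ n := by
    rw [← finrank_top, ← ht]
    exact (finrank_range_le_card t).trans_eq (Fintype.card_fin n)
  have : Finite V := Module.finite_of_finite (ZMod 2)
  have hcard : Nat.card V = 2 ^ Module.finrank (ZMod 2) V := by
    have := Module.natCard_eq_pow_finrank (K := ZMod 2) (V := V)
    rwa [Nat.card_zmod] at this
  have : (powMonoidHom 2 : G →* G).range.index = Nat.card V := rfl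
  rw [this, hcard]
  exact pow_dvd_pow _ hle

theorem index_range_pow_two_units_dvd (F : Type*) [Field F] [NumberField F] [IsTotallyReal F] :
    (powMonoidHom 2 : (𝓞 F)ˣ →* (𝓞 F)ˣ).range.index ∣ 2 ^ Module.finrank ℚ F := by
  have hn : Module.finrank ℚ F = Units.rank F + 1 := by
    rw [IsTotallyReal.finrank F, Units.rank, Nat.sub_add_cancel Fintype.card_pos,
      InfinitePlace.card_eq_nrRealPlaces_add_nrComplexPlaces,
      IsTotallyReal.nrComplexPlaces_eq_zero, add_zero]
  rw [hn]
  obtain ⟨t, ht⟩ := IsCyclic.exists_generator (α := Units.torsion F)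
  refine card_quotient_range_pow_two_dvd
    (Fin.cons (t : (𝓞 F)ˣ) (Units.fundSystem F) : Fin (Units.rank F + 1) → (𝓞 F)ˣ) ?_
  rw [Fin.range_cons, eq_top_iff, ← Units.closure_fundSystem_sup_torsion_eq_top]
  refine sup_le (Subgroup.closure_mono (Set.subset_insert _ _)) fun y hy ↦ ?_
  obtain ⟨k, hk⟩ := Subgroup.mem_zpowers_iff.1 (ht ⟨y, hy⟩)
  have := congrArg Subtype.val hk
  rw [Subgroup.coe_zpow] at this
  change y ∈ _
  rw [show y = (t : (𝓞 F)ˣ) ^ k from this.symm]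
  exact Subgroup.zpow_mem _ (Subgroup.subset_closure (Set.mem_insert _ _)) k

variable (M : ℕ) [NeZero M] (K : Type*) [Field K] [NumberField K] [IsCyclotomicExtension {M} ℚ K]
  [IsCMField K]

variable (J : ClassGroup (𝓞 K) →* ClassGroup (𝓞 K)) (hJ : IsClassAction (conjRingEquiv K) J)

/-- The map from ambiguous classes to units modulo norms. -/
noncomputable abbrev classUnit :
    ambiguousClasses J →* (𝓞 K)ˣ ⧸ (unitNorm (conjRingEquiv K)).range :=
  ambiguousUnit J hJ (conjRingEquiv_conjRingEquiv K)

theorem ker_classUnit_le (hodd : Odd M) (h1 : M ≠ 1) (hsq : Squarefree M) :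
    (classUnit K J hJ).ker.map (ambiguousClasses J).subtype ≤
      (ClassGroup.extendedHom (𝓞 (𝐑 K)) (𝓞 K)).range := by
  rintro _ ⟨x, hx, rfl⟩
  obtain ⟨I, hI⟩ := ClassGroup.mk0_surjective (x : ClassGroup (𝓞 K))
  have hc := conjRingEquiv_conjRingEquiv K
  have hI0 : (I : Ideal (𝓞 K)) ≠ ⊥ := nonZeroDivisors.coe_ne_zero I
  obtain ⟨u, hu⟩ := exists_ambiguousIdeal_of_fixed J hJ hc I (by rw [hI]; exact x.2)
  have hθ := ambiguousUnit_eq J hJ hc x I hI hu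
  have hx' : classUnit K J hJ x = 1 := hx
  rw [hx', eq_comm, QuotientGroup.eq_one_iff] at hθ
  obtain ⟨g, hg, hinv⟩ := hu.exists_invariant hc hθ
  have hg0 : span {g} * (I : Ideal (𝓞 K)) ≠ ⊥ := mul_ne_zero (by simpa using hg) hI0
  obtain ⟨f, hf, A, hA⟩ := exists_span_mul_map_real M K hodd h1 hsq hg0 hinv
  have hA0 : A ≠ ⊥ := by
    rintro rfl
    rw [Ideal.map_bot, mul_bot] at hA
    exact hg0 hA
  refine ⟨ClassGroup.mk0 ⟨A, mem_nonZeroDivisors_of_ne_zero hA0⟩, ?_⟩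
  rw [ClassGroup.extendedHom_mk0]
  change _ = (x : ClassGroup (𝓞 K))
  rw [← hI, ClassGroup.mk0_eq_mk0_iff]
  exact ⟨f, g, hf, hg, hA.symm⟩

/-- If conjugation acts trivially on the class group, the relative class number divides the
number of classes modulo squares of any group of real units containing the relative norms. -/
theorem classNumber_dvd_of_forall_eq (hJ : IsClassAction (conjRingEquiv K) J) (hodd : Odd M)
    (h1 : M ≠ 1) (hsq : Squarefree M)
    (h : ∀ x, J x = x) (P : Subgroup (𝓞 (𝐑 K))ˣ)
    (hP : ∀ v : (𝓞 (𝐑 K))ˣ, (∃ a b : 𝓞 K, a ≠ 0 ∧ b ≠ 0 ∧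
      a * conjRingEquiv K a = algebraMap _ (𝓞 K) (v : 𝓞 (𝐑 K)) *
        (b * conjRingEquiv K b)) → v ∈ P) :
    classNumber K ∣ classNumber (𝐑 K) *
      (powMonoidHom 2 : (𝓞 (𝐑 K))ˣ →* _).range.relIndex P := by
  have hc := conjRingEquiv_conjRingEquiv K
  set θ := classUnit K J hJ with hθ
  let ψ : (𝓞 (𝐑 K))ˣ →* (𝓞 K)ˣ ⧸ (unitNorm (conjRingEquiv K)).range :=
    (QuotientGroup.mk' _).comp (Units.map (algebraMap (𝓞 (𝐑 K)) (𝓞 K)))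
  have hrange : θ.range ≤ P.map ψ := by
    rintro _ ⟨x, rfl⟩
    obtain ⟨I, hI⟩ := ClassGroup.mk0_surjective (x : ClassGroup (𝓞 K))
    obtain ⟨u, hu⟩ := exists_ambiguousIdeal_of_fixed J hJ hc I (by rw [hI]; exact x.2)
    rw [hθ, ambiguousUnit_eq J hJ hc x I hI hu]
    obtain ⟨a, b, ha, hb, h2, h3⟩ := hu
    have hu' : conjRingEquiv K u = u := by
      have h4 := congrArg (conjRingEquiv K) h3
      simp only [map_mul, hc] at h4
      have hb' : b * conjRingEquiv K b ≠ 0 :=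
        mul_ne_zero hb ((map_ne_zero_iff _ (conjRingEquiv K).injective).2 hb)
      refine mul_right_cancel₀ hb' ?_
      linear_combination h3 - h4
    have hu'' : unitsComplexConj K u = u := Units.ext hu'
    obtain ⟨v, hv⟩ := (mem_realUnits_iff K u).1 ((unitsComplexConj_eq_self_iff K u).1 hu'')
    refine ⟨v, hP v ⟨a, b, ha, hb, by rw [hv]; exact h3⟩, ?_⟩
    exact congrArg QuotientGroup.mk (Units.ext hv)
  have hsqker : (powMonoidHom 2 : (𝓞 (𝐑 K))ˣ →* _).range ≤ ψ.ker := by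
    rintro _ ⟨v, rfl⟩
    rw [MonoidHom.mem_ker]
    refine (QuotientGroup.eq_one_iff _).2 ⟨Units.map (algebraMap (𝓞 (𝐑 K)) (𝓞 K)).toMonoidHom v, ?_⟩
    refine Units.ext ?_
    change algebraMap _ (𝓞 K) (v : 𝓞 (𝐑 K)) *
      conjRingEquiv K (algebraMap _ (𝓞 K) (v : 𝓞 (𝐑 K))) =
      algebraMap _ (𝓞 K) ((v : 𝓞 (𝐑 K)) ^ 2)
    rw [conjRingEquiv_algebraMap, map_pow, sq]
  have hcard1 : Nat.card θ.range ∣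
      (powMonoidHom 2 : (𝓞 (𝐑 K))ˣ →* _).range.relIndex P := by
    refine (Subgroup.card_dvd_of_le hrange).trans ?_
    have : Nat.card (P.map ψ) = ψ.ker.relIndex P := by
      rw [Subgroup.relIndex_ker]
    rw [this]
    exact Subgroup.relIndex_dvd_of_le_left _ hsqker
  have htop : ambiguousClasses J = ⊤ := by
    rw [Subgroup.eq_top_iff']
    exact fun x ↦ h x
  have hcard2 : Nat.card θ.ker ∣ classNumber (𝐑 K) := by
    rw [← Subgroup.card_map_of_injective (ambiguousClasses J).subtype_injective]
    refine (Subgroup.card_dvd_of_le (ker_classUnit_le M K J hJ hodd h1 hsq)).trans ?_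
    rw [classNumber, ← Nat.card_eq_fintype_card]
    exact Subgroup.card_range_dvd _
  have hcard3 : classNumber K = Nat.card θ.ker * Nat.card θ.range := by
    rw [classNumber, ← Nat.card_eq_fintype_card, ← Subgroup.card_top, ← htop,
      ← Subgroup.index_ker, Subgroup.card_mul_index]
  rw [hcard3]
  exact mul_dvd_mul hcard2 hcard1

theorem classNumber_dvd_mul_two_pow (hJ : IsClassAction (conjRingEquiv K) J) (hodd : Odd M)
    (h1 : M ≠ 1) (hsq : Squarefree M)
    (h : ∀ x, J x = x) :
    classNumber K ∣ classNumber (𝐑 K) *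
      2 ^ Module.finrank ℚ (𝐑 K) := by
  refine (classNumber_dvd_of_forall_eq M K J hJ hodd h1 hsq h ⊤ fun v _ ↦ Subgroup.mem_top v).trans
    (mul_dvd_mul_left _ ?_)
  rw [Subgroup.relIndex_top_right]
  exact index_range_pow_two_units_dvd _

/-- If the ambiguous classes outnumber the class group, conjugation acts trivially. -/
theorem forall_eq_of_classNumber_le (hJ : IsClassAction (conjRingEquiv K) J) (hodd : Odd M)
    (h1 : M ≠ 1) (hsq : Squarefree M)
    (S : Finset (𝓞 K)ˣ)
    (hS : ∀ u ∈ S, ∃ β b : 𝓞 K, β ≠ 0 ∧ b ≠ 0 ∧ conjRingEquiv K b = b ∧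
      β * conjRingEquiv K β = u * b ^ 2)
    (hS' : ∀ u ∈ S, ∀ v ∈ S, u * v⁻¹ ∈ (unitNorm (conjRingEquiv K)).range → u = v)
    (h : classNumber K ≤ classNumber (𝐑 K) * S.card) (x : ClassGroup (𝓞 K)) :
    J x = x := by
  classical
  have hc := conjRingEquiv_conjRingEquiv K
  set θ := classUnit K J hJ with hθ
  have hmem : ∀ u ∈ S, (QuotientGroup.mk u : (𝓞 K)ˣ ⧸ (unitNorm (conjRingEquiv K)).range) ∈
      θ.range := by
    intro u hu
    obtain ⟨β, b, hβ, hb, hcb, hub⟩ := hS u hu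
    have hI := ambiguousIdeal_of_mul_conj hβ hb hcb hub
    have h0 : span {b, β} ≠ ⊥ := fun h0 ↦ hb (by
      have : b ∈ span {b, β} := subset_span (by simp)
      rwa [h0] at this)
    set I : (Ideal (𝓞 K))⁰ := ⟨span {b, β}, mem_nonZeroDivisors_of_ne_zero h0⟩
    exact ⟨⟨ClassGroup.mk0 I, AmbiguousIdeal.fixed J hJ I hI⟩,
      ambiguousUnit_eq J hJ hc _ I rfl hI⟩
  have hcard1 : S.card ≤ Nat.card θ.range := by
    rw [← Fintype.card_coe, ← Nat.card_eq_fintype_card]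
    have : Finite θ.range := inferInstance
    refine Nat.card_le_card_of_injective (fun u : S ↦ (⟨_, hmem u u.2⟩ : θ.range)) ?_
    intro u v huv
    have h2 := congrArg Subtype.val huv
    symm
    refine Subtype.ext (hS' v v.2 u u.2 ?_)
    have := QuotientGroup.eq.1 h2
    rwa [mul_comm] at this
  have hj : ∀ y, ClassGroup.extendedHom (𝓞 (𝐑 K)) (𝓞 K) y ∈
      θ.ker.map (ambiguousClasses J).subtype := by
    intro y
    obtain ⟨A, rfl⟩ := ClassGroup.mk0_surjective y
    rw [ClassGroup.extendedHom_mk0]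
    set I := ClassGroup.extendedIdeal (𝓞 (𝐑 K)) (𝓞 K) A
    have hI : AmbiguousIdeal (conjRingEquiv K) (I : Ideal (𝓞 K)) 1 := by
      refine ⟨1, 1, one_ne_zero, one_ne_zero, ?_, by simp⟩
      congr 1
      change Ideal.map _ _ = Ideal.map _ (Ideal.map _ _)
      apply le_antisymm
      · rw [map_le_iff_le_comap]
        intro y hy
        rw [mem_comap, ← conjRingEquiv_algebraMap]
        exact mem_map_of_mem _ (mem_map_of_mem _ hy)
      · rw [map_le_iff_le_comap, map_le_iff_le_comap]
        intro y hy
        rw [mem_comap, mem_comap]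
        exact (conjRingEquiv_algebraMap K y).symm ▸ mem_map_of_mem _ hy
    exact ⟨⟨ClassGroup.mk0 I, AmbiguousIdeal.fixed J hJ I hI⟩,
      ambiguousUnit_eq J hJ hc _ I rfl hI, rfl⟩
  have hcard2 : classNumber (𝐑 K) ≤ Nat.card θ.ker := by
    rw [← Subgroup.card_map_of_injective (ambiguousClasses J).subtype_injective,
      classNumber, ← Nat.card_eq_fintype_card]
    exact Nat.card_le_card_of_injective (fun y ↦ (⟨_, hj y⟩ :
      θ.ker.map (ambiguousClasses J).subtype)) fun y z hyz ↦
        extendedHom_real_injective M K hodd h1 hsq (congrArg Subtype.val hyz)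
  have hcard3 : Nat.card (ambiguousClasses J) = Nat.card θ.ker * Nat.card θ.range := by
    rw [← Subgroup.index_ker, Subgroup.card_mul_index]
  have hle : Nat.card (ClassGroup (𝓞 K)) ≤ Nat.card (ambiguousClasses J) := by
    rw [hcard3, Nat.card_eq_fintype_card]
    exact h.trans (Nat.mul_le_mul hcard2 hcard1)
  have htop := Subgroup.eq_top_of_le_card _ hle
  have : x ∈ ambiguousClasses J := htop ▸ Subgroup.mem_top x
  exact this

end Counting

section MeanSquare

open Filter Topology Complex

variable {N : ℕ} [NeZero N]

namespace DirichletCharacter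

theorem tendsto_sum_range_div (χ : 𝐗 N) (hχ : χ ≠ 1) :
    Tendsto (fun X : ℕ ↦ ∑ k ∈ range X, χ (k : ZMod N) / (k : ℂ)) atTop
      (𝓝 (LFunction χ 1)) := by
  rw [← tendsto_add_atTop_iff_nat 1]
  have hsum := (summable_abelSeries (χ.norm_partialSum_le hχ) (s := 1) (by simp)).hasSum
  have h1 := hsum.tendsto_sum_nat
  rw [← abelSeries, ← LFunction_eq_abelSeries χ hχ (by simp)] at h1
  have h2 : Tendsto (fun X : ℕ ↦ χ.partialSum X * ((X + 1 : ℕ) : ℂ) ^ (-1 : ℂ)) atTop (𝓝 0) := by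
    rw [tendsto_zero_iff_norm_tendsto_zero]
    refine squeeze_zero (g := fun X : ℕ ↦ (N : ℝ) * (1 / ((X : ℝ) + 1))) (fun _ ↦ norm_nonneg _)
      (fun X ↦ ?_) (by simpa using tendsto_one_div_add_atTop_nhds_zero_nat.const_mul (N : ℝ))
    rw [norm_mul, cpow_neg_one, norm_inv, norm_natCast, Nat.cast_succ, one_div]
    exact mul_le_mul_of_nonneg_right (χ.norm_partialSum_le hχ X) (by positivity)
  have h3 := h2.add h1
  rw [zero_add] at h3
  refine h3.congr fun X ↦ ?_
  have := sum_abelWeight (fun k ↦ χ (k : ZMod N)) 1 X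
  rw [Finset.sum_range_succ']
  simp only [partialSum]
  rw [← this]
  simp [cpow_neg_one, div_eq_mul_inv]

theorem sum_range_mul_div (χ : 𝐗 N) (X : ℕ) :
    ∑ k ∈ range (X * N), χ (k : ZMod N) / (k : ℂ) =
      ∑ x : ZMod N, χ x * ((∑ j ∈ range X, (1 : ℝ) / (j * N + x.val) : ℝ) : ℂ) := by
  induction X with
  | zero => simp
  | succ X ih =>
    rw [Nat.succ_mul, Finset.sum_range_add, ih]
    simp only [sum_range_succ]
    simp only [ofReal_add, mul_add, sum_add_distrib]
    congr 1
    have := ZMod.sum_range_natCast (N := N) (fun k x ↦ χ x / (((X * N + k : ℕ) : ℂ)))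
    have hk : ∀ k : ℕ, ((X * N + k : ℕ) : ZMod N) = (k : ZMod N) := fun k ↦ by simp
    simp_rw [hk]
    rw [this]
    refine sum_congr rfl fun x _ ↦ ?_
    push_cast
    rw [div_eq_mul_one_div]

/-- **Parseval's identity** for Dirichlet characters. -/
theorem sum_norm_sq_sum_mul (D : ZMod N → ℝ) :
    ∑ χ : 𝐗 N, ‖∑ x, χ x * (D x : ℂ)‖ ^ 2 =
      N.totient * ∑ x : ZMod N with IsUnit x, D x ^ 2 := by
  classical
  have h0 : ∀ χ : 𝐗 N, ∑ x, χ x * (D x : ℂ) =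
      ∑ x : ZMod N with IsUnit x, χ x * (D x : ℂ) := fun χ ↦ by
    rw [Finset.sum_filter]
    refine sum_congr rfl fun x _ ↦ ?_
    split_ifs with h
    · rfl
    · rw [χ.map_nonunit h, zero_mul]
  have hinv : ∀ (χ : 𝐗 N) (x : ZMod N), IsUnit x →
      (starRingEnd ℂ) (χ x) = χ x⁻¹ := by
    intro χ x hx
    rw [starRingEnd_apply, MulChar.star_apply', MulChar.inv_apply]
    obtain ⟨u, rfl⟩ := hx
    rw [Ring.inverse_unit, ZMod.inv_coe_unit]
  rw [← ofReal_inj]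
  push_cast
  have h1 : ∀ χ : 𝐗 N, (‖∑ x, χ x * (D x : ℂ)‖ : ℂ) ^ 2 =
      ∑ x : ZMod N with IsUnit x, ∑ y : ZMod N with IsUnit y,
        (D x : ℂ) * D y * (χ x⁻¹ * χ y) := by
    intro χ
    rw [← conj_mul', h0, map_sum, Finset.sum_mul_sum]
    refine sum_congr rfl fun x hx ↦ sum_congr rfl fun y _ ↦ ?_
    rw [map_mul, hinv χ x (by simpa using hx), conj_ofReal]
    ring
  simp_rw [h1]
  rw [Finset.sum_comm, mul_sum]
  refine sum_congr rfl fun x hx ↦ ?_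
  rw [Finset.sum_comm]
  simp_rw [← mul_sum]
  have hx' : IsUnit x := by simpa using hx
  simp_rw [sum_char_inv_mul_char_eq ℂ hx']
  rw [sum_congr rfl fun y _ ↦ mul_ite _ _ _ _]
  simp only [mul_zero]
  rw [Finset.sum_ite_eq, if_pos hx]
  ring

end DirichletCharacter

/-- The symmetrised, renormalised harmonic sums over residue classes. -/
noncomputable def symHarmonic (N X : ℕ) (v : ℝ) : ℝ :=
  ∑ j ∈ range X, (1 / (j * N + v) + 1 / (j * N + (N - v))) -
    ∑ j ∈ range (X - 1), (1 / ((j + 1) * N) + 1 / ((j + 2) * N) : ℝ)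

theorem symHarmonic_succ {N X : ℕ} {v : ℝ} : symHarmonic N (X + 1) v =
    1 / v + 1 / (N - v) + ∑ j ∈ range X, (1 / ((j + 1) * N + v) + 1 / ((j + 1) * N + (N - v))
      - (1 / ((j + 1) * N) + 1 / ((j + 2) * N)) : ℝ) := by
  rw [symHarmonic, Finset.sum_range_succ', Nat.add_sub_cancel, sum_sub_distrib]
  simp only [Nat.cast_zero, zero_mul, zero_add, Nat.cast_add, Nat.cast_one]
  ring

theorem symHarmonic_le {X : ℕ} {v : ℝ} (h0 : 0 < v) (h1 : v < N) :
    symHarmonic N (X + 1) v ≤ 1 / v + 1 / (N - v) := by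
  have hN : (0 : ℝ) < N := h0.trans h1
  rw [symHarmonic_succ, add_le_iff_nonpos_right]
  refine Finset.sum_nonpos fun j _ ↦ ?_
  set a : ℝ := (j + 1) * N with ha
  have ha0 : 0 < a := by positivity
  rw [show ((j : ℝ) + 2) * N = a + N by rw [ha]; ring]
  rw [sub_nonpos, div_add_div _ _ (by positivity) (by linarith), div_add_div _ _ (by positivity)
    (by positivity), div_le_div_iff₀ (by nlinarith) (by positivity)]
  nlinarith [mul_pos h0 (sub_pos.2 h1), mul_pos (mul_pos h0 (sub_pos.2 h1)) ha0,
    mul_pos (mul_pos h0 (sub_pos.2 h1)) hN]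

theorem symHarmonic_nonneg {X : ℕ} {v : ℝ} (h0 : 0 < v) (h1 : v < N) :
    0 ≤ symHarmonic N (X + 1) v := by
  have hN : (0 : ℝ) < N := h0.trans h1
  rw [symHarmonic_succ]
  have hb : ∀ j : ℕ, (1 / ((j + 2) * N) - 1 / ((j + 1) * N) : ℝ) ≤
      1 / ((j + 1) * N + v) + 1 / ((j + 1) * N + (N - v))
      - (1 / ((j + 1) * N) + 1 / ((j + 2) * N)) := by
    intro j
    have h2 : (1 / ((j + 2) * N) : ℝ) ≤ 1 / ((j + 1) * N + v) :=
      one_div_le_one_div_of_le (by positivity) (by nlinarith)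
    have h3 : (1 / ((j + 2) * N) : ℝ) ≤ 1 / ((j + 1) * N + (N - v)) :=
      one_div_le_one_div_of_le (add_pos (by positivity) (sub_pos.2 h1)) (by nlinarith)
    linarith
  have hs : ∀ X : ℕ, ∑ j ∈ range X, (1 / ((j + 2) * N) - 1 / ((j + 1) * N) : ℝ) =
      1 / ((X + 1) * N) - 1 / N := by
    intro X
    induction X with
    | zero => simp
    | succ X ih =>
      rw [sum_range_succ, ih]
      push_cast
      ring
  have h4 := Finset.sum_le_sum fun j (_ : j ∈ range X) ↦ hb j
  rw [hs] at h4
  have h5 : (1 : ℝ) / N ≤ 1 / v := one_div_le_one_div_of_le h0 h1.le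
  have h6 : (0 : ℝ) ≤ 1 / ((X + 1) * N) := by positivity
  have h7 : (0 : ℝ) ≤ 1 / (N - v) := one_div_nonneg.2 (sub_nonneg.2 h1.le)
  linarith

theorem sum_sq_one_div_add_le (N : ℕ) [NeZero N] :
    ∑ v ∈ range (N - 1), (1 / ((v : ℝ) + 1) + 1 / (N - ((v : ℝ) + 1))) ^ 2 ≤
      2 * (Real.pi ^ 2 / 6) + 4 / N * (1 + Real.log N) := by
  have hN : (0 : ℝ) < N := by exact_mod_cast NeZero.pos N
  have hrefl : ∀ f : ℝ → ℝ, ∑ v ∈ range (N - 1), f (N - ((v : ℝ) + 1)) =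
      ∑ v ∈ range (N - 1), f ((v : ℝ) + 1) := by
    intro f
    rw [← Finset.sum_range_reflect]
    refine sum_congr rfl fun v hv ↦ ?_
    have : v + 1 < N := by have := mem_range.1 hv; omega
    congr 1
    rw [show N - 1 - 1 - v = N - (v + 2) by omega, Nat.cast_sub (by omega)]
    push_cast; ring
  have h1 : ∀ v ∈ range (N - 1), (1 / ((v : ℝ) + 1) + 1 / (N - ((v : ℝ) + 1))) ^ 2 =
      1 / ((v : ℝ) + 1) ^ 2 + 1 / (N - ((v : ℝ) + 1)) ^ 2 +
        2 / N * (1 / ((v : ℝ) + 1) + 1 / (N - ((v : ℝ) + 1))) := by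
    intro v hv
    have h2 : ((v : ℝ) + 1) < N := by
      have := mem_range.1 hv
      have : v + 1 < N := by omega
      exact_mod_cast this
    have h3 : (N - ((v : ℝ) + 1)) ≠ 0 := (sub_pos.2 h2).ne'
    have h4 : (v : ℝ) + 1 ≠ 0 := by positivity
    field_simp
    ring
  rw [sum_congr rfl h1, sum_add_distrib, sum_add_distrib, ← mul_sum,
    sum_add_distrib, hrefl (fun t ↦ 1 / t ^ 2), hrefl (fun t ↦ 1 / t)]
  have h5 : ∑ v ∈ range (N - 1), 1 / ((v : ℝ) + 1) ^ 2 ≤ Real.pi ^ 2 / 6 := by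
    have := hasSum_zeta_two
    rw [← hasSum_nat_add_iff' 1] at this
    simp only [Finset.range_one, Finset.sum_singleton, Nat.cast_zero, ne_eq, OfNat.ofNat_ne_zero,
      not_false_eq_true, zero_pow, div_zero, sub_zero, Nat.cast_add, Nat.cast_one] at this
    exact sum_le_hasSum _ (fun _ _ ↦ by positivity) this
  have h6 : ∑ v ∈ range (N - 1), 1 / ((v : ℝ) + 1) ≤ 1 + Real.log N := by
    have h7 : ∑ v ∈ range (N - 1), 1 / ((v : ℝ) + 1) ≤
        ∑ v ∈ range N, 1 / ((v : ℝ) + 1) :=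
      Finset.sum_le_sum_of_subset_of_nonneg (Finset.range_mono (Nat.sub_le _ _))
        fun _ _ _ ↦ by positivity
    refine h7.trans (le_trans (le_of_eq ?_) (harmonic_le_one_add_log N))
    rw [harmonic]
    push_cast
    simp
  have h8 : (0 : ℝ) ≤ 2 / N := by positivity
  have h9 := mul_le_mul_of_nonneg_left h6 h8
  rw [show (4 : ℝ) / N = 2 / N * 2 by ring]
  nlinarith

/-- The mean square of `L(1, χ)` over nontrivial even characters. -/
theorem sum_even_norm_sq_LFunction_one_le (hN : 1 < N) :
    ∑ χ ∈ (univ.filter fun χ : 𝐗 N ↦ χ (-1) = 1).erase 1,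
      ‖DirichletCharacter.LFunction χ 1‖ ^ 2 ≤
      N.totient / 2 * (Real.pi ^ 2 / 6 + 2 / N * (1 + Real.log N)) := by
  classical
  have : Fact (1 < N) := ⟨hN⟩
  set E := (univ.filter fun χ : 𝐗 N ↦ χ (-1) = 1).erase 1 with hE
  have hlim : Tendsto (fun X : ℕ ↦ ∑ χ ∈ E, ‖∑ k ∈ range ((X + 1) * N),
      χ (k : ZMod N) / (k : ℂ)‖ ^ 2) atTop
      (𝓝 (∑ χ ∈ E, ‖DirichletCharacter.LFunction χ 1‖ ^ 2)) := by
    refine tendsto_finsetSum _ fun χ hχ ↦ ?_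
    have hχ1 : χ ≠ 1 := (Finset.mem_erase.1 hχ).1
    refine ((χ.tendsto_sum_range_div hχ1).comp ?_).norm.pow 2
    refine tendsto_atTop_mono (fun X ↦ ?_) tendsto_id
    exact (Nat.le_succ X).trans (Nat.le_mul_of_pos_right _ (by omega))
  refine le_of_tendsto' hlim fun X ↦ ?_
  set D : ZMod N → ℝ := fun x ↦ symHarmonic N (X + 1) x.val with hD
  have hval : ∀ x : ZMod N, IsUnit x → 0 < x.val ∧ x.val < N := by
    intro x hx
    refine ⟨?_, ZMod.val_lt x⟩
    rw [Nat.pos_iff_ne_zero, Ne, ZMod.val_eq_zero]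
    exact hx.ne_zero
  have hkey : ∀ χ ∈ E, ‖∑ k ∈ range ((X + 1) * N), χ (k : ZMod N) / (k : ℂ)‖ ^ 2 =
      ‖∑ x, χ x * (D x : ℂ)‖ ^ 2 / 4 := by
    intro χ hχ
    have hχ1 : χ ≠ 1 := (Finset.mem_erase.1 hχ).1
    have hχe : χ (-1) = 1 := (mem_filter.1 (Finset.mem_erase.1 hχ).2).2
    set c : ZMod N → ℝ := fun x ↦ ∑ j ∈ range (X + 1), (1 : ℝ) / (j * N + x.val) with hc
    have h2 : ∑ x, χ x * (c (-x) : ℂ) = ∑ x, χ x * (c x : ℂ) := by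
      rw [← Equiv.sum_comp (Equiv.neg (ZMod N))]
      refine sum_congr rfl fun x _ ↦ ?_
      rw [Equiv.neg_apply, neg_neg, ← neg_one_mul, map_mul, hχe, one_mul]
    have h3 : ∑ x, χ x * (D x : ℂ) = ∑ x, χ x * ((c x + c (-x) : ℝ) : ℂ) := by
      have h4 : ∀ x, χ x * (D x : ℂ) = χ x * ((c x + c (-x) : ℝ) : ℂ) - χ x *
          ((∑ j ∈ range X, (1 / ((j + 1) * N) + 1 / ((j + 2) * N) : ℝ) : ℝ) : ℂ) := by
        intro x
        by_cases hx : IsUnit x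
        · rw [← mul_sub, ← ofReal_sub]
          congr 2
          simp only [hD, symHarmonic, hc, Nat.add_sub_cancel]
          rw [← sum_add_distrib]
          congr 1
          refine sum_congr rfl fun j _ ↦ ?_
          have hneg : (((-x).val : ℕ) : ℝ) = N - x.val := by
            haveI : NeZero x := ⟨hx.ne_zero⟩
            rw [ZMod.val_neg_of_ne_zero, Nat.cast_sub (ZMod.val_lt x).le]
          rw [hneg]
        · rw [χ.map_nonunit hx]; simp
      simp_rw [h4]
      rw [sum_sub_distrib, ← Finset.sum_mul, χ.sum_eq_zero_of_ne_one hχ1, zero_mul, sub_zero]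
    rw [χ.sum_range_mul_div]
    have h5 : ∑ x, χ x * (D x : ℂ) = 2 * ∑ x, χ x * (c x : ℂ) := by
      rw [h3]
      simp only [ofReal_add, mul_add, sum_add_distrib]
      rw [h2]; ring
    change ‖∑ x, χ x * (c x : ℂ)‖ ^ 2 = _
    rw [h5, norm_mul, mul_pow, Complex.norm_ofNat]
    ring
  rw [sum_congr rfl hkey, ← Finset.sum_div]
  have h6 : ∑ χ ∈ E, ‖∑ x, χ x * (D x : ℂ)‖ ^ 2 ≤
      N.totient * ∑ x : ZMod N with IsUnit x, D x ^ 2 := by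
    rw [← DirichletCharacter.sum_norm_sq_sum_mul]
    exact Finset.sum_le_sum_of_subset_of_nonneg (Finset.subset_univ _) fun _ _ _ ↦ by positivity
  have h7 : ∑ x : ZMod N with IsUnit x, D x ^ 2 ≤
      2 * (Real.pi ^ 2 / 6) + 4 / N * (1 + Real.log N) := by
    refine le_trans ?_ (sum_sq_one_div_add_le N)
    have h8 : ∑ x : ZMod N with IsUnit x, D x ^ 2 ≤ ∑ x : ZMod N with IsUnit x,
        (1 / (x.val : ℝ) + 1 / (N - (x.val : ℝ))) ^ 2 := by
      refine Finset.sum_le_sum fun x hx ↦ ?_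
      obtain ⟨h9, h10⟩ := hval x (by simpa using hx)
      exact pow_le_pow_left₀ (symHarmonic_nonneg (by exact_mod_cast h9) (by exact_mod_cast h10))
        (symHarmonic_le (by exact_mod_cast h9) (by exact_mod_cast h10)) 2
    refine h8.trans ?_
    refine le_of_eq_of_le (b := ∑ v ∈ (univ.filter fun x : ZMod N ↦ IsUnit x).image
      (fun x ↦ (x.val - 1 : ℕ)), (1 / (((v : ℕ) : ℝ) + 1) + 1 / (N - ((v : ℝ) + 1))) ^ 2) ?_ ?_
    · rw [Finset.sum_image]
      · refine sum_congr rfl fun x hx ↦ ?_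
        obtain ⟨h9, h10⟩ := hval x (by simpa using hx)
        rw [Nat.cast_sub h9]; simp
      · intro x hx y hy hxy
        have h9 := hval x (by simpa using hx)
        have h10 := hval y (by simpa using hy)
        exact ZMod.val_injective N (by simp only at hxy; omega)
    · refine Finset.sum_le_sum_of_subset_of_nonneg ?_ fun _ _ _ ↦ by positivity
      intro v hv
      obtain ⟨x, hx, rfl⟩ := Finset.mem_image.1 hv
      have h9 := hval x (by simpa using hx)
      rw [mem_range]; omega
  have h8 : (0 : ℝ) ≤ N.totient := by positivity
  have h9 := mul_le_mul_of_nonneg_left h7 h8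
  rw [show (2 : ℝ) / N = 4 / N / 2 by ring]
  nlinarith

end MeanSquare

section RealResidue

open Filter Topology Complex DirichletCharacter

theorem prod_le_mean_pow {ι : Type*} (s : Finset ι) (f : ι → ℝ) (hf : ∀ i ∈ s, 0 ≤ f i) :
    ∏ i ∈ s, f i ≤ ((∑ i ∈ s, f i) / s.card) ^ s.card := by
  rcases s.eq_empty_or_nonempty with rfl | hs
  · simp
  have hc : 0 < (s.card : ℝ) := by exact_mod_cast hs.card_pos
  have h := Real.geom_mean_le_arith_mean s (fun _ ↦ 1) f (fun _ _ ↦ zero_le_one) (by simpa using hs)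
    hf
  simp only [Real.rpow_one, Finset.sum_const, nsmul_eq_mul, mul_one, one_mul] at h
  have h0 : 0 ≤ ∏ i ∈ s, f i := Finset.prod_nonneg hf
  calc ∏ i ∈ s, f i = ((∏ i ∈ s, f i) ^ (s.card : ℝ)⁻¹) ^ s.card := by
        rw [← Real.rpow_natCast, ← Real.rpow_mul h0, inv_mul_cancel₀ hc.ne', Real.rpow_one]
    _ ≤ _ := pow_le_pow_left₀ (by positivity) h _

theorem half_le_norm_prod_one_sub {n q : ℕ} [NeZero n] (hn : n ≠ 2) (hq : 2 ≤ q)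
    (hqn : q.Coprime n) :
    1 / 2 ≤ ‖∏ χ : 𝐗 n with χ (-1) = 1,
      (1 - χ (q : ZMod n) * (q : ℂ)⁻¹)‖ := by
  have h := prod_one_sub_dirichletCharacter_apply (-1 : ℤˣ) (ZMod.unitOfCoprime q hqn) (q : ℂ)⁻¹
  simp only [Units.val_neg, Units.val_one, Int.cast_neg, Int.cast_one,
    ZMod.coe_unitOfCoprime] at h
  rw [h]
  have hq0 : (0 : ℝ) < q := by exact_mod_cast (by omega : 0 < q)
  set f := orderOf (QuotientGroup.mk (ZMod.unitOfCoprime q hqn) : (ZMod n)ˣ ⧸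
          Subgroup.zpowers (Units.map (Int.castRingHom (ZMod n)).toMonoidHom (-1))) with hf
  set e := Nat.card ((ZMod n)ˣ ⧸
          Subgroup.zpowers (Units.map (Int.castRingHom (ZMod n)).toMonoidHom (-1))) / f with he
  have hfs : signOrder (-1) n q = f := by rw [signOrder, dif_pos hqn]; rfl
  have hes : e = signIndex (-1) n / f := rfl
  have hf0 : f ≠ 0 := hfs ▸ signOrder_ne_zero hqn
  have hnorm : ‖(1 - ((q : ℂ)⁻¹) ^ f) ^ e‖ = (1 - ((q : ℝ) ^ f)⁻¹) ^ e := by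
    rw [norm_pow]
    congr 1
    rw [show (1 - ((q : ℂ)⁻¹) ^ f) = ((1 - ((q : ℝ) ^ f)⁻¹ : ℝ) : ℂ) by push_cast; simp,
      norm_real, Real.norm_eq_abs, abs_of_nonneg]
    rw [sub_nonneg]
    exact inv_le_one_of_one_le₀ (one_le_pow₀ (by exact_mod_cast (by omega : 1 ≤ q)))
  rw [hnorm]
  have hy0 : (0 : ℝ) < (q : ℝ) ^ f := by positivity
  have hq2 : (2 : ℝ) ≤ (q : ℝ) ^ f := by
    have : (2 : ℝ) ≤ q := by exact_mod_cast hq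
    exact this.trans (le_self_pow₀ (by linarith) hf0)
  have hmain : (2 * e : ℝ) ≤ (q : ℝ) ^ f := by
    by_cases hn1 : n = 1
    · have : e ≤ 1 := by
        rw [hes, hn1, signIndex_neg_one_one]; exact Nat.div_le_self _ _
      have : (e : ℝ) ≤ 1 := by exact_mod_cast this
      linarith
    · have hn2 : 2 < n := by have := NeZero.ne n; omega
      have h1 : 2 * e ≤ n - 1 := by
        calc 2 * e ≤ 2 * signIndex (-1) n := Nat.mul_le_mul_left _ (Nat.div_le_self _ _)
          _ = n.totient := two_mul_signIndex_neg_one hn2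
          _ ≤ n - 1 := Nat.le_sub_one_of_lt (Nat.totient_lt n (by omega))
      have h2 : n - 1 ≤ q ^ f := by
        have h3 := (signOrder_dvd_iff (ε := -1) hqn f).1 (hfs ▸ dvd_rfl)
        have h4 : 1 < q ^ f := Nat.one_lt_pow hf0 (by omega)
        rcases h3 with h3 | h3
        · have h5 : ((q ^ f - 1 : ℕ) : ZMod n) = 0 := by
            rw [Nat.cast_sub h4.le]; push_cast; rw [h3]; simp
          have := Nat.le_of_dvd (by omega) ((ZMod.natCast_eq_zero_iff _ _).1 h5)
          omega
        · have h5 : ((q ^ f + 1 : ℕ) : ZMod n) = 0 := by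
            push_cast; rw [h3]; simp
          have := Nat.le_of_dvd (by omega) ((ZMod.natCast_eq_zero_iff _ _).1 h5)
          omega
      exact_mod_cast h1.trans h2
  have hb := one_add_mul_le_pow (a := -((q : ℝ) ^ f)⁻¹) (by
    have : ((q : ℝ) ^ f)⁻¹ ≤ 1 := inv_le_one_of_one_le₀ (by linarith)
    linarith) e
  rw [← sub_eq_add_neg] at hb
  refine le_trans ?_ hb
  have : (e : ℝ) * ((q : ℝ) ^ f)⁻¹ ≤ 1 / 2 := by
    rw [← div_eq_mul_inv, div_le_div_iff₀ hy0 two_pos]; linarith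
  linarith

variable (M : ℕ) [NeZero M] (K : Type*) [Field K] [NumberField K] [IsCyclotomicExtension {M} ℚ K]
  [IsCMField K]

theorem residue_real_le (hodd : Odd M) (h1 : M ≠ 1) (hsq : Squarefree M) :
    dedekindZeta_residue (𝐑 K) ≤
      M * ∏ χ ∈ (univ.filter fun χ : 𝐗 M ↦ χ (-1) = 1).erase 1,
        ‖LFunction χ 1‖ := by
  set E := (univ.filter fun χ : 𝐗 M ↦ χ (-1) = 1).erase 1 with hE
  have h1mem : (1 : 𝐗 M) ∈
      univ.filter fun χ : 𝐗 M ↦ χ (-1) = 1 := by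
    rw [mem_filter]
    exact ⟨mem_univ _, MulChar.one_apply isUnit_one.neg⟩
  have hres := dedekindZeta_residue_eq_prod (𝐑 K)
    (univ.filter fun χ : 𝐗 M ↦ χ (-1) = 1) h1mem
    (fun s hs ↦ dedekindZeta_real M K hodd h1 (fun h ↦ hsq.prime_of_isPrimePow h) hs)
  have hL : ∀ χ ∈ E, LFunction χ 1 = LFunction χ.primitiveCharacter 1 *
      ∏ q ∈ M.primeFactors, (1 - χ.primitiveCharacter q * (q : ℂ)⁻¹) := by
    intro χ hχ
    have hχ1 : χ ≠ 1 := (Finset.mem_erase.1 hχ).1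
    have := LFunction_changeLevel χ.conductor_dvd_level χ.primitiveCharacter (s := 1)
      (Or.inl (primitiveCharacter_ne_one hχ1))
    rw [changeLevel_primitiveCharacter] at this
    rw [this]
    simp [cpow_neg_one]
  have hprod : ‖∏ χ ∈ E, LFunction χ 1‖ = ‖∏ χ ∈ E, LFunction χ.primitiveCharacter 1‖ *
      ∏ q ∈ M.primeFactors, ‖∏ χ ∈ E, (1 - χ.primitiveCharacter q * (q : ℂ)⁻¹)‖ := by
    rw [prod_congr rfl hL, prod_mul_distrib, norm_mul, Finset.prod_comm, norm_prod]
    simp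
  have hq : ∀ q ∈ M.primeFactors, (q : ℝ)⁻¹ ≤
      ‖∏ χ ∈ E, (1 - χ.primitiveCharacter q * (q : ℂ)⁻¹)‖ := by
    intro q hq
    have hqp := Nat.prime_of_mem_primeFactors hq
    have hq2 : (2 : ℝ) ≤ q := by exact_mod_cast hqp.two_le
    obtain ⟨n, hn⟩ := Nat.dvd_of_mem_primeFactors hq
    have hn0 : n ≠ 0 := by rintro rfl; exact NeZero.ne M (by simpa using hn)
    haveI : NeZero n := ⟨hn0⟩
    have hcop : q.Coprime n := by
      rw [hn] at hsq
      exact Nat.coprime_of_squarefree_mul hsq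
    have h2 := prod_one_sub_primitiveCharacter_apply (M := M) (n := n) (Dvd.intro_left q hn.symm)
      hcop (fun d hd hqd ↦ by rw [hn] at hd; exact hqd.symm.dvd_of_dvd_mul_left hd) (-1 : ℤˣ)
      (q : ℂ)⁻¹
    simp only [Units.val_neg, Units.val_one, Int.cast_neg, Int.cast_one] at h2
    have hn2 : n ≠ 2 := by
      rintro rfl
      rw [hn, Nat.odd_mul] at hodd
      exact absurd hodd.2 (by decide)
    have h3 := half_le_norm_prod_one_sub hn2 hqp.two_le hcop
    rw [← h2, ← Finset.mul_prod_erase _ _ h1mem, norm_mul] at h3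
    have h4 : ‖1 - (1 : 𝐗 M).primitiveCharacter q * (q : ℂ)⁻¹‖ ≤ 1 := by
      have h5 : (1 : 𝐗 M).primitiveCharacter q = 1 := by
        have h6 : (1 : 𝐗 M).conductor = 1 := conductor_one
        have h7 : (q : ZMod (1 : 𝐗 M).conductor) = 1 := by
          haveI : Subsingleton (ZMod (1 : 𝐗 M).conductor) := by
            rw [h6]; infer_instance
          exact Subsingleton.elim _ _
        rw [h7, map_one]
      rw [h5, one_mul, show (1 - (q : ℂ)⁻¹) = ((1 - (q : ℝ)⁻¹ : ℝ) : ℂ) by push_cast; rfl,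
        norm_real, Real.norm_eq_abs, abs_le]
      have h8 : (q : ℝ)⁻¹ ≤ 1 := inv_le_one_of_one_le₀ (by linarith)
      have h9 : (0 : ℝ) ≤ (q : ℝ)⁻¹ := by positivity
      constructor <;> linarith
    have h5 : (q : ℝ)⁻¹ ≤ 1 / 2 := by
      rw [← one_div]; exact one_div_le_one_div_of_le two_pos hq2
    refine h5.trans (h3.trans ?_)
    exact mul_le_of_le_one_left (norm_nonneg _) h4
  have hMinv : ∏ q ∈ M.primeFactors, (q : ℝ)⁻¹ = (M : ℝ)⁻¹ := by
    rw [Finset.prod_inv_distrib, ← Nat.cast_prod, Nat.prod_primeFactors_of_squarefree hsq]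
  have hle := Finset.prod_le_prod (fun q _ ↦ by positivity) hq
  rw [hMinv] at hle
  have hM0 : (0 : ℝ) < M := by exact_mod_cast NeZero.pos M
  rw [← norm_prod, hprod, ← hres]
  have hpos : 0 < dedekindZeta_residue (𝐑 K) := dedekindZeta_residue_pos _
  rw [norm_real, Real.norm_of_nonneg hpos.le]
  calc dedekindZeta_residue (𝐑 K) =
      M * (dedekindZeta_residue (𝐑 K) * (M : ℝ)⁻¹) := by
        field_simp
    _ ≤ _ := by gcongr

theorem residue_real_sq_le (hodd : Odd M) (h1 : M ≠ 1) (hsq : Squarefree M) :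
    dedekindZeta_residue (𝐑 K) ^ 2 ≤
      3 * M ^ 2 * (Real.pi ^ 2 / 6 + 2 / M * (1 + Real.log M)) ^
        (Module.finrank ℚ (𝐑 K)) := by
  have hM1 : 1 < M := by have := NeZero.ne M; omega
  have hle := residue_real_le M K hodd h1 hsq
  have hms := sum_even_norm_sq_LFunction_one_le hM1
  have hn := two_mul_finrank_real M K
  set E := (univ.filter fun χ : 𝐗 M ↦ χ (-1) = 1).erase 1 with hE
  set n := Module.finrank ℚ (𝐑 K) with hnn
  set m := Real.pi ^ 2 / 6 + 2 / M * (1 + Real.log M) with hm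
  have hm1 : 1 ≤ m := by
    have h2 : (1 : ℝ) ≤ Real.pi ^ 2 / 6 := by nlinarith [Real.pi_gt_three]
    have h3 : 0 ≤ Real.log M := Real.log_natCast_nonneg M
    have : 0 ≤ 2 / M * (1 + Real.log M) := by positivity
    linarith
  have hcard : E.card + 1 = n := by
    have hM2 : 2 < M := by
      rcases Nat.lt_or_ge 2 M with h | h
      · exact h
      · have : M = 2 := by omega
        rw [this] at hodd
        exact absurd hodd (by decide)
    have h2 := card_odd_characters hM2
    have h3 := Finset.card_filter_add_card_filter_not (s := univ)
      (fun χ : 𝐗 M ↦ χ (-1) = 1)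
    have h4 : (univ.filter fun χ : 𝐗 M ↦ ¬ χ (-1) = 1) =
        univ.filter fun χ : 𝐗 M ↦ χ (-1) = -1 := by
      ext χ
      simp only [mem_filter, mem_univ, true_and]
      rcases χ.apply_neg_one_eq with h | h <;> rw [h] <;> norm_num
    have h5 : (1 : 𝐗 M) ∈
        univ.filter fun χ : 𝐗 M ↦ χ (-1) = 1 := by
      rw [mem_filter]
      exact ⟨mem_univ _, MulChar.one_apply isUnit_one.neg⟩
    rw [h4, Finset.card_univ, ← Nat.card_eq_fintype_card,
      DirichletCharacter.card_eq_totient_of_hasEnoughRootsOfUnity] at h3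
    have h6 := Finset.card_erase_add_one h5
    rw [← hE] at h6
    omega
  have hpos : 0 < dedekindZeta_residue (𝐑 K) := dedekindZeta_residue_pos _
  have h2 : (∏ χ ∈ E, ‖LFunction χ 1‖) ^ 2 ≤ 3 * m ^ n := by
    rw [← Finset.prod_pow]
    refine (prod_le_mean_pow E _ fun _ _ ↦ by positivity).trans ?_
    have hn0 : (M.totient : ℝ) / 2 = E.card + 1 := by
      rw [← hn, ← hcard]; push_cast; ring
    rw [hn0] at hms
    rcases Nat.eq_zero_or_pos E.card with hc | hc
    · rw [hc, pow_zero]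
      have := one_le_pow₀ (n := n) hm1
      linarith
    · have hc' : (0 : ℝ) < E.card := by exact_mod_cast hc
      calc _ ≤ ((E.card + 1) * m / E.card) ^ E.card := by gcongr
        _ = (1 + 1 / (E.card : ℝ)) ^ E.card * m ^ E.card := by
          rw [← mul_pow]; congr 1; field_simp
        _ ≤ 3 * m ^ n := by
          gcongr
          · have h3 : (1 + 1 / (E.card : ℝ)) ≤ Real.exp (1 / E.card) := by
              rw [add_comm]; exact Real.add_one_le_exp _
            calc _ ≤ Real.exp (1 / E.card) ^ E.card := by gcongr
              _ = Real.exp 1 := by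
                rw [← Real.exp_nat_mul]; congr 1; field_simp
              _ ≤ 3 := by linarith [Real.exp_one_lt_d9]
          · omega
  calc _ ≤ (M * ∏ χ ∈ E, ‖LFunction χ 1‖) ^ 2 := pow_le_pow_left₀ hpos.le hle 2
    _ = M ^ 2 * (∏ χ ∈ E, ‖LFunction χ 1‖) ^ 2 := by ring
    _ ≤ M ^ 2 * (3 * m ^ n) := by gcongr
    _ = _ := by ring

end RealResidue

section QuadraticLowerBound

open Filter Topology Complex

theorem one_div_sub_one_div_exp_sub_one_nonneg {t : ℝ} (ht : 0 < t) :
    0 ≤ 1 / t - 1 / (Real.exp t - 1) := by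
  rw [sub_nonneg]
  exact one_div_le_one_div_of_le ht (by linarith [Real.add_one_le_exp t])

theorem one_div_sub_one_div_exp_sub_one_le_one {t : ℝ} (ht : 0 < t) :
    1 / t - 1 / (Real.exp t - 1) ≤ 1 := by
  have h1 : 0 < Real.exp t - 1 := by linarith [Real.add_one_lt_exp ht.ne']
  have h2 : 1 - t ≤ (Real.exp t)⁻¹ := by
    rw [← Real.exp_neg]; linarith [Real.add_one_le_exp (-t)]
  have h3 : (1 - t) * Real.exp t ≤ 1 := by
    have := mul_le_mul_of_nonneg_right h2 (Real.exp_pos t).le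
    rwa [inv_mul_cancel₀ (Real.exp_pos t).ne'] at this
  rw [div_sub_div _ _ ht.ne' h1.ne', div_le_one (by positivity)]
  linarith

theorem antitoneOn_one_div_sub_one_div_exp_sub_one :
    AntitoneOn (fun t : ℝ ↦ 1 / t - 1 / (Real.exp t - 1)) (Set.Ioi 0) := by
  have hpos : ∀ t : ℝ, 0 < t → 0 < Real.exp t - 1 := fun t ht ↦ by
    linarith [Real.add_one_lt_exp ht.ne']
  have hderiv : ∀ t : ℝ, 0 < t → HasDerivAt (fun t : ℝ ↦ 1 / t - 1 / (Real.exp t - 1))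
      (-(t ^ 2)⁻¹ - -(Real.exp t / (Real.exp t - 1) ^ 2)) t := by
    intro t ht
    have h1 := hasDerivAt_inv ht.ne'
    have h2 := ((Real.hasDerivAt_exp t).sub_const 1).inv (hpos t ht).ne'
    simp only [one_div]
    convert! h1.sub h2 using 1
    ring
  refine antitoneOn_of_deriv_nonpos (convex_Ioi 0)
    (fun t ht ↦ (hderiv t ht).continuousAt.continuousWithinAt)
    (fun t ht ↦ (hderiv t (interior_subset ht)).differentiableAt.differentiableWithinAt)
    fun t ht ↦ ?_
  have ht0 : 0 < t := interior_subset ht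
  rw [(hderiv t ht0).deriv]
  have h1 : t / 2 ≤ Real.sinh (t / 2) := Real.self_le_sinh_iff.2 (by positivity)
  rw [Real.sinh_eq] at h1
  have h2 : t * Real.exp (t / 2) ≤ Real.exp t - 1 := by
    have h3 := mul_le_mul_of_nonneg_right h1 (Real.exp_pos (t / 2)).le
    have h4 : Real.exp (-(t / 2)) * Real.exp (t / 2) = 1 := by rw [← Real.exp_add]; simp
    have h5 : Real.exp (t / 2) * Real.exp (t / 2) = Real.exp t := by rw [← Real.exp_add]; ring_nf
    nlinarith
  have h6 : t ^ 2 * Real.exp t ≤ (Real.exp t - 1) ^ 2 := by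
    have h5 : Real.exp (t / 2) ^ 2 = Real.exp t := by rw [sq, ← Real.exp_add]; ring_nf
    calc t ^ 2 * Real.exp t = (t * Real.exp (t / 2)) ^ 2 := by rw [mul_pow, h5]
      _ ≤ _ := pow_le_pow_left₀ (by positivity) h2 2
  have h7 : Real.exp t / (Real.exp t - 1) ^ 2 ≤ (t ^ 2)⁻¹ := by
    rw [inv_eq_one_div, div_le_div_iff₀ (by have := hpos t ht0; positivity) (by positivity)]
    linarith
  linarith

variable {N : ℕ} [NeZero N]

namespace DirichletCharacter

open scoped ComplexOrder in
theorem one_le_zetaMul_sq {χ : 𝐗 N} (hχ : χ ^ 2 = 1) {m : ℕ} (hm : m ≠ 0) :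
    1 ≤ zetaMul χ (m ^ 2) := by
  have hpp : ∀ p : ℕ, p.Prime → ∀ k : ℕ, 1 ≤ zetaMul χ (p ^ (2 * k)) := by
    intro p hp k
    have hs : zetaMul χ (p ^ (2 * k)) = ∑ i ∈ range (2 * k + 1), χ p ^ i := by
      rw [zetaMul, ArithmeticFunction.coe_zeta_mul_apply, Nat.sum_divisors_prime_pow hp]
      refine sum_congr rfl fun i _ ↦ ?_
      have h0 : toArithmeticFunction (χ ·) (p ^ i) =
          if p ^ i = 0 then 0 else χ ((p ^ i : ℕ) : ZMod N) := rfl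
      rw [h0, if_neg (pow_ne_zero _ hp.ne_zero), Nat.cast_pow, map_pow]
    rw [hs]
    rcases MulChar.isQuadratic_iff_sq_eq_one.mpr hχ p with h | h | h
    · rw [h, Finset.sum_range_succ']
      simp
    · simp only [h, one_pow, Finset.sum_const, Finset.card_range, nsmul_eq_mul, mul_one]
      push_cast
      have : (0 : ℂ) ≤ 2 * k := by positivity
      simpa using this
    · rw [h, neg_one_geom_sum, if_neg (by simp)]
  rw [χ.isMultiplicative_zetaMul.multiplicative_factorization _ (pow_ne_zero 2 hm)]
  rw [Finsupp.prod]
  calc (1 : ℂ) = ∏ p ∈ (m ^ 2).factorization.support, 1 := by simp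
    _ ≤ _ := Finset.prod_le_prod (fun _ _ ↦ zero_le_one) fun p hp ↦ by
      have hp' : p.Prime := Nat.prime_of_mem_primeFactors hp
      rw [Nat.factorization_pow, Finsupp.smul_apply, smul_eq_mul]
      exact hpp p hp' _

theorem hasSum_lambert (χ : 𝐗 N) {q : ℝ} (h0 : 0 ≤ q) (h1 : q < 1) :
    ∃ T : ℂ, HasSum (fun k : ℕ ↦ χ ((k + 1 : ℕ) : ZMod N) * ((q ^ (k + 1) / (1 - q ^ (k + 1)) : ℝ) : ℂ))
      T ∧ HasSum (fun n : ℕ+ ↦ zetaMul χ n * (q : ℂ) ^ (n : ℕ)) T := by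
  have hq : ‖(q : ℂ)‖ < 1 := by rwa [norm_real, Real.norm_of_nonneg h0]
  set f : ℕ+ × ℕ+ → ℂ := fun c ↦ χ ((c.2 : ℕ) : ZMod N) * (q : ℂ) ^ (c.1 * c.2 : ℕ) with hf
  have hsum : Summable f := by
    have h2 := (summable_prod_mul_pow 0 hq).norm
    refine Summable.of_norm_bounded h2 fun c ↦ ?_
    simp only [hf, pow_zero, one_mul, norm_mul]
    exact mul_le_of_le_one_left (norm_nonneg _) (χ.norm_le_one _)
  refine ⟨∑' c, f c, ?_, ?_⟩
  · have h2 : HasSum (f ∘ Prod.swap) (∑' c, f c) := (Equiv.prodComm ℕ+ ℕ+).hasSum_iff.2 hsum.hasSum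
    have h3 : ∀ d : ℕ+, HasSum (fun k : ℕ+ ↦ (f ∘ Prod.swap) (d, k))
        (χ ((d : ℕ) : ZMod N) * ((q ^ (d : ℕ) / (1 - q ^ (d : ℕ)) : ℝ) : ℂ)) := by
      intro d
      have hd : q ^ (d : ℕ) < 1 := pow_lt_one₀ h0 h1 d.ne_zero
      have h4 := (hasSum_geometric_of_lt_one (pow_nonneg h0 _) hd).mul_left (q ^ (d : ℕ))
      rw [← div_eq_mul_inv] at h4
      have h5 := (hasSum_ofReal.2 h4).mul_left (χ ((d : ℕ) : ZMod N))
      rw [← Equiv.pnatEquivNat.hasSum_iff] at h5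
      refine h5.congr_fun fun k ↦ ?_
      simp only [hf, Function.comp, Prod.swap, Equiv.pnatEquivNat_apply]
      congr 1
      push_cast
      rw [← pow_mul, ← pow_add]
      congr 1
      have := k.natPred_add_one
      nth_rewrite 1 [← this]
      ring
    have h6 := h2.prod_fiberwise h3
    rw [← Equiv.pnatEquivNat.symm.hasSum_iff] at h6
    exact h6
  · have h2 := sigmaAntidiagonalEquivProd.hasSum_iff.2 hsum.hasSum
    refine (h2.sigma fun n ↦ hasSum_fintype _).congr_fun fun n ↦ ?_
    rw [zetaMul, ArithmeticFunction.mul_apply, Finset.sum_mul]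
    rw [← Finset.sum_coe_sort]
    refine sum_congr rfl fun x _ ↦ ?_
    obtain ⟨⟨a, b⟩, hab⟩ := x
    have hab' := Nat.mem_divisorsAntidiagonal.1 hab
    have ha : a ≠ 0 := fun h ↦ hab'.2 (by rw [← hab'.1, h]; simp)
    have hb : b ≠ 0 := fun h ↦ hab'.2 (by rw [← hab'.1, h]; simp)
    simp [hf, sigmaAntidiagonalEquivProd, toArithmeticFunction, ha, hb, divisorsAntidiagonalFactors,
      ← hab'.1]

/-- An effective lower bound for `L(1, χ)` with `χ` quadratic. -/
theorem LFunction_one_ge_of_sq_eq_one {χ : 𝐗 N} (hχ : χ ^ 2 = 1) (hχ1 : χ ≠ 1) :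
    1 / (30 * N) ≤ (LFunction χ 1).re := by
  have hN : (0 : ℝ) < N := by exact_mod_cast NeZero.pos N
  set T0 : ℕ := 6 * N with hT0
  set x : ℝ := (T0 : ℝ) ^ 2 with hx
  have hT0pos : (0 : ℝ) < T0 := by rw [hT0]; push_cast; positivity
  have hx0 : 0 < x := by positivity
  set q : ℝ := Real.exp (-(1 / x)) with hq
  have hq0 : 0 < q := Real.exp_pos _
  have hq1 : q < 1 := by
    rw [hq, ← Real.exp_zero, Real.exp_lt_exp, neg_lt_zero]; positivity
  obtain ⟨T, hT1, hT2⟩ := hasSum_lambert χ hq0.le hq1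
  have hlow : T0 * Real.exp (-1) ≤ T.re := by
    have h1 := hasSum_re hT2
    have hnn : ∀ n : ℕ+, 0 ≤ (zetaMul χ n * (q : ℂ) ^ (n : ℕ)).re := by
      intro n
      rw [← ofReal_pow, re_mul_ofReal]
      exact mul_nonneg (Complex.le_def.1 (zetaMul_nonneg hχ n)).1 (pow_nonneg hq0.le _)
    set S : Finset ℕ+ := (range T0).image fun k ↦ k.succPNat ^ 2 with hS
    have h2 := sum_le_hasSum S (fun n _ ↦ hnn n) h1
    refine le_trans ?_ h2
    rw [hS, Finset.sum_image]
    · calc T0 * Real.exp (-1) = ∑ k ∈ range T0, Real.exp (-1) := by simp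
        _ ≤ _ := Finset.sum_le_sum fun k hk ↦ ?_
      have hk' : (k : ℝ) + 1 ≤ T0 := by exact_mod_cast mem_range.1 hk
      rw [PNat.pow_coe, Nat.succPNat_coe, ← ofReal_pow, re_mul_ofReal]
      have h3 : 1 ≤ (zetaMul χ ((k + 1) ^ 2)).re := by
        have := (Complex.le_def.1 (one_le_zetaMul_sq hχ k.succ_ne_zero)).1
        simpa using this
      have h4 : Real.exp (-1) ≤ q ^ ((k + 1) ^ 2) := by
        rw [hq, ← Real.exp_nat_mul, Real.exp_le_exp]
        push_cast
        have : ((k : ℝ) + 1) ^ 2 * (1 / x) ≤ 1 := by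
          rw [mul_one_div, div_le_one hx0]
          exact pow_le_pow_left₀ (by positivity) hk' 2
        linarith
      calc Real.exp (-1) = 1 * Real.exp (-1) := (one_mul _).symm
        _ ≤ _ := mul_le_mul h3 h4 (Real.exp_pos _).le (by linarith)
    · intro a _ b _ hab
      have := congrArg PNat.val hab
      simp only [PNat.pow_coe, Nat.succPNat_coe] at this
      have := Nat.pow_left_injective two_ne_zero this
      omega
  set w : ℕ → ℝ := fun k ↦ 1 / (((k : ℝ) + 1) / x) - 1 / (Real.exp (((k : ℝ) + 1) / x) - 1) with hw
  have hwanti : Antitone w := by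
    intro a b hab
    refine antitoneOn_one_div_sub_one_div_exp_sub_one (Set.mem_Ioi.2 (by positivity))
      (Set.mem_Ioi.2 (by positivity)) ?_
    gcongr
  have hw0 : ∀ k, 0 ≤ w k := fun k ↦ one_div_sub_one_div_exp_sub_one_nonneg (by positivity)
  have hw1 : w 0 ≤ 1 := one_div_sub_one_div_exp_sub_one_le_one (by positivity)
  have hbound : ∀ D, ‖∑ k ∈ range D, χ ((k + 1 : ℕ) : ZMod N) * (w k : ℂ)‖ ≤ N := by
    intro D
    refine (sum_mul_antitone_bound (T := χ.partialSum) (fun n ↦ rfl) (χ.norm_partialSum_le hχ1)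
      hwanti hw0 D).trans ?_
    exact mul_le_of_le_one_right hN.le hw1
  have hlim1 := hT1.tendsto_sum_nat
  have hlim2 := (χ.tendsto_sum_range_div hχ1).const_mul (x : ℂ)
  rw [← tendsto_add_atTop_iff_nat 1] at hlim2
  have hlim := (hlim2.sub hlim1).norm
  have hle : ‖x * LFunction χ 1 - T‖ ≤ N := by
    refine le_of_tendsto' hlim fun D ↦ ?_
    refine le_of_eq_of_le ?_ (hbound D)
    congr 1
    rw [Finset.sum_range_succ', Nat.cast_zero, Nat.cast_zero, div_zero, add_zero, mul_sum,
      ← sum_sub_distrib]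
    refine sum_congr rfl fun k _ ↦ ?_
    have hqk : q ^ (k + 1) / (1 - q ^ (k + 1)) = 1 / (Real.exp (((k : ℝ) + 1) / x) - 1) := by
      have h1 : q ^ (k + 1) = (Real.exp (((k : ℝ) + 1) / x))⁻¹ := by
        rw [hq, ← Real.exp_nat_mul, ← Real.exp_neg]
        congr 1
        push_cast; ring
      have h2 := Real.exp_pos (((k : ℝ) + 1) / x)
      have h3 : Real.exp (((k : ℝ) + 1) / x) - 1 ≠ 0 := by
        have := Real.add_one_lt_exp (x := ((k : ℝ) + 1) / x) (by positivity)
        have h4 : 0 < ((k : ℝ) + 1) / x := by positivity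
        linarith
      rw [h1]
      field_simp
    rw [hqk, hw]
    push_cast
    rw [one_div_div]
    ring
  have hre := (abs_le.1 ((abs_re_le_norm _).trans hle)).1
  rw [sub_re, re_ofReal_mul] at hre
  have he : (3678 : ℝ) / 10000 ≤ Real.exp (-1) := by
    rw [Real.exp_neg, le_inv_comm₀ (by norm_num) (Real.exp_pos _)]
    linarith [Real.exp_one_lt_d9]
  have h8 : 6 * (N : ℝ) * (3678 / 10000) ≤ T.re := by
    refine le_trans ?_ hlow
    rw [hT0]; push_cast
    gcongr
  have h9 : x = 36 * (N : ℝ) ^ 2 := by rw [hx, hT0]; push_cast; ring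
  rw [h9] at hre
  rw [div_le_iff₀ (by positivity)]
  have h10 : (12 : ℝ) / 10 * N ≤ 36 * (N : ℝ) ^ 2 * (LFunction χ 1).re := by linarith
  have h11 : (12 : ℝ) / 10 ≤ 36 * (N : ℝ) * (LFunction χ 1).re := by
    refine le_of_mul_le_mul_right ?_ hN
    linarith
  linarith

end DirichletCharacter

end QuadraticLowerBound

section Estermann

open Filter Topology Complex Metric

open scoped ComplexOrder in
theorem one_le_LSeries_two_re {a : ℕ → ℂ} (ha : 0 ≤ a) (ha1 : a 1 = 1)
    (hs : LSeriesSummable a 2) : 1 ≤ (LSeries a 2).re := by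
  have h1 := hasSum_re hs.LSeriesHasSum
  have hnn : ∀ n, 0 ≤ (LSeries.term a 2 n).re := fun n ↦ by
    rw [LSeries.term_def]
    split_ifs with hn
    · simp
    · have h2 : ((n : ℂ) ^ (2 : ℂ)) = (((n : ℝ) ^ 2 : ℝ) : ℂ) := by
        rw [show (2 : ℂ) = ((2 : ℕ) : ℂ) by norm_num, cpow_natCast]; push_cast; rfl
      rw [h2, div_ofReal_re]
      exact div_nonneg (Complex.le_def.1 (ha n)).1 (by positivity)
  have h2 := le_hasSum h1 1 fun n _ ↦ hnn n
  simpa [LSeries.term_def, ha1] using h2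

open scoped ComplexOrder in
/-- **Estermann's lemma**: a Dirichlet series with nonnegative coefficients which is nonpositive
at a point `β < 1` close to `1` has a large residue at `1`. -/
theorem residue_ge_of_nonneg {a : ℕ → ℂ} (ha : 0 ≤ a) (ha1 : a 1 = 1)
    (habs : LSeries.abscissaOfAbsConv a ≤ 1) {P : ℂ → ℂ} (hP : Differentiable ℂ P)
    (hPa : ∀ s : ℂ, 1 < s.re → P s = (s - 1) * LSeries a s) {κ : ℝ} (hκ : P 1 = κ) {B : ℝ}
    (hB : ∀ s ∈ sphere (2 : ℂ) (3 / 2), ‖P s‖ ≤ B) {β : ℝ} (hβ0 : 19 / 20 ≤ β) (hβ1 : β < 1)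
    (hβ : 0 ≤ (P β).re) {N : ℕ} (hN : 4 * B * (7 / 10) ^ N / (3 / 10) ≤ 1 / 2) :
    (1 - β) / 2 ≤ κ * (2 - β) ^ N := by
  have habs2 : LSeries.abscissaOfAbsConv a < (2 : ℂ).re := by
    refine habs.trans_lt ?_
    rw [show (2 : ℂ).re = 2 from rfl]; exact_mod_cast one_lt_two
  have hsum2 : LSeriesSummable a 2 := LSeriesSummable_of_abscissaOfAbsConv_lt_re habs2
  set G := dslope P 1 with hG
  have hGd : Differentiable ℂ G := by
    have := (differentiableOn_dslope (f := P) (c := 1) (s := Set.univ) univ_mem).2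
      hP.differentiableOn
    exact differentiableOn_univ.1 this
  have hκB : ‖(κ : ℂ)‖ ≤ B := by
    rw [← hκ]
    refine Complex.norm_le_of_forall_mem_frontier_norm_le (U := ball (2 : ℂ) (3 / 2)) isBounded_ball
      hP.diffContOnCl (fun z hz ↦ hB z ?_) ?_
    · rwa [frontier_ball _ (by norm_num)] at hz
    · rw [closure_ball _ (by norm_num), mem_closedBall, dist_eq]; norm_num
  have hGs : ∀ s ∈ sphere (2 : ℂ) (3 / 2), ‖G s‖ ≤ 4 * B := by
    intro s hs
    have h1 : 1 / 2 ≤ ‖s - 1‖ := by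
      have h2 : ‖s - 2‖ = 3 / 2 := by rwa [mem_sphere, dist_eq] at hs
      have h3 : ‖s - 2‖ ≤ ‖s - 1‖ + ‖(1 : ℂ)‖ := by
        rw [show s - 2 = (s - 1) - 1 by ring]; exact norm_sub_le _ _
      rw [h2, norm_one] at h3
      linarith
    have h4 := congrArg norm (sub_smul_dslope P 1 s)
    rw [norm_smul, hκ, ← hG] at h4
    have h5 : ‖P s - κ‖ ≤ B + B := (norm_sub_le _ _).trans (add_le_add (hB s hs) hκB)
    nlinarith [norm_nonneg (G s)]
  have hcauchy : ∀ k, ‖iteratedDeriv k G 2‖ ≤ k.factorial * (4 * B) / (3 / 2) ^ k := fun k ↦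
    norm_iteratedDeriv_le_of_forall_mem_sphere_norm_le k (by norm_num) hGd.diffContOnCl hGs
  have hnear : G =ᶠ[𝓝 2] fun s ↦ LSeries a s - κ * (s - 1)⁻¹ := by
    have : {s : ℂ | 1 < s.re} ∈ 𝓝 (2 : ℂ) :=
      (isOpen_lt continuous_const continuous_re).mem_nhds (by norm_num)
    filter_upwards [this] with s hs
    have hs1 : s ≠ 1 := fun h ↦ by rw [h] at hs; simp at hs
    have hs2 : s - 1 ≠ 0 := sub_ne_zero.2 hs1
    rw [hG, dslope_of_ne _ hs1, slope_def_field, hPa s hs, hκ]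
    field_simp
  have hderiv : ∀ k, (-1) ^ k * iteratedDeriv k G 2 =
      (-1) ^ k * iteratedDeriv k (LSeries a) 2 - κ * k.factorial := by
    intro k
    have hinv : ContDiffAt ℂ k (fun s : ℂ ↦ (s - 1)⁻¹) 2 :=
      (contDiffAt_id.sub contDiffAt_const).inv (by norm_num)
    have hL : ContDiffAt ℂ k (LSeries a) 2 := by
      have : AnalyticAt ℂ (LSeries a) 2 :=
        (LSeries_analyticOnNhd a) 2 habs2
      exact this.contDiffAt
    rw [hnear.iteratedDeriv_eq k]
    have h1 : iteratedDeriv k (fun s : ℂ ↦ LSeries a s - κ * (s - 1)⁻¹) 2 =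
        iteratedDeriv k (LSeries a) 2 - iteratedDeriv k (fun s : ℂ ↦ κ * (s - 1)⁻¹) 2 :=
      iteratedDeriv_sub hL (contDiffAt_const.mul hinv)
    have h2 : iteratedDeriv k (fun s : ℂ ↦ (s - 1)⁻¹) 2 = (-1) ^ k * k.factorial := by
      have h3 := congrFun (iteratedDeriv_comp_sub_const k (fun s : ℂ ↦ s⁻¹) 1) 2
      rw [h3]
      rw [show (2 : ℂ) - 1 = 1 by norm_num, iteratedDeriv_eq_iterate]
      have h4 := iter_deriv_inv k (1 : ℂ)
      rw [one_zpow, mul_one] at h4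
      exact h4
    rw [h1, iteratedDeriv_const_mul_field, h2, mul_sub]
    have h5 : ((-1 : ℂ) ^ k) * (-1) ^ k = 1 := by rw [← mul_pow]; simp
    linear_combination -(κ * k.factorial : ℂ) * h5
  set g : ℕ → ℝ := fun k ↦ (((-1) ^ k * iteratedDeriv k G 2).re) / k.factorial with hg
  have hgk : ∀ k, -κ ≤ g k := by
    intro k
    have h1 := LSeries.iteratedDeriv_alternating ha (x := 2) (by simpa using habs2) k
    have h2 := (Complex.le_def.1 h1).1
    rw [hg]
    simp only
    rw [hderiv, le_div_iff₀ (by positivity), sub_re]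
    have h3 : ((κ : ℂ) * (k.factorial : ℂ)).re = κ * k.factorial := by
      rw [re_ofReal_mul, natCast_re]
    rw [h3]
    simp only [zero_re, ofReal_ofNat] at h2
    linarith
  have hg0 : 1 - κ ≤ g 0 := by
    have h1 := hderiv 0
    simp only [pow_zero, one_mul, iteratedDeriv_zero, Nat.factorial_zero, Nat.cast_one,
      mul_one] at h1
    simp only [hg, pow_zero, one_mul, iteratedDeriv_zero, Nat.factorial_zero, Nat.cast_one, div_one]
    rw [h1, sub_re, ofReal_re]
    linarith [one_le_LSeries_two_re ha ha1 hsum2]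
  have hgle : ∀ k, |g k| ≤ 4 * B * (2 / 3) ^ k := by
    intro k
    have h1 : |((-1) ^ k * iteratedDeriv k G 2).re| ≤ ‖iteratedDeriv k G 2‖ := by
      refine (abs_re_le_norm _).trans ?_
      rw [norm_mul, norm_pow]; simp
    rw [hg]
    simp only
    rw [abs_div, Nat.abs_cast, div_le_iff₀ (by positivity)]
    refine (h1.trans (hcauchy k)).trans (le_of_eq ?_)
    rw [div_pow, div_pow]
    field_simp
  have hx1 : (1 : ℝ) < 2 - β := by linarith
  have htaylor : HasSum (fun k ↦ g k * (2 - β) ^ k) ((κ - (P β).re) / (1 - β)) := by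
    have h1 := hasSum_re (hasSum_taylorSeries_of_entire hGd 2 (β : ℂ))
    have hβ' : (β : ℂ) ≠ 1 := by
      rw [Ne, ofReal_eq_one]; exact hβ1.ne
    have h2 : (G β).re = (κ - (P β).re) / (1 - β) := by
      rw [hG, dslope_of_ne _ hβ', slope_def_field, hκ,
        show (β : ℂ) - 1 = ((β - 1 : ℝ) : ℂ) by push_cast; rfl, div_ofReal_re, sub_re, ofReal_re,
        ← neg_sub κ, ← neg_sub 1 β, neg_div_neg_eq]
    rw [h2] at h1
    refine h1.congr_fun fun k ↦ ?_
    have h3 : ((k.factorial : ℂ)⁻¹ • ((β : ℂ) - 2) ^ k • iteratedDeriv k G 2) =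
        (((2 - β) ^ k / k.factorial : ℝ) : ℂ) * ((-1) ^ k * iteratedDeriv k G 2) := by
      rw [show ((β : ℂ) - 2) = (-1) * (2 - β) by ring, mul_pow]
      simp only [smul_eq_mul]
      push_cast
      ring
    rw [h3, re_ofReal_mul, hg]
    ring
  have hratio : ∀ k, |g k * (2 - β) ^ k| ≤ 4 * B * (7 / 10) ^ k := by
    intro k
    have hB0 : 0 ≤ 4 * B := (norm_nonneg _).trans (hGs (2 + 3 / 2) (by simp))
    rw [abs_mul, abs_of_nonneg (by positivity : (0 : ℝ) ≤ (2 - β) ^ k)]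
    calc _ ≤ 4 * B * (2 / 3) ^ k * (21 / 20) ^ k := by
          gcongr
          · exact hgle k
          · linarith
      _ = _ := by rw [mul_assoc, ← mul_pow]; norm_num
  have htail : -(1 / 2) ≤ ∑' k, g (k + N) * (2 - β) ^ (k + N) := by
    have hgeo : HasSum (fun k : ℕ ↦ 4 * B * (7 / 10) ^ N * (7 / 10 : ℝ) ^ k)
        (4 * B * (7 / 10) ^ N * (1 - 7 / 10)⁻¹) :=
      (hasSum_geometric_of_lt_one (by norm_num) (by norm_num)).mul_left _
    have h1 : ‖∑' k, g (k + N) * (2 - β) ^ (k + N)‖ ≤ 4 * B * (7 / 10) ^ N * (1 - 7 / 10)⁻¹ := by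
      refine tsum_of_norm_bounded hgeo fun k ↦ ?_
      rw [Real.norm_eq_abs]
      refine (hratio (k + N)).trans (le_of_eq ?_)
      rw [pow_add]; ring
    have h2 : 4 * B * (7 / 10) ^ N * (1 - 7 / 10 : ℝ)⁻¹ ≤ 1 / 2 := by
      refine le_trans (le_of_eq ?_) hN
      norm_num
      ring
    exact (abs_le.1 (h1.trans h2)).1
  have hsplit := htaylor.summable.sum_add_tsum_nat_add N
  rw [htaylor.tsum_eq] at hsplit
  have hfin : 1 - κ * ∑ k ∈ range N, (2 - β) ^ k ≤
      ∑ k ∈ range N, g k * (2 - β) ^ k ∨ N = 0 := by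
    rcases Nat.eq_zero_or_pos N with h0 | h0
    · exact Or.inr h0
    left
    obtain ⟨n, rfl⟩ : ∃ n, N = n + 1 := ⟨N - 1, by omega⟩
    rw [Finset.sum_range_succ', Finset.sum_range_succ']
    have h1 : ∑ k ∈ range n, -κ * (2 - β) ^ (k + 1) ≤
        ∑ k ∈ range n, g (k + 1) * (2 - β) ^ (k + 1) := by
      refine Finset.sum_le_sum fun k _ ↦ ?_
      exact mul_le_mul_of_nonneg_right (hgk _) (by positivity)
    rw [← mul_sum] at h1
    simp only [pow_zero, mul_one]
    linarith
  have hN0 : N ≠ 0 := by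
    rintro rfl
    have h1 := hκB
    have h2 := hratio 0
    simp only [pow_zero, mul_one] at h2 hN
    have h3 : |κ| ≤ B := by simpa using h1
    have h4 := (abs_le.1 h2).2
    have h5 := (abs_le.1 h3).2
    linarith
  have hfin' := hfin.resolve_right hN0
  rw [geom_sum_eq hx1.ne'] at hfin'
  rw [show (2 : ℝ) - β - 1 = 1 - β by ring] at hfin'
  have h1β : 0 < 1 - β := by linarith
  have hle : 1 - κ * (((2 - β) ^ N - 1) / (1 - β)) - 1 / 2 ≤ κ / (1 - β) := by
    have : (κ - (P β).re) / (1 - β) ≤ κ / (1 - β) := by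
      gcongr; linarith
    linarith
  simp only [div_eq_mul_inv] at hle
  have hinv : (1 - β) * (1 - β)⁻¹ = 1 := mul_inv_cancel₀ h1β.ne'
  have := mul_le_mul_of_nonneg_left hle h1β.le
  have e1 : (1 - β) * (1 - κ * (((2 - β) ^ N - 1) * (1 - β)⁻¹) - 1 * 2⁻¹) =
      (1 - β) / 2 - κ * ((2 - β) ^ N - 1) := by
    linear_combination (-κ * ((2 - β) ^ N - 1)) * hinv
  have e2 : (1 - β) * (κ * (1 - β)⁻¹) = κ := by linear_combination κ * hinv
  rw [e1, e2] at this
  linarith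

end Estermann

section LFunctionBounds

open Filter Topology Complex Metric

theorem tsum_rpow_neg_le_three {σ : ℝ} (hσ : 1 / 2 ≤ σ) :
    ∑' n : ℕ, ((n + 1 : ℕ) : ℝ) ^ (-(σ + 1)) ≤ 3 := by
  refine (summable_abel_bound (by linarith)).tsum_le_of_sum_range_le fun n ↦ ?_
  have key : ∀ n : ℕ, ∑ k ∈ range (n + 1), ((k + 1 : ℕ) : ℝ) ^ (-(σ + 1)) ≤
      3 - 2 / √(n + 1 : ℕ) := by
    intro n
    induction n with
    | zero => norm_num
    | succ n ih =>
      rw [sum_range_succ]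
      set a := √(n + 1 : ℕ) with ha
      set b := √(n + 1 + 1 : ℕ) with hb
      have ha0 : 0 < a := Real.sqrt_pos.2 (by positivity)
      have hb0 : 0 < b := Real.sqrt_pos.2 (by positivity)
      have ha2 : a ^ 2 = n + 1 := by rw [ha, Real.sq_sqrt (by positivity)]; push_cast; ring
      have hb2 : b ^ 2 = n + 2 := by rw [hb, Real.sq_sqrt (by positivity)]; push_cast; ring
      have hab : a ≤ b := Real.sqrt_le_sqrt (by push_cast; linarith)
      have h1 : ((n + 1 + 1 : ℕ) : ℝ) ^ (-(σ + 1)) ≤ 1 / b ^ 3 := by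
        have : (1 : ℝ) / b ^ 3 = ((n + 1 + 1 : ℕ) : ℝ) ^ (-(3 / 2 : ℝ)) := by
          rw [hb, Real.sqrt_eq_rpow, ← Real.rpow_natCast, ← Real.rpow_mul (by positivity),
            Real.rpow_neg (by positivity), one_div]
          norm_num
        rw [this]
        exact Real.rpow_le_rpow_of_exponent_le (by push_cast; linarith [n.cast_nonneg (α := ℝ)])
          (by linarith)
      have h2 : 1 / b ^ 3 ≤ 2 / a - 2 / b := by
        rw [div_sub_div _ _ ha0.ne' hb0.ne', div_le_div_iff₀ (by positivity) (by positivity)]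
        have h3 : (b - a) * (b + a) = 1 := by linear_combination hb2 - ha2
        have h4 : a * b * (b + a) ≤ 2 * b ^ 3 := by nlinarith [mul_pos ha0 hb0]
        have h5 : 0 < b + a := by positivity
        have h6 : 0 ≤ b - a := by linarith
        have h7 := mul_le_mul_of_nonneg_left h4 h6
        have h8 : (b - a) * (a * b * (b + a)) = a * b := by linear_combination a * b * h3
        linarith
      linarith
  rcases n with _ | n
  · norm_num
  · exact (key n).trans (by linarith [show (0 : ℝ) ≤ 2 / √(n + 1 : ℕ) by positivity])

theorem norm_abelSeries_le_of_half_le_re {S : ℕ → ℂ} {C : ℝ} (hS : ∀ n, ‖S n‖ ≤ C) {s : ℂ}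
    (hs : 1 / 2 ≤ s.re) : ‖abelSeries S s‖ ≤ C * (‖s‖ * 3) := by
  have hC : 0 ≤ C := (norm_nonneg _).trans (hS 0)
  refine (norm_abelSeries_le hS (by linarith)).trans ?_
  gcongr
  exact tsum_rpow_neg_le_three hs

theorem DirichletCharacter.norm_LFunction_le {N : ℕ} [NeZero N] {χ : 𝐗 N}
    (hχ : χ ≠ 1) {s : ℂ} (hs : 1 / 2 ≤ s.re) : ‖LFunction χ s‖ ≤ N * (‖s‖ * 3) := by
  rw [LFunction_eq_abelSeries χ hχ (by linarith)]
  exact norm_abelSeries_le_of_half_le_re (χ.norm_partialSum_le hχ) hs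

theorem DirichletCharacter.norm_LFunction_sub_le {N : ℕ} [NeZero N] {χ : 𝐗 N}
    (hχ : χ ≠ 1) {β : ℝ} (h0 : 19 / 20 ≤ β) (h1 : β ≤ 1) :
    ‖LFunction χ 1 - LFunction χ β‖ ≤ 15 * N * (1 - β) := by
  have hd := differentiable_LFunction hχ
  have hder : ∀ x ∈ Set.Icc β 1, ‖deriv (fun t : ℝ ↦ LFunction χ t) x‖ ≤ 15 * N := by
    intro x hx
    have h2 : HasDerivAt (fun t : ℝ ↦ LFunction χ t) (deriv (LFunction χ) x) x :=
      (hd x).hasDerivAt.comp_ofReal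
    rw [h2.deriv]
    have h3 := norm_deriv_le_of_forall_mem_sphere_norm_le (c := (x : ℂ)) (R := 1 / 4)
      (f := LFunction χ) (C := N * (5 / 4 * 3)) (by norm_num) hd.diffContOnCl fun z hz ↦ ?_
    · exact h3.trans (le_of_eq (by ring))
    · have hz' : ‖z - x‖ = 1 / 4 := by rwa [mem_sphere, dist_eq] at hz
      have hre := (abs_le.1 ((abs_re_le_norm (z - x)).trans hz'.le)).1
      rw [sub_re, ofReal_re] at hre
      refine (norm_LFunction_le hχ (by linarith [hx.1])).trans ?_
      have hnz : ‖z‖ ≤ 5 / 4 := by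
        calc ‖z‖ = ‖(z - x) + x‖ := by rw [sub_add_cancel]
          _ ≤ ‖z - x‖ + ‖(x : ℂ)‖ := norm_add_le _ _
          _ ≤ 1 / 4 + 1 := by
            rw [hz', norm_real, Real.norm_of_nonneg (by linarith [hx.1])]
            linarith [hx.2]
          _ = _ := by norm_num
      gcongr
  have hdiff : ∀ x ∈ Set.Icc β 1, DifferentiableAt ℝ (fun t : ℝ ↦ LFunction χ t) x :=
    fun x _ ↦ (hd x).hasDerivAt.comp_ofReal.differentiableAt
  have := Convex.norm_image_sub_le_of_norm_deriv_le hdiff hder (convex_Icc β 1)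
    (Set.left_mem_Icc.2 h1) (Set.right_mem_Icc.2 h1)
  rw [Real.norm_of_nonneg (by linarith : 0 ≤ 1 - β)] at this
  simpa using this

/-- The coefficients of the Dirichlet eta function. -/
noncomputable def altCoeff (n : ℕ) : ℂ := if 2 ∣ n then -1 else 1

theorem sum_altCoeff (n : ℕ) :
    ∑ k ∈ range n, altCoeff (k + 1) = if 2 ∣ n then 0 else 1 := by
  induction n with
  | zero => simp
  | succ n ih =>
    rw [sum_range_succ, ih, altCoeff]
    by_cases h : 2 ∣ n
    · have : ¬ 2 ∣ n + 1 := by omega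
      simp [h, this]
    · have : 2 ∣ n + 1 := by omega
      simp [h, this]

theorem norm_sum_altCoeff_le (n : ℕ) : ‖∑ k ∈ range n, altCoeff (k + 1)‖ ≤ 1 := by
  rw [sum_altCoeff]
  split_ifs <;> simp

theorem LSeries_altCoeff {s : ℂ} (hs : 1 < s.re) :
    LSeriesSummable altCoeff s ∧ LSeries altCoeff s = (1 - 2 ^ (1 - s)) * riemannZeta s := by
  have hsum : LSeriesSummable 1 s := LSeriesSummable_one_iff.2 hs
  have hone : HasSum (LSeries.term 1 s) (riemannZeta s) := by
    rw [← LSeries_one_eq_riemannZeta hs]; exact hsum.hasSum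
  have hev : HasSum (fun n ↦ if 2 ∣ n then LSeries.term 1 s n else 0)
      (2 ^ (-s) * riemannZeta s) := by
    have hinj : Function.Injective fun n : ℕ ↦ 2 * n := fun a b h ↦ by simpa using h
    rw [← hinj.hasSum_iff]
    · refine HasSum.congr_fun (hone.mul_left ((2 : ℂ) ^ (-s))) fun n ↦ ?_
      simp only [Function.comp_apply, dvd_mul_right, if_true]
      rcases eq_or_ne n 0 with rfl | hn
      · simp
      · rw [LSeries.term_of_ne_zero hn, LSeries.term_of_ne_zero (by omega)]
        push_cast
        rw [show ((2 : ℂ) * n) = ((2 : ℕ) : ℂ) * (n : ℕ) by push_cast; rfl, natCast_mul_natCast_cpow,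
          cpow_neg]
        simp only [Pi.one_apply]
        push_cast
        field_simp
    · intro n hn
      rw [if_neg]
      rintro ⟨k, rfl⟩
      exact hn ⟨k, rfl⟩
  have h2 : HasSum (LSeries.term altCoeff s) (riemannZeta s - 2 * (2 ^ (-s) * riemannZeta s)) := by
    refine HasSum.congr_fun (hone.sub (hev.mul_left 2)) fun n ↦ ?_
    rcases eq_or_ne n 0 with rfl | hn
    · simp
    · rw [LSeries.term_of_ne_zero hn, LSeries.term_of_ne_zero hn, altCoeff]
      split_ifs <;> simp only [Pi.one_apply] <;> ring
  refine ⟨h2.summable, ?_⟩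
  rw [LSeries, h2.tsum_eq, sub_eq_add_neg 1 s, cpow_add _ _ two_ne_zero, cpow_one]
  ring

open DirichletCharacter in
theorem LFunctionTrivChar₁_one_eq {s : ℂ} (hs : s ≠ 1) :
    LFunctionTrivChar₁ 1 s = (s - 1) * riemannZeta s := by
  rw [LFunctionTrivChar₁, Function.update_of_ne hs, LFunctionTrivChar, LFunction_modOne_eq]

open DirichletCharacter in
theorem one_sub_mul_LFunctionTrivChar₁_one {s : ℂ} (hs : 0 < s.re) :
    (1 - 2 ^ (1 - s)) * LFunctionTrivChar₁ 1 s =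
      (s - 1) * abelSeries (fun n ↦ ∑ k ∈ range n, altCoeff (k + 1)) s := by
  have hopen : IsOpen {s : ℂ | 0 < s.re} := isOpen_lt continuous_const continuous_re
  have hd1 : Differentiable ℂ fun s : ℂ ↦ (1 - 2 ^ (1 - s)) * LFunctionTrivChar₁ 1 s := by
    refine Differentiable.mul ?_ (differentiable_LFunctionTrivChar₁ 1)
    exact (differentiable_const _).sub fun s ↦
      ((differentiable_const _).sub differentiable_id s).const_cpow (Or.inl two_ne_zero)
  have h1 : AnalyticOnNhd ℂ (fun s : ℂ ↦ (1 - 2 ^ (1 - s)) * LFunctionTrivChar₁ 1 s)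
      {s | 0 < s.re} := hd1.differentiableOn.analyticOnNhd hopen
  have h2 : AnalyticOnNhd ℂ (fun s ↦ (s - 1) *
      abelSeries (fun n ↦ ∑ k ∈ range n, altCoeff (k + 1)) s) {s | 0 < s.re} := by
    refine DifferentiableOn.analyticOnNhd ?_ hopen
    exact (differentiable_id.sub_const 1).differentiableOn.mul
      (differentiableOn_abelSeries norm_sum_altCoeff_le)
  have hpre : IsPreconnected {s : ℂ | 0 < s.re} := (convex_halfSpace_re_gt 0).isPreconnected
  refine h1.eqOn_of_preconnected_of_eventuallyEq h2 hpre (z₀ := 2) (by simp) ?_ hs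
  filter_upwards [(isOpen_lt continuous_const continuous_re).mem_nhds
    (show (1 : ℝ) < (2 : ℂ).re by simp)] with z hz
  have hz : 1 < z.re := hz
  have hz1 : z ≠ 1 := by rintro rfl; simp at hz
  obtain ⟨h3, h4⟩ := LSeries_altCoeff hz
  rw [← LSeries_eq_abelSeries norm_sum_altCoeff_le (by linarith) h3, h4,
    LFunctionTrivChar₁_one_eq hz1]
  ring

theorem norm_le_norm_exp_sub_one {w : ℂ} (hw : ‖w‖ ≤ 7 / 4) : ‖w‖ ≤ 24 * ‖exp w - 1‖ := by
  set z := w / 2 with hz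
  have hzn : ‖z‖ ≤ 7 / 8 := by rw [hz, norm_div]; norm_num; linarith
  have hwz : w = z + z := by rw [hz]; ring
  have h1 := norm_exp_sub_one_sub_id_le (x := z) (by linarith)
  have h2 := norm_exp_sub_one_sub_id_le (x := -z) (by rw [norm_neg]; linarith)
  have h3 : exp w - 1 = exp z * (2 * z + (exp z - 1 - z) - (exp (-z) - 1 - -z)) := by
    rw [hwz, exp_add]
    have : exp z * exp (-z) = 1 := by rw [← exp_add]; simp
    linear_combination this
  have h4 : 2 * ‖z‖ - ‖z‖ ^ 2 - ‖z‖ ^ 2 ≤ ‖2 * z + (exp z - 1 - z) - (exp (-z) - 1 - -z)‖ := by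
    rw [norm_neg] at h2
    have := norm_sub_norm_le (2 * z) (-(exp z - 1 - z) + (exp (-z) - 1 - -z))
    rw [norm_mul, show ‖(2 : ℂ)‖ = 2 by simp] at this
    have h5 := norm_add_le (-(exp z - 1 - z)) (exp (-z) - 1 - -z)
    rw [norm_neg] at h5
    rw [show 2 * z + (exp z - 1 - z) - (exp (-z) - 1 - -z) =
      2 * z - (-(exp z - 1 - z) + (exp (-z) - 1 - -z)) by ring]
    linarith
  have h5 : 1 / 3 ≤ ‖exp z‖ := by
    rw [norm_exp]
    have : -1 ≤ z.re := by
      have := (abs_le.1 ((abs_re_le_norm z).trans hzn)).1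
      linarith
    refine le_trans ?_ (Real.exp_le_exp.2 this)
    rw [Real.exp_neg, one_div]
    exact inv_anti₀ (Real.exp_pos _) (by linarith [Real.exp_one_lt_d9])
  rw [h3, norm_mul, hwz, ← two_mul, norm_mul, show ‖(2 : ℂ)‖ = 2 by simp]
  have h6 : ‖z‖ / 4 ≤ 2 * ‖z‖ - ‖z‖ ^ 2 - ‖z‖ ^ 2 := by nlinarith [norm_nonneg z]
  have h7 : 0 ≤ ‖z‖ := norm_nonneg z
  calc 2 * ‖z‖ = 24 * (1 / 3 * (‖z‖ / 4)) := by ring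
    _ ≤ _ := by gcongr; linarith

open DirichletCharacter in
theorem norm_LFunctionTrivChar₁_one_le {s : ℂ} (hs : s ∈ sphere (2 : ℂ) (3 / 2)) :
    ‖LFunctionTrivChar₁ 1 s‖ ≤ 504 := by
  have hs' : ‖s - 2‖ = 3 / 2 := by rwa [mem_sphere, dist_eq] at hs
  have hre := (abs_le.1 ((abs_re_le_norm (s - 2)).trans hs'.le)).1
  rw [sub_re, show (2 : ℂ).re = 2 from rfl] at hre
  have hn : ‖s‖ ≤ 7 / 2 := by
    calc ‖s‖ = ‖(s - 2) + 2‖ := by rw [sub_add_cancel]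
      _ ≤ ‖s - 2‖ + ‖(2 : ℂ)‖ := norm_add_le _ _
      _ = 7 / 2 := by rw [hs']; norm_num
  have hn1 : ‖s - 1‖ ≤ 5 / 2 := by
    calc ‖s - 1‖ = ‖(s - 2) + 1‖ := by ring_nf
      _ ≤ ‖s - 2‖ + ‖(1 : ℂ)‖ := norm_add_le _ _
      _ = 5 / 2 := by rw [hs']; norm_num
  have hn2 : 0 < ‖s - 1‖ := by
    rw [norm_pos_iff, sub_ne_zero]
    rintro rfl
    norm_num at hs'
  have hw : ‖(1 - s) * Real.log 2‖ = ‖s - 1‖ * Real.log 2 := by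
    rw [norm_mul, norm_sub_rev, norm_real, Real.norm_of_nonneg (Real.log_nonneg one_le_two)]
  have h2 : (2 : ℂ) ^ (1 - s) = exp ((1 - s) * Real.log 2) := by
    rw [cpow_def_of_ne_zero two_ne_zero, mul_comm, ofReal_log zero_le_two]; push_cast; rfl
  have hl1 := Real.log_two_gt_d9
  have hl2 := Real.log_two_lt_d9
  have h3 := norm_le_norm_exp_sub_one (w := (1 - s) * Real.log 2) (by rw [hw]; nlinarith)
  rw [hw, ← h2, norm_sub_rev (2 ^ (1 - s) : ℂ)] at h3
  have h4 := congrArg norm (one_sub_mul_LFunctionTrivChar₁_one (s := s) (by linarith))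
  rw [norm_mul, norm_mul] at h4
  have h5 := norm_abelSeries_le_of_half_le_re norm_sum_altCoeff_le (s := s) (by linarith)
  set A := ‖abelSeries (fun n ↦ ∑ k ∈ range n, altCoeff (k + 1)) s‖
  set Z := ‖LFunctionTrivChar₁ 1 s‖
  have hZ : 0 ≤ Z := norm_nonneg _
  have h6 : ‖s - 1‖ * (Z / 2) ≤ ‖s - 1‖ * (24 * A) := by
    calc ‖s - 1‖ * (Z / 2) ≤ (‖s - 1‖ * Real.log 2) * Z := by
          nlinarith [mul_nonneg hn2.le hZ]
      _ ≤ 24 * ‖(1 : ℂ) - 2 ^ (1 - s)‖ * Z := by gcongr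
      _ = _ := by rw [mul_assoc, h4]; ring
  have := le_of_mul_le_mul_left h6 hn2
  nlinarith

end LFunctionBounds

section ResidueLowerBound

open Filter Topology Complex Metric DirichletCharacter

open scoped ComplexOrder

theorem Finset.prod_nonneg_of_conj {ι : Type*} [DecidableEq ι] (i : ι → ι) (hi : ∀ x, i (i x) = x)
    (f : ι → ℂ) (s : Finset ι) (hs : ∀ x ∈ s, i x ∈ s)
    (hf : ∀ x ∈ s, f (i x) = starRingEnd ℂ (f x)) (hf0 : ∀ x ∈ s, i x = x → 0 ≤ f x) :
    0 ≤ ∏ x ∈ s, f x := by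
  induction s using Finset.strongInduction with
  | H s ih =>
    rcases s.eq_empty_or_nonempty with rfl | ⟨x, hx⟩
    · simp
    by_cases hix : i x = x
    · rw [← Finset.mul_prod_erase _ _ hx]
      refine mul_nonneg (hf0 x hx hix) (ih _ (Finset.erase_ssubset hx) (fun y hy ↦ ?_)
        (fun y hy ↦ hf y (Finset.mem_of_mem_erase hy))
        (fun y hy ↦ hf0 y (Finset.mem_of_mem_erase hy)))
      rw [Finset.mem_erase] at hy ⊢
      refine ⟨fun h ↦ hy.1 ?_, hs y hy.2⟩
      rw [← hi y, h, hix]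
    · have hix' : i x ∈ s.erase x := Finset.mem_erase.2 ⟨hix, hs x hx⟩
      rw [← Finset.mul_prod_erase _ _ hx, ← Finset.mul_prod_erase _ _ hix', ← mul_assoc, hf x hx,
        mul_conj]
      have hsub : (s.erase x).erase (i x) ⊆ s :=
        (Finset.erase_subset _ _).trans (Finset.erase_subset _ _)
      refine mul_nonneg (by exact_mod_cast normSq_nonneg _) (ih _
        ((Finset.erase_ssubset hix').trans (Finset.erase_ssubset hx)) (fun y hy ↦ ?_)
        (fun y hy ↦ hf y (hsub hy)) (fun y hy ↦ hf0 y (hsub hy)))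
      rw [Finset.mem_erase, Finset.mem_erase] at hy ⊢
      refine ⟨fun h ↦ hy.2.1 ?_, fun h ↦ hy.1 ?_, hs y hy.2.2⟩
      · rw [← hi y, h, hi]
      · rw [← h, hi]

theorem DirichletCharacter.LFunction_primitiveCharacter_eq {M d : ℕ} [NeZero M] [NeZero d]
    {χ : 𝐗 M} (hd : d ∣ M) {ψ : 𝐗 d}
    (hψ : changeLevel hd ψ = χ) (h : d = χ.conductor) (s : ℂ) :
    LFunction χ.primitiveCharacter s = LFunction ψ s := by
  subst h
  have : ψ = χ.primitiveCharacter := by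
    refine changeLevel_injective hd ?_
    rw [hψ]
    exact χ.changeLevel_primitiveCharacter.symm
  rw [this]

theorem DirichletCharacter.LFunction_inv_ofReal {N : ℕ} [NeZero N] {χ : 𝐗 N}
    (hχ : χ ≠ 1) {β : ℝ} (hβ : 0 < β) :
    LFunction χ⁻¹ β = starRingEnd ℂ (LFunction χ β) := by
  have hχ' : χ⁻¹ ≠ 1 := by simpa using hχ
  rw [LFunction_eq_abelSeries _ hχ' (by simpa using hβ), LFunction_eq_abelSeries _ hχ
    (by simpa using hβ), abelSeries, abelSeries, conj_tsum]
  refine tsum_congr fun n ↦ ?_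
  rw [map_mul, abelWeight_ofReal, conj_ofReal]
  congr 1
  rw [partialSum, partialSum, map_sum]
  refine sum_congr rfl fun k _ ↦ ?_
  rw [starRingEnd_apply, MulChar.star_apply']

theorem DirichletCharacter.LFunction_primitiveCharacter_inv {M : ℕ} [NeZero M]
    {χ : 𝐗 M} (hχ : χ ≠ 1) {β : ℝ} (hβ : 0 < β) :
    LFunction χ⁻¹.primitiveCharacter β = starRingEnd ℂ (LFunction χ.primitiveCharacter β) := by
  rw [← LFunction_inv_ofReal (primitiveCharacter_ne_one hχ) hβ]
  refine LFunction_primitiveCharacter_eq χ.conductor_dvd_level ?_ χ.conductor_inv.symm _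
  rw [map_inv, changeLevel_primitiveCharacter]

theorem DirichletCharacter.primitiveCharacter_sq_eq_one {M : ℕ} [NeZero M]
    {χ : 𝐗 M} (hχ : χ ^ 2 = 1) : χ.primitiveCharacter ^ 2 = 1 := by
  refine changeLevel_injective χ.conductor_dvd_level ?_
  rw [map_pow, changeLevel_primitiveCharacter, hχ, map_one]

theorem DirichletCharacter.LFunction_nonneg_of_sq_eq_one {N : ℕ} [NeZero N]
    {χ : 𝐗 N} (hχ : χ ^ 2 = 1) (hχ1 : χ ≠ 1) {β : ℝ} (h0 : 19 / 20 ≤ β)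
    (h1 : β ≤ 1) (hβ : 450 * (N : ℝ) ^ 2 * (1 - β) ≤ 1) : 0 ≤ LFunction χ β := by
  have hinv : χ⁻¹ = χ := by
    rw [inv_eq_iff_mul_eq_one, ← sq, hχ]
  have h2 := LFunction_inv_ofReal hχ1 (by linarith : 0 < β)
  rw [hinv] at h2
  have h3 := LFunction_one_ge_of_sq_eq_one hχ hχ1
  have h4 := norm_LFunction_sub_le hχ1 h0 h1
  have h5 := (abs_le.1 ((abs_re_le_norm _).trans h4)).2
  rw [sub_re] at h5
  have hN : (0 : ℝ) < N := by exact_mod_cast NeZero.pos N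
  have h6 : 15 * N * (1 - β) ≤ 1 / (30 * N) := by
    rw [le_div_iff₀ (by positivity)]
    linarith
  rw [Complex.le_def]
  refine ⟨by simp only [zero_re]; linarith, ?_⟩
  have := congrArg im h2
  rw [conj_im] at this
  simp only [zero_im]
  linarith

theorem LFunctionTrivChar₁_one_nonneg {β : ℝ} (h0 : 0 < β) (h1 : β < 1) :
    0 ≤ LFunctionTrivChar₁ 1 β := by
  have h2 := one_sub_mul_LFunctionTrivChar₁_one (s := β) (by simpa using h0)
  have h3 : (2 : ℂ) ^ (1 - (β : ℂ)) = ((2 ^ (1 - β) : ℝ) : ℂ) := by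
    rw [ofReal_cpow zero_le_two]; push_cast; rfl
  have h4 : (1 : ℝ) < 2 ^ (1 - β) := Real.one_lt_rpow one_lt_two (by linarith)
  have h5 : 0 ≤ abelSeries (fun n ↦ ∑ k ∈ range n, altCoeff (k + 1)) β := by
    rw [abelSeries]
    refine tsum_nonneg fun n ↦ ?_
    rw [abelWeight_ofReal, sum_altCoeff]
    refine mul_nonneg (by split_ifs <;> simp) ?_
    norm_cast
    rw [sub_nonneg]
    refine Real.rpow_le_rpow_of_nonpos (by positivity) (by push_cast; linarith) (by linarith)
  rw [h3] at h2
  have h6 : (1 : ℂ) - ((2 ^ (1 - β) : ℝ) : ℂ) ≠ 0 := by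
    rw [← ofReal_one, ← ofReal_sub, ofReal_ne_zero]
    linarith
  have h7 : LFunctionTrivChar₁ 1 β = (((1 - β) / (2 ^ (1 - β) - 1) : ℝ) : ℂ) *
      abelSeries (fun n ↦ ∑ k ∈ range n, altCoeff (k + 1)) β := by
    refine mul_left_cancel₀ h6 ?_
    rw [h2, ← mul_assoc, ← ofReal_one, ← ofReal_sub, ← ofReal_sub, ← ofReal_mul]
    congr 2
    have : (2 : ℝ) ^ (1 - β) - 1 ≠ 0 := by linarith
    field_simp
    ring
  rw [h7]
  refine mul_nonneg ?_ h5
  have : 0 ≤ (1 - β) / (2 ^ (1 - β) - 1) := div_nonneg (by linarith) (by linarith)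
  exact_mod_cast this

theorem pow_mul_pow_le_one {M : ℕ} (hM : 1 ≤ M) :
    4 * (504 * (11 * (M : ℝ)) ^ M) * (7 / 10) ^ (450 * M ^ 2) / (3 / 10) ≤ 1 / 2 := by
  have h1 : (7 / 10 : ℝ) ^ (450 * M) ≤ (1 / 2 ^ (225 * M) : ℝ) := by
    rw [show 450 * M = 10 * (45 * M) by ring, pow_mul,
      show 225 * M = 5 * (45 * M) by ring, pow_mul (2 : ℝ), ← one_div_pow]
    gcongr
    norm_num
  have h2 : 13440 * (11 * (M : ℝ)) ≤ 2 ^ (225 * M) := by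
    have h3 : (M : ℝ) ≤ 2 ^ M := by exact_mod_cast (Nat.lt_two_pow_self (n := M)).le
    calc 13440 * (11 * (M : ℝ)) ≤ 2 ^ 18 * 2 ^ M := by
          rw [← mul_assoc]; gcongr; norm_num
      _ = 2 ^ (18 + M) := by rw [pow_add]
      _ ≤ _ := pow_le_pow_right₀ one_le_two (by omega)
  have h3 : 13440 * (11 * (M : ℝ)) * (7 / 10 : ℝ) ^ (450 * M) ≤ 1 := by
    calc _ ≤ (2 : ℝ) ^ (225 * M) * (1 / 2 ^ (225 * M)) := by gcongr
      _ = 1 := by field_simp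
  have h4 : (13440 * (11 * (M : ℝ)) * (7 / 10 : ℝ) ^ (450 * M)) ^ M ≤ 1 :=
    pow_le_one₀ (by positivity) h3
  rw [mul_pow, mul_pow, ← pow_mul, show 450 * M * M = 450 * M ^ 2 by ring] at h4
  have h5 : (13440 : ℝ) ≤ 13440 ^ M := le_self_pow₀ (by norm_num) (by omega)
  have h6 : 13440 * (11 * (M : ℝ)) ^ M * (7 / 10 : ℝ) ^ (450 * M ^ 2) ≤ 1 := by
    refine le_trans ?_ h4
    gcongr
  rw [div_le_iff₀ (by norm_num)]
  linarith

theorem one_add_inv_pow_le_three (N : ℕ) : (1 + 1 / (N : ℝ)) ^ N ≤ 3 := by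
  rcases Nat.eq_zero_or_pos N with rfl | hN
  · norm_num
  calc (1 + 1 / (N : ℝ)) ^ N ≤ (Real.exp (1 / N)) ^ N := by
        gcongr; rw [add_comm]; exact Real.add_one_le_exp _
    _ = Real.exp 1 := by rw [← Real.exp_nat_mul]; congr 1; field_simp
    _ ≤ 3 := by linarith [Real.exp_one_lt_d9]

variable (M : ℕ) [NeZero M] (K : Type*) [Field K] [NumberField K] [IsCyclotomicExtension {M} ℚ K]

/-- A lower bound for the residue of the Dedekind zeta function of a cyclotomic field. -/
theorem residue_cyclotomic_ge : 1 / (2700 * (M : ℝ) ^ 2) ≤ dedekindZeta_residue K := by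
  have hM : 1 ≤ M := NeZero.one_le
  have hMR : (1 : ℝ) ≤ M := by exact_mod_cast hM
  set N := 450 * M ^ 2 with hN
  have hNR : (N : ℝ) = 450 * (M : ℝ) ^ 2 := by rw [hN]; push_cast; rfl
  have hN450 : (450 : ℝ) ≤ N := by rw [hNR]; nlinarith
  set β : ℝ := 1 - 1 / N with hβ
  have hβ0 : 19 / 20 ≤ β := by
    have : 1 / (N : ℝ) ≤ 1 / 450 := one_div_le_one_div_of_le (by norm_num) hN450
    rw [hβ]; linarith
  have hβ1 : β < 1 := by
    have : 0 < 1 / (N : ℝ) := by positivity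
    rw [hβ]; linarith
  set X := (univ : Finset (𝐗 M)).erase 1 with hX
  have hX1 : ∀ χ ∈ X, χ ≠ 1 := fun χ hχ ↦ Finset.ne_of_mem_erase hχ
  set a : ℕ → ℂ := fun n ↦ (idealCount K n : ℂ) with ha
  have hzeta : ∀ s, dedekindZeta K s = LSeries a s := fun s ↦ rfl
  set P : ℂ → ℂ := fun s ↦ LFunctionTrivChar₁ 1 s * ∏ χ ∈ X, LFunction χ.primitiveCharacter s
    with hP
  have hcond : ∀ χ : 𝐗 M, (χ.conductor : ℝ) ≤ M := fun χ ↦ by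
    exact_mod_cast Nat.le_of_dvd (NeZero.pos M) χ.conductor_dvd_level
  have key := residue_ge_of_nonneg (a := a) (P := P) (κ := dedekindZeta_residue K)
    (B := 504 * (11 * (M : ℝ)) ^ M) (β := β) (N := N) (fun n ↦ by simp [ha]) (by
      rw [ha]; simp [idealCount_one]) ?_ ?_ ?_ ?_ ?_ hβ0 hβ1 ?_ (pow_mul_pow_le_one hM)
  · rw [show 2 - β = 1 + 1 / (N : ℝ) by rw [hβ]; ring, show 1 - β = 1 / (N : ℝ) by rw [hβ]; ring,
      hNR] at key
    rw [← hNR] at key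
    have h1 := mul_le_mul_of_nonneg_left (one_add_inv_pow_le_three N)
      (dedekindZeta_residue_pos K).le
    rw [show (2700 : ℝ) * (M : ℝ) ^ 2 = 6 * N by rw [hNR]; ring]
    have h2 : 1 / (6 * (N : ℝ)) = 1 / (N : ℝ) / 2 / 3 := by ring
    rw [h2]
    linarith
  · refine LSeries.abscissaOfAbsConv_le_of_forall_lt_LSeriesSummable fun y hy ↦ ?_
    exact summable_idealCount K (by simpa using hy)
  · refine (differentiable_LFunctionTrivChar₁ 1).mul ?_
    refine Differentiable.fun_finsetProd fun χ hχ ↦ ?_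
    exact differentiable_LFunction (primitiveCharacter_ne_one (hX1 χ hχ))
  · intro s hs
    have hs1 : s ≠ 1 := by rintro rfl; simp at hs
    rw [← hzeta, dedekindZeta_cyclotomic M K hs, ← Finset.mul_prod_erase _ _
      (mem_univ (1 : 𝐗 M))]
    simp only [hP]
    rw [LFunctionTrivChar₁_one_eq hs1, mul_assoc]
    congr 2
    · rw [← LSeries_one_eq_riemannZeta hs]
      refine congrFun (congrArg LSeries ?_) _
      funext n
      have hc : (1 : 𝐗 M).conductor = 1 := conductor_one
      have : Subsingleton (ZMod (1 : 𝐗 M).conductor) := by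
        rw [hc]; infer_instance
      have hn : ((n : ℕ) : ZMod (1 : 𝐗 M).conductor) = 1 :=
        Subsingleton.elim _ _
      rw [primitiveCharacter_one, hn, map_one]
      rfl
    · exact prod_congr rfl fun χ _ ↦ LFunction_eq_LSeries _ hs
  · rw [hP, dedekindZeta_residue_eq_prod K (M := M) univ (mem_univ 1)
      (fun s hs ↦ dedekindZeta_cyclotomic M K hs)]
    simp [LFunctionTrivChar₁, hX]
  · intro s hs
    have hs' : ‖s - 2‖ = 3 / 2 := by rwa [mem_sphere, dist_eq] at hs
    have hre := (abs_le.1 ((abs_re_le_norm (s - 2)).trans hs'.le)).1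
    rw [sub_re, show (2 : ℂ).re = 2 from rfl] at hre
    have hn : ‖s‖ ≤ 7 / 2 := by
      calc ‖s‖ = ‖(s - 2) + 2‖ := by rw [sub_add_cancel]
        _ ≤ ‖s - 2‖ + ‖(2 : ℂ)‖ := norm_add_le _ _
        _ = 7 / 2 := by rw [hs']; norm_num
    rw [hP, norm_mul, norm_prod]
    refine mul_le_mul (norm_LFunctionTrivChar₁_one_le hs) ?_ (by positivity) (by norm_num)
    calc ∏ χ ∈ X, ‖LFunction χ.primitiveCharacter s‖ ≤ ∏ χ ∈ X, (11 * (M : ℝ)) := by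
          refine Finset.prod_le_prod (fun _ _ ↦ norm_nonneg _) fun χ hχ ↦ ?_
          refine (norm_LFunction_le (primitiveCharacter_ne_one (hX1 χ hχ)) (by linarith)).trans ?_
          calc (χ.conductor : ℝ) * (‖s‖ * 3) ≤ M * (7 / 2 * 3) := by
                gcongr; exact_mod_cast hcond χ
            _ ≤ _ := by linarith
      _ = (11 * (M : ℝ)) ^ X.card := by rw [Finset.prod_const]
      _ ≤ _ := by
        refine pow_le_pow_right₀ (by linarith) ?_
        refine (Finset.card_le_univ X).trans ?_
        rw [← Nat.card_eq_fintype_card, DirichletCharacter.card_eq_totient_of_hasEnoughRootsOfUnity]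
        exact Nat.totient_le M
  · refine (Complex.le_def.1 (?_ : 0 ≤ P β)).1
    refine mul_nonneg (LFunctionTrivChar₁_one_nonneg (by linarith) hβ1) ?_
    classical
    refine Finset.prod_nonneg_of_conj (fun χ ↦ χ⁻¹) inv_inv _ X (fun χ hχ ↦ ?_) (fun χ hχ ↦ ?_)
      fun χ hχ h ↦ ?_
    · simpa [hX] using hχ
    · exact LFunction_primitiveCharacter_inv (hX1 χ hχ) (by linarith)
    · have hsq : χ ^ 2 = 1 := by rwa [inv_eq_iff_mul_eq_one, ← sq] at h
      refine LFunction_nonneg_of_sq_eq_one (primitiveCharacter_sq_eq_one hsq)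
        (primitiveCharacter_ne_one (hX1 χ hχ)) hβ0 hβ1.le ?_
      rw [show 1 - β = 1 / (N : ℝ) by rw [hβ]; ring, mul_one_div, div_le_one (by positivity), hNR]
      have := hcond χ
      gcongr

end ResidueLowerBound

section LargeConductor

/-- The local factor at `p` of the root discriminant of a cyclotomic field. -/
noncomputable def rootDiscrFactor (p : ℕ) : ℝ := (p : ℝ) ^ (((p - 2 : ℕ) : ℝ) / ((p - 1 : ℕ) : ℝ))

theorem rootDiscrFactor_pos {p : ℕ} (hp : 2 ≤ p) : 0 < rootDiscrFactor p :=
  Real.rpow_pos_of_pos (by positivity) _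

theorem rootDiscrFactor_pow {p : ℕ} (hp : 2 ≤ p) :
    rootDiscrFactor p ^ (p - 1) = (p : ℝ) ^ (p - 2) := by
  have h : ((p - 1 : ℕ) : ℝ) ≠ 0 := by exact_mod_cast (by omega : p - 1 ≠ 0)
  rw [rootDiscrFactor, ← Real.rpow_natCast, ← Real.rpow_mul (by positivity), div_mul_cancel₀ _ h,
    Real.rpow_natCast]

theorem one_le_rootDiscrFactor {p : ℕ} (hp : 2 ≤ p) : 1 ≤ rootDiscrFactor p :=
  Real.one_le_rpow (by exact_mod_cast (by omega : 1 ≤ p)) (by positivity)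

theorem le_rootDiscrFactor_sq {p : ℕ} (hp : 3 ≤ p) : (p : ℝ) ≤ rootDiscrFactor p ^ 2 := by
  refine le_of_pow_le_pow_left₀ (n := p - 1) (by omega)
    (pow_nonneg (rootDiscrFactor_pos (by omega)).le _) ?_
  rw [← pow_mul, mul_comm 2, pow_mul, rootDiscrFactor_pow (by omega), ← pow_mul]
  exact pow_le_pow_right₀ (by exact_mod_cast (by omega : 1 ≤ p)) (by omega)

theorem le_rootDiscrFactor_of_le {p : ℕ} (hp : 409 ≤ p) : 403 ≤ rootDiscrFactor p := by
  refine le_of_pow_le_pow_left₀ (n := p - 1) (by omega) (rootDiscrFactor_pos (by omega)).le ?_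
  rw [rootDiscrFactor_pow (by omega), show p - 1 = (p - 2) + 1 by omega, pow_succ]
  have hpR : (409 : ℝ) ≤ p := by exact_mod_cast hp
  have h1 : (403 : ℝ) ≤ (409 / 403) ^ (p - 2) := by
    have h2 : (1727 / 1000 : ℝ) ≤ (409 / 403) ^ 37 := by norm_num
    calc (403 : ℝ) ≤ (1727 / 1000) ^ 11 := by norm_num
      _ ≤ ((409 / 403) ^ 37) ^ 11 := by gcongr
      _ = (409 / 403) ^ 407 := by rw [← pow_mul]
      _ ≤ _ := pow_le_pow_right₀ (by norm_num) (by omega)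
  calc (403 : ℝ) ^ (p - 2) * 403 ≤ 403 ^ (p - 2) * (409 / 403) ^ (p - 2) := by gcongr
    _ = 409 ^ (p - 2) := by rw [← mul_pow]; norm_num
    _ ≤ _ := by gcongr

variable (M : ℕ) [NeZero M] (K : Type*) [Field K] [NumberField K] [IsCyclotomicExtension {M} ℚ K]

theorem natAbs_discr_cyclotomic_eq_pow (hsq : Squarefree M) :
    ((discr K).natAbs : ℝ) = (∏ p ∈ M.primeFactors, rootDiscrFactor p) ^ M.totient := by
  have hdiv : ∀ p ∈ M.primeFactors, M.totient = (p - 1) * (M.totient / (p - 1)) := by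
    intro p hp
    refine (Nat.mul_div_cancel' ?_).symm
    have := Nat.totient_dvd_of_dvd (Nat.dvd_of_mem_primeFactors hp)
    rwa [Nat.totient_prime (Nat.prime_of_mem_primeFactors hp)] at this
  have hd : (discr K).natAbs = ∏ p ∈ M.primeFactors, p ^ ((p - 2) * (M.totient / (p - 1))) := by
    rw [IsCyclotomicExtension.Rat.natAbs_discr M K]
    have hpos : 0 < ∏ p ∈ M.primeFactors, p ^ (M.totient / (p - 1)) :=
      Finset.prod_pos fun p hp ↦ pow_pos (Nat.prime_of_mem_primeFactors hp).pos _
    apply Nat.div_eq_of_eq_mul_left hpos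
    rw [← prod_mul_distrib]
    conv_lhs => rw [← Nat.prod_primeFactors_of_squarefree hsq, ← Finset.prod_pow]
    rw [Nat.prod_primeFactors_of_squarefree hsq]
    refine prod_congr rfl fun p hp ↦ ?_
    rw [← pow_add]
    congr 1
    conv_lhs => rw [hdiv p hp]
    have := (Nat.prime_of_mem_primeFactors hp).two_le
    rw [show p - 1 = p - 2 + 1 by omega]
    ring
  rw [hd, Nat.cast_prod, ← Finset.prod_pow]
  refine prod_congr rfl fun p hp ↦ ?_
  conv_rhs => rw [hdiv p hp]
  rw [pow_mul (rootDiscrFactor p), rootDiscrFactor_pow (Nat.prime_of_mem_primeFactors hp).two_le]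
  push_cast
  rw [pow_mul]

variable [IsCMField K]

theorem indexRealUnits_pos : 0 < IsCMField.indexRealUnits K := by
  rcases IsCMField.indexRealUnits_eq_one_or_two K with h | h <;> omega

theorem pi_bound {M : ℕ} (hM : 409 ≤ M) :
    16 * Real.pi ^ 2 * (Real.pi ^ 2 / 6 + 2 / M * (1 + Real.log M)) ≤ 268 := by
  have hMR : (409 : ℝ) ≤ M := by exact_mod_cast hM
  have hpi : Real.pi ^ 2 ≤ 98697 / 10000 := by
    have h1 := Real.pi_lt_d4
    have h2 := Real.pi_pos
    nlinarith
  have hlog : 1 + Real.log M ≤ M / 512 + 63 / 10 := by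
    have h1 : Real.log M = Real.log (M / 512) + 9 * Real.log 2 := by
      rw [Real.log_div (by positivity) (by norm_num),
        show (512 : ℝ) = 2 ^ 9 by norm_num, Real.log_pow]
      push_cast; ring
    have h2 := Real.log_le_sub_one_of_pos (show (0 : ℝ) < M / 512 by positivity)
    have h3 := Real.log_two_lt_d9
    linarith
  have h2 : 2 / M * (1 + Real.log M) ≤ 36 / 1000 := by
    calc 2 / M * (1 + Real.log M) ≤ 2 / M * (M / 512 + 63 / 10) := by gcongr
      _ = 1 / 256 + 126 / 10 / M := by field_simp; ring
      _ ≤ 1 / 256 + 126 / 10 / 409 := by gcongr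
      _ ≤ _ := by norm_num
  have h3 : Real.pi ^ 2 / 6 + 2 / M * (1 + Real.log M) ≤ 1681 / 1000 := by linarith
  calc _ ≤ 16 * (98697 / 10000 : ℝ) * (1681 / 1000) := by
        have : 0 ≤ Real.log M := Real.log_nonneg (by linarith)
        gcongr
    _ ≤ _ := by norm_num

theorem pow_bound_of_le {X : ℝ} (hX : 403 ≤ X) {m : ℕ} (hm : 408 ≤ m) :
    2700 ^ 4 * 9 * X ^ 16 * 268 ^ m < 16 * X ^ m := by
  obtain ⟨k, rfl⟩ : ∃ k, m = 16 + (387 + k) := ⟨m - 403, by omega⟩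
  rw [pow_add X, pow_add 268]
  have hX16 : 0 < X ^ 16 := by positivity
  have h16 : (402 : ℝ) ^ (387 + k) ≤ X ^ (387 + k) := by gcongr; linarith
  have h17 : (402 : ℝ) ^ (387 + k) = (3 / 2) ^ (387 + k) * 268 ^ (387 + k) := by
    rw [← mul_pow]; norm_num
  have h18 : (3 / 2 : ℝ) ^ (129 * 3) ≤ (3 / 2) ^ (387 + k) := pow_le_pow_right₀ (by norm_num) (by omega)
  have h19 : (2700 : ℝ) ^ 4 * 9 * 268 ^ 16 < 16 * (3 / 2) ^ (129 * 3) := by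
    have h2 : (2 : ℝ) ^ 75 ≤ (3 / 2) ^ 129 := by norm_num
    calc (2700 : ℝ) ^ 4 * 9 * 268 ^ 16 < 16 * (2 ^ 75) ^ 3 := by norm_num
      _ ≤ 16 * ((3 / 2) ^ 129) ^ 3 := by gcongr
      _ = 16 * (3 / 2) ^ (129 * 3) := by rw [← pow_mul]
  have h20 : (0 : ℝ) < 268 ^ (387 + k) := by positivity
  have h21 : (2700 : ℝ) ^ 4 * 9 * 268 ^ 16 * 268 ^ (387 + k) < 16 * X ^ (387 + k) := by
    calc (2700 : ℝ) ^ 4 * 9 * 268 ^ 16 * 268 ^ (387 + k) <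
          16 * (3 / 2) ^ (129 * 3) * 268 ^ (387 + k) := by gcongr
      _ ≤ 16 * ((3 / 2) ^ (387 + k) * 268 ^ (387 + k)) := by
        rw [← mul_assoc]; gcongr
      _ ≤ _ := by rw [← h17]; gcongr
  calc _ = X ^ 16 * (2700 ^ 4 * 9 * 268 ^ 16 * 268 ^ (387 + k)) := by ring
    _ < X ^ 16 * (16 * X ^ (387 + k)) := by gcongr
    _ = _ := by ring

set_option maxHeartbeats 1000000 in
/-- The relative class number of `ℚ(ζ_M)` exceeds `2 ^ [K⁺ : ℚ]` if `M` has a prime factor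
`≥ 409`. -/
theorem classNumber_gt_of_large_prime (hodd : Odd M) (h1 : M ≠ 1) (hsq : Squarefree M) {q : ℕ}
    (hq : q.Prime) (hqM : q ∣ M) (hq409 : 409 ≤ q) :
    classNumber (𝐑 K) * 2 ^ Module.finrank ℚ (𝐑 K) <
      classNumber K := by
  by_contra! hle
  set n := Module.finrank ℚ (𝐑 K) with hn
  have hn2 : 2 * n = M.totient := two_mul_finrank_real M K
  have hM409 : 409 ≤ M := hq409.trans (Nat.le_of_dvd (NeZero.pos M) hqM)
  have hMR : (409 : ℝ) ≤ M := by exact_mod_cast hM409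
  set X := ∏ p ∈ M.primeFactors, rootDiscrFactor p with hX
  have h3 : ∀ p ∈ M.primeFactors, 3 ≤ p := by
    intro p hp
    have h2 := (Nat.prime_of_mem_primeFactors hp).two_le
    obtain ⟨c, hc⟩ := hodd.of_dvd_nat (Nat.dvd_of_mem_primeFactors hp)
    omega
  have hXge : 403 ≤ X := by
    have hmem : q ∈ M.primeFactors := Nat.mem_primeFactors.2 ⟨hq, hqM, NeZero.ne M⟩
    rw [hX, ← Finset.mul_prod_erase _ _ hmem]
    have h4 : 1 ≤ ∏ p ∈ M.primeFactors.erase q, rootDiscrFactor p := by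
      rw [← Finset.prod_const_one (s := M.primeFactors.erase q)]
      refine Finset.prod_le_prod (fun _ _ ↦ zero_le_one) fun p hp ↦ ?_
      exact one_le_rootDiscrFactor (by have := h3 p (Finset.mem_of_mem_erase hp); omega)
    nlinarith [le_rootDiscrFactor_of_le hq409]
  have hMX : (M : ℝ) ≤ X ^ 2 := by
    conv_lhs => rw [← Nat.prod_primeFactors_of_squarefree hsq]
    rw [hX, ← Finset.prod_pow, Nat.cast_prod]
    exact Finset.prod_le_prod (fun _ _ ↦ by positivity) fun p hp ↦ le_rootDiscrFactor_sq (h3 p hp)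
  have hdX := natAbs_discr_cyclotomic_eq_pow M K hsq
  rw [← hX, ← hn2] at hdX
  have hn408 : 408 ≤ 2 * n := by
    rw [hn2]
    have := Nat.le_of_dvd (Nat.totient_pos.2 (NeZero.pos M)) (Nat.totient_dvd_of_dvd hqM)
    rw [Nat.totient_prime hq] at this
    omega
  set C : ℝ := ((∏ χ : 𝐗 M with χ (-1) = -1, χ.conductor : ℕ) : ℝ) with hC
  have hCd : ((discr K).natAbs : ℝ) ≤ C ^ 2 := by
    rw [hC]
    have h4 := sq_prod_conductor_odd M K hodd h1 hsq
    have h5 : 1 ≤ Ideal.absNorm (differentIdeal (𝓞 (𝐑 K)) (𝓞 K)) := by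
      rcases Nat.eq_zero_or_pos (Ideal.absNorm
        (differentIdeal (𝓞 (𝐑 K)) (𝓞 K))) with h | h
      · rw [h, mul_zero] at h4
        have h6 := pow_eq_zero_iff (two_ne_zero) |>.1 h4
        rw [Finset.prod_eq_zero_iff] at h6
        obtain ⟨χ, _, hχ⟩ := h6
        exact absurd hχ (NeZero.ne χ.conductor)
      · exact h
    have h6 := Nat.mul_le_mul_left (discr K).natAbs h5
    rw [mul_one, ← h4] at h6
    exact_mod_cast h6
  have hformula := classNumber_cyclotomic_eq M K hodd h1 fun h ↦ hsq.prime_of_isPrimePow h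
  rw [sqrt_discr_div_eq M K hodd h1 hsq] at hformula
  have hres := residue_cyclotomic_eq M K hodd h1 fun h ↦ hsq.prime_of_isPrimePow h
  have hlow := residue_cyclotomic_ge M K
  have hup := residue_real_sq_le M K hodd h1 hsq
  set L := ∏ χ : 𝐗 M with χ (-1) = -1,
    ‖DirichletCharacter.LFunction χ.primitiveCharacter 1‖
  set D := ∏ χ : 𝐗 M with χ (-1) = -1, √(χ.conductor : ℝ) with hD
  have hD2 : D ^ 2 = C := by
    rw [hD, ← Finset.prod_pow, hC, Nat.cast_prod]
    exact prod_congr rfl fun χ _ ↦ Real.sq_sqrt (by positivity)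
  have hD0 : 0 ≤ D := Finset.prod_nonneg fun _ _ ↦ Real.sqrt_nonneg _
  set κ := dedekindZeta_residue (𝐑 K) with hκ
  have hκ0 : 0 < κ := dedekindZeta_residue_pos _
  have hh0 : (0 : ℝ) < classNumber (𝐑 K) := by
    exact_mod_cast classNumber_pos _
  have hQ : (1 : ℝ) ≤ IsCMField.indexRealUnits K := by exact_mod_cast indexRealUnits_pos K
  have hleR : (classNumber K : ℝ) ≤ classNumber (𝐑 K) * 2 ^ n := by
    exact_mod_cast hle
  rw [hformula, ← hn] at hleR
  have h5 := le_of_mul_le_mul_left hleR hh0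
  have hL0 : 0 ≤ L := Finset.prod_nonneg fun _ _ ↦ norm_nonneg _
  have h6 : 2 * M * D * L ≤ (4 * Real.pi) ^ n := by
    have h7 : (1 * (2 * M) * D / (2 * Real.pi) ^ n) * L ≤ 2 ^ n := by
      refine le_trans ?_ h5
      gcongr
    rw [div_mul_eq_mul_div, div_le_iff₀ (by positivity), ← mul_pow] at h7
    rw [show 4 * Real.pi = 2 * (2 * Real.pi) by ring]
    linarith
  have h7 : 2 * D ≤ 2700 * M * ((4 * Real.pi) ^ n * κ) := by
    have h8 : 2 * M * D * (1 / (2700 * (M : ℝ) ^ 2)) ≤ (4 * Real.pi) ^ n * κ := by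
      calc 2 * M * D * (1 / (2700 * (M : ℝ) ^ 2)) ≤ 2 * M * D * (κ * L) := by
            rw [← hres]; gcongr
        _ = (2 * M * D * L) * κ := by ring
        _ ≤ _ := by gcongr
    have h9 : 2 * M * D * (1 / (2700 * (M : ℝ) ^ 2)) = 2 * D / (2700 * M) := by
      field_simp
    rw [h9, div_le_iff₀ (by positivity)] at h8
    linarith
  set c := Real.pi ^ 2 / 6 + 2 / M * (1 + Real.log M) with hc
  have hc0 : 0 ≤ c := by
    have : 0 ≤ Real.log M := Real.log_nonneg (by linarith)
    positivity
  have h8 : (2 * D) ^ 4 ≤ (2700 * M * ((4 * Real.pi) ^ n * κ)) ^ 4 := by gcongr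
  have h9 : (2 * D) ^ 4 = 16 * C ^ 2 := by rw [← hD2]; ring
  have h10 : (2700 * M * ((4 * Real.pi) ^ n * κ)) ^ 4 ≤
      2700 ^ 4 * M ^ 4 * (4 * Real.pi) ^ (4 * n) * (3 * M ^ 2 * c ^ n) ^ 2 := by
    rw [mul_pow, mul_pow, mul_pow, ← pow_mul, mul_comm n 4, show κ ^ 4 = (κ ^ 2) ^ 2 by ring,
      ← mul_assoc]
    gcongr
  have h11 : 16 * X ^ (2 * n) ≤ 2700 ^ 4 * 9 * M ^ 8 * (16 * Real.pi ^ 2 * c) ^ (2 * n) := by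
    rw [← hdX]
    have e : (2700 : ℝ) ^ 4 * 9 * M ^ 8 * (16 * Real.pi ^ 2 * c) ^ (2 * n) =
        2700 ^ 4 * M ^ 4 * (4 * Real.pi) ^ (4 * n) * (3 * M ^ 2 * c ^ n) ^ 2 := by
      have e1 : (4 * Real.pi) ^ (4 * n) = (16 * Real.pi ^ 2) ^ (2 * n) := by
        rw [show 4 * n = 2 * (2 * n) by ring, pow_mul _ 2, mul_pow]; norm_num
      have e2 : c ^ (2 * n) = (c ^ n) ^ 2 := by rw [mul_comm, pow_mul]
      rw [e1, mul_pow (16 * Real.pi ^ 2), e2]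
      ring
    rw [e]
    linarith
  have h12 : 16 * X ^ (2 * n) ≤ 2700 ^ 4 * 9 * X ^ 16 * 268 ^ (2 * n) := by
    refine h11.trans ?_
    have h13 : (M : ℝ) ^ 8 ≤ X ^ 16 := by
      rw [show 16 = 2 * 8 by norm_num, pow_mul]; gcongr
    have h14 := pi_bound hM409
    rw [← hc] at h14
    gcongr
  exact (pow_bound_of_le hXge hn408).not_ge h12

end LargeConductor

section Carry

namespace DirichletCharacter

open Finset

theorem sum_mul_eq_zero_of_not_factorsThrough {N d : ℕ} [NeZero N] {χ : 𝐗 N}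
    (hd : d ∣ N) (hχ : ¬ χ.FactorsThrough d) (h : ZMod d → ℂ) :
    ∑ a : ZMod N, χ a * h (ZMod.castHom hd _ a) = 0 := by
  rw [factorsThrough_iff_ker_unitsMap hd, SetLike.not_le_iff_exists] at hχ
  obtain ⟨c, hc, hχc⟩ := hχ
  rw [MonoidHom.mem_ker] at hc hχc
  have hc1 : ZMod.castHom hd (ZMod d) c = 1 := by
    have := congrArg Units.val hc
    simpa [ZMod.unitsMap_def] using this
  have hχ1 : χ c ≠ 1 := by
    intro h1
    exact hχc (Units.ext (by rw [MulChar.coe_toUnitHom, h1]; rfl))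
  set S := ∑ a : ZMod N, χ a * h (ZMod.castHom hd _ a) with hS
  have : S = χ c * S := by
    rw [hS, mul_sum, ← (Equiv.sum_comp (Units.mulLeft c) _)]
    refine sum_congr rfl fun a _ ↦ ?_
    rw [Units.mulLeft_apply, map_mul, map_mul, hc1, one_mul, mul_assoc]
  have h2 : (1 - χ c) * S = 0 := by linear_combination this
  exact (mul_eq_zero.1 h2).resolve_left (sub_ne_zero.2 hχ1.symm)

theorem val_mul_add_val_mul {q f : ℕ} [NeZero q] [NeZero f] (x : ZMod q) (y : ZMod f) :
    (((x.val * f + y.val * q : ℕ) : ZMod (q * f)).val : ℤ) = x.val * f + y.val * q -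
      q * f * (if q * f ≤ x.val * f + y.val * q then 1 else 0) := by
  have hx := x.val_lt
  have hy := y.val_lt
  have hf := NeZero.pos f
  have hq := NeZero.pos q
  have h1 : x.val * f + f ≤ q * f := by nlinarith
  have h2 : y.val * q + q ≤ q * f := by nlinarith
  rw [ZMod.val_natCast]
  split_ifs with h
  · rw [Nat.mod_eq_sub_mod h, Nat.mod_eq_of_lt (by omega), Nat.cast_sub h]
    push_cast; ring
  · rw [Nat.mod_eq_of_lt (by omega)]
    push_cast; ring

theorem bijective_val_mul_add {q f : ℕ} [NeZero q] [NeZero f] (hqf : q.Coprime f) :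
    Function.Bijective fun z : ZMod q × ZMod f ↦
      ((z.1.val * f + z.2.val * q : ℕ) : ZMod (q * f)) := by
  rw [Fintype.bijective_iff_injective_and_card]
  refine ⟨?_, by simp [ZMod.card]⟩
  rintro ⟨x, y⟩ ⟨x', y'⟩ h
  simp only at h
  have h1 := congrArg (ZMod.castHom (Nat.dvd_mul_right q f) (ZMod q)) h
  have h2 := congrArg (ZMod.castHom (Nat.dvd_mul_left f q) (ZMod f)) h
  rw [map_natCast, map_natCast] at h1 h2
  push_cast at h1 h2
  simp only [CharP.cast_eq_zero, mul_zero, add_zero, zero_add, ZMod.natCast_val, ZMod.cast_id',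
    id_eq] at h1 h2
  have hu : IsUnit (f : ZMod q) := (ZMod.isUnit_iff_coprime f q).2 hqf.symm
  have hu' : IsUnit (q : ZMod f) := (ZMod.isUnit_iff_coprime q f).2 hqf
  rw [hu.mul_left_inj] at h1
  rw [hu'.mul_left_inj] at h2
  rw [h1, h2]

/-- The generalized Bernoulli number of a character of composite conductor as a sum of carries. -/
theorem bernoulliSum_div_eq_carry {N q f : ℕ} [NeZero N] [NeZero q] [NeZero f] (hN : N = q * f)
    (hqf : q.Coprime f) {χ : 𝐗 N} (h1 : ¬ χ.FactorsThrough q)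
    (h2 : ¬ χ.FactorsThrough f) :
    χ.bernoulliSum / N = -∑ x : ZMod q, ∑ y : ZMod f, χ ((x.val * f + y.val * q : ℕ) : ZMod N) *
      (if q * f ≤ x.val * f + y.val * q then 1 else 0) := by
  subst hN
  set e : ZMod q × ZMod f → ZMod (q * f) := fun z ↦
    ((z.1.val * f + z.2.val * q : ℕ) : ZMod (q * f)) with he
  have hbij : Function.Bijective e := bijective_val_mul_add hqf
  have hq0 : (q : ℂ) ≠ 0 := by exact_mod_cast NeZero.ne q
  have hf0 : (f : ℂ) ≠ 0 := by exact_mod_cast NeZero.ne f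
  have hs1 : ∑ z : ZMod q × ZMod f, χ (e z) * (z.1.val : ℂ) = 0 := by
    rw [← sum_mul_eq_zero_of_not_factorsThrough (Nat.dvd_mul_right q f) h1
      fun a ↦ ((a * (f : ZMod q)⁻¹).val : ℂ)]
    refine Fintype.sum_bijective e hbij _ _ fun z ↦ ?_
    congr 3
    rw [he, map_natCast]
    push_cast
    simp only [CharP.cast_eq_zero, mul_zero, add_zero, ZMod.natCast_val, ZMod.cast_id', id_eq]
    rw [mul_assoc, ZMod.coe_mul_inv_eq_one _ hqf.symm, mul_one]
  have hs2 : ∑ z : ZMod q × ZMod f, χ (e z) * (z.2.val : ℂ) = 0 := by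
    rw [← sum_mul_eq_zero_of_not_factorsThrough (Nat.dvd_mul_left f q) h2
      fun a ↦ ((a * (q : ZMod f)⁻¹).val : ℂ)]
    refine Fintype.sum_bijective e hbij _ _ fun z ↦ ?_
    congr 3
    rw [he, map_natCast]
    push_cast
    simp only [CharP.cast_eq_zero, mul_zero, zero_add, ZMod.natCast_val, ZMod.cast_id', id_eq]
    rw [mul_assoc, ZMod.coe_mul_inv_eq_one _ hqf, mul_one]
  have hb : χ.bernoulliSum = ∑ z : ZMod q × ZMod f, (χ (e z) * (z.1.val : ℂ) * f +
      χ (e z) * (z.2.val : ℂ) * q - (q * f : ℂ) * (χ (e z) *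
        (if q * f ≤ z.1.val * f + z.2.val * q then 1 else 0))) := by
    rw [bernoulliSum]
    symm
    refine Fintype.sum_bijective e hbij _ _ fun z ↦ ?_
    have h3 : ((e z).val : ℤ) = z.1.val * f + z.2.val * q -
        q * f * (if q * f ≤ z.1.val * f + z.2.val * q then 1 else 0) := val_mul_add_val_mul z.1 z.2
    have h4 : ((e z).val : ℂ) = z.1.val * f + z.2.val * q -
        q * f * (if q * f ≤ z.1.val * f + z.2.val * q then 1 else 0) := by
      have := congrArg (Int.cast (R := ℂ)) h3
      push_cast at this ⊢
      exact this
    rw [h4]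
    ring
  rw [hb, sum_sub_distrib, sum_add_distrib, ← Finset.sum_mul, ← Finset.sum_mul, hs1,
    hs2, ← mul_sum, Fintype.sum_prod_type]
  have hS : ∑ x : ZMod q, ∑ y : ZMod f, χ ((x.val * f + y.val * q : ℕ) : ZMod (q * f)) *
      (if q * f ≤ x.val * f + y.val * q then 1 else 0) = ∑ x : ZMod q, ∑ y : ZMod f, χ (e (x, y)) *
      (if q * f ≤ x.val * f + y.val * q then 1 else 0) := rfl
  rw [hS, Nat.cast_mul]
  field_simp
  ring

theorem isIntegral_apply {N : ℕ} [NeZero N] (χ : 𝐗 N) (a : ZMod N) :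
    IsIntegral ℤ (χ a) := by
  by_cases ha : IsUnit a
  · have h1 : χ a ^ Fintype.card (ZMod N)ˣ = 1 := by
      rw [← map_pow, ← ha.unit_spec, ← Units.val_pow_eq_pow_val, pow_card_eq_one, Units.val_one,
        map_one]
    exact IsIntegral.of_pow Fintype.card_pos (by rw [h1]; exact isIntegral_one)
  · rw [χ.map_nonunit ha]; exact isIntegral_zero

theorem isIntegral_bernoulliSum {N : ℕ} [NeZero N] (χ : 𝐗 N) :
    IsIntegral ℤ χ.bernoulliSum :=
  IsIntegral.sum _ fun a _ ↦ (isIntegral_algebraMap (R := ℤ) (x := (a.val : ℤ))).mul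
    (χ.isIntegral_apply a)

theorem not_factorsThrough_of_isPrimitive {N d : ℕ} [NeZero N] {χ : 𝐗 N}
    (hχ : χ.IsPrimitive) (hd : d < N) : ¬ χ.FactorsThrough d := fun h ↦ by
  have h1 := Nat.le_of_dvd (Nat.pos_of_ne_zero fun h0 ↦ by
    have := h.dvd
    rw [h0, zero_dvd_iff] at this
    exact NeZero.ne N this) (conductor_dvd_of_mem_conductorSet χ h)
  rw [isPrimitive_def] at hχ
  omega

theorem isIntegral_bernoulliSum_div {N : ℕ} [NeZero N] (hsq : Squarefree N) (hN1 : N ≠ 1)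
    (hNp : ¬ N.Prime) {χ : 𝐗 N} (hχ : χ.IsPrimitive) :
    IsIntegral ℤ (χ.bernoulliSum / N) := by
  obtain ⟨f, hf⟩ := N.minFac_dvd
  have hp := Nat.minFac_prime hN1
  set q := N.minFac
  have : NeZero q := ⟨hp.ne_zero⟩
  have : NeZero f := ⟨by rintro rfl; exact NeZero.ne N (by rw [hf, mul_zero])⟩
  have hf1 : f ≠ 1 := by rintro rfl; exact hNp (by rw [hf, mul_one]; exact hp)
  have hcop : q.Coprime f := Nat.coprime_of_squarefree_mul (hf ▸ hsq)
  have hqf := hp.one_lt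
  have hf2 : 1 < f := by have := NeZero.pos f; omega
  rw [bernoulliSum_div_eq_carry hf hcop (not_factorsThrough_of_isPrimitive hχ (by rw [hf]; nlinarith))
    (not_factorsThrough_of_isPrimitive hχ (by rw [hf]; nlinarith))]
  refine (IsIntegral.sum _ fun x _ ↦ IsIntegral.sum _ fun y _ ↦ (χ.isIntegral_apply _).mul ?_).neg
  split_ifs
  exacts [isIntegral_one, isIntegral_zero]

/-- The generalized Bernoulli number `B_{1,χ*}`. -/
noncomputable def bernoulliOne {N : ℕ} [NeZero N] (χ : 𝐗 N) : ℂ :=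
  χ.primitiveCharacter.bernoulliSum / χ.conductor

theorem bernoulliOne_eq_of_changeLevel {M d : ℕ} [NeZero M] [NeZero d]
    {χ : 𝐗 M} (hd : d ∣ M) {ψ : 𝐗 d}
    (hψ : changeLevel hd ψ = χ) (h : d = χ.conductor) :
    χ.bernoulliOne = ψ.bernoulliSum / d := by
  subst h
  have : ψ = χ.primitiveCharacter := by
    refine changeLevel_injective hd ?_
    rw [hψ]
    exact χ.changeLevel_primitiveCharacter.symm
  rw [this, bernoulliOne]

theorem bernoulliOne_changeLevel {M d : ℕ} [NeZero M] [NeZero d] (hd : d ∣ M)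
    (ψ : 𝐗 d) : (changeLevel hd ψ).bernoulliOne = ψ.bernoulliOne := by
  refine bernoulliOne_eq_of_changeLevel (ψ.conductor_dvd_level.trans hd) ?_
    (conductor_changeLevel _ hd).symm
  rw [changeLevel_trans _ ψ.conductor_dvd_level hd, changeLevel_primitiveCharacter]

theorem bernoulliOne_of_isPrimitive {N : ℕ} [NeZero N] {χ : 𝐗 N}
    (hχ : χ.IsPrimitive) : χ.bernoulliOne = χ.bernoulliSum / N :=
  bernoulliOne_eq_of_changeLevel dvd_rfl (changeLevel_self χ) hχ.symm

theorem bernoulliOne_inv {N : ℕ} [NeZero N] (χ : 𝐗 N) :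
    χ⁻¹.bernoulliOne = starRingEnd ℂ χ.bernoulliOne := by
  have h : χ.primitiveCharacter⁻¹.bernoulliSum = starRingEnd ℂ χ.primitiveCharacter.bernoulliSum := by
    rw [bernoulliSum, bernoulliSum, map_sum]
    refine sum_congr rfl fun a _ ↦ ?_
    rw [map_mul, map_natCast, starRingEnd_apply, MulChar.star_apply']
  rw [bernoulliOne_eq_of_changeLevel χ.conductor_dvd_level (ψ := χ.primitiveCharacter⁻¹)
    (by rw [map_inv, changeLevel_primitiveCharacter]) χ.conductor_inv.symm, h, bernoulliOne,
    map_div₀, map_natCast]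

theorem sq_prod_norm_bernoulliOne (N : ℕ) [NeZero N] :
    ((∏ χ : 𝐗 N with χ (-1) = -1, ‖χ.bernoulliOne‖ : ℝ) : ℂ) ^ 2 =
      (∏ χ : 𝐗 N with χ (-1) = -1, χ.bernoulliOne) ^ 2 := by
  have h1 : ∏ χ : 𝐗 N with χ (-1) = -1, χ⁻¹.bernoulliOne =
      ∏ χ : 𝐗 N with χ (-1) = -1, χ.bernoulliOne := by
    have hinv : ∀ χ : 𝐗 N, χ (-1) = -1 → χ⁻¹ (-1) = -1 := by
      intro χ h
      rw [← MulChar.star_apply', h]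
      simp
    refine Finset.prod_nbij' (fun χ ↦ χ⁻¹) (fun χ ↦ χ⁻¹) ?_ ?_ (by simp) (by simp) (by simp)
    · intro χ hχ
      simp only [mem_filter, mem_univ, true_and] at hχ ⊢
      exact hinv χ hχ
    · intro χ hχ
      simp only [mem_filter, mem_univ, true_and] at hχ ⊢
      exact hinv χ hχ
  calc _ = ∏ χ : 𝐗 N with χ (-1) = -1, (χ.bernoulliOne * χ⁻¹.bernoulliOne) := by
        rw [Complex.ofReal_prod, ← Finset.prod_pow]
        refine prod_congr rfl fun χ _ ↦ ?_
        rw [bernoulliOne_inv, Complex.mul_conj']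
    _ = _ := by rw [prod_mul_distrib, h1, sq]

end DirichletCharacter

end Carry

section BernoulliValuation

open Finset DirichletCharacter

theorem exists_valuationSubring_of_prime {l : ℕ} (hl : l.Prime) :
    ∃ B : ValuationSubring ℂ, (∀ x, IsIntegral ℤ x → B.valuation x ≤ 1) ∧
      B.valuation (l : ℂ) < 1 := by
  set A : Subring ℂ := (integralClosure ℤ ℂ).toSubring with hA
  have hlA : (l : ℂ) ∈ A := (mem_integralClosure_iff ℤ ℂ).2 (isIntegral_algebraMap (R := ℤ) (x := (l : ℤ)))
  have hl0 : (l : ℂ) ≠ 0 := by exact_mod_cast hl.ne_zero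
  have hI : Ideal.span {(⟨l, hlA⟩ : A)} ≠ ⊤ := by
    intro h
    rw [Ideal.span_singleton_eq_top] at h
    obtain ⟨⟨y, hy⟩, hy1⟩ := h.exists_right_inv
    have hy2 : (l : ℂ) * y = 1 := congrArg Subtype.val hy1
    have hy3 : IsIntegral ℤ y := hy
    have hy4 : y = algebraMap ℚ ℂ (1 / l) := by
      rw [eq_ratCast]; push_cast; rw [eq_div_iff hl0, mul_comm, hy2]
    rw [hy4, isIntegral_algebraMap_iff (algebraMap ℚ ℂ).injective] at hy3
    obtain ⟨z, hz⟩ := IsIntegrallyClosed.isIntegral_iff.1 hy3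
    have hlQ : (l : ℚ) ≠ 0 := by exact_mod_cast hl.ne_zero
    have hz2 : (z : ℚ) * l = 1 := by
      rw [show (z : ℚ) = 1 / l from hz, one_div, inv_mul_cancel₀ hlQ]
    have hz3 : z * l = 1 := by exact_mod_cast hz2
    have h5 := Int.isUnit_iff.1 (IsUnit.of_mul_eq_one_right z hz3)
    have := hl.two_le
    omega
  obtain ⟨B, hB, hB'⟩ := Ideal.image_subset_nonunits_valuationSubring _ hI
  refine ⟨B, fun x hx ↦ (B.valuation_le_one_iff x).2 (hB ((mem_integralClosure_iff ℤ ℂ).2 hx)), ?_⟩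
  exact B.mem_nonunits_iff.1 (hB' ⟨⟨l, hlA⟩, Ideal.subset_span rfl, rfl⟩)

variable {B : ValuationSubring ℂ}

theorem valuation_intCast_le_one (hB : ∀ x, IsIntegral ℤ x → B.valuation x ≤ 1)
    (n : ℤ) : B.valuation (n : ℂ) ≤ 1 :=
  hB _ (isIntegral_algebraMap (R := ℤ) (x := n))

theorem valuation_intCast_lt_one (hB : ∀ x, IsIntegral ℤ x → B.valuation x ≤ 1)
    {l : ℕ} (hl : B.valuation (l : ℂ) < 1) {n : ℤ} (h : (l : ℤ) ∣ n) :
    B.valuation (n : ℂ) < 1 := by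
  obtain ⟨c, rfl⟩ := h
  push_cast
  rw [map_mul]
  exact mul_lt_one_of_lt_of_le hl (valuation_intCast_le_one hB c)

theorem valuation_natCast_eq_one (hB : ∀ x, IsIntegral ℤ x → B.valuation x ≤ 1)
    {l n : ℕ} (hl : B.valuation (l : ℂ) < 1) (h : n.Coprime l) :
    B.valuation (n : ℂ) = 1 := by
  refine le_antisymm (by exact_mod_cast valuation_intCast_le_one hB (n : ℤ)) ?_
  by_contra! hlt
  obtain ⟨a, b, hab⟩ := Nat.isCoprime_iff_coprime.2 h
  have h1 : ((a : ℂ) * n + b * l) = 1 := by exact_mod_cast congrArg (Int.cast (R := ℂ)) hab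
  have h2 : B.valuation ((a : ℂ) * n + b * l) < 1 := by
    refine Valuation.map_add_lt _ ?_ ?_
    · rw [map_mul, mul_comm]; exact mul_lt_one_of_lt_of_le hlt (valuation_intCast_le_one hB a)
    · rw [map_mul, mul_comm]; exact mul_lt_one_of_lt_of_le hl (valuation_intCast_le_one hB b)
  rw [h1, map_one] at h2
  exact lt_irrefl _ h2

theorem prod_bernoulliOne_eq {M : ℕ} [NeZero M] :
    ∏ χ : 𝐗 M with χ (-1) = -1, χ.bernoulliOne =
      (∏ p ∈ M.primeFactors, ∏ χ : 𝐗 M with χ (-1) = -1 ∧ χ.conductor = p,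
        χ.bernoulliOne) *
      ∏ χ : 𝐗 M with χ (-1) = -1 ∧ ¬ χ.conductor.Prime, χ.bernoulliOne := by
  rw [← Finset.prod_filter_mul_prod_filter_not _ fun χ : 𝐗 M ↦
    χ.conductor.Prime, Finset.filter_filter, Finset.filter_filter]
  congr 1
  rw [← Finset.prod_fiberwise_of_maps_to (t := M.primeFactors)
    (g := fun χ : 𝐗 M ↦ χ.conductor)]
  · refine prod_congr rfl fun p hp ↦ prod_congr ?_ fun _ _ ↦ rfl
    ext χ
    simp only [mem_filter, mem_univ, true_and]
    constructor
    · rintro ⟨⟨h1, -⟩, h2⟩; exact ⟨h1, h2⟩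
    · rintro ⟨h1, h2⟩
      exact ⟨⟨h1, h2 ▸ Nat.prime_of_mem_primeFactors hp⟩, h2⟩
  · intro χ hχ
    simp only [mem_filter, mem_univ, true_and] at hχ
    exact Nat.mem_primeFactors.2 ⟨hχ.2, χ.conductor_dvd_level, NeZero.ne M⟩

theorem DirichletCharacter.changeLevel_neg_one {M d : ℕ} [NeZero M] (hd : d ∣ M)
    (ψ : 𝐗 d) : changeLevel hd ψ (-1) = ψ (-1) := by
  have := changeLevel_eq_cast_of_dvd ψ hd (-1)
  rwa [Units.val_neg, Units.val_one, ZMod.cast_neg hd, ZMod.cast_one hd] at this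

theorem DirichletCharacter.conductor_eq_of_prime {p : ℕ} (hp : p.Prime)
    {χ : 𝐗 p} (hχ : χ ≠ 1) : χ.conductor = p := by
  have : NeZero p := ⟨hp.ne_zero⟩
  rcases (Nat.dvd_prime hp).1 χ.conductor_dvd_level with h | h
  · exact absurd ((eq_one_iff_conductor_eq_one).2 h) hχ
  · exact h

theorem DirichletCharacter.ne_one_of_odd {N : ℕ} {χ : 𝐗 N} (hχ : χ (-1) = -1) :
    χ ≠ 1 := by
  rintro rfl
  have h1 : (1 : 𝐗 N) (-1) = 1 := by
    simpa using MulChar.one_apply_coe (R' := ℂ) (-1 : (ZMod N)ˣ)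
  rw [h1] at hχ
  norm_num at hχ

theorem prod_bernoulliOne_of_conductor_eq {M p : ℕ} [NeZero M] [NeZero p] (hp : p.Prime)
    (hpM : p ∣ M) :
    ∏ χ : 𝐗 M with χ (-1) = -1 ∧ χ.conductor = p, χ.bernoulliOne =
      ∏ χ : 𝐗 p with χ (-1) = -1, χ.bernoulliOne := by
  symm
  refine Finset.prod_bij (fun χ _ ↦ changeLevel hpM χ) ?_ ?_ ?_ ?_
  · intro χ hχ
    simp only [mem_filter, mem_univ, true_and] at hχ ⊢
    rw [changeLevel_neg_one, conductor_changeLevel]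
    exact ⟨hχ, conductor_eq_of_prime hp (ne_one_of_odd hχ)⟩
  · intro χ _ χ' _ h
    exact changeLevel_injective hpM h
  · intro χ hχ
    simp only [mem_filter, mem_univ, true_and] at hχ
    have h1 : χ.FactorsThrough p := by
      have := χ.factorsThrough_conductor
      rwa [hχ.2] at this
    refine ⟨h1.χ₀, ?_, h1.eq_changeLevel.symm⟩
    simp only [mem_filter, mem_univ, true_and]
    rw [← changeLevel_neg_one hpM, ← h1.eq_changeLevel]
    exact hχ.1
  · intro χ _
    exact (bernoulliOne_changeLevel hpM χ).symm

variable (M : ℕ) [NeZero M] (K : Type*) [Field K] [NumberField K] [IsCyclotomicExtension {M} ℚ K]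
  [IsCMField K]

theorem sq_classNumber_mul_two_pow (hodd : Odd M) (h1 : M ≠ 1) (hsq : Squarefree M) :
    ((classNumber K : ℂ) * 2 ^ Module.finrank ℚ (𝐑 K)) ^ 2 =
      (classNumber (𝐑 K) * (IsCMField.indexRealUnits K * (2 * M) *
        ∏ χ : 𝐗 M with χ (-1) = -1, χ.bernoulliOne)) ^ 2 := by
  have h2 := classNumber_eq_bernoulli M K hodd h1 hsq
  have h3 : (classNumber K : ℝ) * 2 ^ Module.finrank ℚ (𝐑 K) =
      classNumber (𝐑 K) * (IsCMField.indexRealUnits K * (2 * M)) *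
      ∏ χ : 𝐗 M with χ (-1) = -1, ‖χ.bernoulliOne‖ := by
    have h4 : ∏ χ : 𝐗 M with χ (-1) = -1,
        (‖χ.primitiveCharacter.bernoulliSum‖ / χ.conductor) =
        ∏ χ : 𝐗 M with χ (-1) = -1, ‖χ.bernoulliOne‖ := by
      refine prod_congr rfl fun χ _ ↦ ?_
      rw [bernoulliOne, norm_div, Complex.norm_natCast]
    rw [h2, h4]
    field_simp
  have h5 := congrArg (fun x : ℝ ↦ ((x : ℂ)) ^ 2) h3
  simp only [Complex.ofReal_mul, Complex.ofReal_natCast, Complex.ofReal_pow,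
    Complex.ofReal_ofNat] at h5
  rw [h5, mul_pow, sq_prod_norm_bernoulliOne]
  ring

theorem classNumber_real_dvd (hodd : Odd M) (h1 : M ≠ 1) (hsq : Squarefree M) :
    classNumber (𝐑 K) ∣ classNumber K := by
  have := Subgroup.card_dvd_of_injective _ (extendedHom_real_injective M K hodd h1 hsq)
  rw [classNumber, classNumber, ← Nat.card_eq_fintype_card, ← Nat.card_eq_fintype_card]
  exact this

theorem cyclotomic_isCMField (hodd : Odd M) (h1 : M ≠ 1) (L : Type*) [Field L] [NumberField L]
    [IsCyclotomicExtension {M} ℚ L] : IsCMField L := by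
  have h2 : 2 < M := by
    have := NeZero.pos M
    obtain ⟨c, hc⟩ := hodd
    omega
  exact IsCyclotomicExtension.Rat.isCMField L (S := {M}) ⟨M, rfl, h2⟩

theorem exists_sq_prod_bernoulliOne_eq {p : ℕ} [NeZero p] (hp : p.Prime) (hodd : Odd p) :
    ∃ z : ℕ, (2 * (p * ∏ χ : 𝐗 p with χ (-1) = -1, χ.bernoulliOne)) ^ 2 =
      (z : ℂ) ^ 2 := by
  have : IsCyclotomicExtension {p} ℚ (CyclotomicField p ℚ) :=
    CyclotomicField.isCyclotomicExtension p ℚ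
  have : IsCMField (CyclotomicField p ℚ) := cyclotomic_isCMField p hodd hp.ne_one _
  have h1 := sq_classNumber_mul_two_pow p (CyclotomicField p ℚ) hodd hp.ne_one
    hp.squarefree
  obtain ⟨c, hc⟩ := classNumber_real_dvd p (CyclotomicField p ℚ) hodd hp.ne_one
    hp.squarefree
  rw [hc, indexRealUnits_eq_one p _ hodd hp] at h1
  have h0 : (classNumber (𝐑 (CyclotomicField p ℚ)) : ℂ) ^ 2 ≠ 0 :=
    pow_ne_zero _ (by exact_mod_cast classNumber_ne_zero _)
  refine ⟨c * 2 ^ Module.finrank ℚ (𝐑 (CyclotomicField p ℚ)), ?_⟩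
  refine mul_left_cancel₀ h0 ?_
  push_cast at h1 ⊢
  linear_combination -h1

theorem valuation_prime_mul_prod_le_one (hB : ∀ x, IsIntegral ℤ x → B.valuation x ≤ 1)
    (hB2 : B.valuation 2 = 1) {p : ℕ} [NeZero p] (hp : p.Prime)
    (hodd : Odd p) :
    B.valuation (p * ∏ χ : 𝐗 p with χ (-1) = -1, χ.bernoulliOne) ≤ 1 := by
  obtain ⟨z, hz⟩ := exists_sq_prod_bernoulliOne_eq hp hodd
  have h1 : IsIntegral ℤ (2 * (p * ∏ χ : 𝐗 p with χ (-1) = -1,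
      χ.bernoulliOne)) := by
    refine IsIntegral.of_pow two_pos ?_
    rw [hz]
    exact (isIntegral_algebraMap (R := ℤ) (x := (z : ℤ))).pow 2
  have h2 := hB _ h1
  rwa [map_mul, hB2, one_mul] at h2

variable {M K}

/-- If conjugation acts trivially on the class group, then the relative class number is a unit
away from `2`, and so is each of its factors. -/
theorem valuation_eq_one_of_classNumber_dvd (hB : ∀ x, IsIntegral ℤ x → B.valuation x ≤ 1)
    (hB2 : B.valuation 2 = 1) (hodd : Odd M) (h1 : M ≠ 1)
    (hsq : Squarefree M) (hdvd : classNumber K ∣ classNumber (𝐑 K) *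
      2 ^ Module.finrank ℚ (𝐑 K)) :
    (∀ p, ∀ _ : NeZero p, p.Prime → p ∣ M →
      B.valuation (p * ∏ χ : 𝐗 p with χ (-1) = -1, χ.bernoulliOne) = 1) ∧
    ∀ χ : 𝐗 M, χ (-1) = -1 → ¬ χ.conductor.Prime →
      B.valuation χ.bernoulliOne = 1 := by
  set n := Module.finrank ℚ (𝐑 K)
  obtain ⟨k, hk⟩ := hdvd
  have hf := sq_classNumber_mul_two_pow M K hodd h1 hsq
  set P := ∏ χ : 𝐗 M with χ (-1) = -1, χ.bernoulliOne with hP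
  have h0 : (classNumber (𝐑 K) : ℂ) ^ 2 ≠ 0 :=
    pow_ne_zero _ (by exact_mod_cast classNumber_ne_zero _)
  have hk' : (classNumber (𝐑 K) : ℂ) * 2 ^ n = classNumber K * k := by
    exact_mod_cast hk
  have h2 : (2 ^ n * 2 ^ n : ℂ) ^ 2 = (IsCMField.indexRealUnits K * k * 2 * (M * P)) ^ 2 := by
    refine mul_left_cancel₀ h0 ?_
    have h3 : ((classNumber (𝐑 K) : ℂ) * 2 ^ n) ^ 2 =
      (classNumber K * k) ^ 2 := by rw [hk']
    linear_combination (k : ℂ) ^ 2 * hf + (2 ^ n) ^ 2 * h3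
  have hv := congrArg B.valuation h2
  rw [map_pow, map_pow, map_mul, map_pow, hB2, one_pow, one_mul, one_pow] at hv
  have hv1 : B.valuation (IsCMField.indexRealUnits K * k * 2 * (M * P)) = 1 :=
    (pow_eq_one_iff.1 hv.symm).resolve_right two_ne_zero
  rw [map_mul, map_mul, map_mul, hB2, mul_one] at hv1
  have hMP : (M : ℂ) * P = (∏ p ∈ M.primeFactors, ((p : ℂ) *
      ∏ χ : 𝐗 M with χ (-1) = -1 ∧ χ.conductor = p, χ.bernoulliOne)) *
      ∏ χ : 𝐗 M with χ (-1) = -1 ∧ ¬ χ.conductor.Prime, χ.bernoulliOne := by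
    rw [prod_mul_distrib, hP, prod_bernoulliOne_eq, ← Nat.cast_prod,
      Nat.prod_primeFactors_of_squarefree hsq, mul_assoc]
  have hp1 : ∀ p ∈ M.primeFactors, B.valuation ((p : ℂ) *
      ∏ χ : 𝐗 M with χ (-1) = -1 ∧ χ.conductor = p, χ.bernoulliOne) ≤ 1 := by
    intro p hp
    have hpp := Nat.prime_of_mem_primeFactors hp
    have : NeZero p := ⟨hpp.ne_zero⟩
    rw [prod_bernoulliOne_of_conductor_eq hpp (Nat.dvd_of_mem_primeFactors hp)]
    exact valuation_prime_mul_prod_le_one hB hB2 hpp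
      (hodd.of_dvd_nat (Nat.dvd_of_mem_primeFactors hp))
  have hc1 : ∀ χ ∈ (univ.filter fun χ : 𝐗 M ↦
      χ (-1) = -1 ∧ ¬ χ.conductor.Prime), B.valuation χ.bernoulliOne ≤ 1 := by
    intro χ hχ
    simp only [mem_filter, mem_univ, true_and] at hχ
    refine hB _ (isIntegral_bernoulliSum_div (hsq.squarefree_of_dvd χ.conductor_dvd_level) ?_ hχ.2
      χ.primitiveCharacter_isPrimitive)
    intro h
    exact ne_one_of_odd hχ.1 ((eq_one_iff_conductor_eq_one).2 h)
  have hMP1 : B.valuation (M * P) = 1 := by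
    have hle : B.valuation (M * P) ≤ 1 := by
      rw [hMP, map_mul, map_prod, map_prod]
      exact mul_le_one' (Finset.prod_le_one' hp1) (Finset.prod_le_one' hc1)
    have hq : B.valuation (IsCMField.indexRealUnits K : ℂ) * B.valuation (k : ℂ) ≤ 1 :=
      mul_le_one' (by exact_mod_cast valuation_intCast_le_one hB (IsCMField.indexRealUnits K : ℤ))
        (by exact_mod_cast valuation_intCast_le_one hB (k : ℤ))
    refine le_antisymm hle ?_
    rw [← hv1]
    exact mul_le_of_le_one_left' hq
  rw [hMP, map_mul, map_prod, map_prod] at hMP1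
  have hle1 := Finset.prod_le_one' hp1
  have hle2 := Finset.prod_le_one' hc1
  have he1 := le_antisymm hle1 (by
    rw [← hMP1]; exact mul_le_of_le_one_right' hle2)
  have he2 := le_antisymm hle2 (by
    rw [← hMP1]; exact mul_le_of_le_one_left' hle1)
  constructor
  · intro p _ hp hpM
    rw [← prod_bernoulliOne_of_conductor_eq hp hpM]
    exact (Finset.prod_eq_one_iff_of_le_one' hp1).1 he1 p
      (Nat.mem_primeFactors.2 ⟨hp, hpM, NeZero.ne M⟩)
  · intro χ hχ hχ'
    exact (Finset.prod_eq_one_iff_of_le_one' hc1).1 he2 χ (by simp [hχ, hχ'])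

end BernoulliValuation

section Certificates

open Finset DirichletCharacter

variable {B : ValuationSubring ℂ}

theorem exists_root_valuation_sub_lt_one {f : Polynomial ℂ} (hf : f.Monic) {t : ℂ}
    (ht : B.valuation (f.eval t) < 1) : ∃ w, f.eval w = 0 ∧ B.valuation (w - t) < 1 := by
  by_contra! h
  have hs : f.eval t = (f.roots.map fun a ↦ t - a).prod :=
    (IsAlgClosed.splits f).eval_eq_prod_roots_of_monic hf t
  rw [hs, map_multiset_prod, Multiset.map_map] at ht
  refine ht.not_ge (Multiset.one_le_prod_of_one_le ?_)
  intro x hx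
  obtain ⟨w, hw, rfl⟩ := Multiset.mem_map.1 hx
  have h1 := h w ((Polynomial.mem_roots hf.ne_zero).1 hw)
  rwa [Function.comp_apply, Valuation.map_sub_swap]

theorem valuation_sum_lt_one {ι : Type*} {s : Finset ι} {f : ι → ℂ}
    (h : ∀ i ∈ s, B.valuation (f i) < 1) : B.valuation (∑ i ∈ s, f i) < 1 :=
  Valuation.map_sum_lt _ one_ne_zero h

theorem valuation_mul_lt_one {x y : ℂ} (hx : B.valuation x ≤ 1) (hy : B.valuation y < 1) :
    B.valuation (x * y) < 1 := by
  rw [map_mul, mul_comm]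
  exact mul_lt_one_of_lt_of_le hy hx

/-- `g` generates the multiplicative group modulo `p`. -/
def isGenMod (p g : ℕ) : Bool :=
  g % p != 0 && (List.range (p - 2)).all fun i ↦ g ^ (i + 1) % p != 1

theorem sum_eq_add_sum_pow {p g : ℕ} [Fact p.Prime] (hg : isGenMod p g = true) {β : Type*}
    [AddCommMonoid β] (f : ZMod p → β) :
    ∑ x, f x = f 0 + ∑ i ∈ range (p - 1), f ((g : ZMod p) ^ i) := by
  have hp := (Fact.out : p.Prime)
  rw [isGenMod, Bool.and_eq_true, List.all_eq_true] at hg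
  obtain ⟨hg0, hg1⟩ := hg
  have hg0' : (g : ZMod p) ≠ 0 := by
    rw [Ne, ZMod.natCast_eq_zero_iff]
    intro h
    simp [Nat.mod_eq_zero_of_dvd h] at hg0
  have hpow : ∀ i, i ≠ 0 → i < p - 1 → (g : ZMod p) ^ i ≠ 1 := by
    intro i hi hip h
    have h2 := hg1 (i - 1) (List.mem_range.2 (by omega))
    rw [Nat.sub_add_cancel (Nat.one_le_iff_ne_zero.2 hi)] at h2
    have h3 : ((g ^ i : ℕ) : ZMod p) = ((1 : ℕ) : ZMod p) := by push_cast; exact h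
    rw [ZMod.natCast_eq_natCast_iff, Nat.ModEq, Nat.mod_eq_of_lt hp.one_lt] at h3
    simp [h3] at h2
  have hle : ∀ i j, i ≤ j → j < p - 1 → (g : ZMod p) ^ i = (g : ZMod p) ^ j → i = j := by
    intro i j hij hj h
    by_contra hne
    obtain ⟨k, rfl⟩ := Nat.exists_eq_add_of_le hij
    refine hpow k (by omega) (by omega) ?_
    rw [pow_add] at h
    exact (mul_left_cancel₀ (pow_ne_zero i hg0') ((mul_one _).trans h)).symm
  have hinj : Set.InjOn (fun i ↦ (g : ZMod p) ^ i) (range (p - 1)) := by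
    intro i hi j hj h
    rw [mem_coe, mem_range] at hi hj
    rcases le_total i j with h1 | h1
    · exact hle i j h1 hj h
    · exact (hle j i h1 hi h.symm).symm
  have himage : (range (p - 1)).image (fun i ↦ (g : ZMod p) ^ i) = univ.erase 0 := by
    refine Finset.eq_of_subset_of_card_le (fun x hx ↦ ?_) ?_
    · obtain ⟨i, _, rfl⟩ := mem_image.1 hx
      exact mem_erase.2 ⟨pow_ne_zero _ hg0', mem_univ _⟩
    · rw [card_image_of_injOn hinj, card_range, card_erase_of_mem (mem_univ _), card_univ,
        ZMod.card]
  rw [← Finset.add_sum_erase _ _ (mem_univ (0 : ZMod p)), ← himage, Finset.sum_image hinj]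

theorem pow_half_eq_neg_one {p g : ℕ} [Fact p.Prime] (hp2 : p ≠ 2) (hg : isGenMod p g = true) :
    (g : ZMod p) ^ ((p - 1) / 2) = -1 := by
  have hp := (Fact.out : p.Prime)
  have hp3 : 3 ≤ p := by have := hp.two_le; omega
  rw [isGenMod, Bool.and_eq_true, List.all_eq_true] at hg
  obtain ⟨hg0, hg1⟩ := hg
  have hg0' : (g : ZMod p) ≠ 0 := by
    rw [Ne, ZMod.natCast_eq_zero_iff]
    intro h
    simp [Nat.mod_eq_zero_of_dvd h] at hg0
  have hodd := hp.odd_of_ne_two hp2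
  obtain ⟨c, hc⟩ := hodd
  have h1 : (g : ZMod p) ^ ((p - 1) / 2) * (g : ZMod p) ^ ((p - 1) / 2) = 1 := by
    rw [← pow_add, show (p - 1) / 2 + (p - 1) / 2 = p - 1 by omega]
    exact ZMod.pow_card_sub_one_eq_one hg0'
  refine (mul_self_eq_one_iff.1 h1).resolve_left fun h ↦ ?_
  have h2 := hg1 ((p - 1) / 2 - 1) (List.mem_range.2 (by omega))
  rw [Nat.sub_add_cancel (by omega)] at h2
  have h3 : ((g ^ ((p - 1) / 2) : ℕ) : ZMod p) = ((1 : ℕ) : ZMod p) := by push_cast; exact h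
  rw [ZMod.natCast_eq_natCast_iff, Nat.ModEq, Nat.mod_eq_of_lt hp.one_lt] at h3
  simp [h3] at h2

/-- The pairs in `L` are the values of `χ` (modulo the maximal ideal of `B`, up to a common factor)
and the residues at which they are taken. -/
def CharReduces (B : ValuationSubring ℂ) {N : ℕ} [NeZero N] (χ : 𝐗 N)
    (L : List (ℕ × ℕ)) : Prop :=
  ∃ c : ℂ, B.valuation c ≤ 1 ∧ ∀ F : ℕ → ℤ, B.valuation (∑ x : ZMod N, χ x * F x.val -
    c * ((L.map fun a ↦ (a.1 : ℤ) * F a.2).sum : ℤ)) < 1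

/-- The values of the character `g ^ i ↦ t ^ i`. -/
def powList (p g t : ℕ) : List (ℕ × ℕ) := (List.range (p - 1)).map fun i ↦ (t ^ i, g ^ i % p)

theorem exists_charReduces (hB : ∀ x, IsIntegral ℤ x → B.valuation x ≤ 1) {l : ℕ}
    (hl : B.valuation (l : ℂ) < 1) {p g t : ℕ} [Fact p.Prime] (hp2 : p ≠ 2)
    (hg : isGenMod p g = true) (ht : l ∣ ∑ i ∈ range (p - 1), t ^ i) :
    ∃ χ : 𝐗 p, χ ≠ 1 ∧ CharReduces B χ (powList p g t) ∧
      B.valuation (χ (-1) - t ^ ((p - 1) / 2)) < 1 := by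
  have hp := (Fact.out : p.Prime)
  have hp3 : 3 ≤ p := by have := hp.two_le; omega
  obtain ⟨w, hw0, hwt⟩ : ∃ w : ℂ, ∑ i ∈ range (p - 1), w ^ i = 0 ∧ B.valuation (w - t) < 1 := by
    have hmon : (∑ i ∈ range (p - 1), (Polynomial.X : Polynomial ℂ) ^ i).Monic :=
      Polynomial.monic_geom_sum_X (by omega)
    have hev : ∀ z : ℂ, (∑ i ∈ range (p - 1), (Polynomial.X : Polynomial ℂ) ^ i).eval z =
        ∑ i ∈ range (p - 1), z ^ i := fun z ↦ by
      rw [Polynomial.eval_finsetSum]; simp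
    obtain ⟨w, hw, hw'⟩ := exists_root_valuation_sub_lt_one (B := B) hmon (t := (t : ℂ)) (by
      rw [hev]
      have := valuation_intCast_lt_one hB hl (n := ((∑ i ∈ range (p - 1), t ^ i : ℕ) : ℤ))
        (by exact_mod_cast ht)
      push_cast at this
      exact this)
    exact ⟨w, by rw [← hev, hw], hw'⟩
  have hwp : w ^ (p - 1) = 1 := by
    have := geom_sum_mul w (p - 1)
    rw [hw0, zero_mul] at this
    exact (sub_eq_zero.1 this.symm)
  have hw1 : w ≠ 1 := by
    rintro rfl
    simp only [one_pow, sum_const, card_range, mul_one, nsmul_eq_mul] at hw0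
    have : p - 1 = 0 := by exact_mod_cast hw0
    omega
  have hwu : w ≠ 0 := by
    rintro rfl
    rw [zero_pow (by omega)] at hwp
    exact zero_ne_one hwp
  have hg0 : (g : ZMod p) ≠ 0 := by
    rw [isGenMod, Bool.and_eq_true] at hg
    rw [Ne, ZMod.natCast_eq_zero_iff]
    intro h
    simp [Nat.mod_eq_zero_of_dvd h] at hg
  have hgen : ∀ x : (ZMod p)ˣ, x ∈ Subgroup.zpowers (Units.mk0 (g : ZMod p) hg0) := by
    intro x
    by_contra hx
    have h1 := sum_eq_add_sum_pow hg fun y : ZMod p ↦ if y = x then (1 : ℕ) else 0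
    rw [Finset.sum_ite_eq' univ, if_pos (mem_univ _), if_neg (fun h ↦ x.ne_zero h.symm),
      zero_add] at h1
    rw [Finset.sum_eq_zero] at h1
    · exact one_ne_zero h1
    · intro i _
      rw [if_neg]
      intro h
      exact hx ⟨i, Units.ext (by simpa using h)⟩
  have hwroot : Units.mk0 w hwu ∈ rootsOfUnity (Fintype.card (ZMod p)ˣ) ℂ := by
    rw [mem_rootsOfUnity, ZMod.card_units_eq_totient, Nat.totient_prime hp]
    exact Units.ext (by simpa using hwp)
  set χ : 𝐗 p := MulChar.ofRootOfUnity hwroot hgen with hχ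
  have hχg : χ (g : ZMod p) = w := by
    have := MulChar.ofRootOfUnity_spec hwroot hgen
    simpa using this
  have h_int : B.valuation w ≤ 1 := hB w (IsIntegral.of_pow (by omega : 0 < p - 1)
    (by rw [hwp]; exact isIntegral_one))
  have hpow : ∀ i : ℕ, B.valuation (w ^ i - (t : ℂ) ^ i) < 1 := by
    intro i
    rw [← geom_sum₂_mul, map_mul, mul_comm]
    refine mul_lt_one_of_lt_of_le hwt (Valuation.map_sum_le _ fun j _ ↦ ?_)
    rw [map_mul, map_pow, map_pow]
    exact mul_le_one' (pow_le_one' h_int _) (pow_le_one' (by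
      exact_mod_cast valuation_intCast_le_one hB (t : ℤ)) _)
  refine ⟨χ, ?_, ⟨1, by rw [map_one], fun F ↦ ?_⟩, ?_⟩
  · intro h
    rw [h, MulChar.one_apply (isUnit_iff_ne_zero.2 hg0)] at hχg
    exact hw1 hχg.symm
  · have h1 := sum_eq_add_sum_pow hg fun x ↦ χ x * F x.val
    rw [h1, map_zero' χ hp.ne_one, zero_mul, zero_add, powList, List.map_map, one_mul,
      show ∀ f : ℕ → ℤ, ((List.range (p - 1)).map f).sum = ∑ i ∈ range (p - 1), f i from
        fun f ↦ rfl]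
    push_cast
    rw [← sum_sub_distrib]
    refine valuation_sum_lt_one fun i _ ↦ ?_
    have h2 : ((g : ZMod p) ^ i).val = g ^ i % p := by
      rw [← Nat.cast_pow, ZMod.val_natCast]
    rw [map_pow, hχg, h2, Function.comp_apply]
    push_cast
    rw [← sub_mul, mul_comm]
    exact valuation_mul_lt_one (valuation_intCast_le_one hB _) (hpow i)
  · rw [← pow_half_eq_neg_one hp2 hg, map_pow, hχg]
    exact hpow _

theorem CharReduces.sum_sum {N N' : ℕ} [NeZero N] [NeZero N']
    (hB : ∀ x, IsIntegral ℤ x → B.valuation x ≤ 1)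
    {χ : 𝐗 N} {χ' : 𝐗 N'} {L L' : List (ℕ × ℕ)}
    (h : CharReduces B χ L) (h' : CharReduces B χ' L') :
    ∃ c : ℂ, B.valuation c ≤ 1 ∧ ∀ F : ℕ → ℕ → ℤ,
      B.valuation (∑ x : ZMod N, ∑ y : ZMod N', χ x * χ' y * F x.val y.val -
        c * ((L.map fun a ↦ (L'.map fun b ↦ (a.1 : ℤ) * (b.1 : ℤ) * F a.2 b.2).sum).sum : ℤ)) <
          1 := by
  obtain ⟨c, hc, h⟩ := h
  obtain ⟨c', hc', h'⟩ := h'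
  refine ⟨c * c', by rw [map_mul]; exact mul_le_one' hc hc', fun F ↦ ?_⟩
  set G : ℕ → ℤ := fun m ↦ (L'.map fun b ↦ (b.1 : ℤ) * F m b.2).sum with hG
  have hGF : (L.map fun a ↦ (L'.map fun b ↦ (a.1 : ℤ) * (b.1 : ℤ) * F a.2 b.2).sum) =
      L.map fun a ↦ (a.1 : ℤ) * G a.2 := by
    refine List.map_congr_left fun a _ ↦ ?_
    rw [hG, ← List.sum_map_mul_left]
    simp only [mul_assoc]
  have h1 : B.valuation (∑ x : ZMod N, χ x * (∑ y : ZMod N', χ' y * F x.val y.val -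
      c' * (G x.val : ℤ))) < 1 :=
    valuation_sum_lt_one fun x _ ↦
      valuation_mul_lt_one (hB _ (χ.isIntegral_apply x)) (h' fun m ↦ F x.val m)
  have h2 := valuation_mul_lt_one hc' (h G)
  refine lt_of_eq_of_lt ?_ (Valuation.map_add_lt _ h1 h2)
  congr 1
  rw [hGF]
  simp only [mul_sub, sum_sub_distrib, mul_sum, mul_assoc]
  rw [show ∑ x : ZMod N, χ x * (c' * (G x.val : ℂ)) = ∑ x : ZMod N, c' * (χ x * (G x.val : ℂ)) from
    sum_congr rfl fun x _ ↦ by ring]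
  ring

/-- The product of two characters of coprime moduli. -/
noncomputable def prodChar {q f : ℕ} (χ : 𝐗 q) (χ' : 𝐗 f) :
    𝐗 (q * f) :=
  changeLevel (Nat.dvd_mul_right q f) χ * changeLevel (Nat.dvd_mul_left f q) χ'

theorem prodChar_natCast {q f : ℕ} [NeZero q] [NeZero f] (χ : 𝐗 q)
    (χ' : 𝐗 f) (a : ℕ) : prodChar χ χ' a = χ a * χ' a := by
  by_cases ha : a.Coprime (q * f)
  · have h1 : IsCoprime (a : ℤ) ((q * f : ℕ) : ℤ) := Nat.isCoprime_iff_coprime.2 ha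
    have h2 := changeLevel_eq_cast_of_dvd' χ (Nat.dvd_mul_right q f) h1
    have h3 := changeLevel_eq_cast_of_dvd' χ' (Nat.dvd_mul_left f q) h1
    rw [Int.cast_natCast, Int.cast_natCast] at h2 h3
    rw [prodChar, MulChar.mul_apply, h2, h3]
  · rw [MulChar.map_nonunit _ (by rwa [ZMod.isUnit_iff_coprime])]
    rw [Nat.coprime_mul_iff_right, not_and_or] at ha
    rcases ha with h | h
    · rw [χ.map_nonunit (by rwa [ZMod.isUnit_iff_coprime]), zero_mul]
    · rw [χ'.map_nonunit (by rwa [ZMod.isUnit_iff_coprime]), mul_zero]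

theorem prodChar_neg_one {q f : ℕ} [NeZero q] [NeZero f] (χ : 𝐗 q)
    (χ' : 𝐗 f) : prodChar χ χ' (-1) = χ (-1) * χ' (-1) := by
  rw [prodChar, MulChar.mul_apply, changeLevel_neg_one, changeLevel_neg_one]

theorem prodChar_val_mul_add {q f : ℕ} [NeZero q] [NeZero f] (χ : 𝐗 q)
    (χ' : 𝐗 f) (x : ZMod q) (y : ZMod f) :
    prodChar χ χ' ((x.val * f + y.val * q : ℕ) : ZMod (q * f)) =
      χ f * χ' q * (χ x * χ' y) := by
  rw [prodChar_natCast]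
  push_cast
  simp only [CharP.cast_eq_zero, mul_zero, add_zero, zero_add, ZMod.natCast_val, ZMod.cast_id',
    id_eq, map_mul]
  ring

theorem conductor_prodChar {q f : ℕ} [NeZero q] [NeZero f] (hqf : q.Coprime f)
    {χ : 𝐗 q} {χ' : 𝐗 f} (h : χ.IsPrimitive)
    (h' : χ'.IsPrimitive) : (prodChar χ χ').IsPrimitive := by
  rw [isPrimitive_def] at *
  have h1 : changeLevel (Nat.dvd_mul_right q f) χ =
      prodChar χ χ' * (changeLevel (Nat.dvd_mul_left f q) χ')⁻¹ := by
    rw [prodChar, mul_inv_cancel_right]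
  have h2 : changeLevel (Nat.dvd_mul_left f q) χ' =
      prodChar χ χ' * (changeLevel (Nat.dvd_mul_right q f) χ)⁻¹ := by
    rw [prodChar, mul_comm (changeLevel _ χ), mul_inv_cancel_right]
  have h3 := conductor_mul_dvd_lcm_conductor (prodChar χ χ')
    (changeLevel (Nat.dvd_mul_left f q) χ')⁻¹
  have h4 := conductor_mul_dvd_lcm_conductor (prodChar χ χ')
    (changeLevel (Nat.dvd_mul_right q f) χ)⁻¹
  rw [← h1, conductor_inv, conductor_changeLevel, conductor_changeLevel, h, h'] at h3
  rw [← h2, conductor_inv, conductor_changeLevel, conductor_changeLevel, h, h'] at h4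
  have h5 : q ∣ (prodChar χ χ').conductor :=
    hqf.dvd_of_dvd_mul_right (h3.trans (Nat.lcm_dvd_mul _ _))
  have h6 : f ∣ (prodChar χ χ').conductor :=
    hqf.symm.dvd_of_dvd_mul_right (h4.trans (Nat.lcm_dvd_mul _ _))
  exact Nat.dvd_antisymm (conductor_dvd_level _) (hqf.mul_dvd_of_dvd_of_dvd h5 h6)

/-- The values of a product of two characters. -/
def prodList (q f : ℕ) (L L' : List (ℕ × ℕ)) : List (ℕ × ℕ) :=
  L.flatMap fun a ↦ L'.map fun b ↦ (a.1 * b.1, (a.2 * f + b.2 * q) % (q * f))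

theorem CharReduces.prod {q f : ℕ} [NeZero q] [NeZero f]
    (hB : ∀ x, IsIntegral ℤ x → B.valuation x ≤ 1) (hqf : q.Coprime f)
    {χ : 𝐗 q} {χ' : 𝐗 f} {L L' : List (ℕ × ℕ)}
    (h : CharReduces B χ L) (h' : CharReduces B χ' L') :
    CharReduces B (prodChar χ χ') (prodList q f L L') := by
  obtain ⟨c, hc, H⟩ := h.sum_sum hB h'
  refine ⟨χ f * χ' q * c, ?_, fun F ↦ ?_⟩
  · rw [map_mul, map_mul]
    exact mul_le_one' (mul_le_one' (hB _ (χ.isIntegral_apply _)) (hB _ (χ'.isIntegral_apply _))) hc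
  have h1 := valuation_mul_lt_one (x := χ f * χ' q) (by
    rw [map_mul]
    exact mul_le_one' (hB _ (χ.isIntegral_apply _)) (hB _ (χ'.isIntegral_apply _)))
    (H fun m n ↦ F ((m * f + n * q) % (q * f)))
  refine lt_of_eq_of_lt ?_ h1
  congr 1
  have h2 : ∑ a : ZMod (q * f), prodChar χ χ' a * F a.val = χ f * χ' q *
      ∑ x : ZMod q, ∑ y : ZMod f, χ x * χ' y * F ((x.val * f + y.val * q) % (q * f)) := by
    rw [← Fintype.sum_prod_type', mul_sum]
    symm
    refine Fintype.sum_bijective _ (bijective_val_mul_add hqf) _ _ fun z ↦ ?_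
    rw [prodChar_val_mul_add, ZMod.val_natCast]
    ring
  rw [h2, mul_sub, ← mul_assoc]
  congr 3
  rw [prodList, List.map_flatMap, List.flatMap_def, List.sum_flatten]
  simp only [List.map_map, Function.comp_def, Nat.cast_mul]

/-- The sum of carries attached to a product of two characters. -/
def carrySum (q f : ℕ) (L L' : List (ℕ × ℕ)) : ℕ :=
  (L.map fun a ↦ (L'.map fun b ↦
    if q * f ≤ a.2 * f + b.2 * q then a.1 * b.1 else 0).sum).sum

theorem valuation_bernoulliSum_prodChar_lt_one {q f : ℕ} [NeZero q] [NeZero f]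
    (hB : ∀ x, IsIntegral ℤ x → B.valuation x ≤ 1) (hq1 : q ≠ 1) (hf1 : f ≠ 1)
    (hqf : q.Coprime f) {l : ℕ} (hl : B.valuation (l : ℂ) < 1)
    {χ : 𝐗 q} {χ' : 𝐗 f} {L L' : List (ℕ × ℕ)}
    (hχ : χ.IsPrimitive) (hχ' : χ'.IsPrimitive)
    (h : CharReduces B χ L) (h' : CharReduces B χ' L') (hs : l ∣ carrySum q f L L') :
    B.valuation ((prodChar χ χ').bernoulliSum / (q * f : ℕ)) < 1 := by
  obtain ⟨c, hc, H⟩ := h.sum_sum hB h'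
  have hq0 := NeZero.pos q
  have hf0 := NeZero.pos f
  have hprim := conductor_prodChar hqf hχ hχ'
  rw [bernoulliSum_div_eq_carry rfl hqf
    (not_factorsThrough_of_isPrimitive hprim (by nlinarith [show 2 ≤ f by omega]))
    (not_factorsThrough_of_isPrimitive hprim (by nlinarith [show 2 ≤ q by omega])),
    Valuation.map_neg]
  have h1 := H fun m n ↦ if q * f ≤ m * f + n * q then 1 else 0
  have h2 : (L.map fun a ↦ (L'.map fun b ↦ (a.1 : ℤ) * (b.1 : ℤ) *
      (if q * f ≤ a.2 * f + b.2 * q then 1 else 0)).sum).sum = (carrySum q f L L' : ℤ) := by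
    rw [carrySum, Nat.cast_list_sum, List.map_map]
    congr 1
    refine List.map_congr_left fun a _ ↦ ?_
    rw [Function.comp_apply, Nat.cast_list_sum, List.map_map]
    congr 1
    refine List.map_congr_left fun b _ ↦ ?_
    simp
  rw [h2] at h1
  have h3 := valuation_mul_lt_one hc (valuation_intCast_lt_one hB hl
    (n := (carrySum q f L L' : ℤ)) (by exact_mod_cast hs))
  have h4 := Valuation.map_add_lt _ h1 h3
  rw [sub_add_cancel] at h4
  have h5 := valuation_mul_lt_one (x := χ f * χ' q) (by
    rw [map_mul]
    exact mul_le_one' (hB _ (χ.isIntegral_apply _)) (hB _ (χ'.isIntegral_apply _))) h4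
  refine lt_of_eq_of_lt ?_ h5
  congr 1
  simp only [mul_sum]
  refine sum_congr rfl fun x _ ↦ sum_congr rfl fun y _ ↦ ?_
  rw [prodChar_val_mul_add]
  push_cast
  ring

end Certificates

section Irregular

open Finset DirichletCharacter

/-- A certificate for an odd prime divisor, prime to `p`, of the relative class number of
`ℚ(ζ_p)`. -/
def primeCert (c : ℕ × ℕ × ℕ × ℕ) : Bool :=
  let (p, g, t, r) := c
  isGenMod p g && (t ^ ((p - 1) / 2) + 1) % r == 0 &&
    ((powList p g t).map fun a ↦ a.1 * a.2).sum % r == 0 && r.gcd (2 * p) == 1 && r != 1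

/-- A certificate for an odd divisor of a generalized Bernoulli number of conductor `p * p'`. -/
def pairCert (c : ℕ × ℕ × ℕ × ℕ × ℕ × ℕ × ℕ) : Bool :=
  let (p, g, t, p', g', t', r) := c
  isGenMod p g && isGenMod p' g' && ((List.range (p - 1)).map fun i ↦ t ^ i).sum % r == 0 &&
    ((List.range (p' - 1)).map fun i ↦ t' ^ i).sum % r == 0 &&
    (t ^ ((p - 1) / 2) * t' ^ ((p' - 1) / 2) + 1) % r == 0 &&
    carrySum p p' (powList p g t) (powList p' g' t') % r == 0 && r % 2 == 1 && r != 1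

/-- A certificate for an odd divisor of a generalized Bernoulli number whose conductor is the
product of three primes. -/
def tripleCert (p g t p' g' t' p'' g'' t'' r : ℕ) : Bool :=
  isGenMod p g && isGenMod p' g' && isGenMod p'' g'' &&
    ((List.range (p - 1)).map fun i ↦ t ^ i).sum % r == 0 &&
    ((List.range (p' - 1)).map fun i ↦ t' ^ i).sum % r == 0 &&
    ((List.range (p'' - 1)).map fun i ↦ t'' ^ i).sum % r == 0 &&
    (t ^ ((p - 1) / 2) * (t' ^ ((p' - 1) / 2) * t'' ^ ((p'' - 1) / 2)) + 1) % r == 0 &&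
    carrySum p (p' * p'') (powList p g t)
      (prodList p' p'' (powList p' g' t') (powList p'' g'' t'')) % r == 0 && r % 2 == 1 && r != 1

variable {B : ValuationSubring ℂ}

theorem neg_one_of_valuation_lt_one (hB2 : B.valuation 2 = 1)
    (hB : ∀ x, IsIntegral ℤ x → B.valuation x ≤ 1) {l : ℕ} (hl : B.valuation (l : ℂ) < 1) {s : ℂ}
    (hs : s = 1 ∨ s = -1) {T : ℕ} (hT : B.valuation (s - T) < 1) (hlT : l ∣ T + 1) : s = -1 := by
  refine hs.resolve_left ?_
  rintro rfl
  have h1 := valuation_intCast_lt_one hB hl (n := ((T + 1 : ℕ) : ℤ)) (by exact_mod_cast hlT)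
  have h2 := Valuation.map_add_lt _ hT h1
  push_cast at h2
  rw [show (1 : ℂ) - T + (T + 1) = 2 by ring, hB2] at h2
  exact lt_irrefl _ h2

theorem valuation_mul_sub_mul_lt_one {x y a b : ℂ} (hx : B.valuation x ≤ 1)
    (hb : B.valuation b ≤ 1) (h1 : B.valuation (x - a) < 1) (h2 : B.valuation (y - b) < 1) :
    B.valuation (x * y - a * b) < 1 := by
  rw [show x * y - a * b = x * (y - b) + b * (x - a) by ring]
  exact Valuation.map_add_lt _ (valuation_mul_lt_one hx h2) (valuation_mul_lt_one hb h1)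

variable {M : ℕ} [NeZero M] {K : Type*} [Field K] [NumberField K] [IsCyclotomicExtension {M} ℚ K]
  [IsCMField K]

theorem exists_valuation_of_odd {r : ℕ} (hr : r % 2 = 1) (hr1 : r ≠ 1) :
    ∃ l : ℕ, l.Prime ∧ l ∣ r ∧ ∃ B : ValuationSubring ℂ,
      (∀ x, IsIntegral ℤ x → B.valuation x ≤ 1) ∧ B.valuation (l : ℂ) < 1 ∧
      B.valuation 2 = 1 := by
  have hl := Nat.minFac_prime hr1
  obtain ⟨B, hB, hBl⟩ := exists_valuationSubring_of_prime hl
  refine ⟨_, hl, r.minFac_dvd, B, hB, hBl, ?_⟩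
  have : Nat.Coprime 2 r.minFac := by
    rw [Nat.coprime_primes Nat.prime_two hl]
    intro h
    have := r.minFac_dvd
    rw [← h] at this
    omega
  exact_mod_cast valuation_natCast_eq_one hB hBl this

theorem false_of_primeCert (hodd : Odd M) (h1 : M ≠ 1) (hsq : Squarefree M)
    (hdvd : classNumber K ∣ classNumber (𝐑 K) *
      2 ^ Module.finrank ℚ (𝐑 K)) {p g t r : ℕ} (hp : p.Prime) (hpM : p ∣ M)
    (hc : primeCert (p, g, t, r) = true) : False := by
  simp only [primeCert, Bool.and_eq_true, beq_iff_eq, bne_iff_ne, ne_eq] at hc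
  obtain ⟨⟨⟨⟨hg, ht⟩, hs⟩, hgcd⟩, hr1⟩ := hc
  have hpodd : Odd p := hodd.of_dvd_nat hpM
  have hp2 : p ≠ 2 := by rintro rfl; exact absurd hpodd (by decide)
  have : Fact p.Prime := ⟨hp⟩
  have hr2 : r % 2 = 1 := by
    by_contra h
    have : 2 ∣ r.gcd (2 * p) := Nat.dvd_gcd (by omega) (Nat.dvd_mul_right 2 p)
    rw [hgcd] at this
    omega
  obtain ⟨l, hl, hlr, B, hB, hBl, hB2⟩ := exists_valuation_of_odd hr2 hr1
  have hlp : B.valuation (p : ℂ) = 1 := by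
    refine valuation_natCast_eq_one hB hBl ?_
    rw [Nat.coprime_primes hp hl]
    rintro rfl
    have : p ∣ r.gcd (2 * p) := Nat.dvd_gcd hlr (Nat.dvd_mul_left p 2)
    rw [hgcd] at this
    exact hp.one_lt.ne' (Nat.dvd_one.1 this)
  have hgeom : l ∣ ∑ i ∈ range (p - 1), t ^ i := by
    obtain ⟨k, hk⟩ := hpodd
    have e1 : (p - 1) / 2 = k := by omega
    rw [e1] at ht
    have e2 : p - 1 = k + k := by omega
    rw [e2, Finset.sum_range_add, show ∑ x ∈ range k, t ^ (k + x) = t ^ k * ∑ x ∈ range k, t ^ x by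
      rw [mul_sum]; exact sum_congr rfl fun _ _ ↦ pow_add _ _ _]
    refine (hlr.trans (Nat.dvd_of_mod_eq_zero ht)).trans
      ⟨∑ x ∈ range k, t ^ x, by ring⟩
  obtain ⟨χ, hχ1, ⟨c, hc, hred⟩, hsign⟩ := exists_charReduces hB hBl hp2 hg hgeom
  have hχodd : χ (-1) = -1 := by
    refine neg_one_of_valuation_lt_one hB2 hB hBl χ.apply_neg_one_eq (T := t ^ ((p - 1) / 2)) ?_
      (hlr.trans (Nat.dvd_of_mod_eq_zero ht))
    push_cast
    exact hsign
  have hbern : B.valuation χ.bernoulliSum < 1 := by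
    have h2 := hred fun m ↦ (m : ℤ)
    have h3 : ((powList p g t).map fun a ↦ (a.1 : ℤ) * (a.2 : ℤ)).sum =
        ((((powList p g t).map fun a ↦ a.1 * a.2).sum : ℕ) : ℤ) := by
      rw [Nat.cast_list_sum, List.map_map]
      simp [Function.comp_def]
    rw [h3] at h2
    have h4 := valuation_mul_lt_one hc (valuation_intCast_lt_one hB hBl
      (n := ((((powList p g t).map fun a ↦ a.1 * a.2).sum : ℕ) : ℤ))
      (by exact_mod_cast hlr.trans (Nat.dvd_of_mod_eq_zero hs)))
    have h5 := Valuation.map_add_lt _ h2 h4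
    rw [sub_add_cancel] at h5
    refine lt_of_eq_of_lt ?_ h5
    rw [bernoulliSum]
    congr 1
    exact sum_congr rfl fun x _ ↦ by push_cast; ring
  have hkey := (valuation_eq_one_of_classNumber_dvd hB hB2 hodd h1 hsq hdvd).1 p inferInstance hp hpM
  rw [map_mul, hlp, one_mul, map_prod, ← Finset.mul_prod_erase _ _
    (show χ ∈ _ by simpa using hχodd)] at hkey
  have hval : ∀ χ : 𝐗 p, χ (-1) = -1 →
      B.valuation χ.bernoulliOne = B.valuation χ.bernoulliSum := by
    intro χ h
    rw [bernoulliOne_of_isPrimitive (conductor_eq_of_prime hp (ne_one_of_odd h)), map_div₀, hlp,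
      div_one]
  have hlt := mul_lt_one_of_lt_of_le ((hval χ hχodd).trans_lt hbern)
    (Finset.prod_le_one' (s := (univ.filter fun χ : 𝐗 p ↦
      χ (-1) = -1).erase χ) (f := fun χ ↦ B.valuation χ.bernoulliOne) fun χ' hχ' ↦ by
        have := (mem_filter.1 (Finset.mem_of_mem_erase hχ')).2
        rw [hval χ' this]
        exact hB _ χ'.isIntegral_bernoulliSum)
  exact hlt.ne hkey

theorem false_of_valuation_lt_one (hB : ∀ x, IsIntegral ℤ x → B.valuation x ≤ 1)
    (hB2 : B.valuation 2 = 1) (hodd : Odd M) (h1 : M ≠ 1) (hsq : Squarefree M)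
    (hdvd : classNumber K ∣ classNumber (𝐑 K) *
      2 ^ Module.finrank ℚ (𝐑 K)) {f : ℕ} [NeZero f] (hfM : f ∣ M)
    (hfp : ¬ f.Prime) {ψ : 𝐗 f} (hψ : ψ.IsPrimitive) (hψ1 : ψ (-1) = -1)
    (hlt : B.valuation (ψ.bernoulliSum / f) < 1) : False := by
  have h2 := (valuation_eq_one_of_classNumber_dvd hB hB2 hodd h1 hsq hdvd).2 (changeLevel hfM ψ)
    (by rw [changeLevel_neg_one, hψ1]) (by rwa [conductor_changeLevel, (isPrimitive_def ψ).1 hψ])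
  rw [bernoulliOne_changeLevel, bernoulliOne_of_isPrimitive hψ] at h2
  exact hlt.ne h2

theorem false_of_pairCert (hodd : Odd M) (h1 : M ≠ 1) (hsq : Squarefree M)
    (hdvd : classNumber K ∣ classNumber (𝐑 K) *
      2 ^ Module.finrank ℚ (𝐑 K)) {p g t p' g' t' r : ℕ} (hp : p.Prime)
    (hp' : p'.Prime) (hpp' : p ≠ p') (hpM : p ∣ M) (hpM' : p' ∣ M)
    (hc : pairCert (p, g, t, p', g', t', r) = true) : False := by
  simp only [pairCert, Bool.and_eq_true, beq_iff_eq, bne_iff_ne, ne_eq] at hc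
  obtain ⟨⟨⟨⟨⟨⟨⟨hg, hg'⟩, ht⟩, ht'⟩, hsgn⟩, hs⟩, hr2⟩, hr1⟩ := hc
  have hp2 : p ≠ 2 := by rintro rfl; exact absurd (hodd.of_dvd_nat hpM) (by decide)
  have hp2' : p' ≠ 2 := by rintro rfl; exact absurd (hodd.of_dvd_nat hpM') (by decide)
  have : Fact p.Prime := ⟨hp⟩
  have : Fact p'.Prime := ⟨hp'⟩
  obtain ⟨l, hl, hlr, B, hB, hBl, hB2⟩ := exists_valuation_of_odd hr2 hr1
  obtain ⟨χ, hχ1, hred, hsign⟩ := exists_charReduces hB hBl hp2 hg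
    (hlr.trans (Nat.dvd_of_mod_eq_zero ht))
  obtain ⟨χ', hχ1', hred', hsign'⟩ := exists_charReduces hB hBl hp2' hg'
    (hlr.trans (Nat.dvd_of_mod_eq_zero ht'))
  have hcop : p.Coprime p' := (Nat.coprime_primes hp hp').2 hpp'
  have hprim : χ.IsPrimitive := conductor_eq_of_prime hp hχ1
  have hprim' : χ'.IsPrimitive := conductor_eq_of_prime hp' hχ1'
  refine false_of_valuation_lt_one hB hB2 hodd h1 hsq hdvd (hcop.mul_dvd_of_dvd_of_dvd hpM hpM')
    (Nat.not_prime_mul hp.ne_one hp'.ne_one) (conductor_prodChar hcop hprim hprim') ?_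
    (valuation_bernoulliSum_prodChar_lt_one hB hp.ne_one hp'.ne_one hcop hBl hprim hprim' hred hred'
      (hlr.trans (Nat.dvd_of_mod_eq_zero hs)))
  refine neg_one_of_valuation_lt_one hB2 hB hBl (apply_neg_one_eq _)
    (T := t ^ ((p - 1) / 2) * t' ^ ((p' - 1) / 2)) ?_ (hlr.trans (Nat.dvd_of_mod_eq_zero hsgn))
  rw [prodChar_neg_one]
  push_cast
  refine valuation_mul_sub_mul_lt_one (hB _ (χ.isIntegral_apply _)) ?_ hsign hsign'
  exact_mod_cast valuation_intCast_le_one hB ((t' ^ ((p' - 1) / 2) : ℕ) : ℤ)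

theorem false_of_tripleCert (hodd : Odd M) (h1 : M ≠ 1) (hsq : Squarefree M)
    (hdvd : classNumber K ∣ classNumber (𝐑 K) *
      2 ^ Module.finrank ℚ (𝐑 K)) {p g t p' g' t' p'' g'' t'' r : ℕ}
    (hp : p.Prime) (hp' : p'.Prime) (hp'' : p''.Prime) (h12 : p ≠ p') (h13 : p ≠ p'')
    (h23 : p' ≠ p'') (hpM : p ∣ M) (hpM' : p' ∣ M) (hpM'' : p'' ∣ M)
    (hc : tripleCert p g t p' g' t' p'' g'' t'' r = true) : False := by
  simp only [tripleCert, Bool.and_eq_true, beq_iff_eq, bne_iff_ne, ne_eq] at hc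
  obtain ⟨⟨⟨⟨⟨⟨⟨⟨⟨hg, hg'⟩, hg''⟩, ht⟩, ht'⟩, ht''⟩, hsgn⟩, hs⟩, hr2⟩, hr1⟩ := hc
  have hp2 : p ≠ 2 := by rintro rfl; exact absurd (hodd.of_dvd_nat hpM) (by decide)
  have hp2' : p' ≠ 2 := by rintro rfl; exact absurd (hodd.of_dvd_nat hpM') (by decide)
  have hp2'' : p'' ≠ 2 := by rintro rfl; exact absurd (hodd.of_dvd_nat hpM'') (by decide)
  have : Fact p.Prime := ⟨hp⟩
  have : Fact p'.Prime := ⟨hp'⟩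
  have : Fact p''.Prime := ⟨hp''⟩
  obtain ⟨l, hl, hlr, B, hB, hBl, hB2⟩ := exists_valuation_of_odd hr2 hr1
  obtain ⟨χ, hχ1, hred, hsign⟩ := exists_charReduces hB hBl hp2 hg
    (hlr.trans (Nat.dvd_of_mod_eq_zero ht))
  obtain ⟨χ', hχ1', hred', hsign'⟩ := exists_charReduces hB hBl hp2' hg'
    (hlr.trans (Nat.dvd_of_mod_eq_zero ht'))
  obtain ⟨χ'', hχ1'', hred'', hsign''⟩ := exists_charReduces hB hBl hp2'' hg''
    (hlr.trans (Nat.dvd_of_mod_eq_zero ht''))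
  have hcop' : p'.Coprime p'' := (Nat.coprime_primes hp' hp'').2 h23
  have hcop : p.Coprime (p' * p'') := Nat.Coprime.mul_right ((Nat.coprime_primes hp hp').2 h12)
    ((Nat.coprime_primes hp hp'').2 h13)
  have hprim : χ.IsPrimitive := conductor_eq_of_prime hp hχ1
  have hprim' : (prodChar χ' χ'').IsPrimitive := conductor_prodChar hcop'
    (conductor_eq_of_prime hp' hχ1') (conductor_eq_of_prime hp'' hχ1'')
  have hne : p' * p'' ≠ 1 := by
    have := hp'.one_lt
    have := hp''.one_lt
    nlinarith
  refine false_of_valuation_lt_one hB hB2 hodd h1 hsq hdvd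
    (hcop.mul_dvd_of_dvd_of_dvd hpM (hcop'.mul_dvd_of_dvd_of_dvd hpM' hpM''))
    (Nat.not_prime_mul hp.ne_one hne) (conductor_prodChar hcop hprim hprim') ?_
    (valuation_bernoulliSum_prodChar_lt_one hB hp.ne_one hne hcop hBl hprim hprim' hred
      (hred'.prod hB hcop' hred'') (hlr.trans (Nat.dvd_of_mod_eq_zero hs)))
  refine neg_one_of_valuation_lt_one hB2 hB hBl (apply_neg_one_eq _)
    (T := t ^ ((p - 1) / 2) * (t' ^ ((p' - 1) / 2) * t'' ^ ((p'' - 1) / 2))) ?_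
    (hlr.trans (Nat.dvd_of_mod_eq_zero hsgn))
  rw [prodChar_neg_one, prodChar_neg_one]
  have hnat : ∀ n : ℕ, B.valuation (n : ℂ) ≤ 1 := fun n ↦ by
    exact_mod_cast valuation_intCast_le_one hB (n : ℤ)
  push_cast
  refine valuation_mul_sub_mul_lt_one (hB _ (χ.isIntegral_apply _)) ?_ hsign
    (valuation_mul_sub_mul_lt_one (hB _ (χ'.isIntegral_apply _)) ?_ hsign' hsign'')
  · exact_mod_cast hnat (t' ^ ((p' - 1) / 2) * t'' ^ ((p'' - 1) / 2))
  · exact_mod_cast hnat (t'' ^ ((p'' - 1) / 2))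

/-- Certificates for primes. -/
def primeCerts : List (ℕ × ℕ × ℕ × ℕ) :=
  [(23, 5, 2, 3), (31, 3, 2, 3), (43, 3, 26, 211), (47, 5, 4, 5), (53, 2, 1972, 4889),
   (59, 2, 2, 3), (61, 2, 33, 41), (67, 2, 75, 12739), (71, 7, 6, 7), (73, 5, 37, 89),
   (79, 3, 4, 5), (83, 2, 2, 3), (89, 3, 44, 113), (97, 5, 439, 577), (101, 2, 3, 5),
   (103, 5, 4, 5), (107, 2, 2, 3), (109, 6, 4, 17), (113, 3, 10, 17), (127, 3, 4, 5),
   (131, 2, 4, 5), (137, 3, 2, 17), (139, 2, 2, 3),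
   (149, 2, 292150232142718487864, 512966338320040805461), (151, 6, 6, 7), (157, 5, 3, 5),
   (163, 2, 142, 181), (167, 5, 10, 11), (173, 2, 2, 5), (179, 2, 4, 5), (181, 2, 3, 5),
   (191, 19, 12, 13), (193, 5, 4648, 6529), (197, 2, 3, 5), (199, 3, 2, 3), (211, 2, 2, 3),
   (223, 3, 6, 7), (227, 2, 4, 5), (229, 6, 13, 17), (233, 3, 507, 1433), (239, 7, 2, 3),
   (241, 7, 5273, 13921), (251, 6, 6, 7), (257, 3, 14684540707, 20738946049), (263, 5, 12, 13),
   (269, 2, 5, 13), (271, 6, 10, 11), (277, 5, 13, 17), (281, 3, 2, 17), (283, 3, 2, 3),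
   (293, 2, 8626540, 52561753), (307, 5, 2, 3), (311, 17, 18, 19), (313, 10, 221, 233),
   (317, 2, 5, 13), (331, 3, 2, 3), (337, 10, 5, 17), (347, 2, 4, 5), (349, 2, 2, 5),
   (353, 3, 5748, 6113), (359, 7, 18, 19), (367, 6, 2, 3), (373, 2, 2, 5), (379, 2, 2, 3),
   (383, 5, 16, 17), (389, 2, 32, 41), (397, 5, 5, 13), (401, 3, 40031, 64849)]

/-- Certificates for pairs of primes. -/
def pairCerts : List (ℕ × ℕ × ℕ × ℕ × ℕ × ℕ × ℕ) :=
  [(3, 2, 4, 17, 3, 2, 5), (5, 2, 46, 17, 3, 22, 73), (5, 2, 8, 19, 2, 9, 13),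
   (5, 2, 228, 29, 2, 116, 281), (7, 3, 10, 13, 2, 8, 37), (7, 3, 4, 17, 3, 4, 5),
   (7, 3, 4, 19, 2, 9, 13), (7, 3, 63, 29, 2, 739, 3907), (11, 2, 4, 13, 2, 4, 5),
   (11, 2, 25, 17, 3, 40, 41), (11, 2, 41, 19, 2, 13, 61), (11, 2, 4, 29, 2, 4, 5),
   (13, 2, 3, 17, 3, 2, 5), (13, 2, 2, 19, 2, 2, 3), (13, 2, 4, 29, 2, 2, 5),
   (17, 3, 6, 19, 2, 5, 7), (17, 3, 3, 29, 2, 3, 5), (19, 2, 5, 29, 2, 6, 7),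
   (5, 2, 2, 11, 2, 1, 5), (3, 2, 2, 19, 2, 1, 3), (7, 3, 4, 11, 2, 1, 5), (3, 2, 2, 29, 2, 2, 3)]

theorem primeCerts_all : primeCerts.all primeCert = true := by decide +kernel

theorem pairCerts_all : pairCerts.all pairCert = true := by decide +kernel

theorem tripleCert_105 : tripleCert 3 2 12 5 2 5 7 3 4 13 = true := by decide +kernel

theorem tripleCert_195 : tripleCert 3 2 12 5 2 5 13 2 7 13 = true := by decide +kernel

theorem mem_primeCerts_of_prime : ∀ p < 409, p.Prime → p ∈ [2, 3, 5, 7, 11, 13, 17, 19, 29, 37, 41] ∨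
    p ∈ primeCerts.map Prod.fst := by decide +kernel

end Irregular

namespace ListMatrix

/-- The square matrix whose rows are given by a list of lists. -/
def toMatrix (n : ℕ) (L : List (List ℤ)) : Matrix (Fin n) (Fin n) ℚ :=
  fun i j ↦ ((L.getD i []).getD j 0 : ℤ)

/-- Fraction-free elimination: check that the matrix `L / e` has determinant `d / e`. -/
def detCheck : ℕ → ℤ → List (List ℤ) → ℤ → Bool
  | 0, e, _, d => e == d
  | n + 1, e, (a :: r) :: L, d => a != 0 && r.length == n && L.length == n &&
      L.all (fun s ↦ s.length == n + 1 &&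
        (List.zipWith (fun x y ↦ (a * x - s.headI * y) % e) s.tail r).all (· == 0)) &&
      detCheck n a (L.map fun s ↦ List.zipWith (fun x y ↦ (a * x - s.headI * y) / e) s.tail r) d
  | _ + 1, _, _, _ => false

theorem det_eq_mul_det_of_pivot {n : ℕ} {A : Matrix (Fin (n + 1)) (Fin (n + 1)) ℚ}
    (h : A 0 0 ≠ 0) : A.det = A 0 0 * (Matrix.of fun i j : Fin n ↦
      A i.succ j.succ - A i.succ 0 / A 0 0 * A 0 j.succ).det := by
  set B : Matrix (Fin (n + 1)) (Fin (n + 1)) ℚ := Matrix.of fun i j ↦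
    A i j - (if i = 0 then 0 else A i 0 / A 0 0) * A 0 j with hB
  have h1 : A.det = B.det := by
    refine Matrix.det_eq_of_forall_row_eq_smul_add_const
      (fun i ↦ if i = 0 then 0 else A i 0 / A 0 0) 0 (by simp) fun i j ↦ ?_
    simp [hB]
  rw [h1, Matrix.det_succ_column_zero, Finset.sum_eq_single 0]
  · simp only [Fin.val_zero, pow_zero, one_mul]
    congr 1
    simp [hB]
  · intro i _ hi
    have : B i 0 = 0 := by
      simp [hB, hi, h]
    simp [this]
  · simp

theorem getD_zipWith {α β γ : Type*} (f : α → β → γ) {l : List α} {l' : List β} {j : ℕ}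
    (h : j < l.length) (h' : j < l'.length) (a : α) (b : β) (c : γ) :
    (List.zipWith f l l').getD j c = f (l.getD j a) (l'.getD j b) := by
  rw [List.getD_eq_getElem _ _ (by simp [h, h']), List.getD_eq_getElem _ _ h,
    List.getD_eq_getElem _ _ h', List.getElem_zipWith]

theorem det_of_detCheck : ∀ (n : ℕ) (e : ℤ) (L : List (List ℤ)) (d : ℤ), e ≠ 0 →
    detCheck n e L d = true → (((e : ℚ)⁻¹) • toMatrix n L).det = d / e
  | 0, e, L, d, he, h => by
    simp only [detCheck, beq_iff_eq] at h
    subst h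
    simp [he]
  | n + 1, e, [], d, he, h => by simp [detCheck] at h
  | n + 1, e, [] :: L, d, he, h => by simp [detCheck] at h
  | n + 1, e, (a :: r) :: L, d, he, h => by
    simp only [detCheck, Bool.and_eq_true, bne_iff_ne, beq_iff_eq] at h
    obtain ⟨⟨⟨⟨ha, hr⟩, hL⟩, hall⟩, h⟩ := h
    have he' : (e : ℚ) ≠ 0 := by exact_mod_cast he
    have ha' : (a : ℚ) ≠ 0 := by exact_mod_cast ha
    have ih := det_of_detCheck n a _ d ha h
    have h00 : (((e : ℚ)⁻¹) • toMatrix (n + 1) ((a :: r) :: L)) 0 0 = a / e := by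
      simp [toMatrix, div_eq_inv_mul]
    rw [det_eq_mul_det_of_pivot (by rw [h00]; positivity), h00]
    rw [show (Matrix.of fun i j : Fin n ↦
      (((e : ℚ)⁻¹) • toMatrix (n + 1) ((a :: r) :: L)) i.succ j.succ -
      (((e : ℚ)⁻¹) • toMatrix (n + 1) ((a :: r) :: L)) i.succ 0 / (a / e) *
      (((e : ℚ)⁻¹) • toMatrix (n + 1) ((a :: r) :: L)) 0 j.succ) = _ from ?_, ih]
    · field_simp
    · ext i j
      have hi : (i : ℕ) < L.length := by omega
      have hs := List.all_eq_true.1 hall _ (List.getElem_mem hi)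
      simp only [Bool.and_eq_true, beq_iff_eq] at hs
      obtain ⟨hlen, hmod⟩ := hs
      generalize hsdef : L[(i : ℕ)] = s at hlen hmod
      have hLi : L.getD i [] = s := by rw [List.getD_eq_getElem _ _ hi, hsdef]
      obtain ⟨b, t, rfl⟩ : ∃ b t, s = b :: t := by
        cases s with
        | nil => simp at hlen
        | cons b t => exact ⟨b, t, rfl⟩
      simp only [List.length_cons, Nat.add_right_cancel_iff] at hlen
      have hj1 : (j : ℕ) < t.length := by omega
      have hj2 : (j : ℕ) < r.length := by omega
      have hlt : (j : ℕ) < (List.zipWith (fun x y ↦ (a * x - b * y) % e) t r).length := by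
        simp [hj1, hj2]
      have hdvd : e ∣ a * t.getD j 0 - b * r.getD j 0 := by
        have h2 := List.all_eq_true.1 hmod _ (List.getElem_mem hlt)
        rw [beq_iff_eq] at h2
        apply Int.dvd_of_emod_eq_zero
        rw [← List.getD_eq_getElem _ 0 hlt] at h2
        exact (getD_zipWith (fun x y ↦ (a * x - b * y) % e) hj1 hj2 0 0 0).symm.trans h2
      have hR : toMatrix n (L.map fun s ↦
          List.zipWith (fun x y ↦ (a * x - s.headI * y) / e) s.tail r) i j =
          (((a * t.getD j 0 - b * r.getD j 0) / e : ℤ) : ℚ) := by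
        rw [toMatrix, List.getD_eq_getElem (L.map _) _ (by simpa using hi), List.getElem_map, hsdef]
        exact congrArg _ (getD_zipWith (fun x y ↦ (a * x - b * y) / e) hj1 hj2 0 0 0)
      rw [Matrix.smul_apply, hR, Int.cast_div hdvd he']
      simp only [Matrix.of_apply, Matrix.smul_apply, toMatrix, Fin.val_succ, Fin.val_zero,
        List.getD_cons_succ, List.getD_cons_zero, hLi, smul_eq_mul]
      push_cast
      field_simp

end ListMatrix

namespace DirichletCharacter

open Matrix

variable {M : ℕ} [NeZero M] {n : ℕ}

theorem sum_reps_of_even {a : Fin n → (ZMod M)ˣ}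
    (ha : ∀ f : ZMod M → ℂ, (∀ x, ¬ IsUnit x → f x = 0) →
      ∑ x, f x = ∑ j, (f (a j) + f (-a j)))
    {f : ZMod M → ℂ} (hf : ∀ x, ¬ IsUnit x → f x = 0) (hf' : ∀ u : (ZMod M)ˣ, f (-u) = f u) :
    2 * ∑ j, f (a j) = ∑ x, f x := by
  rw [ha f hf, mul_sum]
  exact sum_congr rfl fun j _ ↦ by rw [hf' (a j), two_mul]

/-- The determinant of an odd function on `(ℤ/M)ˣ` modulo `±1`. -/
theorem norm_det_eq_prod_odd (hM : 2 < M) (a : Fin n → (ZMod M)ˣ)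
    (ha : ∀ f : ZMod M → ℂ, (∀ x, ¬ IsUnit x → f x = 0) →
      ∑ x, f x = ∑ j, (f (a j) + f (-a j)))
    (F : ZMod M → ℂ) (hF : ∀ u : (ZMod M)ˣ, F (-u) = -F u) :
    2 ^ n * ‖(Matrix.of fun i j ↦ F (a i * a j)).det‖ =
      ∏ χ : 𝐗 M with χ (-1) = -1, ‖∑ x, F x * χ x‖ := by
  have hn : (2 * n : ℂ) = Fintype.card (ZMod M)ˣ := by
    rw [← MulChar.sum_one_eq_card_units (R := ZMod M) (R' := ℂ), ha _ fun x hx ↦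
      MulChar.map_nonunit _ hx]
    have h1 : ∀ u : (ZMod M)ˣ, (1 : MulChar (ZMod M) ℂ) u = 1 := MulChar.one_apply_coe
    simp only [h1, ← Units.val_neg]
    simp
    ring
  have hcard : Fintype.card {χ : 𝐗 M // χ (-1) = -1} = n := by
    have h1 := card_odd_characters hM
    have h2 : 2 * n = Fintype.card (ZMod M)ˣ := by exact_mod_cast hn
    rw [ZMod.card_units_eq_totient] at h2
    rw [Fintype.card_subtype]
    omega
  let e : Fin n ≃ {χ : 𝐗 M // χ (-1) = -1} :=
    (Fintype.equivFinOfCardEq hcard).symm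
  let A : Matrix (Fin n) (Fin n) ℂ := Matrix.of fun i j ↦ F (a i * a j)
  let V : Matrix (Fin n) (Fin n) ℂ := Matrix.of fun j k ↦ (e k).1 (a j)
  have hodd : ∀ (k : Fin n) (x : ZMod M), (e k).1 (-x) = -(e k).1 x := fun k x ↦ by
    have h1 := map_mul (e k).1 (-1) x
    rwa [(e k).2, neg_one_mul, neg_one_mul] at h1
  have hstar : ∀ (k : Fin n) (u : (ZMod M)ˣ), star ((e k).1 u) * (e k).1 u = 1 := fun k u ↦ by
    rw [MulChar.star_apply', ← MulChar.mul_apply, inv_mul_cancel, MulChar.one_apply_coe]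
  have hV : Vᴴ * V = (n : ℂ) • 1 := by
    ext k l
    have h1 : 2 * (Vᴴ * V) k l = ∑ x, ((e k).1⁻¹ * (e l).1) x := by
      rw [← sum_reps_of_even ha fun x hx ↦ MulChar.map_nonunit _ hx]
      · rw [mul_apply]
        congr 1
        refine sum_congr rfl fun j _ ↦ ?_
        rw [conjTranspose_apply, MulChar.mul_apply, ← MulChar.star_apply']
        rfl
      · intro u
        rw [MulChar.mul_apply, MulChar.mul_apply, ← MulChar.star_apply', ← MulChar.star_apply',
          hodd, hodd, star_neg, neg_mul_neg]
    rcases eq_or_ne k l with rfl | hkl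
    · rw [inv_mul_cancel, MulChar.sum_one_eq_card_units, ← hn] at h1
      simpa using h1
    · rw [MulChar.sum_eq_zero_of_ne_one] at h1
      · simpa [hkl] using h1
      · rw [ne_eq, inv_mul_eq_one]
        exact fun h ↦ hkl (e.injective (Subtype.ext h))
  have hVdet : V.det ≠ 0 := by
    intro h0
    have h1 := congrArg Matrix.det hV
    rw [det_mul, h0, mul_zero, det_smul, det_one, mul_one, Fintype.card_fin] at h1
    rcases Nat.eq_zero_or_pos n with rfl | hn0
    · simp at h1
    · exact pow_ne_zero n (Nat.cast_ne_zero.2 hn0.ne' : (n : ℂ) ≠ 0) h1.symm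
  have hAV : (2 : ℂ) • (A * V) = Matrix.of fun i k ↦
      (∑ x, F x * (e k).1 x) * (V.map star) i k := by
    ext i k
    have h1 : 2 * (A * V) i k = ∑ x, F (a i * x) * (e k).1 x := by
      rw [← sum_reps_of_even ha fun x hx ↦ by rw [MulChar.map_nonunit _ hx, mul_zero]]
      · rw [mul_apply]
        rfl
      · intro u
        have := hF (a i * u)
        rw [Units.val_mul] at this
        rw [mul_neg, hodd, this, neg_mul_neg]
    have h2 : ∑ x, F x * (e k).1 x = ∑ x, F (a i * x) * (e k).1 (a i * x) :=
      (Equiv.sum_comp (Units.mulLeft (a i)) fun x ↦ F x * (e k).1 x).symm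
    rw [Matrix.smul_apply, smul_eq_mul, h1, of_apply, h2, Finset.sum_mul]
    refine sum_congr rfl fun x _ ↦ ?_
    rw [map_mul, map_apply]
    have h3 := hstar k (a i)
    change _ = F (a i * x) * ((e k).1 (a i) * (e k).1 x) * star ((e k).1 (a i))
    linear_combination (-(F (a i * x) * (e k).1 x)) * h3
  have h1 := congrArg (fun B ↦ ‖Matrix.det B‖) hAV
  simp only [det_smul, det_mul, det_mul_row, Fintype.card_fin] at h1
  have h2 : ‖(V.map star).det‖ = ‖V.det‖ := by
    rw [← det_transpose, show (V.map star)ᵀ = Vᴴ from rfl, det_conjTranspose, norm_star]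
  rw [norm_mul, norm_mul, norm_mul, h2, ← mul_assoc, norm_pow, Complex.norm_two] at h1
  have h3 := mul_right_cancel₀ (norm_ne_zero_iff.2 hVdet) h1
  rw [h3, norm_prod, Equiv.prod_comp e fun χ ↦ ‖∑ x, F x * χ.1 x‖]
  exact (Finset.prod_subtype (p := fun χ : 𝐗 M ↦ χ (-1) = -1) _ (by simp)
    fun χ ↦ ‖∑ x, F x * χ x‖).symm

end DirichletCharacter

namespace ListMatrix

/-- `F`, an odd function modulo `M`, has determinant `d` on the representatives `l` of
`(ℤ/M)ˣ` modulo `±1`. -/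
def oddDetCheck (M : ℕ) (F : ℕ → ℤ) (l : List ℕ) (d : ℤ) : Bool :=
  (l ++ l.map (M - ·)).isPerm ((List.range M).filter fun u ↦ u.gcd M == 1) &&
  (List.range M).all (fun u ↦ u.gcd M != 1 || F ((M - u) % M) == -F u) &&
  detCheck l.length 1 (l.map fun i ↦ l.map fun j ↦ F (i * j % M)) d

open DirichletCharacter in
theorem prod_norm_of_oddDetCheck {M : ℕ} [NeZero M] (hM : 2 < M) {F : ℕ → ℤ} {l : List ℕ} {d : ℤ}
    (h : oddDetCheck M F l d = true) {c : ℕ} (hc : ∀ χ : 𝐗 M, χ (-1) = -1 →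
      ∑ x : ZMod M, F x.val * χ x = 2 * (c * χ.bernoulliOne)) :
    c ^ l.length * ∏ χ : 𝐗 M with χ (-1) = -1, ‖χ.bernoulliOne‖ = |(d : ℝ)| ∧
      2 * l.length = M.totient := by
  simp only [oddDetCheck, Bool.and_eq_true, List.isPerm_iff] at h
  obtain ⟨⟨hperm, hF⟩, hdet⟩ := h
  have hcop : ∀ u ∈ l, u < M ∧ u.Coprime M := by
    intro u hu
    have := hperm.subset (List.mem_append_left _ hu)
    simpa [Nat.coprime_iff_gcd_eq_one] using this
  let a : Fin l.length → (ZMod M)ˣ := fun j ↦ ZMod.unitOfCoprime (l.get j)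
    (hcop _ (List.get_mem l j)).2
  have ha1 : ∀ j, (a j : ZMod M) = (l.get j : ℕ) := fun j ↦ ZMod.coe_unitOfCoprime _ _
  have ha : ∀ f : ZMod M → ℂ, (∀ x, ¬ IsUnit x → f x = 0) →
      ∑ x, f x = ∑ j, (f (a j) + f (-a j)) := by
    intro f hf
    have h1 : ∑ x, f x = (((List.range M).filter fun u ↦ u.gcd M == 1).map fun u ↦
        f (u : ℕ)).sum := by
      rw [← ZMod.sum_range_natCast (fun _ x ↦ f x), ← List.sum_toFinset _
        ((List.nodup_range).filter _), List.toFinset_filter, List.toFinset_range,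
        Finset.sum_filter]
      refine sum_congr rfl fun u _ ↦ ?_
      split_ifs with hu
      · rfl
      · refine hf _ fun h2 ↦ hu ?_
        rw [ZMod.isUnit_iff_coprime, Nat.coprime_iff_gcd_eq_one] at h2
        simpa using h2
    rw [h1, ← (hperm.map _).sum_eq, List.map_append, List.sum_append, List.map_map,
      sum_add_distrib]
    congr 1
    · simp only [ha1]
      exact (Fin.sum_univ_fun_getElem l fun u : ℕ ↦ f u).symm
    · have h2 : ∀ j, f (-(a j : ZMod M)) = f ((M - l.get j : ℕ) : ZMod M) := fun j ↦ by
        rw [ha1, Nat.cast_sub (hcop _ (List.get_mem l j)).1.le, ZMod.natCast_self, zero_sub]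
      simp only [h2]
      exact (Fin.sum_univ_fun_getElem l fun u : ℕ ↦ f (M - u : ℕ)).symm
  have hlen : 2 * l.length = M.totient := by
    have := hperm.length_eq
    rw [List.length_append, List.length_map] at this
    rw [two_mul, this, Nat.totient_eq_card_coprime, ← List.toFinset_card_of_nodup
      ((List.nodup_range).filter _), List.toFinset_filter, List.toFinset_range]
    congr 1
    ext u
    simp [Nat.coprime_iff_gcd_eq_one, Nat.gcd_comm]
  refine ⟨?_, hlen⟩
  have h1 := norm_det_eq_prod_odd hM a ha (fun x ↦ (F x.val : ℂ)) (fun u ↦ by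
    have hu := List.all_eq_true.1 hF _ (List.mem_range.2 (u : ZMod M).val_lt)
    have h3 : ((u : ZMod M).val).gcd M = 1 := ZMod.val_coe_unit_coprime u
    simp only [h3, bne_self_eq_false, Bool.false_or, beq_iff_eq] at hu
    rw [← Int.cast_neg, ← hu]
    congr 2
    rw [ZMod.neg_val'])
  have h2 : (Matrix.of fun i j ↦ (F ((a i : ZMod M) * a j).val : ℂ)).det = d := by
    have h3 := det_of_detCheck _ _ _ _ one_ne_zero hdet
    rw [Int.cast_one, inv_one, one_smul, div_one] at h3
    rw [← Rat.cast_intCast, ← eq_ratCast (algebraMap ℚ ℂ), ← h3, RingHom.map_det]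
    congr 1
    ext i j
    simp only [Matrix.of_apply, RingHom.mapMatrix_apply, Matrix.map_apply, toMatrix]
    rw [List.getD_eq_getElem (l.map _) _ (by simp), List.getElem_map, List.getD_eq_getElem _ _ (by simp),
      List.getElem_map, ha1, ha1, ← Nat.cast_mul, ZMod.val_natCast]
    simp
  rw [h2] at h1
  have h5 : ∀ χ ∈ univ.filter (fun χ : 𝐗 M ↦ χ (-1) = -1),
      ‖∑ x : ZMod M, (F x.val : ℂ) * χ x‖ = 2 * c * ‖χ.bernoulliOne‖ := by
    intro χ hχ
    rw [hc χ (mem_filter.1 hχ).2]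
    simp [mul_assoc]
  rw [prod_congr rfl h5, prod_mul_distrib, Finset.prod_const] at h1
  have h6 := card_odd_characters hM
  rw [show (univ.filter fun χ : 𝐗 M ↦ χ (-1) = -1).card = l.length by
    omega, mul_pow, mul_assoc] at h1
  have h7 := mul_left_cancel₀ (by positivity) h1
  rw [← h7, Complex.norm_intCast]

end ListMatrix

open Finset

theorem Finset.sum_range_mul_eq {β : Type*} [AddCommMonoid β] (p q : ℕ) (f : ℕ → β) :
    ∑ a ∈ range (p * q), f a = ∑ k ∈ range q, ∑ x ∈ range p, f (p * k + x) := by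
  induction q with
  | zero => simp
  | succ q ih => rw [Nat.mul_succ, sum_range_add, ih, sum_range_succ]

namespace DirichletCharacter

variable {p q : ℕ} [NeZero p] [NeZero q]

theorem sum_changeLevel_mul (hq : q.Prime) (ψ : 𝐗 p)
    (h : ℕ → ℂ) :
    ∑ a : ZMod (p * q), changeLevel (Nat.dvd_mul_right p q) ψ a * h a.val =
      ∑ k ∈ range q, ∑ x ∈ range p, ψ x * h (p * k + x) - ψ q * ∑ c ∈ range p, ψ c * h (q * c) := by
  rw [← ZMod.sum_range_natCast (fun k x ↦ changeLevel (Nat.dvd_mul_right p q) ψ x * h k)]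
  have h1 : ∑ c ∈ range p, ψ q * (ψ c * h (q * c)) =
      ∑ a ∈ range (p * q) with q ∣ a, ψ a * h a := by
    refine sum_bij (fun c _ ↦ q * c) ?_ ?_ ?_ ?_
    · intro c hc
      rw [mem_range] at hc
      simp only [mem_filter, mem_range, Nat.dvd_mul_right, and_true]
      rw [mul_comm p q]
      exact Nat.mul_lt_mul_of_pos_left hc hq.pos
    · intro c _ c' _ hcc
      exact Nat.eq_of_mul_eq_mul_left hq.pos hcc
    · intro a ha
      obtain ⟨h2, c, rfl⟩ := mem_filter.1 ha
      refine ⟨c, ?_, rfl⟩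
      rw [mem_range, mul_comm p q] at h2
      exact mem_range.2 (Nat.lt_of_mul_lt_mul_left h2)
    · intro c _
      push_cast
      rw [map_mul, mul_assoc]
  have h2 := sum_range_mul_eq p q fun a ↦ ψ a * h a
  simp only [Nat.cast_add, Nat.cast_mul, CharP.cast_eq_zero, zero_mul, zero_add] at h2
  rw [mul_sum, h1, ← h2, eq_sub_iff_add_eq, sum_filter, ← sum_add_distrib]
  refine sum_congr rfl fun a _ ↦ ?_
  have h3 : changeLevel (Nat.dvd_mul_right p q) ψ (a : ZMod (p * q)) =
      if q ∣ a then 0 else ψ a := by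
    have := prodChar_natCast ψ (1 : 𝐗 q) a
    rw [prodChar, changeLevel_one, mul_one] at this
    rw [this]
    split_ifs with hqa
    · rw [MulChar.map_nonunit (1 : 𝐗 q), mul_zero]
      rw [ZMod.isUnit_iff_coprime, Nat.coprime_comm, hq.coprime_iff_not_dvd, not_not]
      exact hqa
    · rw [MulChar.one_apply, mul_one]
      rw [ZMod.isUnit_iff_coprime, Nat.coprime_comm, hq.coprime_iff_not_dvd]
      exact hqa
  rw [h3]
  split_ifs <;> simp

theorem sum_eq_zero_of_odd {N : ℕ} [NeZero N] {χ : 𝐗 N} (hχ : χ (-1) = -1) :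
    ∑ x, χ x = 0 := MulChar.sum_eq_zero_of_ne_one (ne_one_of_odd hχ)

theorem sum_val_mul_changeLevel (hq : q.Prime) {ψ : 𝐗 p}
    (hψ : ψ (-1) = -1) :
    ∑ a : ZMod (p * q), changeLevel (Nat.dvd_mul_right p q) ψ a * a.val =
      q * (1 - ψ q) * ψ.bernoulliSum := by
  have h0 : ∑ x ∈ range p, ψ x = 0 := by
    rw [ZMod.sum_range_natCast fun _ x ↦ ψ x, sum_eq_zero_of_odd hψ]
  have h1 : ∑ x ∈ range p, ψ x * x = ψ.bernoulliSum := by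
    rw [ZMod.sum_range_natCast fun k x ↦ ψ x * k, bernoulliSum]
    simp_rw [mul_comm]
  rw [sum_changeLevel_mul hq ψ fun k ↦ (k : ℂ)]
  have h2 : ∀ k ∈ range q, ∑ x ∈ range p, ψ x * ((p * k + x : ℕ) : ℂ) = ψ.bernoulliSum := by
    intro k _
    push_cast
    simp_rw [mul_add, sum_add_distrib, ← sum_mul, h0, h1]
    ring
  have h3 : ∑ c ∈ range p, ψ c * ((q * c : ℕ) : ℂ) = q * ψ.bernoulliSum := by
    rw [← h1, mul_sum]
    exact sum_congr rfl fun c _ ↦ by push_cast; ring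
  rw [sum_congr rfl h2, h3, sum_const, card_range, nsmul_eq_mul]
  ring

theorem sum_val_mul_inv_mul_changeLevel (hq : q.Prime)
    {ψ : 𝐗 p} {r : ℕ} (hr : q * r % p = 1 % p) :
    ∑ a : ZMod (p * q), changeLevel (Nat.dvd_mul_right p q) ψ a * (a.val * r % p : ℕ) =
      (q - 1) * ψ q * ψ.bernoulliSum := by
  have hqr : (q : ZMod p) * r = 1 := by
    have := (ZMod.natCast_eq_natCast_iff (q * r) 1 p).2 hr
    simpa using this
  have h1 : ∑ x ∈ range p, ψ x * (x * r % p : ℕ) = ψ q * ψ.bernoulliSum := by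
    rw [ZMod.sum_range_natCast fun k x ↦ ψ x * (k * r % p : ℕ), bernoulliSum]
    have hu : IsUnit (q : ZMod p) := IsUnit.of_mul_eq_one _ hqr
    rw [← Equiv.sum_comp (Units.mulLeft hu.unit), mul_sum]
    refine sum_congr rfl fun x _ ↦ ?_
    simp only [Units.mulLeft_apply, IsUnit.unit_spec, map_mul]
    rw [← ZMod.val_natCast, Nat.cast_mul, ZMod.natCast_zmod_val,
      mul_right_comm (q : ZMod p), hqr, one_mul]
    ring
  rw [sum_changeLevel_mul hq ψ fun k ↦ ((k * r % p : ℕ) : ℂ)]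
  have h2 : ∀ k ∈ range q, ∑ x ∈ range p, ψ x * (((p * k + x) * r % p : ℕ) : ℂ) =
      ψ q * ψ.bernoulliSum := by
    intro k _
    rw [← h1]
    refine sum_congr rfl fun x _ ↦ ?_
    rw [add_mul, mul_assoc, Nat.mul_add_mod]
  have h3 : ∑ c ∈ range p, ψ c * ((q * c * r % p : ℕ) : ℂ) = ψ.bernoulliSum := by
    rw [ZMod.sum_range_natCast fun k x ↦ ψ x * (q * k * r % p : ℕ), bernoulliSum]
    refine sum_congr rfl fun x _ ↦ ?_
    rw [← ZMod.val_natCast, Nat.cast_mul, Nat.cast_mul, ZMod.natCast_zmod_val, mul_right_comm, hqr,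
      one_mul, mul_comm]
  rw [sum_congr rfl h2, h3, sum_const, card_range, nsmul_eq_mul]
  ring

/-- An odd function modulo `p * q` whose character sums are multiples of the generalized Bernoulli
numbers of the associated primitive characters. -/
def stickelbergerFun (p q r s : ℕ) (u : ℕ) : ℤ :=
  (p - 1) * (q - 1) * (2 * u - p * q) + q * (p - 1) * (2 * (u * s % p : ℕ) - p) +
    p * (q - 1) * (2 * (u * r % q : ℕ) - q)

theorem sum_stickelbergerFun_mul {r s : ℕ} {N : ℕ} [NeZero N] {χ : 𝐗 N}
    (hχ : χ (-1) = -1) :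
    ∑ x : ZMod N, (stickelbergerFun p q r s x.val : ℂ) * χ x =
      2 * ((p - 1) * (q - 1) * ∑ x : ZMod N, χ x * x.val +
        q * (p - 1) * ∑ x : ZMod N, χ x * (x.val * s % p : ℕ) +
        p * (q - 1) * ∑ x : ZMod N, χ x * (x.val * r % q : ℕ)) := by
  have h0 := sum_eq_zero_of_odd hχ
  have h1 : ∀ x : ZMod N, (stickelbergerFun p q r s x.val : ℂ) * χ x =
      2 * ((p - 1) * (q - 1) * (χ x * x.val) + q * (p - 1) * (χ x * (x.val * s % p : ℕ)) +
        p * (q - 1) * (χ x * (x.val * r % q : ℕ))) -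
        ((p - 1) * (q - 1) * (p * q) + q * (p - 1) * p + p * (q - 1) * q) * χ x := by
    intro x
    rw [stickelbergerFun]
    generalize x.val * s % p = y
    generalize x.val * r % q = z
    push_cast
    ring
  simp_rw [h1]
  rw [sum_sub_distrib, ← mul_sum, ← mul_sum, h0, mul_zero, sub_zero, sum_add_distrib,
    sum_add_distrib, ← mul_sum, ← mul_sum, ← mul_sum]

theorem sum_mul_val_eq_zero {N d : ℕ} [NeZero N] [NeZero d] (hd : d ∣ N)
    {χ : 𝐗 N} (hχ : ¬ χ.FactorsThrough d) (r : ℕ) :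
    ∑ x : ZMod N, χ x * (x.val * r % d : ℕ) = 0 := by
  rw [← sum_mul_eq_zero_of_not_factorsThrough hd hχ fun y ↦ (y.val * r % d : ℕ)]
  refine sum_congr rfl fun x _ ↦ ?_
  rw [ZMod.castHom_apply, ZMod.cast_eq_val, ZMod.val_natCast, Nat.mod_mul_mod]

theorem sum_stickelbergerFun_of_changeLevel (hpq : p.Coprime q) (hp : p.Prime) (hq : q.Prime)
    {r s : ℕ} (hs : q * s % p = 1 % p) {ψ : 𝐗 p} (hψ : ψ (-1) = -1) :
    (p - 1) * (q - 1) * ∑ x : ZMod (p * q), changeLevel (Nat.dvd_mul_right p q) ψ x * x.val +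
      q * (p - 1) * ∑ x : ZMod (p * q), changeLevel (Nat.dvd_mul_right p q) ψ x *
        (x.val * s % p : ℕ) +
      p * (q - 1) * ∑ x : ZMod (p * q), changeLevel (Nat.dvd_mul_right p q) ψ x *
        (x.val * r % q : ℕ) =
      (p * q * (p - 1) * (q - 1)) * (changeLevel (Nat.dvd_mul_right p q) ψ).bernoulliOne := by
  have hψp := conductor_eq_of_prime hp (ne_one_of_odd hψ)
  rw [sum_val_mul_changeLevel hq hψ, sum_val_mul_inv_mul_changeLevel hq hs,
    sum_mul_val_eq_zero (Nat.dvd_mul_left q p), bernoulliOne_changeLevel,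
    bernoulliOne_of_isPrimitive hψp]
  · have : (p : ℂ) ≠ 0 := NeZero.ne _
    field_simp
    ring
  · intro h
    have h1 := conductor_dvd_of_mem_conductorSet _ h
    rw [conductor_changeLevel, hψp] at h1
    exact hp.ne_one (Nat.eq_one_of_dvd_coprimes hpq dvd_rfl h1)

theorem sum_stickelbergerFun (hpq : p.Coprime q) (hp : p.Prime) (hq : q.Prime)
    {r s : ℕ} (hr : p * r % q = 1 % q) (hs : q * s % p = 1 % p)
    {χ : 𝐗 (p * q)} (hχ : χ (-1) = -1) :
    ∑ x : ZMod (p * q), (stickelbergerFun p q r s x.val : ℂ) * χ x =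
      2 * ((p * q * (p - 1) * (q - 1) : ℕ) * χ.bernoulliOne) := by
  rw [sum_stickelbergerFun_mul hχ]
  congr 1
  push_cast [hp.one_le, hq.one_le]
  by_cases h1 : χ.FactorsThrough p
  · obtain ⟨hd, ψ, rfl⟩ := h1
    exact sum_stickelbergerFun_of_changeLevel hpq hp hq hs (by rwa [changeLevel_neg_one] at hχ)
  by_cases h2 : χ.FactorsThrough q
  · obtain ⟨hd, ψ, rfl⟩ := h2
    have key : ∀ N (hN : N = q * p) [NeZero N] (hd : q ∣ N),
      (p - 1) * (q - 1) * ∑ x : ZMod N, changeLevel hd ψ x * x.val +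
      q * (p - 1) * ∑ x : ZMod N, changeLevel hd ψ x * (x.val * s % p : ℕ) +
      p * (q - 1) * ∑ x : ZMod N, changeLevel hd ψ x * (x.val * r % q : ℕ) =
      (p * q * (p - 1) * (q - 1)) * (changeLevel hd ψ).bernoulliOne := by
      rintro N rfl _ _
      have := sum_stickelbergerFun_of_changeLevel (r := s) hpq.symm hq hp hr
        (by rwa [changeLevel_neg_one] at hχ)
      linear_combination this
    exact key _ (mul_comm p q) hd
  rw [sum_mul_val_eq_zero (Nat.dvd_mul_right p q) h1, sum_mul_val_eq_zero (Nat.dvd_mul_left q p) h2]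
  have h3 : χ.IsPrimitive := by
    rw [isPrimitive_def]
    have h4 : ∀ d (hd : d ∣ p * q), χ.conductor ∣ d → χ.FactorsThrough d := fun d hd h ↦
      ⟨hd, changeLevel h χ.primitiveCharacter, by
        rw [← changeLevel_trans, changeLevel_primitiveCharacter]⟩
    obtain ⟨a, b, ha, hb, hab⟩ := Nat.dvd_mul.1 χ.conductor_dvd_level
    rcases (Nat.dvd_prime hp).1 ha with rfl | rfl
    · exact absurd (h4 q (Nat.dvd_mul_left q p) (by rwa [← hab, one_mul])) h2
    rcases (Nat.dvd_prime hq).1 hb with rfl | rfl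
    · exact absurd (h4 a (Nat.dvd_mul_right a q) (by rw [← hab, mul_one])) h1
    · exact hab.symm
  rw [bernoulliOne_of_isPrimitive h3, bernoulliSum]
  simp_rw [mul_comm (χ _)]
  have : (p : ℂ) ≠ 0 := NeZero.ne _
  have : (q : ℂ) ≠ 0 := NeZero.ne _
  push_cast
  field_simp
  ring

end DirichletCharacter

open ListMatrix DirichletCharacter

section Ratio

variable (M : ℕ) [NeZero M] (K : Type*) [Field K] [NumberField K] [IsCyclotomicExtension {M} ℚ K]
  [IsCMField K]

theorem classNumber_eq_mul_of_oddDetCheck (hodd : Odd M) (h1 : M ≠ 1) (hsq : Squarefree M)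
    {F : ℕ → ℤ} {l : List ℕ} {d : ℤ} (h : oddDetCheck M F l d = true) {c k : ℕ} (hc0 : c ≠ 0)
    (hc : ∀ χ : 𝐗 M, χ (-1) = -1 →
      ∑ x : ZMod M, F x.val * χ x = 2 * (c * χ.bernoulliOne))
    (hd : IsCMField.indexRealUnits K * (2 * M) * |d| = k * (2 * c) ^ l.length) :
    classNumber K = classNumber (𝐑 K) * k := by
  have h2 := classNumber_eq_bernoulli M K hodd h1 hsq
  have hM3 : 2 < M := by
    have := NeZero.pos M
    obtain ⟨a, rfl⟩ := hodd
    omega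
  obtain ⟨h3, h4⟩ := prod_norm_of_oddDetCheck hM3 h hc
  have h5 := two_mul_finrank_real M K
  rw [show Module.finrank ℚ (𝐑 K) = l.length by omega,
    show (∏ χ : 𝐗 M with χ (-1) = -1,
      (‖χ.primitiveCharacter.bernoulliSum‖ / χ.conductor)) =
      ∏ χ : 𝐗 M with χ (-1) = -1, ‖χ.bernoulliOne‖ from
      prod_congr rfl fun χ _ ↦ by simp [bernoulliOne]] at h2
  have hd' : (IsCMField.indexRealUnits K * (2 * M) * |(d : ℝ)| : ℝ) = k * (2 * c) ^ l.length := by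
    exact_mod_cast hd
  rw [← h3, mul_pow] at hd'
  have hc' : (c : ℝ) ^ l.length ≠ 0 := pow_ne_zero _ (Nat.cast_ne_zero.2 hc0)
  have h6 : (classNumber K : ℝ) = classNumber (𝐑 K) * k := by
    rw [h2]
    congr 1
    rw [div_mul_eq_mul_div, div_eq_iff (by positivity)]
    refine mul_left_cancel₀ hc' ?_
    linear_combination hd'
  exact_mod_cast h6

/-- Certificate for the relative class number `k` of the `p`-th cyclotomic field. -/
def primeDetCert (c : ℕ × List ℕ × ℤ × ℕ) : Bool :=
  let (p, l, s, k) := c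
  oddDetCheck p (fun u ↦ 2 * u - p) l (s * (k * (2 * p) ^ (l.length - 1))) && |s| == 1 &&
    l.length != 0

theorem classNumber_eq_mul_of_primeDetCert (hodd : Odd M) (hM : M.Prime) {l : List ℕ} {s : ℤ}
    {k : ℕ} (h : primeDetCert (M, l, s, k) = true) :
    classNumber K = classNumber (𝐑 K) * k := by
  simp only [primeDetCert, Bool.and_eq_true, beq_iff_eq, bne_iff_ne] at h
  obtain ⟨⟨h, hs⟩, hl⟩ := h
  refine classNumber_eq_mul_of_oddDetCheck M K hodd hM.ne_one hM.squarefree h hM.ne_zero ?_ ?_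
  · intro χ hχ
    rw [bernoulliOne_of_isPrimitive (conductor_eq_of_prime hM (ne_one_of_odd hχ)), bernoulliSum,
      mul_div_cancel₀ _ (NeZero.ne _ : (M : ℂ) ≠ 0)]
    have h1 : ∀ x : ZMod M, ((2 * x.val - M : ℤ) : ℂ) * χ x = 2 * (x.val * χ x) - M * χ x := by
      intro x
      push_cast
      ring
    simp_rw [h1]
    rw [sum_sub_distrib, ← mul_sum, ← mul_sum, sum_eq_zero_of_odd hχ, mul_zero,
      sub_zero]
  · rw [indexRealUnits_eq_one M K hodd hM, abs_mul, hs, abs_of_nonneg (by positivity)]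
    obtain ⟨j, hj⟩ := Nat.exists_eq_succ_of_ne_zero hl
    rw [hj, Nat.succ_sub_one, pow_succ]
    push_cast
    ring

/-- Certificate for the relative class number `k` of the `p * q`-th cyclotomic field. -/
def pairDetCert (p q r s : ℕ) (l : List ℕ) (t : ℤ) (k : ℕ) : Bool :=
  oddDetCheck (p * q) (stickelbergerFun p q r s) l
    (t * (k * (2 * (p * q * (p - 1) * (q - 1) : ℕ)) ^ l.length / (4 * (p * q)))) && |t| == 1 &&
    k * (2 * (p * q * (p - 1) * (q - 1))) ^ l.length % (4 * (p * q)) == 0 &&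
    p * r % q == 1 && q * s % p == 1

theorem classNumber_eq_mul_of_pairDetCert (hodd : Odd M) {p q : ℕ} (hM : M = p * q)
    (hp : p.Prime) (hq : q.Prime) (hpq : p ≠ q) {r s k : ℕ} {l : List ℕ} {t : ℤ}
    (h : pairDetCert p q r s l t k = true) :
    classNumber K = classNumber (𝐑 K) * k := by
  subst hM
  have : NeZero p := ⟨hp.ne_zero⟩
  have : NeZero q := ⟨hq.ne_zero⟩
  simp only [pairDetCert, Bool.and_eq_true, beq_iff_eq] at h
  obtain ⟨⟨⟨⟨h, ht⟩, hdvd⟩, hr⟩, hs⟩ := h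
  have hcop := (Nat.coprime_primes hp hq).2 hpq
  have hsq : Squarefree (p * q) :=
    (Nat.squarefree_mul hcop).2 ⟨hp.squarefree, hq.squarefree⟩
  have hpp : ¬ IsPrimePow (p * q) := fun h ↦
    Nat.not_prime_mul hp.ne_one hq.ne_one (hsq.prime_of_isPrimePow h)
  have h1 : p * q ≠ 1 := fun h ↦ hp.ne_one (Nat.eq_one_of_mul_eq_one_right h)
  refine classNumber_eq_mul_of_oddDetCheck (p * q) K hodd h1 hsq h (c := p * q * (p - 1) * (q - 1))
    ?_ ?_ ?_
  · have := hp.two_le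
    have := hq.two_le
    exact Nat.mul_ne_zero (Nat.mul_ne_zero (Nat.mul_ne_zero hp.ne_zero hq.ne_zero) (by omega))
      (by omega)
  · exact fun χ hχ ↦ sum_stickelbergerFun hcop hp hq (by rw [hr, Nat.one_mod_eq_one.2 hq.ne_one])
      (by rw [hs, Nat.one_mod_eq_one.2 hp.ne_one]) hχ
  · rw [indexRealUnits_eq_two (p * q) K hodd h1 hpp, abs_mul, ht, one_mul]
    generalize p * q * (p - 1) * (q - 1) = c at hdvd
    obtain ⟨z, hz⟩ := Nat.dvd_of_mod_eq_zero hdvd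
    have hz' : ((k * (2 * (c : ℤ)) ^ l.length : ℤ)) = 4 * (p * q) * z := by exact_mod_cast hz
    have h0 : (4 * (p * q) : ℤ) ≠ 0 := by
      exact_mod_cast (Nat.mul_ne_zero (by norm_num) (Nat.mul_ne_zero hp.ne_zero hq.ne_zero) :
        4 * (p * q) ≠ 0)
    rw [hz', Int.mul_ediv_cancel_left _ h0, abs_of_nonneg (by positivity)]
    push_cast
    ring

end Ratio

def primeDetCerts : List (ℕ × List ℕ × ℤ × ℕ) :=
  [(3, [1], -1, 1), (5, [1, 2], -1, 1), (7, [1, 3, 2], 1, 1), (11, [1, 2, 4, 3, 5], -1, 1),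
   (13, [1, 5, 2, 3, 4, 6], -1, 1), (17, [1, 8, 3, 6, 4, 5, 2, 7], 1, 1),
   (19, [1, 8, 2, 7, 6, 3, 5, 4, 9], -1, 1),
   (29, [2, 13, 8, 1, 14, 9, 7, 6, 12, 5, 3, 4, 10, 11], -1, 8),
   (37, [1, 16, 3, 11, 9, 4, 10, 12, 7, 2, 5, 6, 15, 18, 8, 17, 13, 14], -1, 37),
   (41, [3, 7, 6, 13, 8, 4, 20, 11, 10, 5, 9, 15, 1, 19, 17, 18, 16, 2, 12, 14], 1, 121)]

theorem primeDetCerts_all : primeDetCerts.all primeDetCert = true := by decide +kernel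

theorem pairDetCert_15 : pairDetCert 3 5 2 2 [1, 2, 4, 7] (-1) 1 = true := by decide +kernel

theorem pairDetCert_21 : pairDetCert 3 7 5 1 [1, 2, 4, 8, 5, 10] 1 1 = true := by decide +kernel

theorem pairDetCert_33 : pairDetCert 3 11 4 2 [1, 2, 4, 8, 16, 5, 10, 13, 7, 14] 1 1 = true := by
  decide +kernel

theorem pairDetCert_35 :
    pairDetCert 5 7 3 3 [1, 2, 4, 8, 16, 3, 6, 12, 11, 13, 9, 17] (-1) 1 = true := by
  decide +kernel

theorem pairDetCert_39 :
    pairDetCert 3 13 9 1 [1, 2, 4, 8, 16, 7, 14, 11, 17, 5, 10, 19] (-1) 2 = true := by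
  decide +kernel

theorem pairDetCert_65 :
    pairDetCert 5 13 8 2 [1, 3, 9, 27, 16, 17, 14, 23, 4, 12, 29, 22, 2, 6, 18, 11, 32, 31, 28, 19, 8,
      24, 7, 21] 1 64 = true := by
  decide +kernel

variable {M : ℕ} [NeZero M] {K : Type*} [Field K] [NumberField K] [IsCyclotomicExtension {M} ℚ K]
  [IsCMField K]

/-- If the relative class number of the `p`-th cyclotomic field is not a power of two, neither is
that of any cyclotomic field containing it. -/
theorem false_of_primeDetCert (hodd : Odd M) (h1 : M ≠ 1) (hsq : Squarefree M)
    (hdvd : classNumber K ∣ classNumber (𝐑 K) *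
      2 ^ Module.finrank ℚ (𝐑 K)) {p k : ℕ} {l : List ℕ} {s : ℤ} (hp : p.Prime)
    (hpM : p ∣ M) (hc : primeDetCert (p, l, s, k) = true) (hk : k % 2 = 1) (hk1 : k ≠ 1) :
    False := by
  have : NeZero p := ⟨hp.ne_zero⟩
  have hpodd : Odd p := hodd.of_dvd_nat hpM
  obtain ⟨r, -, ⟨z, rfl⟩, B, hB, hBr, hB2⟩ := exists_valuation_of_odd hk hk1
  have h2 := (valuation_eq_one_of_classNumber_dvd hB hB2 hodd h1 hsq hdvd).1 p inferInstance hp hpM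
  have : IsCyclotomicExtension {p} ℚ (CyclotomicField p ℚ) :=
    CyclotomicField.isCyclotomicExtension p ℚ
  have : IsCMField (CyclotomicField p ℚ) := cyclotomic_isCMField p hpodd hp.ne_one _
  have h3 := sq_classNumber_mul_two_pow p (CyclotomicField p ℚ) hpodd hp.ne_one hp.squarefree
  rw [classNumber_eq_mul_of_primeDetCert p (CyclotomicField p ℚ) hpodd hp hc,
    indexRealUnits_eq_one p _ hpodd hp] at h3
  have h0 : (classNumber (𝐑 (CyclotomicField p ℚ)) : ℂ) ^ 2 ≠ 0 :=
    pow_ne_zero _ (by exact_mod_cast classNumber_ne_zero _)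
  set n := Module.finrank ℚ (𝐑 (CyclotomicField p ℚ))
  have h4 : ((r : ℂ) * z * 2 ^ n) ^ 2 = (2 * (p * ∏ χ : 𝐗 p with χ (-1) = -1,
      χ.bernoulliOne)) ^ 2 := by
    refine mul_left_cancel₀ h0 ?_
    push_cast at h3
    linear_combination h3
  have h5 := congrArg B.valuation h4
  rw [map_pow, map_pow, map_mul, map_mul, map_mul, h2, map_pow, hB2, one_pow, mul_one, mul_one,
    one_pow] at h5
  have h6 : B.valuation (r : ℂ) * B.valuation (z : ℂ) < 1 :=
    mul_lt_one_of_lt_of_le hBr (by exact_mod_cast valuation_intCast_le_one hB z)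
  exact (pow_lt_one₀ zero_le h6 two_ne_zero).ne h5

theorem prod_mem_of_no_certificate : ∀ S ∈ ({3, 5, 7, 11, 13, 17, 19, 29} : Finset ℕ).powerset,
    S ≠ ∅ → (∀ c ∈ pairCerts, ¬ (c.1 ∈ S ∧ c.2.2.2.1 ∈ S)) → ¬ (3 ∈ S ∧ 5 ∈ S ∧ 7 ∈ S) →
    ¬ (3 ∈ S ∧ 5 ∈ S ∧ 13 ∈ S) →
    S.prod id ∈ [3, 5, 7, 11, 13, 17, 19, 29, 15, 21, 33, 35, 39, 65] := by
  decide +kernel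

theorem pairCerts_primes : ∀ c ∈ pairCerts, c.1.Prime ∧ c.2.2.2.1.Prime ∧ c.1 ≠ c.2.2.2.1 := by
  decide +kernel

variable {M : ℕ} [NeZero M] {K : Type*} [Field K] [NumberField K] [IsCyclotomicExtension {M} ℚ K]
  [IsCMField K]

theorem mem_of_classNumber_dvd (hodd : Odd M) (h1 : M ≠ 1) (hsq : Squarefree M)
    (hdvd : classNumber K ∣ classNumber (𝐑 K) *
      2 ^ Module.finrank ℚ (𝐑 K)) :
    M ∈ [3, 5, 7, 11, 13, 17, 19, 29, 15, 21, 33, 35, 39, 65] := by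
  have hle := Nat.le_of_dvd (Nat.mul_pos (Nat.pos_of_ne_zero (classNumber_ne_zero _))
    (by positivity)) hdvd
  have hA : M.primeFactors ⊆ {3, 5, 7, 11, 13, 17, 19, 29} := by
    intro p hpM
    obtain ⟨hp, hpM, -⟩ := Nat.mem_primeFactors.1 hpM
    have hp409 : p < 409 := by
      by_contra! h
      exact (classNumber_gt_of_large_prime M K hodd h1 hsq hp hpM h).not_ge hle
    have hp2 : p ≠ 2 := by
      rintro rfl
      exact absurd (hodd.of_dvd_nat hpM) (by decide)
    have hdet : ∀ {l s k}, (p, l, s, k) ∈ primeDetCerts → k % 2 = 1 → k ≠ 1 → False :=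
      fun h hk hk1 ↦ false_of_primeDetCert hodd h1 hsq hdvd hp hpM
        (List.all_eq_true.1 primeDetCerts_all _ h) hk hk1
    rcases mem_primeCerts_of_prime p hp409 hp with h | h
    · have h37 : p ≠ 37 := by
        rintro rfl
        exact hdet (l := [1, 16, 3, 11, 9, 4, 10, 12, 7, 2, 5, 6, 15, 18, 8, 17, 13, 14])
          (s := -1) (k := 37) (by simp [primeDetCerts]) (by decide) (by decide)
      have h41 : p ≠ 41 := by
        rintro rfl
        exact hdet (l := [3, 7, 6, 13, 8, 4, 20, 11, 10, 5, 9, 15, 1, 19, 17, 18, 16, 2, 12, 14])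
          (s := 1) (k := 121) (by simp [primeDetCerts]) (by decide) (by decide)
      simp only [List.mem_cons, List.not_mem_nil, or_false] at h
      simp only [Finset.mem_insert, Finset.mem_singleton]
      tauto
    · obtain ⟨⟨p', g, t, r⟩, hc, rfl⟩ := List.mem_map.1 h
      exact (false_of_primeCert hodd h1 hsq hdvd hp hpM
        (List.all_eq_true.1 primeCerts_all _ hc)).elim
  have hd : ∀ {p}, p ∈ M.primeFactors → p ∣ M := Nat.dvd_of_mem_primeFactors
  have key := prod_mem_of_no_certificate M.primeFactors (Finset.mem_powerset.2 hA) ?_ ?_ ?_ ?_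
  · have := Nat.prod_primeFactors_of_squarefree hsq
    rwa [show M.primeFactors.prod id = M from this] at key
  · rw [ne_eq, Nat.primeFactors_eq_empty]
    exact fun h ↦ h.elim (NeZero.ne M) h1
  · rintro ⟨p, g, t, p', g', t', r⟩ hc ⟨hp, hp'⟩
    obtain ⟨h2, h3, h4⟩ := pairCerts_primes _ hc
    exact false_of_pairCert hodd h1 hsq hdvd h2 h3 h4 (hd hp) (hd hp')
      (List.all_eq_true.1 pairCerts_all _ hc)
  · rintro ⟨h3, h5, h7⟩
    exact false_of_tripleCert hodd h1 hsq hdvd Nat.prime_three Nat.prime_five Nat.prime_seven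
      (by decide) (by decide) (by decide) (hd h3) (hd h5) (hd h7) tripleCert_105
  · rintro ⟨h3, h5, h13⟩
    exact false_of_tripleCert hodd h1 hsq hdvd Nat.prime_three Nat.prime_five
      (by norm_num : Nat.Prime 13)
      (by decide) (by decide) (by decide) (hd h3) (hd h5) (hd h13) tripleCert_195

section NormUnits

variable {R : Type*} [CommRing R]

/-- A unit of the `29`-th cyclotomic field, up to squares of real elements a norm. -/
def normUnit29 (z : R) : R :=
  2 - 2 * z ^ 2 - 3 * z ^ 3 - 3 * z ^ 4 - 2 * z ^ 5 - z ^ 6 - 2 * z ^ 7 - 2 * z ^ 8 - 2 * z ^ 9 -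
  2 * z ^ 10 - z ^ 11 - z ^ 12 - 3 * z ^ 13 - 4 * z ^ 14 - 4 * z ^ 15 - 3 * z ^ 16 - z ^ 17 -
  z ^ 18 - 2 * z ^ 19 - 2 * z ^ 20 - 2 * z ^ 21 - 2 * z ^ 22 - z ^ 23 - 2 * z ^ 24 -
  3 * z ^ 25 - 3 * z ^ 26 - 2 * z ^ 27

theorem normUnit29_eq {z : R} (hz : 1 + z + z ^ 2 + z ^ 3 + z ^ 4 + z ^ 5 + z ^ 6 + z ^ 7 + z ^ 8 + z ^ 9 + z ^ 10 + z ^ 11 + z ^ 12 + z ^ 13 + z ^ 14 + z ^ 15 + z ^ 16 + z ^ 17 + z ^ 18 + z ^ 19 + z ^ 20 + z ^ 21 + z ^ 22 + z ^ 23 + z ^ 24 + z ^ 25 + z ^ 26 + z ^ 27 + z ^ 28 = 0) :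
    (1 + z + z ^ 2 - z ^ 5) * (1 - z ^ 24 + z ^ 27 + z ^ 28) =
      normUnit29 z * (-1 + z - z ^ 7 - z ^ 22 + z ^ 28) ^ 2 := by
  rw [normUnit29]
  linear_combination (
    -1 + 6 * z - 4 * z ^ 2 - 2 * z ^ 3 - z ^ 5 + 2 * z ^ 6 - 2 * z ^ 7 + 5 * z ^ 8 + z ^ 9 -
    2 * z ^ 10 - 3 * z ^ 11 + z ^ 13 - z ^ 14 + 2 * z ^ 16 + z ^ 17 + z ^ 18 + z ^ 20 -
    6 * z ^ 22 + 5 * z ^ 23 - z ^ 25 - z ^ 26 + 6 * z ^ 28 - 5 * z ^ 29 + z ^ 30 + 3 * z ^ 31 +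
    z ^ 32 - z ^ 33 - 2 * z ^ 34 + 2 * z ^ 35 - 2 * z ^ 37 - 2 * z ^ 38 - z ^ 39 - z ^ 40 -
    z ^ 41 + z ^ 42 + 3 * z ^ 43 + 2 * z ^ 45 + z ^ 46 - 2 * z ^ 48 - 4 * z ^ 49 + z ^ 50 -
    z ^ 51 - z ^ 52 + z ^ 54 + 2 * z ^ 55) * hz

theorem isUnit_normUnit29 {z : R} (hz : 1 + z + z ^ 2 + z ^ 3 + z ^ 4 + z ^ 5 + z ^ 6 + z ^ 7 + z ^ 8 + z ^ 9 + z ^ 10 + z ^ 11 + z ^ 12 + z ^ 13 + z ^ 14 + z ^ 15 + z ^ 16 + z ^ 17 + z ^ 18 + z ^ 19 + z ^ 20 + z ^ 21 + z ^ 22 + z ^ 23 + z ^ 24 + z ^ 25 + z ^ 26 + z ^ 27 + z ^ 28 = 0) :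
    IsUnit (normUnit29 z) := by
  refine IsUnit.of_mul_eq_one (
    8 + 2 * z ^ 2 + 4 * z ^ 3 + 3 * z ^ 4 + 3 * z ^ 5 + 6 * z ^ 7 + 2 * z ^ 8 + z ^ 9 +
    4 * z ^ 10 + 3 * z ^ 11 + 3 * z ^ 12 + z ^ 13 + 4 * z ^ 14 + 4 * z ^ 15 + z ^ 16 +
    3 * z ^ 17 + 3 * z ^ 18 + 4 * z ^ 19 + z ^ 20 + 2 * z ^ 21 + 6 * z ^ 22 + 3 * z ^ 24 +
    3 * z ^ 25 + 4 * z ^ 26 + 2 * z ^ 27) ?_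
  rw [normUnit29]
  linear_combination (
    15 - 15 * z - 12 * z ^ 2 - 4 * z ^ 3 - 6 * z ^ 4 - 2 * z ^ 5 - 8 * z ^ 6 - 3 * z ^ 7 -
    5 * z ^ 8 - 9 * z ^ 9 - 2 * z ^ 10 + 2 * z ^ 11 - 6 * z ^ 12 - 20 * z ^ 13 - 10 * z ^ 14 -
    3 * z ^ 15 - 8 * z ^ 16 - 6 * z ^ 18 - 4 * z ^ 19 - 8 * z ^ 20 - 7 * z ^ 21 + 3 * z ^ 22 -
    7 * z ^ 23 - 10 * z ^ 24 - 10 * z ^ 25 - 4 * z ^ 26) * hz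

/-- A unit of the `39`-th cyclotomic field, up to squares of real elements a norm. -/
def normUnit39 (z : R) : R :=
  13 - 13 * z ^ 2 + 3 * z ^ 4 + 2 * z ^ 5 + 9 * z ^ 6 - 3 * z ^ 7 - 14 * z ^ 8 + 3 * z ^ 9 +
  6 * z ^ 10 + z ^ 11 + 6 * z ^ 12 + 6 * z ^ 13 - 12 * z ^ 14 - 7 * z ^ 15 + 8 * z ^ 16 +
  2 * z ^ 17 + 4 * z ^ 18 + 2 * z ^ 19 - 13 * z ^ 20 - 4 * z ^ 21 + 11 * z ^ 22 + 2 * z ^ 23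

theorem normUnit39_eq {z : R} (hz : 1 - z + z ^ 3 - z ^ 4 + z ^ 6 - z ^ 7 + z ^ 9 - z ^ 10 + z ^ 12 - z ^ 14 + z ^ 15 - z ^ 17 + z ^ 18 - z ^ 20 + z ^ 21 - z ^ 23 + z ^ 24 = 0) :
    (1 + z + z ^ 3) * (1 + z ^ 36 + z ^ 38) =
      normUnit39 z * (1 + z - z ^ 6 - z ^ 33 + z ^ 38) ^ 2 := by
  rw [normUnit39]
  linear_combination (
    -12 - 37 * z - 37 * z ^ 2 + 2 * z ^ 3 + 37 * z ^ 4 + 29 * z ^ 5 + 12 * z ^ 6 + 11 * z ^ 7 +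
    4 * z ^ 8 - 4 * z ^ 9 - 5 * z ^ 10 + 4 * z ^ 11 - 3 * z ^ 12 - 6 * z ^ 13 - 2 * z ^ 14 +
    6 * z ^ 15 + 7 * z ^ 16 - 6 * z ^ 18 - 7 * z ^ 19 + 5 * z ^ 21 + 4 * z ^ 22 - 3 * z ^ 23 -
    8 * z ^ 24 - 3 * z ^ 25 + 3 * z ^ 26 + 6 * z ^ 27 - 6 * z ^ 29 - 7 * z ^ 30 - z ^ 31 +
    6 * z ^ 32 + 30 * z ^ 33 + 49 * z ^ 34 + 17 * z ^ 35 - 30 * z ^ 36 - 42 * z ^ 37 -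
    27 * z ^ 38 - 33 * z ^ 39 - 9 * z ^ 40 + 23 * z ^ 41 + 28 * z ^ 42 - 5 * z ^ 44 + z ^ 45 +
    6 * z ^ 46 + 6 * z ^ 47 - z ^ 48 - 5 * z ^ 49 - 4 * z ^ 50 + 2 * z ^ 51 + 6 * z ^ 52 +
    3 * z ^ 53 - 3 * z ^ 54 - 6 * z ^ 55 - z ^ 56 + 4 * z ^ 57 + 5 * z ^ 58 - 5 * z ^ 60 -
    4 * z ^ 61 + z ^ 62 + 6 * z ^ 63 + 3 * z ^ 64 - 3 * z ^ 65 - 19 * z ^ 66 - 15 * z ^ 67 +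
    4 * z ^ 68 + 18 * z ^ 69 + 11 * z ^ 70 + 15 * z ^ 71 + 6 * z ^ 72 - 9 * z ^ 73 -
    13 * z ^ 74 - 2 * z ^ 75) * hz

theorem isUnit_normUnit39 {z : R} (hz : 1 - z + z ^ 3 - z ^ 4 + z ^ 6 - z ^ 7 + z ^ 9 - z ^ 10 + z ^ 12 - z ^ 14 + z ^ 15 - z ^ 17 + z ^ 18 - z ^ 20 + z ^ 21 - z ^ 23 + z ^ 24 = 0) :
    IsUnit (normUnit39 z) := by
  refine IsUnit.of_mul_eq_one (
    2 - z ^ 3 + z ^ 4 - z ^ 5 + z ^ 8 - z ^ 9 + z ^ 10 - z ^ 18 + z ^ 19 + z ^ 20 - z ^ 22 +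
    z ^ 23) ?_
  rw [normUnit39]
  linear_combination (
    25 + 25 * z - z ^ 2 - 39 * z ^ 3 - 20 * z ^ 4 + 10 * z ^ 5 + 28 * z ^ 6 + 13 * z ^ 7 -
    5 * z ^ 8 - 27 * z ^ 9 - 9 * z ^ 10 + 22 * z ^ 11 + 27 * z ^ 12 + 2 * z ^ 13 -
    27 * z ^ 14 - 24 * z ^ 15 + 5 * z ^ 16 + 28 * z ^ 17 + 6 * z ^ 18 - 13 * z ^ 19 -
    4 * z ^ 20 + 11 * z ^ 21 + 2 * z ^ 22) * hz

end NormUnits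

section Ambiguous

variable (M : ℕ) [NeZero M] (K : Type*) [Field K] [NumberField K] [IsCyclotomicExtension {M} ℚ K]
  [IsCMField K]

theorem exists_ringHom_of_isPrimitiveRoot {ζ : K} (hζ : IsPrimitiveRoot ζ M) {r : ℕ}
    [Fact r.Prime] {t : ZMod r} (ht : IsPrimitiveRoot t M) :
    ∃ θ : 𝓞 K →+* ZMod r, θ hζ.toInteger = t := by
  have hne : NeZero (M : ZMod r) := ht.neZero'
  have h1 : Polynomial.aeval t (minpoly ℤ hζ.integralPowerBasis.gen) = 0 := by
    have h2 : minpoly ℤ hζ.integralPowerBasis.gen = Polynomial.cyclotomic M ℤ := by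
      rw [IsPrimitiveRoot.integralPowerBasis_gen, Polynomial.cyclotomic_eq_minpoly hζ (NeZero.pos M),
        ← minpoly.algebraMap_eq (B' := K) RingOfIntegers.coe_injective hζ.toInteger]
      rfl
    rw [h2, Polynomial.aeval_def, Polynomial.eval₂_eq_eval_map, Polynomial.map_cyclotomic]
    exact Polynomial.isRoot_cyclotomic_iff.2 ht
  refine ⟨(hζ.integralPowerBasis.lift t h1).toRingHom, ?_⟩
  have h3 := hζ.integralPowerBasis.lift_gen t h1
  rwa [IsPrimitiveRoot.integralPowerBasis_gen] at h3

theorem isSquare_of_mem_range_unitNorm (hodd : Odd M) {F : Type*} [Field F]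
    (hF : IsSquare (-1 : F)) (θ : 𝓞 K →+* F) {u : (𝓞 K)ˣ}
    (hu : u ∈ (unitNorm (conjRingEquiv K)).range) : IsSquare (θ u) := by
  obtain ⟨v, rfl⟩ := hu
  set w : 𝓞 K := conjRingEquiv K v with hw
  set τ := IsCMField.unitsMulComplexConjInv K v with hτ
  have h1 : (v : 𝓞 K) = ((τ : (𝓞 K)ˣ) : 𝓞 K) * w := by
    have h3 : (τ : (𝓞 K)ˣ) * IsCMField.unitsComplexConj K v = v := by
      rw [hτ, IsCMField.unitsMulComplexConjInv_apply, inv_mul_cancel_right]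
    exact congrArg Units.val h3.symm
  have h2 : ((τ : (𝓞 K)ˣ) : 𝓞 K) ^ (2 * M) = 1 := by
    have h3 : τ ^ Units.torsionOrder K = 1 := by
      rw [Units.torsionOrder]
      exact pow_card_eq_one'
    rw [IsCyclotomicExtension.Rat.torsionOrder_eq (n := M), if_neg (Nat.not_even_iff_odd.2 hodd)]
      at h3
    have := congrArg (fun x : Units.torsion K ↦ ((x : (𝓞 K)ˣ) : 𝓞 K)) h3
    simpa using this
  have h4 : IsSquare (θ ((τ : (𝓞 K)ˣ) : 𝓞 K)) := by
    set x := θ ((τ : (𝓞 K)ˣ) : 𝓞 K)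
    have h5 : x ^ M * x ^ M = 1 := by
      rw [← pow_add, ← two_mul, ← map_pow, h2, map_one]
    have h6 : IsSquare (x ^ M) := by
      rcases mul_self_eq_one_iff.1 h5 with h | h <;> rw [h]
      · exact IsSquare.one
      · exact hF
    obtain ⟨k, hk⟩ := hodd
    have hx0 : x ≠ 0 := by
      rintro h
      rw [h, zero_pow (NeZero.ne M), zero_mul] at h5
      exact zero_ne_one h5
    have h7 : x = x ^ M * ((x ^ k) * (x ^ k))⁻¹ := by
      rw [hk]
      field_simp
      ring
    rw [h7]
    exact h6.mul (IsSquare.mul_self _).inv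
  have h8 : θ (unitNorm (conjRingEquiv K) v : (𝓞 K)ˣ) = θ ((τ : (𝓞 K)ˣ) : 𝓞 K) * (θ w * θ w) := by
    rw [unitNorm_val, map_mul, ← hw, h1, map_mul]
    ring
  rw [h8]
  exact h4.mul (IsSquare.mul_self _)

theorem forall_eq_of_nonsquares (J : ClassGroup (𝓞 K) →* ClassGroup (𝓞 K))
    (hJ : IsClassAction (conjRingEquiv K) J)
    (hodd : Odd M) (h1 : M ≠ 1) (hsq : Squarefree M) {s : ℕ} (u : Fin s → (𝓞 K)ˣ)
    (hu : ∀ i, ∃ β b : 𝓞 K, β ≠ 0 ∧ b ≠ 0 ∧ conjRingEquiv K b = b ∧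
      β * conjRingEquiv K β = u i * b ^ 2) {F : Type*} [Field F] (hF : IsSquare (-1 : F))
    (θ : Fin s → 𝓞 K →+* F) (hθ : ∀ i, ¬ IsSquare (θ i (u i)))
    (hθ' : ∀ i j, i ≠ j → IsSquare (θ i (u j)))
    (h : classNumber K ≤ classNumber (𝐑 K) * 2 ^ s) (x : ClassGroup (𝓞 K)) :
    J x = x := by
  classical
  choose β b hβ hb hb' hβb using hu
  let f : Finset (Fin s) → (𝓞 K)ˣ := fun T ↦ ∏ i ∈ T, u i
  have key : ∀ T T', f T * (f T')⁻¹ ∈ (unitNorm (conjRingEquiv K)).range → T ⊆ T' := by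
    intro T T' hTT' i hi
    by_contra hi'
    have h2 := isSquare_of_mem_range_unitNorm M K hodd hF (θ i) hTT'
    have h3 : ∀ S : Finset (Fin s), i ∉ S → IsSquare (θ i (f S)) := by
      intro S hS
      rw [Units.coe_prod, map_prod]
      refine Finset.prod_induction _ _ (fun _ _ ↦ IsSquare.mul) IsSquare.one fun j hj ↦ hθ' i j ?_
      rintro rfl
      exact hS hj
    have h4 : u i = f T * (f T')⁻¹ * f T' * (f (T.erase i))⁻¹ := by
      rw [inv_mul_cancel_right, eq_mul_inv_iff_mul_eq]
      exact Finset.mul_prod_erase T u hi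
    have h5 : IsSquare (θ i ((f (T.erase i))⁻¹ : (𝓞 K)ˣ)) := by
      have h6 := h3 _ (Finset.notMem_erase i T)
      have h7 : θ i ((f (T.erase i))⁻¹ : (𝓞 K)ˣ) = (θ i (f (T.erase i)))⁻¹ := by
        refine eq_inv_of_mul_eq_one_left ?_
        rw [← map_mul, Units.inv_mul, map_one]
      rw [h7]
      exact h6.inv
    refine hθ i ?_
    rw [h4, Units.val_mul, Units.val_mul, map_mul, map_mul]
    exact (h2.mul (h3 T' hi')).mul h5
  have hinj : ∀ T T', f T * (f T')⁻¹ ∈ (unitNorm (conjRingEquiv K)).range → T = T' := by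
    intro T T' hTT'
    refine (key T T' hTT').antisymm (key T' T ?_)
    have := inv_mem hTT'
    rwa [mul_inv_rev, inv_inv] at this
  refine forall_eq_of_classNumber_le M K J hJ hodd h1 hsq (univ.image f) ?_ ?_ ?_ x
  · intro v hv
    obtain ⟨T, -, rfl⟩ := Finset.mem_image.1 hv
    refine ⟨∏ i ∈ T, β i, ∏ i ∈ T, b i, Finset.prod_ne_zero_iff.2 fun i _ ↦ hβ i,
      Finset.prod_ne_zero_iff.2 fun i _ ↦ hb i, ?_, ?_⟩
    · rw [map_prod]
      exact prod_congr rfl fun i _ ↦ hb' i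
    · rw [map_prod, ← prod_mul_distrib, Units.coe_prod, ← Finset.prod_pow,
        ← prod_mul_distrib]
      exact prod_congr rfl fun i _ ↦ hβb i
  · intro v hv v' hv' hvv'
    obtain ⟨T, -, rfl⟩ := Finset.mem_image.1 hv
    obtain ⟨T', -, rfl⟩ := Finset.mem_image.1 hv'
    rw [hinj T T' hvv']
  · rw [Finset.card_image_of_injective, Finset.card_univ, Fintype.card_finset, Fintype.card_fin]
    · exact h
    · intro T T' hTT'
      refine hinj T T' ?_
      rw [hTT', mul_inv_cancel]
      exact one_mem _

end Ambiguous

theorem ZMod.isPrimitiveRoot_of_lt {r M : ℕ} {t : ZMod r} (hM : 0 < M) (h1 : t ^ M = 1)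
    (h : ∀ l < M, 0 < l → t ^ l ≠ 1) : IsPrimitiveRoot t M :=
  IsPrimitiveRoot.mk_of_lt t hM h1 fun l h0 hl ↦ h l hl h0

theorem IsPrimitiveRoot.sum_pow_mul_eq_zero {R : Type*} [CommRing R] [IsDomain R] {z : R}
    {M p : ℕ} (hz : IsPrimitiveRoot z M) (d : ℕ) (hM : M = d * p) (hp : 1 < p) (hd : 0 < d) :
    ∑ i ∈ range p, z ^ (d * i) = 0 := by
  have h1 : IsPrimitiveRoot (z ^ d) p := hz.pow (by rw [hM]; positivity) hM
  simpa [pow_mul] using h1.geom_sum_eq_zero hp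

theorem pow_eq_pow_of_mul_eq_one {R : Type*} [CommRing R] {M : ℕ} {z w : R} (hz : z ^ M = 1)
    (hw : z * w = 1) (i j : ℕ) (hij : i + j = M) : w ^ i = z ^ j := by
  have h1 : z ^ i * w ^ i = 1 := by rw [← mul_pow, hw, one_pow]
  calc w ^ i = (z ^ (i + j)) * w ^ i := by rw [hij, hz, one_mul]
    _ = z ^ j * (z ^ i * w ^ i) := by ring
    _ = z ^ j := by rw [h1, mul_one]

section Small

variable (M : ℕ) [NeZero M] (K : Type*) [Field K] [NumberField K] [IsCyclotomicExtension {M} ℚ K]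
  [IsCMField K]

theorem mul_conj_eq_one_of_pow {ζ : K} (hζ : IsPrimitiveRoot ζ M) (k : ℕ) :
    hζ.toInteger ^ k * conjRingEquiv K (hζ.toInteger ^ k) = 1 := by
  have h1 : conjRingEquiv K hζ.toInteger * hζ.toInteger = 1 :=
    ringOfIntegersComplexConj_toInteger M K hζ
  rw [map_pow, ← mul_pow, mul_comm, h1, one_pow]

theorem forall_eq_of_classNumber_eq (J : ClassGroup (𝓞 K) →* ClassGroup (𝓞 K))
    (hJ : IsClassAction (conjRingEquiv K) J)
    (hodd : Odd M) (h1 : M ≠ 1) (hsq : Squarefree M)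
    (h : classNumber K = classNumber (𝐑 K) * 1) (x : ClassGroup (𝓞 K)) :
    J x = x :=
  forall_eq_of_nonsquares M K J hJ hodd h1 hsq (s := 0) ![] (fun i ↦ i.elim0) (F := ℂ)
    ⟨Complex.I, by simp⟩ ![] (fun i ↦ i.elim0) (fun i ↦ i.elim0)
    (by rw [h, pow_zero]) x

end Small

theorem exists_mul_conj_eq_normUnit29 {K : Type*} [Field K] [NumberField K] [IsCMField K] {z : 𝓞 K}
    (hz : IsPrimitiveRoot z 29) (hc : z * conjRingEquiv K z = 1)
    (hβ : 1 + z + z ^ 2 - z ^ 5 ≠ 0) (hb : -1 + z - z ^ 7 - z ^ 22 + z ^ 28 ≠ 0) :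
    ∃ u : (𝓞 K)ˣ, (u : 𝓞 K) = normUnit29 z ∧ ∃ β b : 𝓞 K, β ≠ 0 ∧ b ≠ 0 ∧
      conjRingEquiv K b = b ∧ β * conjRingEquiv K β = u * b ^ 2 := by
  have hsum := hz.geom_sum_eq_zero (by norm_num)
  simp only [sum_range_succ, Finset.sum_range_zero, pow_zero, zero_add, pow_one] at hsum
  have hpow := pow_eq_pow_of_mul_eq_one hz.pow_eq_one hc
  have h1 := hpow 1 28 rfl
  have h2 := hpow 2 27 rfl
  have h5 := hpow 5 24 rfl
  have h7 := hpow 7 22 rfl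
  have h22 := hpow 22 7 rfl
  have h28 := hpow 28 1 rfl
  rw [pow_one] at h1 h28
  refine ⟨(isUnit_normUnit29 hsum).unit, rfl, _, _, hβ, hb, ?_, ?_⟩
  · simp only [map_add, map_sub, map_neg, map_pow, map_one]
    rw [h28, h22, h7, h1]
    ring
  · simp only [map_add, map_sub, map_pow, map_one, IsUnit.unit_spec]
    rw [h5, h2, h1, ← normUnit29_eq hsum]
    ring

theorem exists_mul_conj_eq_normUnit39 {K : Type*} [Field K] [NumberField K] [IsCMField K] {z : 𝓞 K}
    (hz : IsPrimitiveRoot z 39) (hc : z * conjRingEquiv K z = 1)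
    (hβ : 1 + z + z ^ 3 ≠ 0) (hb : 1 + z - z ^ 6 - z ^ 33 + z ^ 38 ≠ 0) :
    ∃ u : (𝓞 K)ˣ, (u : 𝓞 K) = normUnit39 z ∧ ∃ β b : 𝓞 K, β ≠ 0 ∧ b ≠ 0 ∧
      conjRingEquiv K b = b ∧ β * conjRingEquiv K β = u * b ^ 2 := by
  have h3 := hz.sum_pow_mul_eq_zero 13 (p := 3) rfl (by norm_num) (by norm_num)
  have h13 := hz.sum_pow_mul_eq_zero 3 (p := 13) rfl (by norm_num) (by norm_num)
  simp only [sum_range_succ, Finset.sum_range_zero, zero_add] at h3 h13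
  have hsum : 1 - z + z ^ 3 - z ^ 4 + z ^ 6 - z ^ 7 + z ^ 9 - z ^ 10 + z ^ 12 - z ^ 14 + z ^ 15 -
      z ^ 17 + z ^ 18 - z ^ 20 + z ^ 21 - z ^ 23 + z ^ 24 = 0 := by
    linear_combination h13 - (z + z ^ 4 + z ^ 7 + z ^ 10) * h3
  have hpow := pow_eq_pow_of_mul_eq_one hz.pow_eq_one hc
  have h1 := hpow 1 38 rfl
  have h3 := hpow 3 36 rfl
  have h6 := hpow 6 33 rfl
  have h33 := hpow 33 6 rfl
  have h38 := hpow 38 1 rfl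
  rw [pow_one] at h1 h38
  refine ⟨(isUnit_normUnit39 hsum).unit, rfl, _, _, hβ, hb, ?_, ?_⟩
  · simp only [map_add, map_sub, map_pow, map_one]
    rw [h38, h33, h6, h1]
    ring
  · simp only [map_add, map_pow, map_one, IsUnit.unit_spec]
    rw [h3, h1, ← normUnit39_eq hsum]
    ring

/-- The images of the units `normUnit29 (ζ ^ k)` modulo primes over `233`. -/
theorem normUnit29_values : let t : Fin 3 → ZMod 233 := ![64, 8, 2]
    let k : Fin 3 → ℕ := ![1, 2, 4]
    ∀ i, (∀ j, IsSquare (normUnit29 (t i ^ k j)) ↔ i ≠ j) ∧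
      (t i ^ 29 = 1 ∧ ∀ l < 29, 0 < l → t i ^ l ≠ 1) ∧
      ∀ j, 1 + t i ^ k j + (t i ^ k j) ^ 2 - (t i ^ k j) ^ 5 ≠ 0 ∧
        -1 + t i ^ k j - (t i ^ k j) ^ 7 - (t i ^ k j) ^ 22 + (t i ^ k j) ^ 28 ≠ 0 := by
  decide +kernel

theorem normUnit39_values : let t : ZMod 157 := 9
    ¬ IsSquare (normUnit39 t) ∧ (t ^ 39 = 1 ∧ ∀ l < 39, 0 < l → t ^ l ≠ 1) ∧
      1 + t + t ^ 3 ≠ 0 ∧ 1 + t - t ^ 6 - t ^ 33 + t ^ 38 ≠ 0 := by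
  decide +kernel

theorem ne_zero_of_ringHom {R S : Type*} [Semiring R] [Semiring S] (θ : R →+* S) {x : R} {y : S}
    (hy : y ≠ 0) (h : θ x = y) : x ≠ 0 := fun h0 ↦ hy (by rw [← h, h0, map_zero])

theorem forall_eq_twentyNine (K : Type*) [Field K] [NumberField K]
    [IsCyclotomicExtension {29} ℚ K] [IsCMField K] (J : ClassGroup (𝓞 K) →* ClassGroup (𝓞 K))
    (hJ : IsClassAction (conjRingEquiv K) J)
    (h : classNumber K = classNumber (𝐑 K) * 8) (x : ClassGroup (𝓞 K)) :
    J x = x := by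
  have hζ := IsCyclotomicExtension.zeta_spec 29 ℚ K
  have hF : IsSquare (-1 : ZMod 233) := ⟨89, by decide⟩
  have : Fact (Nat.Prime 233) := ⟨by norm_num⟩
  obtain ⟨k, hk⟩ : ∃ k : Fin 3 → ℕ, k = ![1, 2, 4] := ⟨_, rfl⟩
  obtain ⟨t, ht⟩ : ∃ t : Fin 3 → ZMod 233, t = ![64, 8, 2] := ⟨_, rfl⟩
  have hval := normUnit29_values
  simp only [← hk, ← ht] at hval
  have hkc : ∀ i, (k i).Coprime 29 := by subst hk; decide
  choose θ hθ using fun i ↦ exists_ringHom_of_isPrimitiveRoot 29 K hζ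
    (ZMod.isPrimitiveRoot_of_lt (by norm_num) (hval i).2.1.1 (hval i).2.1.2)
  choose u hu hu' using fun j ↦ exists_mul_conj_eq_normUnit29
    (hζ.toInteger_isPrimitiveRoot.pow_of_coprime _ (hkc j)) (mul_conj_eq_one_of_pow 29 K hζ (k j))
    (ne_zero_of_ringHom (θ 0) ((hval 0).2.2 j).1 (by simp [hθ]))
    (ne_zero_of_ringHom (θ 0) ((hval 0).2.2 j).2 (by simp [hθ]))
  have hθu : ∀ i j, θ i (u j) = normUnit29 (t i ^ k j) := by
    intro i j
    rw [← hθ i, hu]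
    simp only [normUnit29, map_sub, map_mul, map_pow, map_ofNat]
  refine forall_eq_of_nonsquares 29 K J hJ (by decide) (by norm_num)
    (by norm_num : Nat.Prime 29).squarefree u hu' (F := ZMod 233) hF θ ?_ ?_ h.le x
  · intro i
    rw [hθu, (hval i).1 i]
    simp
  · intro i j hij
    rw [hθu, (hval i).1 j]
    exact hij

theorem forall_eq_thirtyNine (K : Type*) [Field K] [NumberField K]
    [IsCyclotomicExtension {39} ℚ K] [IsCMField K] (J : ClassGroup (𝓞 K) →* ClassGroup (𝓞 K))
    (hJ : IsClassAction (conjRingEquiv K) J)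
    (h : classNumber K = classNumber (𝐑 K) * 2) (x : ClassGroup (𝓞 K)) :
    J x = x := by
  have hζ := IsCyclotomicExtension.zeta_spec 39 ℚ K
  have hF : IsSquare (-1 : ZMod 157) := ⟨28, by decide⟩
  have : Fact (Nat.Prime 157) := ⟨by norm_num⟩
  obtain ⟨t, ht⟩ : ∃ t : ZMod 157, t = 9 := ⟨_, rfl⟩
  have hval := normUnit39_values
  simp only [← ht] at hval
  obtain ⟨θ, hθ⟩ := exists_ringHom_of_isPrimitiveRoot 39 K hζ
    (ZMod.isPrimitiveRoot_of_lt (by norm_num) hval.2.1.1 hval.2.1.2)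
  have hc := mul_conj_eq_one_of_pow 39 K hζ 1
  rw [pow_one] at hc
  obtain ⟨u, hu, hu'⟩ := exists_mul_conj_eq_normUnit39 hζ.toInteger_isPrimitiveRoot hc
    (ne_zero_of_ringHom θ hval.2.2.1 (by simp [hθ]))
    (ne_zero_of_ringHom θ hval.2.2.2 (by simp [hθ]))
  have hθu : θ u = normUnit39 t := by
    rw [← hθ, hu]
    simp only [normUnit39, map_add, map_sub, map_mul, map_pow, map_ofNat]
  refine forall_eq_of_nonsquares 39 K J hJ (by decide) (by norm_num)
    (by decide +kernel) (s := 1) (fun _ ↦ u) (fun _ ↦ hu')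
    (F := ZMod 157) hF (fun _ ↦ θ) ?_ ?_ (by rw [h, pow_one]) x
  · intro i
    rw [hθu]
    exact hval.1
  · intro i j hij
    exact absurd (Subsingleton.elim i j) hij

section SignChar

/-- The sign of a real character, written additively. -/
noncomputable def signChar {G : Type*} [Group G] (f : G →* ℝ) : G →* Multiplicative (ZMod 2) where
  toFun g := Multiplicative.ofAdd (if f g < 0 then 1 else 0)
  map_one' := by simp
  map_mul' g h := by
    have hne : ∀ g, f g ≠ 0 := fun g hg ↦ by
      have := map_mul f g g⁻¹
      rw [mul_inv_cancel, map_one, hg, zero_mul] at this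
      exact one_ne_zero this
    rw [← ofAdd_add, map_mul]
    congr 1
    rcases (hne g).lt_or_gt with hg | hg <;> rcases (hne h).lt_or_gt with hh | hh
    · rw [if_pos hg, if_pos hh, if_neg (mul_pos_of_neg_of_neg hg hh).not_gt]
      decide
    · rw [if_pos hg, if_neg hh.not_gt, if_pos (mul_neg_of_neg_of_pos hg hh), add_zero]
    · rw [if_neg hg.not_gt, if_pos hh, if_pos (mul_neg_of_pos_of_neg hg hh), zero_add]
    · rw [if_neg hg.not_gt, if_neg hh.not_gt, if_neg (mul_pos hg hh).not_gt, add_zero]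

theorem signChar_apply {G : Type*} [Group G] (f : G →* ℝ) (g : G) :
    signChar f g = Multiplicative.ofAdd (if f g < 0 then 1 else 0) := rfl

theorem signChar_eq_one {G : Type*} [Group G] {f : G →* ℝ} {g : G} (h : 0 < f g) :
    signChar f g = 1 := by
  rw [signChar_apply, if_neg h.not_gt, ofAdd_zero]

theorem surjective_of_mulSingle {G : Type*} [Group G] {s : ℕ}
    (t : G →* Fin s → Multiplicative (ZMod 2))
    (u : Fin s → G) (h : ∀ j, t (u j) = Pi.mulSingle j (Multiplicative.ofAdd 1)) :
    Function.Surjective t := by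
  intro y
  rw [← MonoidHom.mem_range, ← Finset.univ_prod_mulSingle y]
  refine Subgroup.prod_mem _ fun j _ ↦ ?_
  have h2 : ∀ a : Multiplicative (ZMod 2), a = 1 ∨ a = Multiplicative.ofAdd 1 := by decide
  rcases h2 (y j) with h3 | h3
  · rw [h3, Pi.mulSingle_one]
    exact one_mem _
  · rw [h3, ← h j]
    exact ⟨_, rfl⟩

end SignChar

theorem sin_two_pi_mul_div {M x : ℕ} (hM : Odd M) (hx : ¬ M ∣ x) :
    (M < 2 * (x % M) → Real.sin (2 * Real.pi * (x / M)) < 0) ∧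
      (¬ M < 2 * (x % M) → 0 < Real.sin (2 * Real.pi * (x / M))) := by
  have hM0 : 0 < M := hM.pos
  have hr0 : 0 < x % M := Nat.pos_of_ne_zero fun h ↦ hx (Nat.dvd_of_mod_eq_zero h)
  have hrM := Nat.mod_lt x hM0
  have hM' : (0 : ℝ) < M := by exact_mod_cast hM0
  have h1 : Real.sin (2 * Real.pi * (x / M)) = Real.sin (2 * Real.pi * ((x % M : ℕ) / M)) := by
    have h2 : (x : ℝ) = M * (x / M : ℕ) + (x % M : ℕ) := by exact_mod_cast (Nat.div_add_mod x M).symm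
    rw [← Real.sin_add_nat_mul_two_pi (2 * Real.pi * ((x % M : ℕ) / M)) (x / M)]
    congr 1
    rw [h2]
    field_simp
    ring
  rw [h1]
  generalize x % M = r at *
  have hr0' : (0 : ℝ) < r := by exact_mod_cast hr0
  have hpi := Real.pi_pos
  refine ⟨fun h ↦ ?_, fun h ↦ ?_⟩
  · have h3 : (M : ℝ) < 2 * r := by exact_mod_cast h
    have h4 : (r : ℝ) < M := by exact_mod_cast hrM
    have h5 : Real.pi < 2 * Real.pi * (r / M) := by
      rw [← mul_div_assoc, lt_div_iff₀ hM']
      nlinarith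
    have h6 : 2 * Real.pi * (r / M) < 2 * Real.pi := by
      rw [← mul_div_assoc, div_lt_iff₀ hM']
      nlinarith
    rw [← Real.sin_sub_two_pi]
    exact Real.sin_neg_of_neg_of_neg_pi_lt (by linarith) (by linarith)
  · have h3 : 2 * r < M := by
      obtain ⟨c, hc⟩ := hM
      omega
    have h3' : (2 * r : ℝ) < M := by exact_mod_cast h3
    refine Real.sin_pos_of_pos_of_lt_pi (by positivity) ?_
    rw [← mul_div_assoc, div_lt_iff₀ hM']
    nlinarith

section TotallyPositive

variable (M : ℕ) [NeZero M] (K : Type*) [Field K] [NumberField K] [IsCyclotomicExtension {M} ℚ K]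
  [IsCMField K]

theorem im_algebraMap_real (φ : K →+* ℂ) (x : 𝓞 (𝐑 K)) :
    (φ (algebraMap (𝓞 (𝐑 K)) (𝓞 K) x : 𝓞 K)).im = 0 := by
  rw [← Complex.conj_eq_iff_im, ← IsCMField.complexEmbedding_complexConj]
  congr 1
  exact congrArg (fun y : 𝓞 K ↦ (y : K)) (conjRingEquiv_algebraMap K x)

/-- The real values of the units of the maximal real subfield at a complex embedding. -/
noncomputable def realUnitValue (φ : K →+* ℂ) : (𝓞 (𝐑 K))ˣ →* ℝ where
  toFun v := (φ (algebraMap (𝓞 (𝐑 K)) (𝓞 K) v : 𝓞 K)).re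
  map_one' := by simp
  map_mul' v w := by
    simp only [Units.val_mul, map_mul, Complex.mul_re, im_algebraMap_real]
    ring

theorem coe_realUnitValue (φ : K →+* ℂ) (v : (𝓞 (𝐑 K))ˣ) :
    (realUnitValue K φ v : ℂ) = φ (algebraMap (𝓞 (𝐑 K)) (𝓞 K) v : 𝓞 K) :=
  Complex.ext rfl (im_algebraMap_real K φ v).symm

theorem exists_embedding_eq_exp {ζ : K} (hζ : IsPrimitiveRoot ζ M) {k : ℕ} (hk : k.Coprime M) :
    ∃ φ : K →+* ℂ, φ ζ = Complex.exp ((2 * Real.pi * (k / M) : ℝ) * Complex.I) := by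
  have h1 := Complex.isPrimitiveRoot_exp_of_coprime k M (NeZero.ne M) hk
  have hirr := Polynomial.cyclotomic.irreducible_rat (NeZero.pos M)
  obtain ⟨φ, hφ⟩ := (hζ.embeddingsEquivPrimitiveRoots ℂ hirr).surjective
    ⟨_, (mem_primitiveRoots (NeZero.pos M)).2 h1⟩
  refine ⟨φ.toRingHom, ?_⟩
  have h2 := hζ.embeddingsEquivPrimitiveRoots_apply_coe ℂ hirr φ
  rw [hφ] at h2
  change φ ζ = _
  rw [← h2]
  push_cast
  congr 1
  ring

theorem exists_real_unit_mul_sub_conj (hodd : Odd M) (h1 : M ≠ 1) (hpp : ¬ IsPrimePow M) {ζ : K}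
    (hζ : IsPrimitiveRoot ζ M) {b : ℕ} (hb : b.Coprime M) :
    ∃ v : (𝓞 (𝐑 K))ˣ, algebraMap _ (𝓞 K) (v : 𝓞 (𝐑 K)) *
      (hζ.toInteger - conjRingEquiv K hζ.toInteger) =
      hζ.toInteger ^ b - conjRingEquiv K (hζ.toInteger ^ b) := by
  have hb' := hζ.pow_of_coprime b hb
  obtain ⟨A, hA⟩ := isUnit_sub_conj M K hodd h1 hpp hb'
  obtain ⟨B, hB⟩ := isUnit_sub_conj M K hodd h1 hpp hζ
  have hneg : ∀ (C : (𝓞 K)ˣ) (w : 𝓞 K), (C : 𝓞 K) = w - conjRingEquiv K w →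
      IsCMField.unitsComplexConj K C = -C := by
    intro C w hC
    ext1
    change conjRingEquiv K C = -C
    rw [hC, map_sub, conjRingEquiv_conjRingEquiv, neg_sub]
  have hfix : IsCMField.unitsComplexConj K (A * B⁻¹) = A * B⁻¹ := by
    rw [map_mul, map_inv, hneg A _ hA, hneg B _ hB, inv_neg, neg_mul_neg]
  obtain ⟨v, hv⟩ := (IsCMField.unitsComplexConj_eq_self_iff K _).1 hfix
  refine ⟨v, ?_⟩
  have h2 : algebraMap _ (𝓞 K) (v : 𝓞 (𝐑 K)) = ((A * B⁻¹ : (𝓞 K)ˣ) : 𝓞 K) :=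
    congrArg Units.val hv
  have h3 : hζ.toInteger - conjRingEquiv K hζ.toInteger = B := hB.symm
  have h4 : hζ.toInteger ^ b - conjRingEquiv K (hζ.toInteger ^ b) = A := hA.symm
  rw [h2, h3, h4, ← Units.val_mul, inv_mul_cancel_right]

theorem realUnitValue_mul_sin {ζ : K} (hζ : IsPrimitiveRoot ζ M) {b k : ℕ}
    {v : (𝓞 (𝐑 K))ˣ}
    (hv : algebraMap _ (𝓞 K) (v : 𝓞 (𝐑 K)) *
      (hζ.toInteger - conjRingEquiv K hζ.toInteger) =
      hζ.toInteger ^ b - conjRingEquiv K (hζ.toInteger ^ b)) {φ : K →+* ℂ}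
    (hφ : φ ζ = Complex.exp ((2 * Real.pi * (k / M) : ℝ) * Complex.I)) :
    realUnitValue K φ v * Real.sin (2 * Real.pi * (k / M)) =
      Real.sin (2 * Real.pi * ((b * k : ℕ) / M)) := by
  set Φ : 𝓞 K →+* ℂ := φ.comp (algebraMap (𝓞 K) K) with hΦ
  have hconj : ∀ x : 𝓞 K, Φ (conjRingEquiv K x) = starRingEnd ℂ (Φ x) := fun x ↦
    IsCMField.complexEmbedding_complexConj K φ x
  have h1 := congrArg Φ hv
  have h2 : Φ hζ.toInteger = Complex.exp ((2 * Real.pi * (k / M) : ℝ) * Complex.I) := hφ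
  have h3 : Φ hζ.toInteger ^ b =
      Complex.exp ((2 * Real.pi * ((b * k : ℕ) / M) : ℝ) * Complex.I) := by
    rw [h2, ← Complex.exp_nat_mul]
    congr 1
    push_cast
    ring
  have h4 : Φ (algebraMap (𝓞 (𝐑 K)) (𝓞 K) v) = (realUnitValue K φ v : ℂ) :=
    (coe_realUnitValue K φ v).symm
  rw [map_mul, map_sub, map_sub, hconj, hconj, map_pow, h3, h2, h4] at h1
  have h5 := congrArg Complex.im h1
  rw [Complex.im_ofReal_mul, Complex.sub_im, Complex.sub_im, Complex.conj_im, Complex.conj_im,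
    Complex.exp_ofReal_mul_I_im, Complex.exp_ofReal_mul_I_im] at h5
  linear_combination h5 / 2

/-- A bound for the number of classes of totally positive units modulo squares, by means of `s`
units with independent signs. -/
theorem two_pow_mul_relIndex_dvd (hodd : Odd M) (h1 : M ≠ 1) (hpp : ¬ IsPrimePow M) {s : ℕ}
    (b : Fin s → ℕ) (W : Fin s → Finset ℕ) (hb : ∀ j, (b j).Coprime M)
    (hW : ∀ i, ∀ k ∈ W i, k.Coprime M)
    (hbW : ∀ i j, ∑ k ∈ W i, (if (M < 2 * (b j * k % M) ↔ M < 2 * (k % M)) then 0 else 1 : ZMod 2) =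
      if i = j then 1 else 0) :
    ∃ P : Subgroup (𝓞 (𝐑 K))ˣ,
      (∀ v : (𝓞 (𝐑 K))ˣ, (∃ a b : 𝓞 K, a ≠ 0 ∧ b ≠ 0 ∧
        a * conjRingEquiv K a = algebraMap _ (𝓞 K) (v : 𝓞 (𝐑 K)) *
          (b * conjRingEquiv K b)) → v ∈ P) ∧
      2 ^ s * (powMonoidHom 2 : (𝓞 (𝐑 K))ˣ →* _).range.relIndex P ∣
        2 ^ Module.finrank ℚ (𝐑 K) := by
  classical
  have hζ := IsCyclotomicExtension.zeta_spec M ℚ K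
  have hφ' : ∀ k : ℕ, ∃ φ : K →+* ℂ, k.Coprime M → φ (IsCyclotomicExtension.zeta M ℚ K) =
      Complex.exp ((2 * Real.pi * (k / M) : ℝ) * Complex.I) := by
    intro k
    by_cases hk : k.Coprime M
    · obtain ⟨φ, hφ⟩ := exists_embedding_eq_exp M K hζ hk
      exact ⟨φ, fun _ ↦ hφ⟩
    · obtain ⟨φ, -⟩ := exists_embedding_eq_exp M K hζ (Nat.coprime_one_left M)
      exact ⟨φ, fun h ↦ absurd h hk⟩
  choose φ hφ using hφ'
  choose v hv using fun j ↦ exists_real_unit_mul_sub_conj M K hodd h1 hpp hζ (hb j)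
  set P : Subgroup (𝓞 (𝐑 K))ˣ :=
    ⨅ k : ℕ, (signChar (realUnitValue K (φ k))).ker with hP
  have hmem : ∀ w, (∀ k, 0 < realUnitValue K (φ k) w) → w ∈ P := fun w hw ↦
    Subgroup.mem_iInf.2 fun k ↦ (MonoidHom.mem_ker).2 (signChar_eq_one (hw k))
  set t : (𝓞 (𝐑 K))ˣ →* Fin s → Multiplicative (ZMod 2) :=
    MonoidHom.pi fun i ↦ ∏ k ∈ W i, signChar (realUnitValue K (φ k)) with ht
  have hPt : P ≤ t.ker := by
    intro w hw
    rw [MonoidHom.mem_ker]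
    ext1 i
    rw [ht, MonoidHom.pi_apply, MonoidHom.finsetProd_apply]
    exact Finset.prod_eq_one fun k _ ↦ MonoidHom.mem_ker.1 (Subgroup.mem_iInf.1 hw k)
  have hval : ∀ j, t (v j) = Pi.mulSingle j (Multiplicative.ofAdd 1) := by
    intro j
    ext1 i
    rw [ht, MonoidHom.pi_apply, MonoidHom.finsetProd_apply]
    have h2 : ∀ k ∈ W i, signChar (realUnitValue K (φ k)) (v j) = Multiplicative.ofAdd
        (if (M < 2 * (b j * k % M) ↔ M < 2 * (k % M)) then 0 else 1 : ZMod 2) := by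
      intro k hk
      have h3 := realUnitValue_mul_sin M K hζ (hv j) (hφ k (hW i k hk))
      have hdvd : ∀ x : ℕ, x.Coprime M → ¬ M ∣ x := fun x hx hd ↦
        h1 (Nat.eq_one_of_dvd_coprimes hx hd dvd_rfl)
      have h4 := sin_two_pi_mul_div hodd (hdvd k (hW i k hk))
      have h5 := sin_two_pi_mul_div hodd (hdvd _ ((hb j).mul_left (hW i k hk)))
      rw [signChar_apply]
      congr 1
      rw [← h3] at h5
      generalize realUnitValue K (φ k) (v j) = x at *
      generalize Real.sin (2 * Real.pi * (k / M)) = y at *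
      by_cases h6 : M < 2 * (k % M) <;> by_cases h7 : M < 2 * (b j * k % M) <;>
        simp only [h6, h7, not_true_eq_false, not_false_eq_true, true_imp_iff, false_imp_iff,
          and_true, true_and, if_true, if_false, iff_true, iff_false, iff_self] at h4 h5 ⊢
      · rw [if_neg (not_lt.2 (by nlinarith))]
      · rw [if_pos (by nlinarith)]
      · rw [if_pos (by nlinarith)]
      · rw [if_neg (not_lt.2 (by nlinarith))]
    rw [prod_congr rfl h2, ← ofAdd_sum, hbW i j, Pi.mulSingle_apply]
    split_ifs <;> rfl
  refine ⟨P, ?_, ?_⟩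
  · rintro w ⟨x, y, hx, hy, hxy⟩
    refine hmem w fun k ↦ ?_
    set Φ : 𝓞 K →+* ℂ := (φ k).comp (algebraMap (𝓞 K) K) with hΦ
    have hconj : ∀ x : 𝓞 K, Φ (conjRingEquiv K x) = starRingEnd ℂ (Φ x) := fun x ↦
      IsCMField.complexEmbedding_complexConj K (φ k) x
    have hΦ0 : ∀ x : 𝓞 K, x ≠ 0 → 0 < Complex.normSq (Φ x) := by
      intro x hx
      rw [Complex.normSq_pos, hΦ, RingHom.comp_apply, map_ne_zero, Ne,
        RingOfIntegers.coe_eq_zero_iff]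
      exact hx
    have h2 := congrArg Φ hxy
    have h4 : Φ (algebraMap (𝓞 (𝐑 K)) (𝓞 K) w) =
      (realUnitValue K (φ k) w : ℂ) := (coe_realUnitValue K (φ k) w).symm
    rw [map_mul, map_mul, map_mul, hconj, hconj, Complex.mul_conj, Complex.mul_conj, h4] at h2
    have h5 : Complex.normSq (Φ x) = realUnitValue K (φ k) w * Complex.normSq (Φ y) := by
      exact_mod_cast h2
    exact pos_of_mul_pos_left (h5 ▸ hΦ0 x hx) (hΦ0 y hy).le
  · have hle : (powMonoidHom 2 : (𝓞 (𝐑 K))ˣ →* _).range ≤ P := by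
      rintro _ ⟨w, rfl⟩
      refine hmem _ fun k ↦ ?_
      rw [powMonoidHom_apply, map_pow]
      refine pow_two_pos_of_ne_zero fun h0 ↦ ?_
      have := map_mul (realUnitValue K (φ k)) w w⁻¹
      rw [mul_inv_cancel, map_one, h0, zero_mul] at this
      exact one_ne_zero this
    have h2 := Subgroup.index_dvd_of_le hPt
    rw [Subgroup.index_ker, MonoidHom.range_eq_top.2 (surjective_of_mulSingle t v hval),
      Subgroup.card_top, Nat.card_eq_fintype_card, Fintype.card_fun, Fintype.card_fin,
      Fintype.card_multiplicative, ZMod.card] at h2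
    refine (mul_dvd_mul_right h2 _).trans ?_
    rw [mul_comm, Subgroup.relIndex_mul_index hle]
    exact index_range_pow_two_units_dvd _

end TotallyPositive

/-- Units `sin (b x) / sin x` and sets of embeddings detecting their signs. -/
def signUnits : Fin 19 → ℕ :=
  ![64, 2, 3, 4, 6, 7, 8, 9, 11, 12, 14, 16, 17, 18, 19, 21, 22, 23, 24]

def signEmbeddings : Fin 19 → Finset ℕ :=
  ![{1}, {1, 2, 3, 7, 8, 9, 12, 18}, {1, 2, 3, 7, 11, 16, 18, 19, 21, 24}, {6, 9, 11, 16, 23, 24},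
    {4, 6, 7, 8, 9, 12, 18, 22, 23, 24}, {2, 3, 6, 8, 9, 11, 12, 16, 19, 22, 23, 24},
    {1, 2, 6, 7, 11, 16, 18, 19}, {2, 4, 6, 7, 11, 14, 19, 21, 23, 24},
    {3, 4, 7, 8, 9, 16, 17, 24}, {1, 2, 6, 7, 12, 14, 19, 21, 22, 24}, {9, 12, 21, 24},
    {3, 4, 7, 8, 11, 16, 17, 21, 22, 23}, {11, 16, 17, 21}, {2, 3, 6, 8, 18, 19, 22, 24},
    {1, 3, 7, 8, 9, 12, 18, 19, 21, 23}, {1, 3, 9, 12, 14, 16, 17, 19, 21, 22},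
    {6, 7, 12, 16, 18, 21, 22, 23}, {1, 4, 6, 7, 9, 16, 19, 22},
    {3, 4, 6, 7, 9, 11, 12, 14, 18, 24}]

theorem not_forall_eq_sixtyFive (K : Type*) [Field K] [NumberField K]
    [IsCyclotomicExtension {65} ℚ K] [IsCMField K] (J : ClassGroup (𝓞 K) →* ClassGroup (𝓞 K))
    (hJ : IsClassAction (conjRingEquiv K) J) : ¬ ∀ x, J x = x := by
  intro h
  have hodd : Odd 65 := by decide
  have hsq : Squarefree 65 := by decide +kernel
  have hcl := classNumber_eq_mul_of_pairDetCert 65 K hodd (p := 5) (q := 13) rfl (by norm_num)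
    (by norm_num) (by norm_num) pairDetCert_65
  obtain ⟨P, hP, hdvd⟩ := two_pow_mul_relIndex_dvd 65 K hodd (by norm_num)
    (fun h ↦ absurd (hsq.prime_of_isPrimePow h) (by norm_num)) signUnits signEmbeddings
    (by decide +kernel) (by decide +kernel) (by decide +kernel)
  have h2 := classNumber_dvd_of_forall_eq 65 K J hJ hodd (by norm_num) hsq h P hP
  rw [hcl] at h2
  have h3 := Nat.dvd_of_mul_dvd_mul_left (Nat.pos_of_ne_zero (classNumber_ne_zero _)) h2
  have h4 := (mul_dvd_mul_left (2 ^ 19) h3).trans hdvd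
  have h5 := two_mul_finrank_real 65 K
  rw [show Nat.totient 65 = 48 by decide +kernel] at h5
  rw [show Module.finrank ℚ (𝐑 K) = 24 by omega] at h4
  revert h4
  decide

theorem forall_eq_iff_mem (M : ℕ) [NeZero M] (K : Type*) [Field K] [NumberField K]
    [IsCyclotomicExtension {M} ℚ K] [IsCMField K] (hodd : Odd M) (h1 : M ≠ 1) (hsq : Squarefree M)
    (J : ClassGroup (𝓞 K) →* ClassGroup (𝓞 K))
    (hJ : IsClassAction (conjRingEquiv K) J) :
    (∀ x, J x = x) ↔ M ∈ [3, 5, 7, 11, 13, 17, 19, 29, 15, 21, 33, 35, 39] := by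
  constructor
  · intro h
    have h2 := mem_of_classNumber_dvd hodd h1 hsq
      (classNumber_dvd_mul_two_pow M K J hJ hodd h1 hsq h)
    have h65 : M ≠ 65 := by
      rintro rfl
      exact not_forall_eq_sixtyFive K J hJ h
    simp only [List.mem_cons, List.not_mem_nil, or_false] at h2 ⊢
    tauto
  · intro h
    have hprime : ∀ l s, (M, l, s, 1) ∈ primeDetCerts → M.Prime → ∀ x, J x = x := fun l s hl hp ↦
      forall_eq_of_classNumber_eq M K J hJ hodd h1 hsq
        (classNumber_eq_mul_of_primeDetCert M K hodd hp (List.all_eq_true.1 primeDetCerts_all _ hl))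
    have hpair : ∀ {p q r s l t}, pairDetCert p q r s l t 1 = true → M = p * q → p.Prime →
        q.Prime → p ≠ q → ∀ x, J x = x := fun hc hM hp hq hpq ↦
      forall_eq_of_classNumber_eq M K J hJ hodd h1 hsq
        (classNumber_eq_mul_of_pairDetCert M K hodd hM hp hq hpq hc)
    simp only [List.mem_cons, List.not_mem_nil, or_false] at h
    rcases h with rfl | rfl | rfl | rfl | rfl | rfl | rfl | rfl | rfl | rfl | rfl | rfl | rfl
    · exact hprime [1] (-1) (by simp [primeDetCerts]) (by norm_num)
    · exact hprime [1, 2] (-1) (by simp [primeDetCerts]) (by norm_num)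
    · exact hprime [1, 3, 2] 1 (by simp [primeDetCerts]) (by norm_num)
    · exact hprime [1, 2, 4, 3, 5] (-1) (by simp [primeDetCerts]) (by norm_num)
    · exact hprime [1, 5, 2, 3, 4, 6] (-1) (by simp [primeDetCerts]) (by norm_num)
    · exact hprime [1, 8, 3, 6, 4, 5, 2, 7] 1 (by simp [primeDetCerts]) (by norm_num)
    · exact hprime [1, 8, 2, 7, 6, 3, 5, 4, 9] (-1) (by simp [primeDetCerts]) (by norm_num)
    · exact forall_eq_twentyNine K J hJ (classNumber_eq_mul_of_primeDetCert 29 K hodd (by norm_num)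
        (List.all_eq_true.1 primeDetCerts_all (29, [2, 13, 8, 1, 14, 9, 7, 6, 12, 5, 3, 4, 10, 11],
          -1, 8) (by simp [primeDetCerts])))
    · exact hpair pairDetCert_15 rfl (by norm_num) (by norm_num) (by norm_num)
    · exact hpair pairDetCert_21 rfl (by norm_num) (by norm_num) (by norm_num)
    · exact hpair pairDetCert_33 rfl (by norm_num) (by norm_num) (by norm_num)
    · exact hpair pairDetCert_35 rfl (by norm_num) (by norm_num) (by norm_num)
    · exact forall_eq_thirtyNine K J hJ (classNumber_eq_mul_of_pairDetCert 39 K hodd (p := 3)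
        (q := 13) rfl (by norm_num) (by norm_num) (by norm_num) pairDetCert_39)

theorem ringEquiv_eq_of_isPrimitiveRoot {n : ℕ} [NeZero n] {K : Type*} [Field K] [NumberField K]
    [IsCyclotomicExtension {n} ℚ K] {ζ : 𝓞 K} (hζ : IsPrimitiveRoot ζ n) {σ τ : 𝓞 K ≃+* 𝓞 K}
    (h : σ ζ = τ ζ) : σ = τ := by
  have hζ' : IsPrimitiveRoot (ζ : K) n := hζ.map_of_injective RingOfIntegers.coe_injective
  have htop := IsCyclotomicExtension.Rat.adjoin_singleton_eq_top hζ'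
  have h1 : σ.toRingHom.toIntAlgHom = τ.toRingHom.toIntAlgHom := by
    refine AlgHom.ext_of_adjoin_eq_top htop ?_
    rintro x rfl
    exact h
  ext x
  exact congrArg (fun f : 𝓞 K →ₐ[ℤ] 𝓞 K ↦ (f x : K)) h1

theorem IsCyclotomicExtension.of_two_mul {M : ℕ} [NeZero M] (hodd : Odd M) (K : Type*) [Field K]
    [NumberField K] [IsCyclotomicExtension {2 * M} ℚ K] : IsCyclotomicExtension {M} ℚ K := by
  have hζ := IsCyclotomicExtension.zeta_spec (2 * M) ℚ K
  have h1 := ((IsCyclotomicExtension.iff_adjoin_eq_top {2 * M} ℚ K).1 inferInstance).2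
  refine (IsCyclotomicExtension.iff_adjoin_eq_top {M} ℚ K).2 ⟨?_, top_le_iff.1 ?_⟩
  · rintro n rfl -
    exact ⟨_, hζ.pow (NeZero.pos _) (rfl : 2 * n = 2 * n)⟩
  · rw [← h1]
    refine Algebra.adjoin_le ?_
    rintro x ⟨n, rfl, -, hx⟩
    have hmem : ∀ y : K, y ^ M = 1 →
        y ∈ Algebra.adjoin ℚ {b : K | ∃ n : ℕ, n ∈ ({M} : Set ℕ) ∧ n ≠ 0 ∧ b ^ n = 1} :=
      fun y hy ↦ Algebra.subset_adjoin ⟨M, rfl, NeZero.ne M, hy⟩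
    rw [two_mul, pow_add, mul_self_eq_one_iff] at hx
    rcases hx with hx | hx
    · exact hmem x hx
    · have h2 := neg_mem (hmem (-x) (by rw [hodd.neg_pow, hx, neg_neg]))
      rwa [neg_neg] at h2

theorem subsingleton_classGroup_of_two (K : Type*) [Field K] [NumberField K]
    [IsCyclotomicExtension {2} ℚ K] : Subsingleton (ClassGroup (𝓞 K)) := by
  have hζ := IsCyclotomicExtension.zeta_spec 2 ℚ K
  have htop := IsCyclotomicExtension.Rat.adjoin_singleton_eq_top hζ
  have hbot : Algebra.adjoin ℤ {hζ.toInteger} ≤ ⊥ := by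
    refine Algebra.adjoin_le ?_
    rintro _ rfl
    rw [hζ.toInteger_isPrimitiveRoot.eq_neg_one_of_two_right]
    exact neg_mem (one_mem _)
  have hsurj : Function.Surjective (algebraMap ℤ (𝓞 K)) := fun x ↦
    Algebra.mem_bot.1 (hbot (htop ▸ Algebra.mem_top))
  have h1 := classNumber_eq_one_iff.2
    (IsPrincipalIdealRing.of_surjective (algebraMap ℤ (𝓞 K)) hsurj)
  exact Fintype.card_le_one_iff_subsingleton.1 h1.le

end CyclotomicClassNumbers

/-- For `m ≥ 2` squarefree, the subgroup `{x · x̄⁻¹ : x ∈ Cl_m}` of the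
ideal class group of the `m`-th cyclotomic field is trivial if and only if
`m ∈ {2, 3, 5, 6, 7, 10, 11, 13, 14, 15, 17, 19, 21, 22, 26, 29, 30, 33, 34, 35, 38, 39,
42, 58, 66, 70, 78}`. -/
theorem stmt_7 (m : ℕ+) (hm : 2 ≤ (m : ℕ)) (hsq : Squarefree (m : ℕ))
    (K : Type) [Field K] [NumberField K] [IsCyclotomicExtension {(m : ℕ)} ℚ K]
    (ζ : 𝓞 K) (hζ : IsPrimitiveRoot ζ (m : ℕ))
    (σ : 𝓞 K ≃+* 𝓞 K) (hσ : σ ζ * ζ = 1)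
    (J : ClassGroup (𝓞 K) →* ClassGroup (𝓞 K))
    (hJ : ∀ I I' : (Ideal (𝓞 K))⁰,
      Ideal.map σ (I : Ideal (𝓞 K)) = (I' : Ideal (𝓞 K)) →
      J (ClassGroup.mk0 I) = ClassGroup.mk0 I') :
    (∀ x : ClassGroup (𝓞 K), x * (J x)⁻¹ = 1) ↔
      (m : ℕ) ∈ ({2, 3, 5, 6, 7, 10, 11, 13, 14, 15, 17, 19, 21, 22, 26, 29, 30, 33, 34,
        35, 38, 39, 42, 58, 66, 70, 78} : Set ℕ) := by
  have : NeZero (m : ℕ) := ⟨m.ne_zero⟩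
  have hiff : (∀ x : ClassGroup (𝓞 K), x * (J x)⁻¹ = 1) ↔ ∀ x, J x = x :=
    forall_congr' fun x ↦ by rw [mul_inv_eq_one, eq_comm]
  rw [hiff]
  have key : ∀ M : ℕ, Odd M → M ≠ 1 → Squarefree M → IsCyclotomicExtension {M} ℚ K →
      ((∀ x, J x = x) ↔ M ∈ [3, 5, 7, 11, 13, 17, 19, 29, 15, 21, 33, 35, 39]) := by
    intro M hodd h1 hsqM hM
    have : NeZero M := ⟨hsqM.ne_zero⟩
    have : IsCMField K := cyclotomic_isCMField M hodd h1 K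
    have hζ' : IsPrimitiveRoot (ζ : K) m := hζ.map_of_injective RingOfIntegers.coe_injective
    have hconj : conjRingEquiv K ζ * ζ = 1 := ringOfIntegersComplexConj_toInteger m K hζ'
    have hσc : σ = conjRingEquiv K := ringEquiv_eq_of_isPrimitiveRoot hζ
      (mul_right_cancel₀ (hζ.ne_zero (NeZero.ne _)) (hσ.trans hconj.symm))
    subst hσc
    exact forall_eq_iff_mem M K hodd h1 hsqM J hJ
  rcases Nat.even_or_odd (m : ℕ) with ⟨M, hM⟩ | hodd
  · rw [← two_mul] at hM
    have hsqM : Squarefree M := hsq.squarefree_of_dvd ⟨2, by rw [hM, mul_comm]⟩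
    have hodd : Odd M := by
      rw [← Nat.not_even_iff_odd]
      rintro ⟨c, rfl⟩
      have h2 := hsq 2 ⟨c, by rw [hM]; ring⟩
      exact absurd (Nat.isUnit_iff.1 h2) (by norm_num)
    rw [hM]
    by_cases h1 : M = 1
    · subst h1
      have : IsCyclotomicExtension {2} ℚ K := by
        have h2 : IsCyclotomicExtension {(m : ℕ)} ℚ K := inferInstance
        rwa [hM] at h2
      have := subsingleton_classGroup_of_two K
      simp [eq_iff_true_of_subsingleton]
    · have : NeZero M := ⟨hsqM.ne_zero⟩
      have : IsCyclotomicExtension {2 * M} ℚ K := by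
        have h2 : IsCyclotomicExtension {(m : ℕ)} ℚ K := inferInstance
        rwa [hM] at h2
      rw [key M hodd h1 hsqM (IsCyclotomicExtension.of_two_mul hodd K)]
      simp only [List.mem_cons, List.not_mem_nil, or_false, Set.mem_insert_iff,
        Set.mem_singleton_iff]
      omega
  · rw [key m hodd (by omega) hsq inferInstance]
    obtain ⟨c, hc⟩ := hodd
    simp only [List.mem_cons, List.not_mem_nil, or_false, Set.mem_insert_iff,
      Set.mem_singleton_iff]
    omega
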